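/- There exist η > 0 and a constant C > 0 such that for all real P ≥ 2 and all R with 2 ≤ R ≤ P^η one has ∫₀¹ |h(α;P,R)|⁷ dα ≤ C·P^{3 + Δ₇}, ∫₀¹ |h(α;P,R)|¹⁰ dα ≤ C·P^{6 + Δ₁₀}, and ∫₀¹ |h(α;P,R)|¹² dα ≤ C·P^{8}; that is, the exponents Δ₇ = 0.849408, Δ₁₀ = 0.213431 and Δ₁₂ = 0 are admissible. -/

import Mathlib

open scoped Real
open Filter MeasureTheory

noncomputable section

/-- `e(z) = exp(2πiz)`. -/
def e (z : ℝ) : ℂ := Complex.exp (2 * Real.pi * Complex.I * z)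

/-- The set `𝒜(P,R)` of `R`-smooth positive integers not exceeding `P`. -/
def smoothA (P R : ℝ) : Finset ℕ :=
  (Finset.Icc 1 ⌊P⌋₊).filter (fun n => ∀ p ∈ n.primeFactors, (p : ℝ) ≤ R)

/-- The smooth Weyl sum `h(α; P, R)`. -/
def h (P R α : ℝ) : ℂ := ∑ x ∈ smoothA P R, e (α * (x : ℝ) ^ 4)

/-- `Δ₇ = 0.849408`. -/
def Δ₇ : ℝ := 0.849408

/-- `Δ₁₀ = 0.213431`. -/
def Δ₁₀ : ℝ := 0.213431

open Finset (Icc card_eq_zero card_filter card_filter_le card_image_of_injOn card_le_card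
  card_le_card_of_injOn card_pos card_product card_range card_sigma coe_filter coe_product
  coe_sigma filter_congr filter_eq_empty_iff filter_filter filter_subset filter_true image mem_Icc
  mem_coe mem_filter mem_image mem_product mem_range mem_sigma mul_sum range range_one
  single_le_sum sum_add_distrib sum_comm sum_congr sum_const sum_fiberwise_of_maps_to sum_filter
  sum_image sum_le_card_nsmul sum_le_sum sum_le_sum_of_subset_of_nonneg sum_mul sum_mul_sum
  sum_nbij' sum_nonneg sum_product sum_range_succ sum_sigma univ)
open Real (div_rpow log_le_log log_mul log_nonneg log_pow log_two_lt_d9 mul_rpow norm_eq_abs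
  one_le_rpow pi_pos rpow_add rpow_add_of_nonneg rpow_add_one rpow_le_rpow
  rpow_le_rpow_of_exponent_le rpow_le_rpow_of_nonpos rpow_mul rpow_natCast rpow_neg rpow_neg_one
  rpow_nonneg rpow_one rpow_one_add' rpow_sub rpow_sub_one rpow_two rpow_zero sin zero_rpow)
open Nat (Coprime abs_cast card_Icc cast_div cast_div_le cast_le cast_mul cast_nonneg cast_sub
  cast_zero coprime_of_dvd div_add_mod div_dvd_of_dvd dvd_one eq_of_mul_eq_mul_left floor_le
  gcd_pos_of_pos_left gcd_rec le_floor le_floor_iff le_of_dvd lt_succ_iff mem_divisors minFac_dvd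
  minFac_le_of_dvd minFac_prime mod_lt mod_one mul_div_cancel' one_le_iff_ne_zero pow_le_pow_left
  pow_lt_pow_left sub_le)
open Int (emod_lt_of_pos emod_nonneg natCast_dvd natCast_dvd_natCast)
open Complex (I add_re conj_ofReal continuous_re exp exp_nat_mul mul_conj mul_re normSq_eq_norm_sq
  norm_real ofReal_pow ofReal_re ofReal_sum re reCLM re_le_norm re_sum sq_norm sub_re)

/-! ### The exponential `e` and unit-interval averages -/

lemma e_zero : e 0 = 1 := by simp [e]

lemma e_add (x y : ℝ) : e (x + y) = e x * e y := by
  simp only [e, ← Complex.exp_add]; congr 1; push_cast; ring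

lemma norm_e (x : ℝ) : ‖e x‖ = 1 := by
  have : e x = exp ((2 * π * x : ℝ) * I) := by
    simp only [e]; congr 1; push_cast; ring
  rw [this, Complex.norm_exp_ofReal_mul_I]

lemma e_int (n : ℤ) : e n = 1 := by
  have : e n = exp (n * (2 * π * I)) := by
    simp only [e]; congr 1; push_cast; ring
  rw [this, Complex.exp_int_mul_two_pi_mul_I]

lemma conj_e (x : ℝ) : (starRingEnd ℂ) (e x) = e (-x) := by
  simp only [e, ← Complex.exp_conj]
  congr 1
  simp [conj_ofReal, Complex.conj_ofNat]

lemma e_add_int (x : ℝ) (n : ℤ) : e (x + n) = e x := by rw [e_add, e_int, mul_one]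

@[fun_prop]
lemma continuous_e : Continuous e := by unfold e; fun_prop

lemma integral_e (n : ℤ) : ∫ α in (0:ℝ)..1, e (α * n) = if n = 0 then 1 else 0 := by
  split_ifs with hn
  · simp [hn, e_zero]
  · have hc : (2 * π * I * n : ℂ) ≠ 0 := by
      simp [Real.pi_ne_zero, Complex.I_ne_zero, hn]
    have h1 : ∀ α : ℝ, e (α * n) = exp ((2 * π * I * n) * (α : ℝ)) := by
      intro α; simp only [e]; congr 1; push_cast; ring
    simp only [h1]
    rw [integral_exp_mul_complex hc, ← h1, ← h1]
    have : e (1 * n) = 1 := by rw [one_mul, e_int]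
    rw [this]; simp [e_zero]

/-- The average of a real function over the unit interval. -/
def avg (f : ℝ → ℝ) : ℝ := ∫ α in (0:ℝ)..1, f α

lemma avg_nonneg {f : ℝ → ℝ} (hf : ∀ α, 0 ≤ f α) : 0 ≤ avg f :=
  intervalIntegral.integral_nonneg zero_le_one (fun α _ => hf α)

lemma avg_mono {f g : ℝ → ℝ} (hf : Continuous f) (hg : Continuous g) (hfg : ∀ α, f α ≤ g α) :
    avg f ≤ avg g :=
  intervalIntegral.integral_mono zero_le_one (hf.intervalIntegrable _ _)
    (hg.intervalIntegrable _ _) hfg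

lemma avg_add {f g : ℝ → ℝ} (hf : Continuous f) (hg : Continuous g) :
    avg (fun α => f α + g α) = avg f + avg g :=
  intervalIntegral.integral_add (hf.intervalIntegrable _ _) (hg.intervalIntegrable _ _)

lemma avg_const_mul (c : ℝ) (f : ℝ → ℝ) : avg (fun α => c * f α) = c * avg f :=
  intervalIntegral.integral_const_mul _ _

lemma avg_const (c : ℝ) : avg (fun _ => c) = c := by simp [avg]

lemma avg_sum {ι : Type*} (s : Finset ι) (f : ι → ℝ → ℝ) (hf : ∀ i ∈ s, Continuous (f i)) :
    avg (fun α => ∑ i ∈ s, f i α) = ∑ i ∈ s, avg (f i) :=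
  intervalIntegral.integral_finsetSum (fun i hi => (hf i hi).intervalIntegrable _ _)

lemma avg_comp_mul {f : ℝ → ℝ} (hf : Continuous f) (hp : Function.Periodic f 1) {n : ℕ}
    (hn : n ≠ 0) : avg (fun α => f (n * α)) = avg f := by
  have hn' : (n : ℝ) ≠ 0 := mod_cast hn
  unfold avg
  rw [intervalIntegral.integral_comp_mul_left f hn']
  have := hp.intervalIntegral_add_zsmul_eq (n : ℤ) 0 (fun a b => hf.intervalIntegrable a b)
  simp only [zsmul_eq_mul, mul_one, zero_add, Int.cast_natCast] at this
  rw [mul_zero, mul_one, this, smul_eq_mul]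
  field_simp

lemma avg_comp_add {f : ℝ → ℝ} (hp : Function.Periodic f 1) (a : ℝ) :
    avg (fun α => f (α + a)) = avg f := by
  unfold avg
  rw [intervalIntegral.integral_comp_add_right]
  have := hp.intervalIntegral_add_eq a 0
  simp only [zero_add] at this ⊢
  rw [add_comm 1 a, this]

lemma holder_two {f g : ℝ → ℝ} (hf : Continuous f) (hg : Continuous g) (hf0 : ∀ α, 0 ≤ f α)
    (hg0 : ∀ α, 0 ≤ g α) {a b : ℝ} (ha : 0 ≤ a) (hb : 0 ≤ b) (hab : a + b = 1) :
    avg (fun α => f α ^ a * g α ^ b) ≤ avg f ^ a * avg g ^ b := by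
  rcases ha.eq_or_lt with rfl | ha'
  · have : b = 1 := by linarith
    simp [this]
  rcases hb.eq_or_lt with rfl | hb'
  · have : a = 1 := by linarith
    simp [this]
  have hpq : (1 / a).HolderConjugate (1 / b) := by
    rw [Real.holderConjugate_iff]
    refine ⟨by rw [lt_div_iff₀ ha']; linarith, by simpa using hab⟩
  have hfa : Continuous (fun α => f α ^ a) := hf.rpow_const (fun _ => Or.inr ha)
  have hgb : Continuous (fun α => g α ^ b) := hg.rpow_const (fun _ => Or.inr hb)
  have hm : ∀ (k : ℝ → ℝ) (p : ENNReal), Continuous k →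
      MemLp k p (volume.restrict (Set.Ioc (0:ℝ) 1)) := by
    intro k p hk
    obtain ⟨C, hC⟩ := isCompact_Icc.exists_bound_of_continuousOn (s := Set.Icc (0:ℝ) 1)
      hk.continuousOn
    refine MemLp.of_bound hk.aestronglyMeasurable C ?_
    rw [ae_restrict_iff' measurableSet_Ioc]
    exact Filter.Eventually.of_forall fun x hx => hC x ⟨hx.1.le, hx.2⟩
  have := integral_mul_le_Lp_mul_Lq_of_nonneg (μ := volume.restrict (Set.Ioc (0:ℝ) 1)) hpq
    (f := fun α => f α ^ a) (g := fun α => g α ^ b)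
    (Filter.Eventually.of_forall fun α => rpow_nonneg (hf0 α) a)
    (Filter.Eventually.of_forall fun α => rpow_nonneg (hg0 α) b)
    (hm _ _ hfa) (hm _ _ hgb)
  unfold avg
  simp only [intervalIntegral.integral_of_le zero_le_one]
  convert this using 2
  · rw [one_div_one_div]; congr 2; funext α
    rw [← rpow_mul (hf0 α)]; simp [ha'.ne']
  · rw [one_div_one_div]; congr 2; funext α
    rw [← rpow_mul (hg0 α)]; simp [hb'.ne']

lemma holder_three {f g k : ℝ → ℝ} (hf : Continuous f) (hg : Continuous g) (hk : Continuous k)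
    (hf0 : ∀ α, 0 ≤ f α) (hg0 : ∀ α, 0 ≤ g α) (hk0 : ∀ α, 0 ≤ k α) {a b c : ℝ}
    (ha : 0 ≤ a) (hb : 0 ≤ b) (hc : 0 ≤ c) (habc : a + b + c = 1) :
    avg (fun α => f α ^ a * g α ^ b * k α ^ c) ≤ avg f ^ a * avg g ^ b * avg k ^ c := by
  rcases hc.eq_or_lt with rfl | hc'
  · have := holder_two hf hg hf0 hg0 ha hb (by linarith)
    simpa using this
  have hbc : 0 < b + c := by linarith
  have hb1 : 0 ≤ b / (b + c) := by positivity
  have hc1 : 0 ≤ c / (b + c) := by positivity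
  have h1 := holder_two hg hk hg0 hk0 hb1 hc1 (by field_simp)
  have hcont : Continuous (fun α => g α ^ (b / (b + c)) * k α ^ (c / (b + c))) :=
    (hg.rpow_const (fun _ => Or.inr hb1)).mul (hk.rpow_const (fun _ => Or.inr hc1))
  have hn : ∀ α, 0 ≤ g α ^ (b / (b + c)) * k α ^ (c / (b + c)) := fun α =>
    mul_nonneg (rpow_nonneg (hg0 α) _) (rpow_nonneg (hk0 α) _)
  have h2 := holder_two hf hcont hf0 hn ha hbc.le (by linarith)
  have e1 : ∀ x y : ℝ, 0 ≤ x → 0 ≤ y →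
      (x ^ (b / (b + c)) * y ^ (c / (b + c))) ^ (b + c) = x ^ b * y ^ c := by
    intro x y hx hy
    rw [mul_rpow (rpow_nonneg hx _) (rpow_nonneg hy _), ← rpow_mul hx, ← rpow_mul hy]
    congr 2 <;> field_simp
  calc avg (fun α => f α ^ a * g α ^ b * k α ^ c)
      = avg (fun α => f α ^ a * (g α ^ (b / (b + c)) * k α ^ (c / (b + c))) ^ (b + c)) := by
        congr 1; funext α; rw [e1 _ _ (hg0 α) (hk0 α), mul_assoc]
    _ ≤ avg f ^ a * avg (fun α => g α ^ (b / (b + c)) * k α ^ (c / (b + c))) ^ (b + c) := h2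
    _ ≤ avg f ^ a * (avg g ^ (b / (b + c)) * avg k ^ (c / (b + c))) ^ (b + c) := by
        gcongr
        · exact rpow_nonneg (avg_nonneg hf0) _
        · exact avg_nonneg hn
    _ = avg f ^ a * avg g ^ b * avg k ^ c := by
        rw [e1 _ _ (avg_nonneg hg0) (avg_nonneg hk0), mul_assoc]

/-- A weighted power mean inequality. -/
lemma weighted_rpow_sum_le {ι : Type*} (s : Finset ι) {p : ℝ} (hp : 1 ≤ p) (w f : ι → ℝ)
    (hw : ∀ i, 0 ≤ w i) (hf : ∀ i, 0 ≤ f i) :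
    (∑ i ∈ s, w i * f i) ^ p ≤ (∑ i ∈ s, w i) ^ (p - 1) * ∑ i ∈ s, w i * f i ^ p := by
  have h1 := Real.inner_le_weight_mul_Lp_of_nonneg s hp w f hw hf
  have hp0 : 0 < p := by linarith
  have hA : 0 ≤ ∑ i ∈ s, w i := sum_nonneg fun i _ => hw i
  have hB : 0 ≤ ∑ i ∈ s, w i * f i ^ p :=
    sum_nonneg fun i _ => mul_nonneg (hw i) (rpow_nonneg (hf i) p)
  calc (∑ i ∈ s, w i * f i) ^ p
      ≤ ((∑ i ∈ s, w i) ^ (1 - p⁻¹) * (∑ i ∈ s, w i * f i ^ p) ^ p⁻¹) ^ p := by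
        gcongr
        exact sum_nonneg fun i _ => mul_nonneg (hw i) (hf i)
    _ = _ := by
        rw [mul_rpow (rpow_nonneg hA _) (rpow_nonneg hB _), ← rpow_mul hA, ← rpow_mul hB]
        congr 2
        · field_simp
        · rw [inv_mul_cancel₀ hp0.ne', rpow_one]

/-- The trigonometric sum with frequencies `φ i`. -/
def trig {ι : Type*} (s : Finset ι) (φ : ι → ℤ) (α : ℝ) : ℂ := ∑ i ∈ s, e (α * φ i)

@[fun_prop]
lemma continuous_trig {ι : Type*} (s : Finset ι) (φ : ι → ℤ) : Continuous (trig s φ) := by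
  unfold trig; fun_prop

lemma periodic_trig {ι : Type*} (s : Finset ι) (φ : ι → ℤ) : Function.Periodic (trig s φ) 1 := by
  intro α
  unfold trig
  refine sum_congr rfl fun i _ => ?_
  rw [add_mul, one_mul, e_add_int]

lemma norm_trig_le {ι : Type*} (s : Finset ι) (φ : ι → ℤ) (α : ℝ) : ‖trig s φ α‖ ≤ s.card := by
  refine (norm_sum_le _ _).trans ?_
  simp [norm_e]

lemma normSq_trig {ι : Type*} (s : Finset ι) (φ : ι → ℤ) (α : ℝ) :
    ((‖trig s φ α‖ ^ 2 : ℝ) : ℂ) = ∑ p ∈ s ×ˢ s, e (α * ((φ p.1 - φ p.2 : ℤ) : ℝ)) := by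
  have : ((‖trig s φ α‖ ^ 2 : ℝ) : ℂ) = trig s φ α * (starRingEnd ℂ) (trig s φ α) := by
    rw [mul_conj, normSq_eq_norm_sq]
  rw [this]
  unfold trig
  rw [map_sum, sum_mul_sum, sum_product]
  refine sum_congr rfl fun i _ => sum_congr rfl fun j _ => ?_
  rw [conj_e, ← e_add]
  congr 1; push_cast; ring

lemma avg_normSq_trig {ι : Type*} (s : Finset ι) (φ : ι → ℤ) :
    avg (fun α => ‖trig s φ α‖ ^ 2) = ((s ×ˢ s).filter (fun p => φ p.1 = φ p.2)).card := by
  have h1 : ((avg (fun α => ‖trig s φ α‖ ^ 2) : ℝ) : ℂ) =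
      ∫ α in (0:ℝ)..1, ((‖trig s φ α‖ ^ 2 : ℝ) : ℂ) := by
    unfold avg; rw [intervalIntegral.integral_ofReal]
  have h2 : ((avg (fun α => ‖trig s φ α‖ ^ 2) : ℝ) : ℂ) =
      (((s ×ˢ s).filter (fun p => φ p.1 = φ p.2)).card : ℝ) := by
    rw [h1]
    simp only [normSq_trig]
    rw [intervalIntegral.integral_finsetSum]
    · simp only [integral_e, sub_eq_zero]
      rw [← sum_filter]
      simp
    · intro i _
      apply Continuous.intervalIntegrable
      fun_prop
  exact_mod_cast h2

lemma h_eq_trig (P R α : ℝ) : h P R α = trig (smoothA P R) (fun x => (x : ℤ) ^ 4) α := by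
  unfold h trig
  refine sum_congr rfl fun x _ => ?_
  push_cast; rfl

lemma continuous_h (P R : ℝ) : Continuous (h P R) := by
  have : h P R = trig (smoothA P R) (fun x => (x : ℤ) ^ 4) := funext (h_eq_trig P R)
  rw [this]; fun_prop

lemma periodic_h (P R : ℝ) : Function.Periodic (h P R) 1 := by
  have : h P R = trig (smoothA P R) (fun x => (x : ℤ) ^ 4) := funext (h_eq_trig P R)
  rw [this]; exact periodic_trig _ _

lemma card_smoothA_le (P R : ℝ) (hP : 0 ≤ P) : ((smoothA P R).card : ℝ) ≤ P := by
  have h1 : (smoothA P R).card ≤ ⌊P⌋₊ := by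
    refine (card_filter_le _ _).trans ?_
    simp
  exact (cast_le.mpr h1).trans (floor_le hP)

lemma norm_h_le (P R α : ℝ) (hP : 0 ≤ P) : ‖h P R α‖ ≤ P := by
  rw [h_eq_trig]
  exact (norm_trig_le _ _ _).trans (card_smoothA_le P R hP)

lemma mem_smoothA {P R : ℝ} {n : ℕ} (hP : 0 ≤ P) :
    n ∈ smoothA P R ↔ 0 < n ∧ (n : ℝ) ≤ P ∧ ∀ p ∈ n.primeFactors, (p : ℝ) ≤ R := by
  unfold smoothA
  rw [mem_filter, mem_Icc, le_floor_iff hP]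
  constructor
  · rintro ⟨⟨a, b⟩, c⟩; exact ⟨a, b, c⟩
  · rintro ⟨a, b, c⟩; exact ⟨⟨a, b⟩, c⟩

lemma smoothA_mono {P P' R R' : ℝ} (hP : P ≤ P') (hR : R ≤ R') :
    smoothA P R ⊆ smoothA P' R' := by
  intro n hn
  unfold smoothA at hn ⊢
  rw [mem_filter, mem_Icc] at hn ⊢
  exact ⟨⟨hn.1.1, hn.1.2.trans (Nat.floor_le_floor hP)⟩, fun p hp => (hn.2 p hp).trans hR⟩

/-! ### Trigonometric polynomials with nonnegative coefficients -/

/-- Trigonometric polynomials with nonnegative Fourier coefficients. -/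
inductive PosDefTrig : (ℝ → ℂ) → Prop
  | zero : PosDefTrig (fun _ => 0)
  | e (n : ℤ) : PosDefTrig (fun α => e (α * n))
  | add {F G : ℝ → ℂ} : PosDefTrig F → PosDefTrig G → PosDefTrig (fun α => F α + G α)
  | smul {F : ℝ → ℂ} (c : ℝ) : 0 ≤ c → PosDefTrig F → PosDefTrig (fun α => c * F α)

namespace PosDefTrig

lemma const {c : ℝ} (hc : 0 ≤ c) : PosDefTrig (fun _ => (c : ℂ)) := by
  have := smul c hc (e 0)
  simpa [e_zero] using this

lemma e_mul (n : ℤ) {F : ℝ → ℂ} (hF : PosDefTrig F) :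
    PosDefTrig (fun α => _root_.e (α * n) * F α) := by
  induction hF with
  | zero => simpa using zero
  | e m =>
    have := e (n + m)
    convert this using 2 with α
    rw [← e_add]; congr 1; push_cast; ring
  | add _ _ h1 h2 =>
    have := add h1 h2
    simpa only [mul_add] using this
  | smul c hc _ h1 =>
    have := smul c hc h1
    simpa only [mul_left_comm] using this

lemma mul {F G : ℝ → ℂ} (hF : PosDefTrig F) (hG : PosDefTrig G) :
    PosDefTrig (fun α => F α * G α) := by
  induction hF with
  | zero => simpa using zero
  | e m => exact e_mul m hG
  | add _ _ h1 h2 =>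
    have := add h1 h2
    simpa only [add_mul] using this
  | smul c hc _ h1 =>
    have := smul c hc h1
    simpa only [mul_assoc] using this

lemma conj {F : ℝ → ℂ} (hF : PosDefTrig F) : PosDefTrig (fun α => (starRingEnd ℂ) (F α)) := by
  induction hF with
  | zero => simpa using zero
  | e m =>
    have := e (-m)
    simpa [conj_e] using this
  | add _ _ h1 h2 => simpa only [map_add] using add h1 h2
  | smul c hc _ h1 => simpa only [map_mul, conj_ofReal] using smul c hc h1

lemma pow {F : ℝ → ℂ} (hF : PosDefTrig F) (k : ℕ) : PosDefTrig (fun α => F α ^ k) := by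
  induction k with
  | zero => simpa using const zero_le_one
  | succ k ih => simpa only [pow_succ] using mul ih hF

lemma sum {ι : Type*} (s : Finset ι) {F : ι → ℝ → ℂ} (hF : ∀ i ∈ s, PosDefTrig (F i)) :
    PosDefTrig (fun α => ∑ i ∈ s, F i α) := by
  classical
  induction s using Finset.induction_on with
  | empty => simpa using zero
  | insert a s ha ih =>
    simp only [Finset.sum_insert ha]
    exact add (hF a (Finset.mem_insert_self a s))
      (ih fun i hi => hF i (Finset.mem_insert_of_mem hi))

lemma trig {ι : Type*} (s : Finset ι) (φ : ι → ℤ) : PosDefTrig (_root_.trig s φ) :=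
  sum s fun i _ => e (φ i)

lemma comp_mul {F : ℝ → ℂ} (hF : PosDefTrig F) (n : ℕ) : PosDefTrig (fun α => F (n * α)) := by
  induction hF with
  | zero => exact zero
  | e m =>
    have := e (n * m)
    convert this using 3
    push_cast; ring
  | add _ _ h1 h2 => exact add h1 h2
  | smul c hc _ h1 => exact smul c hc h1

lemma normSq {F : ℝ → ℂ} (hF : PosDefTrig F) :
    PosDefTrig (fun α => ((‖F α‖ ^ 2 : ℝ) : ℂ)) := by
  have := mul hF (conj hF)
  simpa only [mul_conj, normSq_eq_norm_sq] using this

lemma norm_pow {F : ℝ → ℂ} (hF : PosDefTrig F) (k : ℕ) :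
    PosDefTrig (fun α => ((‖F α‖ ^ (2 * k) : ℝ) : ℂ)) := by
  have := (normSq hF).pow k
  simpa only [pow_mul, ofReal_pow] using this

lemma continuous {F : ℝ → ℂ} (hF : PosDefTrig F) : Continuous F := by
  induction hF with
  | zero => fun_prop
  | e m => fun_prop
  | add _ _ h1 h2 => exact h1.add h2
  | smul c hc _ h1 => exact continuous_const.mul h1

lemma integral_re_nonneg {F : ℝ → ℂ} (hF : PosDefTrig F) : 0 ≤ (∫ α in (0:ℝ)..1, F α).re := by
  induction hF with
  | zero => simp
  | e m => rw [integral_e]; split_ifs <;> simp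
  | add hF hG h1 h2 =>
    rw [intervalIntegral.integral_add (hF.continuous.intervalIntegrable _ _)
      (hG.continuous.intervalIntegrable _ _), add_re]
    exact add_nonneg h1 h2
  | smul c hc _ h1 =>
    rw [intervalIntegral.integral_const_mul, Complex.re_ofReal_mul]
    exact mul_nonneg hc h1

/-- Integrals against a function with nonnegative coefficients are monotone in the coefficients. -/
lemma integral_re_mono {F G H : ℝ → ℂ} (hF : Continuous F) (hG : Continuous G)
    (hFG : PosDefTrig (fun α => G α - F α)) (hH : PosDefTrig H) :
    (∫ α in (0:ℝ)..1, F α * H α).re ≤ (∫ α in (0:ℝ)..1, G α * H α).re := by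
  have h1 := (mul hFG hH).integral_re_nonneg
  simp only [sub_mul] at h1
  have h2 := intervalIntegral.integral_sub (μ := volume)
    ((hG.mul hH.continuous).intervalIntegrable 0 1) ((hF.mul hH.continuous).intervalIntegrable 0 1)
  simp only [Pi.mul_apply] at h2
  rw [h2, sub_re] at h1
  linarith

lemma sum_subset {ι : Type*} {s t : Finset ι} (hst : s ⊆ t) {F : ι → ℝ → ℂ}
    (hF : ∀ i ∈ t, PosDefTrig (F i)) :
    PosDefTrig (fun α => ∑ i ∈ t, F i α - ∑ i ∈ s, F i α) := by
  classical
  have h1 := sum (t \ s) (fun i hi => hF i (Finset.sdiff_subset hi))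
  convert h1 using 2 with α
  rw [← Finset.sum_sdiff hst, add_sub_cancel_right]

lemma trig_subset {ι : Type*} {s t : Finset ι} (hst : s ⊆ t) (φ : ι → ℤ) :
    PosDefTrig (fun α => _root_.trig t φ α - _root_.trig s φ α) :=
  sum_subset hst fun i _ => e (φ i)

lemma mul_sub_mul {F F' G G' : ℝ → ℂ} (hF : PosDefTrig F) (hG' : PosDefTrig G')
    (h1 : PosDefTrig (fun α => F' α - F α)) (h2 : PosDefTrig (fun α => G' α - G α)) :
    PosDefTrig (fun α => F' α * G' α - F α * G α) := by
  have := add (mul h1 hG') (mul hF h2)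
  convert this using 2
  ring

lemma pow_sub_pow {F G : ℝ → ℂ} (hF : PosDefTrig F) (hG : PosDefTrig G)
    (h1 : PosDefTrig (fun α => G α - F α)) (k : ℕ) :
    PosDefTrig (fun α => G α ^ k - F α ^ k) := by
  induction k with
  | zero => simpa using zero
  | succ k ih =>
    simp only [pow_succ]
    exact mul_sub_mul (hF.pow k) hG ih h1

lemma conj_sub {F G : ℝ → ℂ} (h1 : PosDefTrig (fun α => G α - F α)) :
    PosDefTrig (fun α => (starRingEnd ℂ) (G α) - (starRingEnd ℂ) (F α)) := by
  simpa only [map_sub] using conj h1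

lemma norm_pow_sub {F G : ℝ → ℂ} (hF : PosDefTrig F) (hG : PosDefTrig G)
    (h1 : PosDefTrig (fun α => G α - F α)) (k : ℕ) :
    PosDefTrig (fun α => ((‖G α‖ ^ (2 * k) : ℝ) : ℂ) - ((‖F α‖ ^ (2 * k) : ℝ) : ℂ)) := by
  have h2 := mul_sub_mul hF hG.conj h1 (conj_sub h1)
  simp only [mul_conj, normSq_eq_norm_sq] at h2
  have := pow_sub_pow hF.normSq hG.normSq h2 k
  simpa only [pow_mul, ofReal_pow] using this

/-- A trigonometric polynomial with nonnegative coefficients has even moments monotone in the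
coefficients. -/
lemma avg_norm_pow_mono {F G : ℝ → ℂ} (hF : PosDefTrig F) (hG : PosDefTrig G)
    (h1 : PosDefTrig (fun α => G α - F α)) (k : ℕ) :
    avg (fun α => ‖F α‖ ^ (2 * k)) ≤ avg (fun α => ‖G α‖ ^ (2 * k)) := by
  have h2 := (norm_pow_sub hF hG h1 k).integral_re_nonneg
  have hF' := hF.continuous
  have hG' := hG.continuous
  rw [intervalIntegral.integral_sub (Continuous.intervalIntegrable (by fun_prop) _ _)
    (Continuous.intervalIntegrable (by fun_prop) _ _), sub_re,
    intervalIntegral.integral_ofReal, intervalIntegral.integral_ofReal] at h2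
  simp only [ofReal_re] at h2
  unfold avg; linarith

end PosDefTrig

/-! ### Slowly growing factors -/

/-- Factors that are at least `1` and `O(X ^ ε * R ^ K)` for every `ε > 0`. -/
def Slow (f : ℝ → ℝ → ℝ) : Prop :=
  (∀ X R : ℝ, 1 ≤ X → 2 ≤ R → 1 ≤ f X R) ∧
  ∀ ε : ℝ, 0 < ε → ∃ C K : ℝ, 0 ≤ C ∧ 0 ≤ K ∧ ∀ X R : ℝ, 1 ≤ X → 2 ≤ R → f X R ≤ C * X ^ ε * R ^ K

namespace Slow

lemma const {c : ℝ} (hc : 1 ≤ c) : Slow (fun _ _ => c) := by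
  refine ⟨fun _ _ _ _ => hc, fun ε hε => ⟨c, 0, by linarith, le_rfl, fun X R hX hR => ?_⟩⟩
  rw [rpow_zero, mul_one]
  have := one_le_rpow hX hε.le
  nlinarith

lemma snd : Slow (fun _ R => R) := by
  refine ⟨fun _ R _ h => by linarith, fun ε hε => ⟨1, 1, by norm_num, by norm_num,
    fun X R hX hR => ?_⟩⟩
  rw [rpow_one]
  have := one_le_rpow hX hε.le
  nlinarith

lemma mul {f g : ℝ → ℝ → ℝ} (hf : Slow f) (hg : Slow g) : Slow (fun X R => f X R * g X R) := by
  refine ⟨fun X R hX hR => one_le_mul_of_one_le_of_one_le (hf.1 X R hX hR) (hg.1 X R hX hR),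
    fun ε hε => ?_⟩
  obtain ⟨C, K, hC, hK, h1⟩ := hf.2 (ε / 2) (by linarith)
  obtain ⟨C', K', hC', hK', h2⟩ := hg.2 (ε / 2) (by linarith)
  refine ⟨C * C', K + K', by positivity, by positivity, fun X R hX hR => ?_⟩
  have hX0 : 0 < X := by linarith
  have hR0 : 0 < R := by linarith
  calc f X R * g X R ≤ (C * X ^ (ε / 2) * R ^ K) * (C' * X ^ (ε / 2) * R ^ K') :=
        mul_le_mul (h1 X R hX hR) (h2 X R hX hR) (by linarith [hg.1 X R hX hR]) (by positivity)
    _ = C * C' * (X ^ (ε / 2) * X ^ (ε / 2)) * (R ^ K * R ^ K') := by ring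
    _ = C * C' * X ^ ε * R ^ (K + K') := by
        rw [← rpow_add hX0, ← rpow_add hR0, add_halves]

lemma of_le {f g : ℝ → ℝ → ℝ} (hg : Slow g) (h1 : ∀ X R : ℝ, 1 ≤ X → 2 ≤ R → 1 ≤ f X R)
    (h2 : ∀ X R : ℝ, 1 ≤ X → 2 ≤ R → f X R ≤ g X R) : Slow f := by
  refine ⟨h1, fun ε hε => ?_⟩
  obtain ⟨C, K, hC, hK, h3⟩ := hg.2 ε hε
  exact ⟨C, K, hC, hK, fun X R hX hR => (h2 X R hX hR).trans (h3 X R hX hR)⟩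

lemma add {f g : ℝ → ℝ → ℝ} (hf : Slow f) (hg : Slow g) : Slow (fun X R => f X R + g X R) := by
  refine of_le (mul (const one_le_two) (mul hf hg)) (fun X R hX hR => ?_) (fun X R hX hR => ?_)
  · linarith [hf.1 X R hX hR, hg.1 X R hX hR]
  · have := hf.1 X R hX hR
    have := hg.1 X R hX hR
    nlinarith

lemma rpow {f : ℝ → ℝ → ℝ} (hf : Slow f) {a : ℝ} (ha : 0 ≤ a) :
    Slow (fun X R => f X R ^ a) := by
  refine ⟨fun X R hX hR => one_le_rpow (hf.1 X R hX hR) ha, fun ε hε => ?_⟩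
  obtain ⟨C, K, hC, hK, h1⟩ := hf.2 (ε / (a + 1)) (by positivity)
  refine ⟨C ^ a, K * a, by positivity, by positivity, fun X R hX hR => ?_⟩
  have hX0 : 0 < X := by linarith
  have hR0 : 0 < R := by linarith
  calc f X R ^ a ≤ (C * X ^ (ε / (a + 1)) * R ^ K) ^ a :=
        rpow_le_rpow (by linarith [hf.1 X R hX hR]) (h1 X R hX hR) ha
    _ = C ^ a * X ^ (ε / (a + 1) * a) * R ^ (K * a) := by
        rw [mul_rpow (by positivity) (by positivity), mul_rpow hC (by positivity),
          ← rpow_mul hX0.le, ← rpow_mul hR0.le]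
    _ ≤ C ^ a * X ^ ε * R ^ (K * a) := by
        gcongr
        rw [div_mul_eq_mul_div, div_le_iff₀ (by positivity)]; nlinarith

lemma pow {f : ℝ → ℝ → ℝ} (hf : Slow f) (n : ℕ) : Slow (fun X R => f X R ^ n) := by
  simpa using rpow hf (cast_nonneg n)

lemma one_add_log : Slow (fun X _ => 1 + Real.log X) := by
  refine ⟨fun X R hX _ => by linarith [log_nonneg hX], fun ε hε =>
    ⟨1 + 1 / ε, 0, by positivity, le_rfl, fun X R hX _ => ?_⟩⟩
  rw [rpow_zero, mul_one]
  have h1 := Real.log_le_rpow_div (by linarith : (0:ℝ) ≤ X) hε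
  have h2 := one_le_rpow hX hε.le
  rw [add_mul, one_div_mul_eq_div]; linarith

lemma nonneg {f : ℝ → ℝ → ℝ} (hf : Slow f) {X R : ℝ} (hX : 1 ≤ X) (hR : 2 ≤ R) : 0 ≤ f X R := by
  linarith [hf.1 X R hX hR]

end Slow

/-! ### The divisor bound -/

lemma card_divisors_le_rpow {ε : ℝ} (hε : 0 < ε) :
    ∃ C : ℝ, 0 ≤ C ∧ ∀ n : ℕ, n ≠ 0 → (n.divisors.card : ℝ) ≤ C * (n : ℝ) ^ ε := by
  set B : ℕ := ⌈(2:ℝ) ^ (1 / ε)⌉₊ with hB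
  set c : ℝ := 1 + 1 / (ε * Real.log 2) with hc
  have hl : 0 < ε * Real.log 2 := mul_pos hε (Real.log_pos one_lt_two)
  have hc1 : 1 ≤ c := by rw [hc]; have := one_div_pos.mpr hl; linarith
  refine ⟨c ^ B, by positivity, fun n hn => ?_⟩
  have hfac : (n : ℝ) ^ ε = ∏ p ∈ n.primeFactors, ((p : ℝ) ^ ε) ^ (n.factorization p) := by
    conv_lhs => rw [← Nat.prod_factorization_pow_eq_self hn]
    rw [Finsupp.prod, Nat.cast_prod, ← Real.finsetProd_rpow _ _ (fun i _ => by positivity)]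
    refine Finset.prod_congr rfl fun p _ => ?_
    push_cast
    rw [← rpow_natCast, ← rpow_mul (by positivity), mul_comm, rpow_mul
      (by positivity), rpow_natCast]
  rw [Nat.card_divisors hn, hfac]
  push_cast
  have key : ∀ p ∈ n.primeFactors, ((n.factorization p : ℝ) + 1) ≤
      (if p < B then c else 1) * ((p : ℝ) ^ ε) ^ (n.factorization p) := by
    intro p hp
    have hp2 : (2:ℝ) ≤ p := mod_cast (Nat.prime_of_mem_primeFactors hp).two_le
    set a := n.factorization p
    split_ifs with hpB
    · have h1 : (2:ℝ) ^ ε ≤ (p:ℝ) ^ ε := rpow_le_rpow (by norm_num) hp2 hε.le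
      have h2 : 1 + ε * Real.log 2 ≤ (2:ℝ) ^ ε := by
        rw [Real.rpow_def_of_pos two_pos, mul_comm]
        linarith [Real.add_one_le_exp (Real.log 2 * ε)]
      have h3 : 1 + (a:ℝ) * (ε * Real.log 2) ≤ ((p:ℝ) ^ ε) ^ a := by
        calc 1 + (a:ℝ) * (ε * Real.log 2) ≤ (1 + ε * Real.log 2) ^ a :=
              one_add_mul_le_pow (by linarith) a
          _ ≤ _ := by gcongr; linarith
      have h4 : (a:ℝ) + 1 ≤ c * (1 + (a:ℝ) * (ε * Real.log 2)) := by
        rw [hc]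
        have : (1 + 1 / (ε * Real.log 2)) * (1 + (a:ℝ) * (ε * Real.log 2)) =
          1 + a + a * (ε * Real.log 2) + 1 / (ε * Real.log 2) := by field_simp; ring
        rw [this]
        have : 0 ≤ (a:ℝ) * (ε * Real.log 2) := by positivity
        have := one_div_pos.mpr hl
        linarith
      exact h4.trans (by gcongr)
    · push Not at hpB
      have h1 : (2:ℝ) ≤ (p:ℝ) ^ ε := by
        calc (2:ℝ) = ((2:ℝ) ^ (1 / ε)) ^ ε := by
              rw [← rpow_mul (by norm_num)]; field_simp; simp
          _ ≤ (p:ℝ) ^ ε := by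
              refine rpow_le_rpow (by positivity) ?_ hε.le
              exact (Nat.le_ceil _).trans (mod_cast hpB)
      rw [one_mul]
      have h2 : (a:ℝ) + 1 ≤ 2 ^ a := mod_cast Nat.lt_two_pow_self
      exact h2.trans (by gcongr)
  refine (Finset.prod_le_prod (fun p _ => by positivity) key).trans ?_
  rw [Finset.prod_mul_distrib]
  refine mul_le_mul_of_nonneg_right ?_ (Finset.prod_nonneg fun p _ => by positivity)
  rw [← Finset.prod_filter, Finset.prod_const]
  refine pow_le_pow_right₀ hc1 ?_
  calc (n.primeFactors.filter (fun p => p < B)).card ≤ (range B).card :=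
        card_le_card fun p hp => by simpa using (mem_filter.mp hp).2
    _ = B := card_range B

/-- Divisor counts of integers of polynomial size are slowly growing. -/
lemma exists_slow_card_divisors (A : ℕ) : ∃ f : ℝ → ℝ → ℝ, Slow f ∧
    ∀ X R : ℝ, 1 ≤ X → 2 ≤ R → ∀ n : ℕ, n ≠ 0 → (n : ℝ) ≤ A * X ^ A →
      (n.divisors.card : ℝ) ≤ f X R := by
  set g : ℝ → ℕ := fun X => (range (⌊A * X ^ A⌋₊ + 1)).sup fun n => n.divisors.card with hg
  have hgle : ∀ X : ℝ, ∀ n : ℕ, 1 ≤ X → (n : ℝ) ≤ A * X ^ A → n.divisors.card ≤ g X := by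
    intro X n hX hn
    refine Finset.le_sup (f := fun n : ℕ => n.divisors.card) ?_
    rw [mem_range, lt_succ_iff]
    exact le_floor hn
  refine ⟨fun X _ => 1 + g X, ⟨fun X R _ _ => by simp, fun ε hε => ?_⟩, ?_⟩
  · obtain ⟨C, hC, h1⟩ := card_divisors_le_rpow (ε := ε / (A + 1)) (by positivity)
    refine ⟨1 + C * (A:ℝ) ^ (ε / (A + 1)), 0, by positivity, le_rfl, fun X R hX _ => ?_⟩
    rw [rpow_zero, mul_one, add_mul, one_mul]
    refine add_le_add (one_le_rpow hX hε.le) ?_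
    have hne : (range (⌊A * X ^ A⌋₊ + 1)).Nonempty := ⟨0, by simp⟩
    obtain ⟨n, hn, h2⟩ := Finset.exists_mem_eq_sup _ hne (fun n : ℕ => n.divisors.card)
    have h3 : g X = n.divisors.card := h2
    rw [h3]
    rcases eq_or_ne n 0 with rfl | hn0
    · simp; positivity
    have hn1 : (n : ℝ) ≤ A * X ^ A := by
      rw [mem_range, lt_succ_iff] at hn
      exact (cast_le.mpr hn).trans (floor_le (by positivity))
    refine (h1 n hn0).trans ?_
    rw [mul_assoc]
    refine mul_le_mul_of_nonneg_left ?_ hC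
    have hX0 : 0 ≤ X := by linarith
    calc (n : ℝ) ^ (ε / (A + 1)) ≤ (A * X ^ A) ^ (ε / (A + 1)) :=
          rpow_le_rpow (by positivity) hn1 (by positivity)
      _ = (A:ℝ) ^ (ε / (A + 1)) * X ^ (A * (ε / (A + 1))) := by
          rw [mul_rpow (by positivity) (by positivity), ← rpow_natCast, ← rpow_mul hX0]
      _ ≤ _ := by
          gcongr
          rw [mul_div_assoc', div_le_iff₀ (by positivity)]; nlinarith
  · intro X R hX _ n _ hn
    have := hgle X n hX hn
    have : (n.divisors.card : ℝ) ≤ g X := mod_cast this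
    linarith

/-! ### Admissible growth exponents for moments of `h` -/

/-- The `t`-th moment of `h` grows at most like the power `l`, up to slowly growing factors. -/
def Adm (t l : ℝ) : Prop :=
  ∃ f : ℝ → ℝ → ℝ, Slow f ∧ ∀ X R Y R' : ℝ, 1 ≤ X → 2 ≤ R → 1 ≤ Y → Y ≤ X → 2 ≤ R' → R' ≤ R →
    avg (fun α => ‖h Y R' α‖ ^ t) ≤ f X R * Y ^ l

lemma continuous_norm_h_rpow (Y R : ℝ) {t : ℝ} (ht : 0 ≤ t) : Continuous (fun α => ‖h Y R α‖ ^ t) :=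
  (continuous_h Y R).norm.rpow_const fun _ => Or.inr ht

lemma Adm.mono {t l l' : ℝ} (hl : l ≤ l') (H : Adm t l) : Adm t l' := by
  obtain ⟨f, hf, H⟩ := H
  refine ⟨f, hf, fun X R Y R' hX hR hY hYX hR' hRR => (H X R Y R' hX hR hY hYX hR' hRR).trans ?_⟩
  have := hf.nonneg hX hR
  gcongr

lemma adm_self {t : ℝ} (ht : 0 ≤ t) : Adm t t := by
  refine ⟨_, Slow.const le_rfl, fun X R Y R' hX hR hY hYX hR' hRR => ?_⟩
  rw [one_mul, ← avg_const (Y ^ t)]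
  refine avg_mono (continuous_norm_h_rpow _ _ ht) continuous_const fun α => ?_
  exact rpow_le_rpow (norm_nonneg _) (norm_h_le _ _ _ (by linarith)) ht

lemma Adm.interp {a b x y ρ σ : ℝ} (ha : 0 ≤ a) (hb : 0 ≤ b) (hρ : 0 ≤ ρ) (hσ : 0 ≤ σ)
    (h1 : ρ + σ = 1) (Ha : Adm a x) (Hb : Adm b y) : Adm (ρ * a + σ * b) (ρ * x + σ * y) := by
  obtain ⟨f, hf, Ha⟩ := Ha
  obtain ⟨g, hg, Hb⟩ := Hb
  refine ⟨_, (hf.rpow hρ).mul (hg.rpow hσ), fun X R Y R' hX hR hY hYX hR' hRR => ?_⟩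
  have hf0 := hf.nonneg hX hR
  have hg0 := hg.nonneg hX hR
  have hY0 : 0 < Y := by linarith
  have h2 : ∀ α, ‖h Y R' α‖ ^ (ρ * a + σ * b) =
      (‖h Y R' α‖ ^ a) ^ ρ * (‖h Y R' α‖ ^ b) ^ σ := by
    intro α
    rw [rpow_add_of_nonneg (norm_nonneg _) (by positivity) (by positivity),
      mul_comm ρ a, mul_comm σ b, rpow_mul (norm_nonneg _), rpow_mul (norm_nonneg _)]
  simp only [h2]
  refine (holder_two (continuous_norm_h_rpow _ _ ha) (continuous_norm_h_rpow _ _ hb)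
    (fun α => by positivity) (fun α => by positivity) hρ hσ h1).trans ?_
  have e1 := Ha X R Y R' hX hR hY hYX hR' hRR
  have e2 := Hb X R Y R' hX hR hY hYX hR' hRR
  have n1 : 0 ≤ avg (fun α => ‖h Y R' α‖ ^ a) := avg_nonneg fun α => by positivity
  have n2 : 0 ≤ avg (fun α => ‖h Y R' α‖ ^ b) := avg_nonneg fun α => by positivity
  calc _ ≤ (f X R * Y ^ x) ^ ρ * (g X R * Y ^ y) ^ σ := by gcongr
    _ = f X R ^ ρ * g X R ^ σ * (Y ^ (ρ * x) * Y ^ (σ * y)) := by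
        rw [mul_rpow hf0 (by positivity), mul_rpow hg0 (by positivity),
          ← rpow_mul hY0.le, ← rpow_mul hY0.le, mul_comm x, mul_comm y]
        ring
    _ = _ := by rw [← rpow_add hY0]

/-- Admissibility is closed under decreasing limits of the exponent. -/
lemma Adm.of_forall_add {t l : ℝ} (H : ∀ n : ℕ, Adm t (l + 1 / (n + 1))) : Adm t l := by
  choose f hf H using H
  set g : ℝ → ℝ → ℝ := fun X R => ⨅ n : ℕ, f n X R * X ^ (1 / ((n:ℝ) + 1)) with hg
  have hge : ∀ X R : ℝ, 1 ≤ X → 2 ≤ R → ∀ n : ℕ, 1 ≤ f n X R * X ^ (1 / ((n:ℝ) + 1)) := by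
    intro X R hX hR n
    exact one_le_mul_of_one_le_of_one_le ((hf n).1 X R hX hR)
      (one_le_rpow hX (by positivity))
  have hle : ∀ X R : ℝ, 1 ≤ X → 2 ≤ R → ∀ n : ℕ, g X R ≤ f n X R * X ^ (1 / ((n:ℝ) + 1)) := by
    intro X R hX hR n
    exact ciInf_le ⟨1, by rintro _ ⟨n, rfl⟩; exact hge X R hX hR n⟩ n
  refine ⟨g, ⟨fun X R hX hR => le_ciInf (hge X R hX hR), fun ε hε => ?_⟩, ?_⟩
  · obtain ⟨n, hn⟩ := exists_nat_one_div_lt (half_pos hε)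
    obtain ⟨C, K, hC, hK, h1⟩ := (hf n).2 (ε / 2) (by linarith)
    refine ⟨C, K, hC, hK, fun X R hX hR => (hle X R hX hR n).trans ?_⟩
    have hX0 : 0 < X := by linarith
    calc f n X R * X ^ (1 / ((n:ℝ) + 1)) ≤ (C * X ^ (ε / 2) * R ^ K) * X ^ (ε / 2) := by
          gcongr
          exact h1 X R hX hR
      _ = C * (X ^ (ε / 2) * X ^ (ε / 2)) * R ^ K := by ring
      _ = _ := by rw [← rpow_add hX0, add_halves]
  · intro X R Y R' hX hR hY hYX hR' hRR
    have hY0 : 0 < Y := by linarith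
    rw [← div_le_iff₀ (by positivity)]
    refine le_ciInf fun n => ?_
    rw [div_le_iff₀ (by positivity)]
    refine (H n X R Y R' hX hR hY hYX hR' hRR).trans ?_
    rw [rpow_add hY0, mul_assoc, mul_comm (Y ^ l)]
    have := (hf n).nonneg hX hR
    gcongr

lemma avg_normSq_trig_le {ι : Type*} (s : Finset ι) (φ : ι → ℤ) (B Z : ℝ) (hB : 0 ≤ B)
    (h1 : ∀ i ∈ s, φ i ≠ 0 → ((s.filter (fun j => φ j = φ i)).card : ℝ) ≤ B)
    (h2 : ((s.filter (fun j => φ j = 0)).card : ℝ) ≤ Z) :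
    avg (fun α => ‖trig s φ α‖ ^ 2) ≤ B * s.card + Z ^ 2 := by
  classical
  rw [avg_normSq_trig]
  have e1 : ((s ×ˢ s).filter (fun p => φ p.1 = φ p.2)).card =
      ∑ i ∈ s, (s.filter (fun j => φ j = φ i)).card := by
    rw [card_filter, sum_product]
    refine sum_congr rfl fun i _ => ?_
    rw [card_filter]
    exact sum_congr rfl fun j _ => by simp only [eq_comm]
  rw [e1]
  push_cast
  have h3 : ∀ i ∈ s, ((s.filter (fun j => φ j = φ i)).card : ℝ) ≤ B + if φ i = 0 then Z else 0 := by
    intro i hi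
    split_ifs with h0
    · rw [h0]; linarith
    · linarith [h1 i hi h0]
  refine (sum_le_sum h3).trans ?_
  rw [sum_add_distrib, ← sum_filter, sum_const, sum_const, nsmul_eq_mul, nsmul_eq_mul]
  have hZ : (0:ℝ) ≤ Z := le_trans (cast_nonneg _) h2
  nlinarith

lemma adm_two : Adm 2 1 := by
  refine ⟨_, Slow.const le_rfl, fun X R Y R' hX hR hY hYX hR' hRR => ?_⟩
  have h1 := avg_normSq_trig_le (smoothA Y R') (fun x => (x:ℤ) ^ 4) 1 0 zero_le_one ?_ ?_
  · have h2 := card_smoothA_le Y R' (by linarith)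
    simp only [h_eq_trig, rpow_one, Real.rpow_ofNat]
    linarith
  · intro i _ _
    have : (smoothA Y R').filter (fun j : ℕ => (j:ℤ) ^ 4 = (i:ℤ) ^ 4) ⊆ {i} := by
      intro j hj
      have := (mem_filter.mp hj).2
      rw [Finset.mem_singleton]
      have h3 : j ^ 4 = i ^ 4 := mod_cast this
      exact Nat.pow_left_injective (by norm_num) h3
    exact_mod_cast card_le_card this
  · have : (smoothA Y R').filter (fun j : ℕ => (j:ℤ) ^ 4 = 0) = ∅ := by
      refine filter_eq_empty_iff.mpr fun j hj => ?_
      have := ((mem_smoothA (by linarith)).mp hj).1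
      positivity
    rw [this]; simp

/-- Pairs with a prescribed nonzero difference of fourth powers are bounded by divisor counts. -/
lemma card_pow_four_sub_le (s : Finset (ℕ × ℕ)) (n : ℤ) (hn : n ≠ 0) :
    (s.filter (fun p => (p.1:ℤ) ^ 4 - (p.2:ℤ) ^ 4 = n)).card ≤ n.natAbs.divisors.card ^ 2 := by
  rw [pow_two, ← card_product]
  refine card_le_card_of_injOn (fun p => (((p.1:ℤ) - p.2).natAbs, p.1 + p.2)) ?_ ?_
  · intro p hp
    have hp := (mem_filter.mp hp).2
    have hn0 : n.natAbs ≠ 0 := by simpa using hn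
    simp only [coe_product, Set.mem_prod, mem_coe, mem_divisors, ne_eq, hn0,
      not_false_eq_true, and_true]
    have hfac : n = ((p.1:ℤ) - p.2) * (((p.1 + p.2 : ℕ):ℤ) * ((p.1:ℤ) ^ 2 + (p.2:ℤ) ^ 2)) := by
      rw [← hp]; push_cast; ring
    constructor
    · rw [Int.natAbs_dvd_natAbs, hfac]; exact Dvd.intro _ rfl
    · rw [← natCast_dvd, hfac]; exact (Dvd.intro _ rfl).mul_left _
  · intro p hp q hq hpq
    have hp := (mem_filter.mp hp).2
    have hq := (mem_filter.mp hq).2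
    simp only [Prod.mk.injEq] at hpq
    obtain ⟨h1, h2⟩ := hpq
    rcases Int.natAbs_eq_natAbs_iff.mp h1 with h3 | h3
    · ext <;> omega
    · exfalso
      have h4 : (p.1:ℤ) + p.2 = q.1 + q.2 := mod_cast h2
      have h5 : (p.1:ℤ) = q.2 := by linarith
      have h6 : (p.2:ℤ) = q.1 := by linarith
      rw [h5, h6] at hp
      omega

lemma normSq_trig_eq_trig {ι : Type*} (s : Finset ι) (φ : ι → ℤ) (α : ℝ) :
    ((‖trig s φ α‖ ^ 2 : ℝ) : ℂ) = trig (s ×ˢ s) (fun p => φ p.1 - φ p.2) α :=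
  normSq_trig s φ α

lemma adm_four : Adm 4 2 := by
  obtain ⟨f, hf, hd⟩ := exists_slow_card_divisors 4
  refine ⟨_, (hf.pow 2).add (Slow.const le_rfl), fun X R Y R' hX hR hY hYX hR' hRR => ?_⟩
  have hf1 := hf.nonneg hX hR
  have hY0 : 0 ≤ Y := by linarith
  set A := smoothA Y R' with hA
  have hAc := card_smoothA_le Y R' hY0
  have hpair : ((A ×ˢ A).card : ℝ) ≤ Y ^ 2 := by
    rw [card_product, pow_two]; push_cast; gcongr
  have h1 := avg_normSq_trig_le (A ×ˢ A) (fun p => (p.1:ℤ) ^ 4 - (p.2:ℤ) ^ 4) (f X R ^ 2) Y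
    (by positivity) ?_ ?_
  · have h3 : ∀ α, ‖h Y R' α‖ ^ (4:ℝ) =
        ‖trig (A ×ˢ A) (fun p => (p.1:ℤ) ^ 4 - (p.2:ℤ) ^ 4) α‖ ^ 2 := by
      intro α
      rw [← normSq_trig_eq_trig A (fun x => (x:ℤ) ^ 4), ← h_eq_trig, norm_real,
        Real.norm_of_nonneg (by positivity), ← pow_mul]
      norm_cast
    simp only [h3, Real.rpow_ofNat]
    nlinarith [sq_nonneg (f X R)]
  · intro i hi h0
    rw [mem_product] at hi
    have b1 := (mem_smoothA hY0).mp hi.1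
    have b2 := (mem_smoothA hY0).mp hi.2
    have hc := card_pow_four_sub_le (A ×ˢ A) _ h0
    have hd' := hd X R hX hR ((i.1:ℤ) ^ 4 - (i.2:ℤ) ^ 4).natAbs (by simpa using h0) ?_
    · calc _ ≤ ((((i.1:ℤ) ^ 4 - (i.2:ℤ) ^ 4).natAbs.divisors.card ^ 2 : ℕ) : ℝ) := by
            exact_mod_cast hc
        _ ≤ _ := by push_cast; gcongr
    · have e1 : (i.1:ℝ) ^ 4 ≤ X ^ 4 := by gcongr; linarith
      have e2 : (i.2:ℝ) ^ 4 ≤ X ^ 4 := by gcongr; linarith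
      have e3 : (0:ℝ) ≤ (i.1:ℝ) ^ 4 := by positivity
      have e4 : (0:ℝ) ≤ (i.2:ℝ) ^ 4 := by positivity
      rw [Nat.cast_natAbs]; push_cast
      rw [abs_le]; constructor <;> linarith
  · refine le_trans (cast_le.mpr ?_) hAc
    refine card_le_card_of_injOn Prod.fst (fun p hp => ?_) (fun p hp q hq hpq => ?_)
    · exact (mem_product.mp (mem_filter.mp hp).1).1
    · have hp := (mem_filter.mp hp).2
      have hq := (mem_filter.mp hq).2
      have h3 : p.1 ^ 4 = p.2 ^ 4 := by rw [sub_eq_zero] at hp; exact_mod_cast hp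
      have h4 : q.1 ^ 4 = q.2 ^ 4 := by rw [sub_eq_zero] at hq; exact_mod_cast hq
      have h5 := Nat.pow_left_injective (n := 4) (by norm_num) h3
      have h6 := Nat.pow_left_injective (n := 4) (by norm_num) h4
      ext
      · exact hpq
      · omega

/-! ### Decomposing pairs of smooth numbers -/

/-- Every `w > M` has a divisor just above `M` composed of its largest prime factors. -/
lemma exists_partial_prod {M w : ℕ} (hM : 1 ≤ M) (hw : M < w) :
    ∃ m r : ℕ, w = m * r ∧ M < m ∧ m / m.minFac ≤ M ∧
      ∀ p : ℕ, p.Prime → p ∣ r → p ≤ m.minFac := by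
  classical
  have hex : ∃ m : ℕ, ∃ r : ℕ, w = m * r ∧ M < m ∧ ∀ p : ℕ, p.Prime → p ∣ r → p ≤ m.minFac :=
    ⟨w, 1, by simp, hw, fun p hp h1 => absurd (dvd_one.mp h1) hp.ne_one⟩
  obtain ⟨r, h1, h2, h3⟩ := Nat.find_spec hex
  set m := Nat.find hex with hm
  refine ⟨m, r, h1, h2, ?_, h3⟩
  by_contra! hcon
  have hm1 : m ≠ 1 := by omega
  have hmp := minFac_prime hm1
  have hdiv : m = m.minFac * (m / m.minFac) := (mul_div_cancel' (minFac_dvd m)).symm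
  have hlt : m / m.minFac < m := Nat.div_lt_self (by omega) hmp.one_lt
  refine Nat.find_min hex hlt ⟨m.minFac * r, ?_, hcon, ?_⟩
  · rw [h1]; conv_lhs => rw [hdiv]
    ring
  · intro p hp hpd
    have hle : m.minFac ≤ (m / m.minFac).minFac :=
      minFac_le_of_dvd (minFac_prime (by omega)).two_le
        ((minFac_dvd _).trans (div_dvd_of_dvd (minFac_dvd m)))
    rcases (Nat.Prime.dvd_mul hp).mp hpd with h4 | h4
    · rw [(Nat.prime_dvd_prime_iff_eq hp hmp).mp h4]; exact hle
    · exact (h3 p hp h4).trans hle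

lemma prefix_unique_aux {M m r m' r' : ℕ} (hM : 1 ≤ M) (h1 : m * r = m' * r') (hm : M < m)
    (hm' : M < m') (hq' : m' / m'.minFac ≤ M)
    (hr' : ∀ p : ℕ, p.Prime → p ∣ r' → p ≤ m'.minFac) (hlt : m'.minFac < m.minFac) : False := by
  have hp' := minFac_prime (show m' ≠ 1 by omega)
  have hcop : ∀ k : ℕ, (∀ p : ℕ, p.Prime → p ∣ k → p ≤ m'.minFac) → m.Coprime k := by
    intro k hk
    refine Coprime.symm (coprime_of_dvd fun p hp hpk hpm => ?_)
    have := minFac_le_of_dvd hp.two_le hpm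
    have := hk p hp hpk
    omega
  have hd : m ∣ m' := (hcop r' hr').dvd_of_dvd_mul_right (h1 ▸ Dvd.intro _ rfl)
  have hd2 : m ∣ m' / m'.minFac := by
    refine (hcop m'.minFac ?_).dvd_of_dvd_mul_left
      (by rwa [mul_div_cancel' (minFac_dvd m')])
    intro p hp h2
    exact ((Nat.prime_dvd_prime_iff_eq hp hp').mp h2).le
  have hpos : 0 < m' / m'.minFac :=
    Nat.div_pos (Nat.minFac_le (by omega)) hp'.pos
  have := le_of_dvd hpos hd2
  omega

lemma prefix_unique_aux_eq {M m r m' r' : ℕ} (hM : 1 ≤ M) (h1 : m * r = m' * r') (hm : M < m)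
    (hm' : M < m') (hq' : m' / m'.minFac ≤ M)
    (hr' : ∀ p : ℕ, p.Prime → p ∣ r' → p ≤ m'.minFac) (heq : m.minFac = m'.minFac)
    (hlt : m.factorization m.minFac < m'.factorization m.minFac) : False := by
  set ϖ := m.minFac with hϖ
  have hp : ϖ.Prime := minFac_prime (show m ≠ 1 by omega)
  have hr0 : m * r ≠ 0 → r ≠ 0 := fun h => right_ne_zero_of_mul h
  have hd2 : m ∣ m' / ϖ := by
    have hdvd : ϖ ∣ m' := heq ▸ minFac_dvd m'
    have hm'0 : m' / ϖ ≠ 0 := (Nat.div_pos (le_of_dvd (by omega) hdvd) hp.pos).ne'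
    rw [← Nat.factorization_le_iff_dvd (by omega) hm'0]
    intro p
    rw [Nat.factorization_div hdvd, hp.factorization]
    simp only [Finsupp.coe_tsub, Pi.sub_apply]
    by_cases hpp : p = ϖ
    · subst hpp; simp only [Finsupp.single_eq_same]; omega
    · rw [Finsupp.single_eq_of_ne hpp, Nat.sub_zero]
      by_cases hpd : p.Prime ∧ p ∣ m
      · have h2 := minFac_le_of_dvd hpd.1.two_le hpd.2
        have h3 : ϖ < p := lt_of_le_of_ne h2 (Ne.symm hpp)
        have h4 : ¬ p ∣ r' := fun h => by have := hr' p hpd.1 h; omega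
        by_cases hr'0 : r' = 0
        · exfalso; exact h4 (hr'0 ▸ dvd_zero p)
        by_cases hr0 : r = 0
        · simp [hr0] at h1; omega
        have h5 := congrArg (fun n => n.factorization p) h1
        simp only [Nat.factorization_mul (show m ≠ 0 by omega) hr0,
          Nat.factorization_mul (show m' ≠ 0 by omega) hr'0, Finsupp.add_apply,
          Nat.factorization_eq_zero_of_not_dvd h4] at h5
        omega
      · have : m.factorization p = 0 := by
          rw [Nat.factorization_eq_zero_iff]; tauto
        omega
  have hpos : 0 < m' / ϖ :=
    Nat.div_pos (le_of_dvd (by omega) (heq ▸ minFac_dvd m')) hp.pos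
  have := le_of_dvd hpos hd2
  rw [← heq] at hq'
  omega

lemma prefix_unique {M m r m' r' : ℕ} (hM : 1 ≤ M) (h1 : m * r = m' * r') (hm : M < m)
    (hm' : M < m') (hq : m / m.minFac ≤ M) (hq' : m' / m'.minFac ≤ M)
    (hr : ∀ p : ℕ, p.Prime → p ∣ r → p ≤ m.minFac)
    (hr' : ∀ p : ℕ, p.Prime → p ∣ r' → p ≤ m'.minFac) : m = m' := by
  rcases lt_trichotomy m.minFac m'.minFac with hlt | heq | hlt
  · exact (prefix_unique_aux hM h1.symm hm' hm hq hr hlt).elim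
  · rcases lt_trichotomy (m.factorization m.minFac) (m'.factorization m.minFac) with h2 | h2 | h2
    · exact (prefix_unique_aux_eq hM h1 hm hm' hq' hr' heq h2).elim
    · set ϖ := m.minFac with hϖ
      have hz : r ≠ 0 := by
        rintro rfl
        obtain ⟨p, hp1, hp2⟩ := Nat.exists_infinite_primes (ϖ + 1)
        have := hr p hp2 (dvd_zero p); omega
      have hz' : r' ≠ 0 := by
        rintro rfl
        obtain ⟨p, hp1, hp2⟩ := Nat.exists_infinite_primes (m'.minFac + 1)
        have := hr' p hp2 (dvd_zero p); omega
      refine Nat.eq_of_factorization_eq (by omega) (by omega) fun p => ?_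
      by_cases hpp : p = ϖ
      · subst hpp; exact h2
      have h5 := congrArg (fun n => n.factorization p) h1
      simp only [Nat.factorization_mul (show m ≠ 0 by omega) hz,
        Nat.factorization_mul (show m' ≠ 0 by omega) hz', Finsupp.add_apply] at h5
      by_cases hprime : p.Prime
      swap
      · simp [Nat.factorization_eq_zero_of_not_prime _ hprime]
      rcases lt_or_gt_of_ne hpp with hlt | hgt
      · have e1 : ¬ p ∣ m := fun h => by
          have := minFac_le_of_dvd hprime.two_le h; omega
        have e2 : ¬ p ∣ m' := fun h => by
          have := minFac_le_of_dvd hprime.two_le h; omega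
        rw [Nat.factorization_eq_zero_of_not_dvd e1, Nat.factorization_eq_zero_of_not_dvd e2]
      · have e1 : ¬ p ∣ r := fun h => by have := hr p hprime h; omega
        have e2 : ¬ p ∣ r' := fun h => by have := hr' p hprime h; omega
        rw [Nat.factorization_eq_zero_of_not_dvd e1, Nat.factorization_eq_zero_of_not_dvd e2] at h5
        omega
    · exact (prefix_unique_aux_eq hM h1.symm hm' hm hq hr heq.symm (by rw [← heq]; exact h2)).elim
  · exact (prefix_unique_aux hM h1 hm hm' hq' hr' hlt).elim

/-- The part of `g` composed of primes at least `ϖ`. -/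
lemma exists_rough_part (g ϖ : ℕ) (hg : g ≠ 0) : ∃ d k : ℕ, g = d * k ∧
    (∀ p : ℕ, p.Prime → p ∣ d → ϖ ≤ p) ∧ ∀ p : ℕ, p.Prime → p ∣ k → p < ϖ := by
  induction g using Nat.recOnMul with
  | zero => exact absurd rfl hg
  | one => exact ⟨1, 1, rfl, fun p hp h => absurd (dvd_one.mp h) hp.ne_one,
      fun p hp h => absurd (dvd_one.mp h) hp.ne_one⟩
  | prime q hq =>
    rcases lt_or_ge q ϖ with h1 | h1
    · refine ⟨1, q, by simp, fun p hp h => absurd (dvd_one.mp h) hp.ne_one, fun p hp h => ?_⟩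
      rwa [(Nat.prime_dvd_prime_iff_eq hp hq).mp h]
    · refine ⟨q, 1, by simp, fun p hp h => ?_, fun p hp h => absurd (dvd_one.mp h) hp.ne_one⟩
      rwa [(Nat.prime_dvd_prime_iff_eq hp hq).mp h]
  | mul a b ha hb =>
    obtain ⟨d, k, h1, h2, h3⟩ := ha (left_ne_zero_of_mul hg)
    obtain ⟨d', k', h1', h2', h3'⟩ := hb (right_ne_zero_of_mul hg)
    refine ⟨d * d', k * k', by rw [h1, h1']; ring, fun p hp h => ?_, fun p hp h => ?_⟩
    · rcases (Nat.Prime.dvd_mul hp).mp h with h4 | h4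
      · exact h2 p hp h4
      · exact h2' p hp h4
    · rcases (Nat.Prime.dvd_mul hp).mp h with h4 | h4
      · exact h3 p hp h4
      · exact h3' p hp h4

lemma rough_part_unique {d k d' k' ϖ : ℕ} (h1 : d * k = d' * k')
    (h2 : ∀ p : ℕ, p.Prime → p ∣ d → ϖ ≤ p) (h3 : ∀ p : ℕ, p.Prime → p ∣ k → p < ϖ)
    (h2' : ∀ p : ℕ, p.Prime → p ∣ d' → ϖ ≤ p) (h3' : ∀ p : ℕ, p.Prime → p ∣ k' → p < ϖ) :
    d = d' := by
  have aux : ∀ a b c : ℕ, (∀ p : ℕ, p.Prime → p ∣ a → ϖ ≤ p) →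
      (∀ p : ℕ, p.Prime → p ∣ c → p < ϖ) → a ∣ b * c → a ∣ b := by
    intro a b c ha hc habc
    refine Coprime.dvd_of_dvd_mul_right (coprime_of_dvd fun p hp hpa hpc => ?_) habc
    have := ha p hp hpa
    have := hc p hp hpc
    omega
  exact Nat.dvd_antisymm (aux _ _ _ h2 h3' (h1 ▸ Dvd.intro _ rfl))
    (aux _ _ _ h2' h3 (h1 ▸ Dvd.intro _ rfl))

/-- The smooth Weyl sum restricted to integers coprime to `m`. -/
def hCop (m : ℕ) (Y R α : ℝ) : ℂ :=
  trig ((smoothA Y R).filter fun x => x.Coprime m) (fun x => (x : ℤ) ^ 4) α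

/-- The moduli between `M` and `M * R` with least prime factor at most `R`. -/
def moduli (M : ℕ) (R : ℝ) : Finset ℕ :=
  (Icc 1 ⌊M * R⌋₊).filter fun m => M < m ∧ (m.minFac : ℝ) ≤ R

/-- Majorant for the pairs whose quotient has a divisor just above `M`. -/
def pairMain (M : ℕ) (Y R α : ℝ) : ℝ :=
  ∑ m ∈ moduli M R, ‖hCop m Y R α‖ * ‖h (Y / m) m.minFac ((m ^ 4 : ℕ) * α)‖

/-- Majorant for the pairs whose quotient is at most `M`. -/
def pairSmall (M : ℕ) (Y R α : ℝ) : ℝ :=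
  ∑ m ∈ Icc 1 (min M ⌊Y⌋₊), ‖hCop m Y R α‖

lemma smooth_of_dvd {R : ℝ} {a b : ℕ} (hb : b ≠ 0) (hab : a ∣ b)
    (H : ∀ p ∈ b.primeFactors, (p : ℝ) ≤ R) : ∀ p ∈ a.primeFactors, (p : ℝ) ≤ R :=
  fun p hp => H p (Nat.primeFactors_mono hab hb hp)

lemma smooth_mul {R : ℝ} {a b : ℕ} (ha : a ≠ 0) (hb : b ≠ 0)
    (Ha : ∀ p ∈ a.primeFactors, (p : ℝ) ≤ R) (Hb : ∀ p ∈ b.primeFactors, (p : ℝ) ≤ R) :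
    ∀ p ∈ (a * b).primeFactors, (p : ℝ) ≤ R := by
  intro p hp
  rw [Nat.primeFactors_mul ha hb, Finset.mem_union] at hp
  exact hp.elim (Ha p) (Hb p)

/-- Data attached to a pair by the decomposition, with the factor structure it must satisfy. -/
structure PairData (M d m a v : ℕ) : Prop where
  lt : M < m
  div_le : m / m.minFac ≤ M
  rough : ∀ p : ℕ, p.Prime → p ∣ d → m.minFac ≤ p
  cop : a.Coprime m
  smooth : ∀ p : ℕ, p.Prime → p ∣ v → p ≤ m.minFac

lemma PairData.gcd_eq {M d m a v : ℕ} (H : PairData M d m a v) :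
    Nat.gcd (d * a) (d * (m * v)) = d * Nat.gcd a v := by
  rw [Nat.gcd_mul_left, Coprime.gcd_mul_left_cancel_right v H.cop.symm]

lemma PairData.unique {M d m a v d' m' a' v' : ℕ} (hM : 1 ≤ M) (H : PairData M d m a v)
    (H' : PairData M d' m' a' v') (hd : d ≠ 0) (ha : a ≠ 0) (hv : v ≠ 0)
    (h1 : d * a = d' * a') (h2 : d * (m * v) = d' * (m' * v')) :
    d = d' ∧ m = m' ∧ a = a' ∧ v = v' := by
  have hg : d * Nat.gcd a v = d' * Nat.gcd a' v' := by rw [← H.gcd_eq, ← H'.gcd_eq, h1, h2]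
  have hm0 : m ≠ 0 := by have := H.lt; omega
  have hd' : d' ≠ 0 := by
    rintro rfl; simp [hd, ha] at h1
  have ha' : a' ≠ 0 := by
    rintro rfl; simp [hd, ha] at h1
  have hv' : v' ≠ 0 := by
    rintro rfl; simp [hd, hm0, hv] at h2
  have hgp : 0 < Nat.gcd a v := gcd_pos_of_pos_left _ (by omega)
  have hgp' : 0 < Nat.gcd a' v' := gcd_pos_of_pos_left _ (by omega)
  have hdv := mul_div_cancel' (Nat.gcd_dvd_right a v)
  have hdv' := mul_div_cancel' (Nat.gcd_dvd_right a' v')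
  have hm : m * (v / Nat.gcd a v) = m' * (v' / Nat.gcd a' v') := by
    have e1 : (d * Nat.gcd a v) * (m * (v / Nat.gcd a v)) = d * (m * v) := by
      conv_rhs => rw [← hdv]
      ring
    have e2 : (d' * Nat.gcd a' v') * (m' * (v' / Nat.gcd a' v')) = d' * (m' * v') := by
      conv_rhs => rw [← hdv']
      ring
    have : (d * Nat.gcd a v) * (m * (v / Nat.gcd a v)) =
        (d * Nat.gcd a v) * (m' * (v' / Nat.gcd a' v')) := by
      rw [e1, h2, ← e2, hg]
    exact eq_of_mul_eq_mul_left (Nat.mul_pos (by omega) hgp) this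
  have hmm : m = m' := prefix_unique hM hm H.lt H'.lt H.div_le H'.div_le
    (fun p hp hpd => H.smooth p hp (hpd.trans (div_dvd_of_dvd (Nat.gcd_dvd_right _ _))))
    (fun p hp hpd => H'.smooth p hp (hpd.trans (div_dvd_of_dvd (Nat.gcd_dvd_right _ _))))
  subst hmm
  have hM1 : m ≠ 1 := by have := H.lt; omega
  have aux : ∀ b w : ℕ, b.Coprime m → (∀ p : ℕ, p.Prime → p ∣ w → p ≤ m.minFac) →
      ∀ p : ℕ, p.Prime → p ∣ Nat.gcd b w → p < m.minFac := by
    intro b w hb hw p hp hpd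
    refine lt_of_le_of_ne (hw p hp (hpd.trans (Nat.gcd_dvd_right _ _))) ?_
    rintro rfl
    exact Nat.not_coprime_of_dvd_of_dvd hp.one_lt (hpd.trans (Nat.gcd_dvd_left _ _))
      (minFac_dvd m) hb
  have hdd : d = d' := rough_part_unique hg H.rough (aux a v H.cop H.smooth) H'.rough
    (aux a' v' H'.cop H'.smooth)
  subst hdd
  refine ⟨rfl, rfl, eq_of_mul_eq_mul_left (by omega) h1, ?_⟩
  exact eq_of_mul_eq_mul_left (by omega) (eq_of_mul_eq_mul_left (by omega) h2)

lemma PairData.exists {M x y : ℕ} (hM : 1 ≤ M) (hx : x ≠ 0) (hy : y ≠ 0)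
    (hw : M < y / Nat.gcd x y) :
    ∃ d m a v : ℕ, PairData M d m a v ∧ x = d * a ∧ y = d * (m * v) := by
  have hg : Nat.gcd x y ≠ 0 := (gcd_pos_of_pos_left _ (by omega)).ne'
  obtain ⟨m, r, h1, h2, h3, h4⟩ := exists_partial_prod hM hw
  obtain ⟨d, k, h5, h6, h7⟩ := exists_rough_part (Nat.gcd x y) m.minFac hg
  have hxg := mul_div_cancel' (Nat.gcd_dvd_left x y)
  have hyg := mul_div_cancel' (Nat.gcd_dvd_right x y)
  have hcop : Coprime (x / Nat.gcd x y) (y / Nat.gcd x y) :=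
    Nat.coprime_div_gcd_div_gcd (by omega)
  refine ⟨d, m, k * (x / Nat.gcd x y), k * r, ⟨h2, h3, h6, ?_, ?_⟩, ?_, ?_⟩
  · refine Coprime.mul_left ?_ (hcop.coprime_dvd_right (h1 ▸ Dvd.intro _ rfl))
    refine coprime_of_dvd fun p hp hpk hpm => ?_
    have := h7 p hp hpk
    have := minFac_le_of_dvd hp.two_le hpm
    omega
  · intro p hp hpd
    rcases (Nat.Prime.dvd_mul hp).mp hpd with h8 | h8
    · exact (h7 p hp h8).le
    · exact h4 p hp h8
  · rw [← mul_assoc, ← h5, hxg]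
  · rw [h1] at hyg
    rw [← hyg, h5]; ring

lemma norm_sum_prod_e {ι κ : Type*} (s : Finset ι) (t : Finset κ) (φ : ι → ℤ) (ψ : κ → ℤ)
    (α : ℝ) : ‖∑ p ∈ s ×ˢ t, e (α * ((φ p.1 - ψ p.2 : ℤ) : ℝ))‖ = ‖trig s φ α‖ * ‖trig t ψ α‖ := by
  have : ∑ p ∈ s ×ˢ t, e (α * ((φ p.1 - ψ p.2 : ℤ) : ℝ)) =
      trig s φ α * (starRingEnd ℂ) (trig t ψ α) := by
    unfold trig
    rw [map_sum, sum_mul_sum, sum_product]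
    refine sum_congr rfl fun i _ => sum_congr rfl fun j _ => ?_
    rw [conj_e, ← e_add]; congr 1; push_cast; ring
  rw [this, norm_mul, RCLike.norm_conj]

lemma trig_mul_left {ι : Type*} (s : Finset ι) (φ : ι → ℤ) (c : ℤ) (α : ℝ) :
    trig s (fun i => c * φ i) α = trig s φ (c * α) := by
  unfold trig
  refine sum_congr rfl fun i _ => ?_
  congr 1; push_cast; ring

lemma norm_sum_pairs_le {ι σ τ : Type*} (B : Finset (ℕ × ℕ)) (D : Finset ι)
    (S : ι → Finset σ) (T : ι → Finset τ) (φ : ι → σ → ℕ) (ψ : ι → τ → ℕ)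
    (hmaps : ∀ i ∈ D, ∀ a ∈ S i, ∀ v ∈ T i, (φ i a, ψ i v) ∈ B)
    (hinj : ∀ i ∈ D, ∀ a ∈ S i, ∀ v ∈ T i, ∀ i' ∈ D, ∀ a' ∈ S i', ∀ v' ∈ T i',
      φ i a = φ i' a' → ψ i v = ψ i' v' → i = i' ∧ HEq a a' ∧ HEq v v')
    (hsurj : ∀ p ∈ B, ∃ i ∈ D, ∃ a ∈ S i, ∃ v ∈ T i, φ i a = p.1 ∧ ψ i v = p.2) (α : ℝ) :
    ‖∑ p ∈ B, e (α * (((p.1 : ℤ) ^ 4 - (p.2 : ℤ) ^ 4 : ℤ) : ℝ))‖ ≤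
      ∑ i ∈ D, ‖trig (S i) (fun a => (φ i a : ℤ) ^ 4) α‖ * ‖trig (T i) (fun v => (ψ i v : ℤ) ^ 4) α‖ := by
  classical
  have h1 : ∑ p ∈ B, e (α * (((p.1 : ℤ) ^ 4 - (p.2 : ℤ) ^ 4 : ℤ) : ℝ)) =
      ∑ q ∈ D.sigma (fun i => S i ×ˢ T i),
        e (α * (((φ q.1 q.2.1 : ℤ) ^ 4 - (ψ q.1 q.2.2 : ℤ) ^ 4 : ℤ) : ℝ)) := by
    symm
    refine Finset.sum_nbij (fun q => (φ q.1 q.2.1, ψ q.1 q.2.2)) ?_ ?_ ?_ ?_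
    · rintro ⟨i, a, v⟩ hq
      simp only [mem_sigma, mem_product] at hq
      exact hmaps i hq.1 a hq.2.1 v hq.2.2
    · rintro ⟨i, a, v⟩ hq ⟨i', a', v'⟩ hq' heq
      simp only [coe_sigma, mem_coe, Set.mem_sigma_iff, mem_product] at hq hq'
      simp only [Prod.mk.injEq] at heq
      obtain ⟨rfl, h2, h3⟩ := hinj i hq.1 a hq.2.1 v hq.2.2 i' hq'.1 a' hq'.2.1 v' hq'.2.2 heq.1 heq.2
      rw [eq_of_heq h2, eq_of_heq h3]
    · rintro ⟨x, y⟩ hp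
      obtain ⟨i, hi, a, ha, v, hv, h2, h3⟩ := hsurj _ hp
      exact ⟨⟨i, a, v⟩, by simp [hi, ha, hv], by simp [h2, h3]⟩
    · intro q _; rfl
  rw [h1, sum_sigma]
  refine (norm_sum_le _ _).trans (sum_le_sum fun i _ => ?_)
  rw [← norm_sum_prod_e]

lemma norm_sum_main_le {X R : ℝ} (hX : 1 ≤ X) {M : ℕ} (hM : 1 ≤ M) (α : ℝ) :
    ‖∑ p ∈ (smoothA X R ×ˢ smoothA X R).filter (fun p => M < p.2 / Nat.gcd p.1 p.2),
      e (α * (((p.1 : ℤ) ^ 4 - (p.2 : ℤ) ^ 4 : ℤ) : ℝ))‖ ≤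
    ∑ d ∈ Icc 1 ⌊X⌋₊, pairMain M (X / d) R ((d ^ 4 : ℕ) * α) := by
  classical
  have hX0 : 0 ≤ X := by linarith
  let D : Finset (ℕ × ℕ) := (Icc 1 ⌊X⌋₊ ×ˢ moduli M R).filter fun q =>
    q.2 / q.2.minFac ≤ M ∧ (∀ p : ℕ, p.Prime → p ∣ q.1 → q.2.minFac ≤ p) ∧
    (∀ p ∈ q.1.primeFactors, (p : ℝ) ≤ R) ∧ (∀ p ∈ q.2.primeFactors, (p : ℝ) ≤ R)
  have hD : ∀ d m, (d, m) ∈ D ↔ (d ∈ Icc 1 ⌊X⌋₊ ∧ m ∈ moduli M R) ∧ m / m.minFac ≤ M ∧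
      (∀ p : ℕ, p.Prime → p ∣ d → m.minFac ≤ p) ∧
      (∀ p ∈ d.primeFactors, (p : ℝ) ≤ R) ∧ (∀ p ∈ m.primeFactors, (p : ℝ) ≤ R) := by
    intro d m; simp only [D, mem_filter, mem_product]
  refine (norm_sum_pairs_le _ D
    (fun q => (smoothA (X / q.1) R).filter fun x => x.Coprime q.2)
    (fun q => smoothA (X / q.1 / q.2) q.2.minFac)
    (fun q a => q.1 * a) (fun q v => q.1 * (q.2 * v)) ?_ ?_ ?_ α).trans ?_
  · rintro ⟨d, m⟩ hq a ha v hv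
    rw [hD] at hq
    obtain ⟨⟨hd, hm⟩, h1, h2, h3, h4⟩ := hq
    rw [mem_Icc] at hd
    rw [moduli, mem_filter] at hm
    have hd0 : (0:ℝ) < d := mod_cast hd.1
    have hm0 : (0:ℝ) < m := by have := hm.2.1; exact_mod_cast (by omega : 0 < m)
    rw [mem_filter, mem_smoothA (by positivity)] at ha
    rw [mem_smoothA (by positivity)] at hv
    obtain ⟨⟨ha1, ha2, ha3⟩, hcop⟩ := ha
    obtain ⟨hv1, hv2, hv3⟩ := hv
    have P : PairData M d m a v := ⟨hm.2.1, h1, h2, hcop, fun p hp hpv => by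
      exact_mod_cast hv3 p (Nat.mem_primeFactors.mpr ⟨hp, hpv, by omega⟩)⟩
    have hm0' : m ≠ 0 := by have := hm.2.1; omega
    have hvR : ∀ p ∈ v.primeFactors, (p : ℝ) ≤ R := fun p hp => (hv3 p hp).trans hm.2.2
    rw [mem_filter, mem_product, mem_smoothA hX0, mem_smoothA hX0]
    refine ⟨⟨⟨Nat.mul_pos hd.1 ha1, ?_, smooth_mul (by omega) (by omega) h3 ha3⟩,
      Nat.mul_pos hd.1 (Nat.mul_pos (by omega) hv1), ?_,
      smooth_mul (by omega) (Nat.mul_ne_zero hm0' (by omega)) h3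
        (smooth_mul hm0' (by omega) h4 hvR)⟩, ?_⟩
    · push_cast; rw [le_div_iff₀ hd0] at ha2; linarith
    · push_cast
      rw [le_div_iff₀ hm0, le_div_iff₀ hd0] at hv2; linarith
    · change M < d * (m * v) / Nat.gcd (d * a) (d * (m * v))
      rw [P.gcd_eq, Nat.mul_div_mul_left _ _ hd.1]
      have hg : Nat.gcd a v ∣ v := Nat.gcd_dvd_right _ _
      rw [Nat.mul_div_assoc _ hg]
      have : 0 < v / Nat.gcd a v := Nat.div_pos (le_of_dvd hv1 hg)
        (gcd_pos_of_pos_left _ ha1)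
      exact lt_of_lt_of_le hm.2.1 (Nat.le_mul_of_pos_right _ this)
  · rintro ⟨d, m⟩ hq a ha v hv ⟨d', m'⟩ hq' a' ha' v' hv' e1 e2
    have key : ∀ d m a v, (d, m) ∈ D → a ∈ (smoothA (X / d) R).filter (fun x => x.Coprime m) →
        v ∈ smoothA (X / d / m) m.minFac → PairData M d m a v ∧ d ≠ 0 ∧ a ≠ 0 ∧ v ≠ 0 := by
      intro d m a v hq ha hv
      rw [hD] at hq
      obtain ⟨⟨hd, hm⟩, h1, h2, h3, h4⟩ := hq
      rw [mem_Icc] at hd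
      rw [moduli, mem_filter] at hm
      rw [mem_filter, mem_smoothA (by positivity)] at ha
      rw [mem_smoothA (by positivity)] at hv
      exact ⟨⟨hm.2.1, h1, h2, ha.2, fun p hp hpv => by
        exact_mod_cast hv.2.2 p (Nat.mem_primeFactors.mpr ⟨hp, hpv, by omega⟩)⟩,
        by omega, by omega, by omega⟩
    obtain ⟨P, hd, ha0, hv0⟩ := key d m a v hq ha hv
    obtain ⟨P', -, -, -⟩ := key d' m' a' v' hq' ha' hv'
    obtain ⟨rfl, rfl, rfl, rfl⟩ := P.unique hM P' hd ha0 hv0 e1 e2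
    exact ⟨rfl, HEq.rfl, HEq.rfl⟩
  · rintro ⟨x, y⟩ hp
    rw [mem_filter, mem_product, mem_smoothA hX0, mem_smoothA hX0] at hp
    obtain ⟨⟨⟨hx1, hx2, hx3⟩, hy1, hy2, hy3⟩, hlt⟩ := hp
    simp only at hx1 hx2 hx3 hy1 hy2 hy3 hlt
    obtain ⟨d, m, a, v, P, rfl, rfl⟩ := PairData.exists hM (by omega) (by omega) hlt
    have hd : 0 < d := Nat.pos_of_mul_pos_right hx1
    have ha : 0 < a := Nat.pos_of_mul_pos_left hx1
    have hmv : 0 < m * v := Nat.pos_of_mul_pos_left hy1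
    have hm : 0 < m := Nat.pos_of_mul_pos_right hmv
    have hv : 0 < v := Nat.pos_of_mul_pos_left hmv
    have hd0 : (0:ℝ) < d := mod_cast hd
    have hm0 : (0:ℝ) < m := mod_cast hm
    have hm1 : m ≠ 1 := by have := P.lt; omega
    have hmf := minFac_prime hm1
    have hmy : ∀ p ∈ m.primeFactors, (p : ℝ) ≤ R :=
      smooth_of_dvd (by positivity) (Dvd.intro _ (by ring : m * (d * v) = _)) hy3
    have hmR : (m.minFac : ℝ) ≤ R :=
      hmy _ (Nat.mem_primeFactors.mpr ⟨hmf, minFac_dvd m, by omega⟩)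
    refine ⟨(d, m), ?_, a, ?_, v, ?_, rfl, rfl⟩
    · rw [hD]
      refine ⟨⟨?_, ?_⟩, P.div_le, P.rough,
        smooth_of_dvd (by positivity) (Dvd.intro _ rfl) hx3, hmy⟩
      · rw [mem_Icc, le_floor_iff hX0]
        refine ⟨hd, le_trans ?_ hx2⟩
        push_cast
        have : (1:ℝ) ≤ a := mod_cast ha
        nlinarith
      · rw [moduli, mem_filter, mem_Icc]
        refine ⟨⟨hm, le_floor ?_⟩, P.lt, hmR⟩
        have h1 : (m : ℝ) = (m / m.minFac : ℕ) * m.minFac := by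
          exact_mod_cast (Nat.div_mul_cancel (minFac_dvd m)).symm
        rw [h1]
        have h2 : ((m / m.minFac : ℕ) : ℝ) ≤ M := mod_cast P.div_le
        gcongr
    · rw [mem_filter, mem_smoothA (by positivity)]
      refine ⟨⟨ha, ?_, smooth_of_dvd (by positivity) (Dvd.intro_left _ rfl) hx3⟩, P.cop⟩
      rw [le_div_iff₀ hd0]; push_cast at hx2; linarith
    · rw [mem_smoothA (by positivity)]
      refine ⟨hv, ?_, fun p hp => ?_⟩
      · rw [le_div_iff₀ hm0, le_div_iff₀ hd0]; push_cast at hy2; linarith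
      · rw [Nat.mem_primeFactors] at hp
        exact_mod_cast P.smooth p hp.1 hp.2.1
  · refine (sum_le_sum_of_subset_of_nonneg (filter_subset _ _)
      fun _ _ _ => by positivity).trans ?_
    rw [sum_product]
    refine sum_le_sum fun d _ => ?_
    unfold pairMain
    refine sum_le_sum fun m _ => le_of_eq ?_
    congr 2
    · rw [hCop, show (((d ^ 4 : ℕ) : ℝ) * α) = ((d ^ 4 : ℤ) : ℝ) * α by push_cast; ring,
        ← trig_mul_left]
      congr 1; funext a; push_cast; ring
    · rw [h_eq_trig, show ((m ^ 4 : ℕ) : ℝ) * (((d ^ 4 : ℕ) : ℝ) * α) =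
        (((m : ℤ) ^ 4 * d ^ 4 : ℤ) : ℝ) * α by push_cast; ring, ← trig_mul_left]
      congr 1; funext a; push_cast; ring

lemma norm_sum_small_le {X R : ℝ} (hX : 1 ≤ X) {M : ℕ} (α : ℝ) :
    ‖∑ p ∈ (smoothA X R ×ˢ smoothA X R).filter (fun p => ¬ M < p.2 / Nat.gcd p.1 p.2),
      e (α * (((p.1 : ℤ) ^ 4 - (p.2 : ℤ) ^ 4 : ℤ) : ℝ))‖ ≤
    ∑ d ∈ Icc 1 ⌊X⌋₊, pairSmall M (X / d) R ((d ^ 4 : ℕ) * α) := by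
  classical
  have hX0 : 0 ≤ X := by linarith
  let D : Finset (Σ _ : ℕ, ℕ) := ((Icc 1 ⌊X⌋₊).sigma
      fun d => Icc 1 (min M ⌊X / d⌋₊)).filter fun q =>
    (∀ p ∈ q.1.primeFactors, (p : ℝ) ≤ R) ∧ (∀ p ∈ q.2.primeFactors, (p : ℝ) ≤ R)
  have hD : ∀ d m, (⟨d, m⟩ : Σ _ : ℕ, ℕ) ∈ D ↔ (d ∈ Icc 1 ⌊X⌋₊ ∧ m ∈ Icc 1 (min M ⌊X / d⌋₊)) ∧
      (∀ p ∈ d.primeFactors, (p : ℝ) ≤ R) ∧ (∀ p ∈ m.primeFactors, (p : ℝ) ≤ R) := by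
    intro d m; simp only [D, mem_filter, mem_sigma]
  refine (norm_sum_pairs_le _ D
    (fun q => (smoothA (X / q.1) R).filter fun x => x.Coprime q.2)
    (fun q => ({()} : Finset Unit))
    (fun q a => q.1 * a) (fun q _ => q.1 * q.2) ?_ ?_ ?_ α).trans ?_
  · rintro ⟨d, m⟩ hq a ha v -
    rw [hD] at hq
    obtain ⟨⟨hd, hm⟩, h3, h4⟩ := hq
    rw [mem_Icc] at hd hm
    rw [le_min_iff, le_floor_iff (by positivity)] at hm
    obtain ⟨hm1, hmM, hmX⟩ := hm
    have hd0 : (0:ℝ) < d := mod_cast hd.1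
    simp only [mem_filter] at ha
    rw [mem_smoothA (by positivity)] at ha
    obtain ⟨⟨ha1, ha2, ha3⟩, hcop⟩ := ha
    rw [mem_filter, mem_product, mem_smoothA hX0, mem_smoothA hX0]
    have hd' : d ≠ 0 := by have := hd.1; omega
    have ha' : a ≠ 0 := by omega
    have hm' : m ≠ 0 := by have : 1 ≤ m := hm1; omega
    refine ⟨⟨⟨Nat.mul_pos hd.1 ha1, ?_, smooth_mul hd' ha' h3 ha3⟩,
      Nat.mul_pos hd.1 hm1, ?_, smooth_mul hd' hm' h3 h4⟩, ?_⟩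
    · push_cast; rw [le_div_iff₀ hd0] at ha2; linarith
    · push_cast; rw [le_div_iff₀ hd0] at hmX; linarith
    · change ¬ M < d * m / Nat.gcd (d * a) (d * m)
      rw [Nat.gcd_mul_left, hcop.gcd_eq_one, mul_one, Nat.mul_div_cancel_left _ hd.1]
      omega
  · rintro ⟨d, m⟩ hq a ha v - ⟨d', m'⟩ hq' a' ha' v' - e1 e2
    simp only [mem_filter] at ha ha'
    rw [hD] at hq hq'
    simp only [mem_Icc] at hq hq'
    have hdd : d = d' := by
      have h1 : Nat.gcd (d * a) (d * m) = d := by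
        rw [Nat.gcd_mul_left, ha.2.gcd_eq_one, mul_one]
      have h2 : Nat.gcd (d' * a') (d' * m') = d' := by
        rw [Nat.gcd_mul_left, ha'.2.gcd_eq_one, mul_one]
      simp only at e1 e2
      rw [← h1, ← h2, e1, e2]
    subst hdd
    have hd : 0 < d := by omega
    obtain rfl := eq_of_mul_eq_mul_left hd e1
    obtain rfl := eq_of_mul_eq_mul_left hd e2
    exact ⟨rfl, HEq.rfl, HEq.rfl⟩
  · rintro ⟨x, y⟩ hp
    rw [mem_filter, mem_product, mem_smoothA hX0, mem_smoothA hX0] at hp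
    obtain ⟨⟨⟨hx1, hx2, hx3⟩, hy1, hy2, hy3⟩, hlt⟩ := hp
    simp only at hx1 hx2 hx3 hy1 hy2 hy3 hlt
    have hg : 0 < Nat.gcd x y := gcd_pos_of_pos_left _ hx1
    have hxg := mul_div_cancel' (Nat.gcd_dvd_left x y)
    have hyg := mul_div_cancel' (Nat.gcd_dvd_right x y)
    have hcop : Coprime (x / Nat.gcd x y) (y / Nat.gcd x y) :=
      Nat.coprime_div_gcd_div_gcd hg
    have hg0 : (0:ℝ) < Nat.gcd x y := mod_cast hg
    refine ⟨⟨Nat.gcd x y, y / Nat.gcd x y⟩, ?_, x / Nat.gcd x y, ?_, (), by simp, hxg, hyg⟩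
    · rw [hD, mem_Icc, mem_Icc, le_min_iff, le_floor_iff hX0,
        le_floor_iff (by positivity)]
      refine ⟨⟨⟨hg, le_trans ?_ hx2⟩, Nat.div_pos (Nat.gcd_le_right _ hy1) hg, by omega, ?_⟩,
        smooth_of_dvd (by omega) (Nat.gcd_dvd_left _ _) hx3,
        smooth_of_dvd (by omega) (div_dvd_of_dvd (Nat.gcd_dvd_right _ _)) hy3⟩
      · exact_mod_cast Nat.gcd_le_left _ hx1
      · rw [cast_div (Nat.gcd_dvd_right _ _) hg0.ne']
        gcongr
    · simp only [mem_filter]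
      rw [mem_smoothA (by positivity)]
      refine ⟨⟨Nat.div_pos (Nat.gcd_le_left _ hx1) hg, ?_,
        smooth_of_dvd (by omega) (div_dvd_of_dvd (Nat.gcd_dvd_left _ _)) hx3⟩, hcop⟩
      rw [cast_div (Nat.gcd_dvd_left _ _) hg0.ne']
      gcongr
  · refine (sum_le_sum_of_subset_of_nonneg (filter_subset _ _)
      fun _ _ _ => by positivity).trans ?_
    rw [sum_sigma]
    refine sum_le_sum fun d _ => ?_
    unfold pairSmall
    refine sum_le_sum fun m _ => le_of_eq ?_
    have : ‖trig ({()} : Finset Unit) (fun _ => ((d * m : ℕ) : ℤ) ^ 4) α‖ = 1 := by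
      simp [trig, norm_e]
    rw [this, mul_one]
    rw [hCop, show (((d ^ 4 : ℕ) : ℝ) * α) = ((d ^ 4 : ℤ) : ℝ) * α by push_cast; ring,
        ← trig_mul_left]
    congr 2; funext a; push_cast; ring

/-- Decomposition of `|h|²` according to the size of the reduced second coordinate. -/
lemma normSq_h_le {X R : ℝ} (hX : 1 ≤ X) {M : ℕ} (hM : 1 ≤ M) (α : ℝ) :
    ‖h X R α‖ ^ 2 ≤ ∑ d ∈ Icc 1 ⌊X⌋₊,
      (pairMain M (X / d) R ((d ^ 4 : ℕ) * α) + pairSmall M (X / d) R ((d ^ 4 : ℕ) * α)) := by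
  have h1 := normSq_trig (smoothA X R) (fun x => (x : ℤ) ^ 4) α
  rw [← h_eq_trig, ← Finset.sum_filter_add_sum_filter_not _
    (fun p : ℕ × ℕ => M < p.2 / Nat.gcd p.1 p.2)] at h1
  have h2 : ‖h X R α‖ ^ 2 = ‖((‖h X R α‖ ^ 2 : ℝ) : ℂ)‖ := by
    rw [norm_real, Real.norm_of_nonneg (by positivity)]
  rw [h2, h1, sum_add_distrib]
  exact (norm_add_le _ _).trans (add_le_add (norm_sum_main_le hX hM α) (norm_sum_small_le hX α))

/-! ### Completing a sum over an interval -/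

lemma sum_e_range {N : ℕ} (hN : 0 < N) (k : ℤ) :
    ∑ b ∈ range N, e ((b : ℝ) * k / N) = if (N : ℤ) ∣ k then (N : ℂ) else 0 := by
  have hN0 : (N : ℝ) ≠ 0 := by positivity
  have hpow : ∀ b : ℕ, e ((b : ℝ) * k / N) = e ((k : ℝ) / N) ^ b := by
    intro b
    simp only [e, ← exp_nat_mul]
    congr 1; push_cast; ring
  simp_rw [hpow]
  have hone : e ((k : ℝ) / N) ^ N = 1 := by
    rw [← hpow, mul_div_cancel_left₀ _ hN0, e_int]
  split_ifs with hd
  · obtain ⟨j, rfl⟩ := hd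
    have : e (((N * j : ℤ) : ℝ) / N) = 1 := by
      push_cast; rw [mul_div_cancel_left₀ _ hN0, e_int]
    rw [this]; simp
  · have hne : e ((k : ℝ) / N) ≠ 1 := by
      intro h1
      rw [e, Complex.exp_eq_one_iff] at h1
      obtain ⟨j, hj⟩ := h1
      apply hd
      refine ⟨j, ?_⟩
      have h2 : ((((k : ℝ) / N : ℝ)) : ℂ) = j := by
        have : (2 * (π : ℂ) * I) ≠ 0 := by
          simp [Real.pi_ne_zero]
        apply mul_left_cancel₀ this
        rw [hj]; ring
      have h3 : (k : ℝ) / N = j := mod_cast h2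
      rw [div_eq_iff hN0] at h3
      have : (k : ℝ) = ((N * j : ℤ) : ℝ) := by push_cast; linarith
      exact_mod_cast this
    rw [geom_sum_eq hne, hone, sub_self, zero_div]

/-- Fourier coefficients modulo `N` of the indicator function of `[0, B]`. -/
def cutCoeff (N B b : ℕ) : ℂ := (∑ j ∈ range (B + 1), e (-((b : ℝ) * j / N))) / N

/-- A summable majorant of `cutCoeff`, independent of the endpoint. -/
def cutWeight (N b : ℕ) : ℝ := if b = 0 then 1 else 1 / (b : ℝ) + 1 / ((N : ℝ) - b)

lemma sum_cutCoeff {N B n : ℕ} (hB : B < N) (hn : n < N) :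
    ∑ b ∈ range N, cutCoeff N B b * e ((b : ℝ) * n / N) = if n ≤ B then 1 else 0 := by
  have hN : 0 < N := by omega
  have hN0 : (N : ℂ) ≠ 0 := mod_cast hN.ne'
  have h1 : ∀ b ∈ range N, cutCoeff N B b * e ((b : ℝ) * n / N) =
      (∑ j ∈ range (B + 1), e ((b : ℝ) * ((n : ℤ) - (j : ℤ) : ℤ) / N)) / N := by
    intro b _
    rw [cutCoeff, div_mul_eq_mul_div, sum_mul]
    congr 1
    refine sum_congr rfl fun j _ => ?_
    rw [← e_add]; congr 1; push_cast; ring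
  rw [sum_congr rfl h1, ← Finset.sum_div, sum_comm]
  simp_rw [sum_e_range hN]
  have h2 : ∀ j ∈ range (B + 1), (if (N : ℤ) ∣ (n : ℤ) - (j : ℤ) then (N : ℂ) else 0) =
      if j = n then (N : ℂ) else 0 := by
    intro j hj
    rw [mem_range] at hj
    congr 1
    rw [eq_iff_iff]
    constructor
    · intro hd
      have := Int.eq_zero_of_abs_lt_dvd hd (by rw [abs_lt]; constructor <;> omega)
      omega
    · rintro rfl; simp
  rw [sum_congr rfl h2, Finset.sum_ite_eq']
  simp only [mem_range, lt_succ_iff]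
  split_ifs <;> simp [hN0]

lemma norm_e_sub_one_ge {x : ℝ} (h0 : 0 ≤ x) (h1 : x ≤ 1) : 4 * min x (1 - x) ≤ ‖e x - 1‖ := by
  have hx : ‖e x - 1‖ = 2 * |sin (π * x)| := by
    have : e x = exp (I * (2 * π * x : ℝ)) := by
      simp only [e]; congr 1; push_cast; ring
    rw [this, Complex.norm_exp_I_mul_ofReal_sub_one, norm_eq_abs, abs_mul, abs_two]
    congr 3; ring
  rw [hx]
  have key : ∀ y : ℝ, 0 ≤ y → y ≤ 1 / 2 → 2 * y ≤ sin (π * y) := by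
    intro y hy hy'
    have := Real.mul_le_sin (x := π * y) (by positivity) (by nlinarith [pi_pos])
    calc 2 * y = 2 / π * (π * y) := by field_simp
      _ ≤ _ := this
  rcases le_total x (1 / 2) with hx2 | hx2
  · have := key x h0 hx2
    have := le_abs_self (sin (π * x))
    have := min_le_left x (1 - x)
    linarith
  · have h3 := key (1 - x) (by linarith) (by linarith)
    rw [show π * (1 - x) = π - π * x by ring, Real.sin_pi_sub] at h3
    have := le_abs_self (sin (π * x))
    have := min_le_right x (1 - x)
    linarith

lemma norm_geom_sum_e_le {x : ℝ} (hx0 : 0 < x) (hx1 : x < 1) (n : ℕ) :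
    ‖∑ j ∈ range n, e (x * j)‖ ≤ 1 / (2 * min x (1 - x)) := by
  have hm : 0 < min x (1 - x) := lt_min hx0 (by linarith)
  have hge := norm_e_sub_one_ge hx0.le hx1.le
  have hne : e x ≠ 1 := by
    intro h1; rw [h1, sub_self, norm_zero] at hge; linarith
  have hpow : ∀ j : ℕ, e (x * j) = e x ^ j := by
    intro b
    simp only [e, ← exp_nat_mul]
    congr 1; push_cast; ring
  simp_rw [hpow]
  rw [geom_sum_eq hne, norm_div]
  have h2 : ‖e x ^ n - 1‖ ≤ 2 := by
    refine (norm_sub_le _ _).trans ?_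
    rw [norm_pow, norm_e, one_pow, norm_one]; norm_num
  calc ‖e x ^ n - 1‖ / ‖e x - 1‖ ≤ 2 / (4 * min x (1 - x)) := by gcongr
    _ = _ := by field_simp; norm_num

lemma norm_cutCoeff_le {N B b : ℕ} (hB : B < N) (hb : b < N) :
    ‖cutCoeff N B b‖ ≤ cutWeight N b := by
  have hN : (0:ℝ) < N := mod_cast (by omega : 0 < N)
  unfold cutCoeff cutWeight
  rw [norm_div, Complex.norm_natCast]
  split_ifs with h0
  · rw [div_le_one hN]
    refine (norm_sum_le _ _).trans ?_
    simp only [norm_e, sum_const, card_range, nsmul_eq_mul, mul_one]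
    exact_mod_cast hB
  · have hb0 : (0:ℝ) < b := mod_cast Nat.pos_of_ne_zero h0
    have hbN : (b:ℝ) < N := mod_cast hb
    have h1 : ‖∑ j ∈ range (B + 1), e (-((b : ℝ) * j / N))‖ =
        ‖∑ j ∈ range (B + 1), e ((b / N : ℝ) * j)‖ := by
      rw [← RCLike.norm_conj (∑ j ∈ range (B + 1), e ((b / N : ℝ) * j)), map_sum]
      congr 1
      refine sum_congr rfl fun j _ => ?_
      rw [conj_e]; congr 1; ring
    have h2 := norm_geom_sum_e_le (x := (b / N : ℝ)) (by positivity) (by rwa [div_lt_one hN]) (B + 1)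
    rw [h1, div_le_iff₀ hN]
    refine h2.trans ?_
    rcases le_total (b / N : ℝ) (1 - b / N) with h3 | h3
    · rw [min_eq_left h3]
      have h4 : (0:ℝ) ≤ 1 / (N - b) * N := by
        have : (0:ℝ) < N - b := by linarith
        positivity
      have h5 : 1 / (2 * (b / N : ℝ)) = (1 / b * N) / 2 := by field_simp
      have : (0:ℝ) ≤ 1 / b * N := by positivity
      rw [h5, add_mul]; linarith
    · rw [min_eq_right h3]
      have h6 : (0:ℝ) < N - b := by linarith
      have h4 : (0:ℝ) ≤ 1 / (N - b) * N := by positivity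
      have h5 : 1 / (2 * (1 - b / N : ℝ)) = (1 / (N - b) * N) / 2 := by
        rw [show (1 - b / N : ℝ) = (N - b) / N by field_simp]
        field_simp
      have : (0:ℝ) ≤ 1 / b * N := by positivity
      rw [h5, add_mul]; linarith

lemma cutWeight_nonneg {N b : ℕ} (hb : b < N) : 0 ≤ cutWeight N b := by
  unfold cutWeight
  have hbN : (b:ℝ) < N := mod_cast hb
  have : (0:ℝ) < N - b := by linarith
  split_ifs <;> positivity

lemma sum_Icc_one_div_le (n : ℕ) :
    ∑ d ∈ Icc 1 n, 1 / (d : ℝ) ≤ 1 + Real.log n := by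
  have := harmonic_le_one_add_log n
  rw [harmonic_eq_sum_Icc] at this
  push_cast at this
  simpa [one_div] using this

lemma sum_cutWeight_le {N : ℕ} (hN : 1 ≤ N) :
    ∑ b ∈ range N, cutWeight N b ≤ 3 + 2 * Real.log N := by
  obtain ⟨n, rfl⟩ : ∃ n, N = n + 1 := ⟨N - 1, by omega⟩
  rw [Finset.sum_range_succ']
  have h1 : ∀ b ∈ range n, cutWeight (n + 1) (b + 1) =
      1 / ((b + 1 : ℕ) : ℝ) + 1 / (((n - 1 - b) + 1 : ℕ) : ℝ) := by
    intro b hb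
    rw [mem_range] at hb
    have : ((((n - 1 - b) + 1 : ℕ)) : ℝ) = n - b := by
      rw [show n - 1 - b + 1 = n - b by omega, cast_sub hb.le]
    rw [cutWeight, if_neg (by omega), this]
    congr 2
    push_cast; ring
  rw [sum_congr rfl h1, sum_add_distrib,
    Finset.sum_range_reflect (fun b => 1 / ((b + 1 : ℕ) : ℝ)) n]
  have h3 : ∑ b ∈ range n, 1 / ((b + 1 : ℕ) : ℝ) ≤ 1 + Real.log (n + 1 : ℕ) := by
    refine le_trans ?_ (sum_Icc_one_div_le (n + 1))
    rw [Finset.range_eq_Ico, Finset.sum_Ico_add' (fun b : ℕ => 1 / (b : ℝ)) 0 n 1]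
    refine sum_le_sum_of_subset_of_nonneg ?_ fun _ _ _ => by positivity
    intro x; simp only [Finset.mem_Ico, mem_Icc]; omega
  have h4 : cutWeight (n + 1) 0 = 1 := by simp [cutWeight]
  rw [h4]; linarith

lemma h_eq_sum_shift {Y Q R : ℝ} (hY : 0 ≤ Y) (hYQ : Y ≤ Q) (β : ℝ) :
    h Y R β = ∑ b ∈ range (⌊Q⌋₊ ^ 4 + 1),
      cutCoeff (⌊Q⌋₊ ^ 4 + 1) (⌊Y⌋₊ ^ 4) b * h Q R (β + b / (⌊Q⌋₊ ^ 4 + 1 : ℕ)) := by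
  set N := ⌊Q⌋₊ ^ 4 + 1 with hN
  have hfl : ⌊Y⌋₊ ≤ ⌊Q⌋₊ := Nat.floor_mono hYQ
  have hB : ⌊Y⌋₊ ^ 4 < N := by
    have := pow_le_pow_left hfl 4; omega
  have hQ : 0 ≤ Q := hY.trans hYQ
  have h1 : ∀ b ∈ range N, cutCoeff N (⌊Y⌋₊ ^ 4) b * h Q R (β + b / (N : ℕ)) =
      ∑ x ∈ smoothA Q R, e (β * (x : ℝ) ^ 4) *
        (cutCoeff N (⌊Y⌋₊ ^ 4) b * e ((b : ℝ) * (x ^ 4 : ℕ) / N)) := by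
    intro b _
    rw [h, mul_sum]
    refine sum_congr rfl fun x _ => ?_
    rw [mul_left_comm, ← e_add]
    congr 2; push_cast; ring
  rw [sum_congr rfl h1, sum_comm]
  have h2 : ∀ x ∈ smoothA Q R, ∑ b ∈ range N, e (β * (x : ℝ) ^ 4) *
        (cutCoeff N (⌊Y⌋₊ ^ 4) b * e ((b : ℝ) * (x ^ 4 : ℕ) / N)) =
      if x ≤ ⌊Y⌋₊ then e (β * (x : ℝ) ^ 4) else 0 := by
    intro x hx
    rw [mem_smoothA hQ] at hx
    have hxQ : x ^ 4 < N := by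
      have := pow_le_pow_left (le_floor hx.2.1) 4; omega
    rw [← mul_sum, sum_cutCoeff hB hxQ]
    simp only [pow_le_pow_iff_left₀ (Nat.zero_le x) (Nat.zero_le ⌊Y⌋₊) (by norm_num : (4:ℕ) ≠ 0)]
    split_ifs <;> simp
  rw [sum_congr rfl h2, ← sum_filter, h]
  refine sum_congr ?_ fun _ _ => rfl
  ext x
  rw [mem_filter, mem_smoothA hQ, mem_smoothA hY, le_floor_iff hY]
  constructor
  · rintro ⟨a, b, c⟩; exact ⟨⟨a, b.trans hYQ, c⟩, b⟩
  · rintro ⟨⟨a, b, c⟩, d⟩; exact ⟨a, d, c⟩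

/-- Majorant of the powers of all sums `h Y p` with `Y ≤ Q` and `p ≤ R`. -/
def shiftSum (u Q R : ℝ) (β : ℝ) : ℝ :=
  ∑ q ∈ Icc 2 ⌊R⌋₊ ×ˢ range (⌊Q⌋₊ ^ 4 + 1),
    ((3 + 2 * Real.log (⌊Q⌋₊ ^ 4 + 1 : ℕ)) ^ (u - 1) * cutWeight (⌊Q⌋₊ ^ 4 + 1) q.2) *
      ‖h Q q.1 (β + q.2 / (⌊Q⌋₊ ^ 4 + 1 : ℕ))‖ ^ u

lemma norm_h_rpow_le_shiftSum {u Y Q R : ℝ} (hu : 1 ≤ u) (hY : 0 ≤ Y) (hYQ : Y ≤ Q)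
    {p : ℕ} (hp : 2 ≤ p) (hpR : (p : ℝ) ≤ R) (β : ℝ) : ‖h Y p β‖ ^ u ≤ shiftSum u Q R β := by
  set N := ⌊Q⌋₊ ^ 4 + 1 with hN
  have hNl : 0 ≤ Real.log (N : ℕ) := Real.log_natCast_nonneg _
  have hw : ∀ b ∈ range N, 0 ≤ cutWeight N b := fun b hb =>
    cutWeight_nonneg (mem_range.mp hb)
  have hB : ⌊Y⌋₊ ^ 4 < N := by
    have := pow_le_pow_left (Nat.floor_mono hYQ : ⌊Y⌋₊ ≤ ⌊Q⌋₊) 4; omega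
  have h1 : ‖h Y p β‖ ≤ ∑ b ∈ range N, |cutWeight N b| * ‖h Q p (β + b / (N : ℕ))‖ := by
    rw [h_eq_sum_shift hY hYQ]
    refine (norm_sum_le _ _).trans (sum_le_sum fun b hb => ?_)
    rw [norm_mul, abs_of_nonneg (hw b hb)]
    gcongr
    exact norm_cutCoeff_le hB (mem_range.mp hb)
  have h2 := weighted_rpow_sum_le (range N) hu (fun b => |cutWeight N b|)
    (fun b => ‖h Q p (β + b / (N : ℕ))‖) (fun _ => abs_nonneg _) (fun _ => norm_nonneg _)
  have h3 : ∑ b ∈ range N, |cutWeight N b| ≤ 3 + 2 * Real.log (N : ℕ) := by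
    rw [sum_congr rfl fun b hb => abs_of_nonneg (hw b hb)]
    exact sum_cutWeight_le (by omega)
  calc ‖h Y p β‖ ^ u ≤ _ := rpow_le_rpow (norm_nonneg _) h1 (by linarith)
    _ ≤ _ := h2
    _ ≤ (3 + 2 * Real.log (N : ℕ)) ^ (u - 1) *
        ∑ b ∈ range N, |cutWeight N b| * ‖h Q p (β + b / (N : ℕ))‖ ^ u := by
      have : 0 ≤ u - 1 := by linarith
      gcongr
    _ = ∑ b ∈ range N, ((3 + 2 * Real.log (N : ℕ)) ^ (u - 1) * cutWeight N b) *
          ‖h Q p (β + b / (N : ℕ))‖ ^ u := by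
      rw [mul_sum]
      refine sum_congr rfl fun b hb => ?_
      rw [abs_of_nonneg (hw b hb)]; ring
    _ ≤ _ := by
      rw [shiftSum, sum_product]
      refine single_le_sum (f := fun p : ℕ => ∑ b ∈ range N,
        ((3 + 2 * Real.log (N : ℕ)) ^ (u - 1) * cutWeight N b) *
          ‖h Q p (β + b / (N : ℕ))‖ ^ u) (fun q _ => sum_nonneg fun b hb => ?_) ?_
      · have := hw b hb
        positivity
      · rw [mem_Icc]; exact ⟨hp, le_floor hpR⟩

lemma shiftSum_nonneg (u Q R β : ℝ) : 0 ≤ shiftSum u Q R β := by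
  refine sum_nonneg fun q hq => ?_
  rw [mem_product, mem_range] at hq
  have := cutWeight_nonneg hq.2
  have : 0 ≤ Real.log (⌊Q⌋₊ ^ 4 + 1 : ℕ) := Real.log_natCast_nonneg _
  positivity

lemma continuous_shiftSum {u : ℝ} (hu : 0 ≤ u) (Q R : ℝ) : Continuous (shiftSum u Q R) := by
  unfold shiftSum
  refine continuous_finsetSum _ fun q _ => continuous_const.mul ?_
  refine Continuous.rpow_const ?_ fun _ => Or.inr hu
  exact ((continuous_h _ _).comp (continuous_id.add continuous_const)).norm

lemma periodic_shiftSum (u Q R : ℝ) : Function.Periodic (shiftSum u Q R) 1 := by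
  intro β
  unfold shiftSum
  refine sum_congr rfl fun q _ => ?_
  rw [show β + 1 + (q.2 : ℝ) / (⌊Q⌋₊ ^ 4 + 1 : ℕ) = β + (q.2 : ℝ) / (⌊Q⌋₊ ^ 4 + 1 : ℕ) + 1 by ring,
    periodic_h]

lemma exists_slow_shiftSum {u r l : ℝ} (hu : 1 ≤ u) (hr : 1 ≤ r) (H : Adm (u * r) l) :
    ∃ f : ℝ → ℝ → ℝ, Slow f ∧ ∀ X R Q R' : ℝ, 1 ≤ X → 2 ≤ R → 1 ≤ Q → Q ≤ X → 2 ≤ R' → R' ≤ R →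
      avg (fun β => shiftSum u Q R' β ^ r) ≤ f X R * Q ^ l := by
  obtain ⟨g, hg, H⟩ := H
  refine ⟨_, ((Slow.snd.mul (((Slow.const (by norm_num : (1:ℝ) ≤ 8)).mul
    Slow.one_add_log).rpow (show 0 ≤ u by linarith))).rpow (show 0 ≤ r by linarith)).mul hg,
    fun X R Q R' hX hR hQ hQX hR' hRR => ?_⟩
  have hg0 := hg.nonneg hX hR
  set N := ⌊Q⌋₊ ^ 4 + 1 with hN
  set L := 3 + 2 * Real.log (N : ℕ) with hL
  have hNl : 0 ≤ Real.log (N : ℕ) := Real.log_natCast_nonneg _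
  have hlX : 0 ≤ Real.log X := log_nonneg hX
  have hLX : L ≤ 8 * (1 + Real.log X) := by
    have h1 : ((N : ℕ) : ℝ) ≤ 2 * X ^ 4 := by
      rw [hN]; push_cast
      have h2 : (⌊Q⌋₊ : ℝ) ≤ X := (floor_le (by linarith)).trans hQX
      have h3 : (1:ℝ) ≤ X ^ 4 := one_le_pow₀ hX
      have h4 : (⌊Q⌋₊ : ℝ) ^ 4 ≤ X ^ 4 := by gcongr
      linarith
    have h2 := log_le_log (by rw [hN]; positivity) h1
    rw [log_mul (by norm_num) (by positivity), log_pow] at h2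
    have := log_two_lt_d9
    push_cast at h2
    rw [hL]; linarith
  set s := Icc 2 ⌊R'⌋₊ ×ˢ range N with hs
  set w : ℕ × ℕ → ℝ := fun q => if q ∈ s then L ^ (u - 1) * cutWeight N q.2 else 0 with hw
  have hL0 : 0 < L := by rw [hL]; positivity
  have hw0 : ∀ q, 0 ≤ w q := by
    intro q
    simp only [hw]
    split_ifs with hq
    · have := cutWeight_nonneg (mem_range.mp (mem_product.mp hq).2)
      positivity
    · exact le_rfl
  have hW : ∑ q ∈ s, w q ≤ R * (8 * (1 + Real.log X)) ^ u := by
    have h1 : ∑ q ∈ s, w q = ∑ q ∈ s, L ^ (u - 1) * cutWeight N q.2 :=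
      sum_congr rfl fun q hq => by simp only [hw, if_pos hq]
    rw [h1, hs, sum_product]
    dsimp only
    rw [sum_const, nsmul_eq_mul, ← mul_sum]
    have h2 := sum_cutWeight_le (N := N) (by omega)
    have h3 : ((Icc 2 ⌊R'⌋₊).card : ℝ) ≤ R := by
      refine le_trans ?_ ((floor_le (by linarith : 0 ≤ R')).trans hRR)
      exact_mod_cast (by simp : (Icc 2 ⌊R'⌋₊).card ≤ ⌊R'⌋₊)
    have h4 : 0 ≤ ∑ b ∈ range N, cutWeight N b :=
      sum_nonneg fun b hb => cutWeight_nonneg (mem_range.mp hb)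
    calc _ ≤ R * (L ^ (u - 1) * L) := by
          gcongr
      _ = R * L ^ u := by
          rw [← rpow_add_one hL0.ne']; ring_nf
      _ ≤ _ := by gcongr
  have hW0 : 0 ≤ ∑ q ∈ s, w q := sum_nonneg fun q _ => hw0 q
  have hpt : ∀ β, shiftSum u Q R' β ^ r ≤
      (∑ q ∈ s, w q) ^ (r - 1) * ∑ q ∈ s, w q * ‖h Q q.1 (β + q.2 / (N : ℕ))‖ ^ (u * r) := by
    intro β
    have h1 : shiftSum u Q R' β = ∑ q ∈ s, w q * ‖h Q q.1 (β + q.2 / (N : ℕ))‖ ^ u := by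
      rw [shiftSum]
      exact sum_congr rfl fun q hq => by simp only [hw, if_pos (show q ∈ s from hq)]; rfl
    rw [h1]
    refine (weighted_rpow_sum_le s hr w _ hw0 fun q => by positivity).trans (le_of_eq ?_)
    congr 1
    refine sum_congr rfl fun q _ => ?_
    rw [rpow_mul (norm_nonneg _)]
  have hc : ∀ q : ℕ × ℕ, Continuous fun β => w q * ‖h Q q.1 (β + q.2 / (N : ℕ))‖ ^ (u * r) := by
    intro q
    refine continuous_const.mul (Continuous.rpow_const ?_ fun _ => Or.inr (by positivity))
    exact ((continuous_h _ _).comp (continuous_id.add continuous_const)).norm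
  calc avg (fun β => shiftSum u Q R' β ^ r)
      ≤ avg (fun β => (∑ q ∈ s, w q) ^ (r - 1) *
          ∑ q ∈ s, w q * ‖h Q q.1 (β + q.2 / (N : ℕ))‖ ^ (u * r)) := by
        refine avg_mono ?_ ?_ hpt
        · exact (continuous_shiftSum (by linarith) _ _).rpow_const fun _ => Or.inr (by linarith)
        · exact continuous_const.mul (continuous_finsetSum _ fun q _ => hc q)
    _ = (∑ q ∈ s, w q) ^ (r - 1) *
          ∑ q ∈ s, w q * avg (fun β => ‖h Q q.1 β‖ ^ (u * r)) := by
        rw [avg_const_mul, avg_sum _ _ fun q _ => hc q]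
        congr 1
        refine sum_congr rfl fun q _ => ?_
        rw [avg_const_mul]
        congr 1
        exact avg_comp_add (f := fun β => ‖h Q q.1 β‖ ^ (u * r))
          (fun β => by simp only [periodic_h Q q.1 β]) _
    _ ≤ (∑ q ∈ s, w q) ^ (r - 1) * ∑ q ∈ s, w q * (g X R * Q ^ l) := by
        gcongr with q hq
        · exact hw0 q
        · have hq1 := mem_Icc.mp (mem_product.mp hq).1
          refine H X R Q q.1 hX hR hQ hQX (mod_cast hq1.1) ?_
          exact le_trans ((le_floor_iff (by linarith)).mp hq1.2) hRR
    _ = (∑ q ∈ s, w q) ^ r * (g X R * Q ^ l) := by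
        rw [← sum_mul, ← mul_assoc]
        congr 1
        rcases hW0.eq_or_lt with h0 | h0
        · rw [← h0, mul_zero, zero_rpow (by linarith)]
        · rw [← rpow_add_one h0.ne']; ring_nf
    _ ≤ _ := by
        rw [← mul_assoc]
        gcongr

/-! ### Counting roots of power congruences -/

lemma natAbs_gcd_mul_dvd {n : ℕ} {a b : ℤ} (hab : (n : ℤ) ∣ a * b) :
    n ∣ Nat.gcd n a.natAbs * Nat.gcd n b.natAbs := by
  have h1 : n ∣ a.natAbs * b.natAbs := by
    rw [← Int.natAbs_mul]; exact natCast_dvd.mp hab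
  have h2 := Nat.gcd_mul_right_dvd_mul_gcd n a.natAbs b.natAbs
  rwa [Nat.gcd_eq_left h1] at h2

lemma card_sq_congr_gcd_le {n g : ℕ} (hn : 0 < n) (hg : 0 < g) (S : Finset ℕ) (h1 : ∀ x ∈ S, x < n)
    (h2 : ∀ x ∈ S, x.gcd n ∣ g) (h3 : ∀ x ∈ S, ∀ y ∈ S, (n : ℤ) ∣ (x : ℤ) ^ 2 - (y : ℤ) ^ 2) :
    S.card ≤ 2 * g * n.divisors.card ^ 2 := by
  classical
  rcases S.eq_empty_or_nonempty with rfl | ⟨w, hw⟩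
  · simp
  have hcard : ((range (2 * g)) ×ˢ (n.divisors ×ˢ n.divisors)).card = 2 * g * n.divisors.card ^ 2 := by
    simp [pow_two]
  rw [← hcard]
  refine card_le_card_of_injOn (fun z => (2 * g * z / n,
    (Nat.gcd n ((z : ℤ) - w).natAbs, Nat.gcd n ((z : ℤ) + w).natAbs))) ?_ ?_
  · intro z hz
    simp only [coe_product, Set.mem_prod, mem_coe, mem_divisors, mem_range]
    exact ⟨Nat.div_lt_of_lt_mul (by
      have := h1 z hz; nlinarith), ⟨Nat.gcd_dvd_left _ _, hn.ne'⟩,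
      ⟨Nat.gcd_dvd_left _ _, hn.ne'⟩⟩
  · intro z hz z' hz' heq
    simp only [Prod.mk.injEq] at heq
    obtain ⟨e0, e1, e2⟩ := heq
    have hzS : z ∈ S := hz
    have hzS' : z' ∈ S := hz'
    set g₁ := Nat.gcd n ((z : ℤ) - w).natAbs with hg₁
    set g₂ := Nat.gcd n ((z : ℤ) + w).natAbs with hg₂
    have hdvd : n ∣ g₁ * g₂ := natAbs_gcd_mul_dvd (by
      have := h3 z hzS w hw
      rwa [show ((z : ℤ) - w) * (z + w) = (z : ℤ) ^ 2 - (w : ℤ) ^ 2 by ring])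
    have a1 : (g₁ : ℤ) ∣ z - w := natCast_dvd.mpr (Nat.gcd_dvd_right _ _)
    have a2 : (g₂ : ℤ) ∣ z + w := natCast_dvd.mpr (Nat.gcd_dvd_right _ _)
    have b1 : (g₁ : ℤ) ∣ z' - w := by rw [e1]; exact natCast_dvd.mpr (Nat.gcd_dvd_right _ _)
    have b2 : (g₂ : ℤ) ∣ z' + w := by rw [e2]; exact natCast_dvd.mpr (Nat.gcd_dvd_right _ _)
    have c1 : g₁ ∣ ((z : ℤ) - z').natAbs := natCast_dvd.mp (by
      have := dvd_sub a1 b1; rwa [sub_sub_sub_cancel_right] at this)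
    have c2 : g₂ ∣ ((z : ℤ) - z').natAbs := natCast_dvd.mp (by
      have := dvd_sub a2 b2; rwa [add_sub_add_right_eq_sub] at this)
    have hg2 : Nat.gcd g₁ g₂ ∣ 2 * g := by
      have d1 : ((Nat.gcd g₁ g₂ : ℕ) : ℤ) ∣ 2 * w := by
        have := dvd_sub ((natCast_dvd_natCast.mpr (Nat.gcd_dvd_right g₁ g₂)).trans a2)
          ((natCast_dvd_natCast.mpr (Nat.gcd_dvd_left g₁ g₂)).trans a1)
        rwa [show (z : ℤ) + w - (z - w) = 2 * w by ring] at this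
      have d2 : Nat.gcd g₁ g₂ ∣ 2 * w := mod_cast d1
      have d3 : Nat.gcd g₁ g₂ ∣ n := (Nat.gcd_dvd_left _ _).trans (Nat.gcd_dvd_left _ _)
      have d4 : Nat.gcd g₁ g₂ ∣ Nat.gcd (2 * w) (2 * n) := Nat.dvd_gcd d2 (d3.mul_left 2)
      rw [Nat.gcd_mul_left] at d4
      exact d4.trans (mul_dvd_mul_left 2 (h2 w hw))
    have hfin : n ∣ 2 * g * ((z : ℤ) - z').natAbs := by
      refine hdvd.trans ?_
      rw [← Nat.gcd_mul_lcm g₁ g₂]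
      exact mul_dvd_mul hg2 (Nat.lcm_dvd c1 c2)
    have l1 := h1 z hzS
    have l2 := h1 z' hzS'
    have q1 := div_add_mod (2 * g * z) n
    have q2 := div_add_mod (2 * g * z') n
    have r1 := mod_lt (2 * g * z) hn
    have r2 := mod_lt (2 * g * z') hn
    rw [e0] at q1
    have hlt : 2 * g * ((z : ℤ) - z').natAbs < n := by
      zify
      rw [show (2 * (g : ℤ) * |(z : ℤ) - z'|) = |2 * (g : ℤ) * ((z : ℤ) - z')| by
        rw [abs_mul, abs_of_nonneg (by positivity : (0 : ℤ) ≤ 2 * g)]]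
      zify at q1 q2 r1 r2
      have p1 : (0 : ℤ) ≤ 2 * g * z % n := emod_nonneg _ (by omega)
      have p2 : (0 : ℤ) ≤ 2 * g * z' % n := emod_nonneg _ (by omega)
      rw [abs_lt]
      constructor <;> linarith
    have h0 := Nat.eq_zero_of_dvd_of_lt hfin hlt
    rcases Nat.mul_eq_zero.mp h0 with h0 | h0 <;> omega

lemma card_sq_congr_le {n : ℕ} (hn : 0 < n) (S : Finset ℕ) (h1 : ∀ x ∈ S, x < n)
    (h2 : ∀ x ∈ S, x.Coprime n) (h3 : ∀ x ∈ S, ∀ y ∈ S, (n : ℤ) ∣ (x : ℤ) ^ 2 - (y : ℤ) ^ 2) :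
    S.card ≤ 2 * n.divisors.card ^ 2 := by
  have := card_sq_congr_gcd_le hn one_pos S h1 (fun x hx => dvd_one.mpr (h2 x hx)) h3
  simpa using this

lemma card_pow_four_congr_le {n : ℕ} (hn : 0 < n) (S : Finset ℕ) (h1 : ∀ x ∈ S, x < n)
    (h2 : ∀ x ∈ S, x.Coprime n) (h3 : ∀ x ∈ S, ∀ y ∈ S, (n : ℤ) ∣ (x : ℤ) ^ 4 - (y : ℤ) ^ 4) :
    S.card ≤ 4 * n.divisors.card ^ 4 := by
  classical
  have hmod : ∀ x : ℕ, ((x ^ 2 % n : ℕ) : ℤ) ≡ (x : ℤ) ^ 2 [ZMOD n] := fun x => by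
    push_cast; exact Int.mod_modEq _ _
  have hT : (S.image fun x => x ^ 2 % n).card ≤ 2 * n.divisors.card ^ 2 := by
    refine card_sq_congr_le hn _ ?_ ?_ ?_
    · intro y hy
      obtain ⟨x, -, rfl⟩ := mem_image.mp hy
      exact mod_lt _ hn
    · intro y hy
      obtain ⟨x, hx, rfl⟩ := mem_image.mp hy
      rw [Nat.coprime_iff_gcd_eq_one, ← gcd_rec, Nat.gcd_comm]
      exact (h2 x hx).pow_left 2
    · intro y hy y' hy'
      obtain ⟨x, hx, rfl⟩ := mem_image.mp hy
      obtain ⟨x', hx', rfl⟩ := mem_image.mp hy'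
      refine Int.ModEq.dvd ?_
      refine ((hmod x').pow 2).trans (Int.ModEq.trans ?_ ((hmod x).pow 2).symm)
      refine (Int.modEq_iff_dvd.mpr ?_)
      have := h3 x hx x' hx'
      convert this using 1; ring
  have hfib := Finset.card_le_mul_card_image S (2 * n.divisors.card ^ 2)
    (f := fun x => x ^ 2 % n) (fun b _ => ?_)
  · calc S.card ≤ _ := hfib
      _ ≤ (2 * n.divisors.card ^ 2) * (2 * n.divisors.card ^ 2) := by gcongr
      _ = _ := by ring
  · refine card_sq_congr_le hn _ ?_ ?_ ?_
    · exact fun x hx => h1 x (mem_filter.mp hx).1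
    · exact fun x hx => h2 x (mem_filter.mp hx).1
    · intro x hx y hy
      have ex := (mem_filter.mp hx).2
      have ey := (mem_filter.mp hy).2
      refine Int.ModEq.dvd ?_
      refine (hmod y).symm.trans (Int.ModEq.trans ?_ (hmod x))
      rw [ex, ey]

/-! ### Splitting mean values into residue classes -/

lemma integral_e_mul_comp_eq_zero {N : ℕ} (hN : 0 < N) {k : ℤ} (hk : ¬ (N : ℤ) ∣ k) {G : ℝ → ℝ}
    (hG : Function.Periodic G 1) : ∫ α in (0:ℝ)..1, e (α * k) * (G (N * α) : ℂ) = 0 := by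
  have hN0 : (N : ℝ) ≠ 0 := by positivity
  set F : ℝ → ℂ := fun α => e (α * k) * (G (N * α) : ℂ) with hF
  have hGN : ∀ α : ℝ, ∀ j : ℕ, G (α + j) = G α := fun α j => by
    simpa using hG.nat_mul j α
  have hper : Function.Periodic F 1 := by
    intro α
    simp only [hF]
    rw [show (α + 1) * (k : ℝ) = α * k + k by ring, e_add_int, mul_add, mul_one, hGN]
  have hshift : ∀ α, F (α + 1 / N) = e ((1:ℝ) * k / N) * F α := by
    intro α
    simp only [hF]
    have h1 := hGN (N * α) 1
    rw [Nat.cast_one] at h1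
    rw [show (N : ℝ) * (α + 1 / N) = N * α + 1 by field_simp, h1,
      show (α + 1 / N) * (k : ℝ) = 1 * k / N + α * k by ring, e_add]
    ring
  have h1 : ∫ α in (0:ℝ)..1, F (α + 1 / N) = ∫ α in (0:ℝ)..1, F α := by
    rw [intervalIntegral.integral_comp_add_right, zero_add, add_comm (1:ℝ)]
    exact (hper.intervalIntegral_add_eq (1 / N) 0).trans (by simp)
  simp_rw [hshift] at h1
  rw [intervalIntegral.integral_const_mul] at h1
  have hne : e ((1:ℝ) * k / N) ≠ 1 := by
    intro he
    have h2 := sum_e_range hN k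
    rw [if_neg hk] at h2
    have h3 : ∀ b ∈ range N, e ((b : ℝ) * k / N) = 1 := by
      intro b _
      have : e ((b : ℝ) * k / N) = e ((1:ℝ) * k / N) ^ b := by
        simp only [e, ← exp_nat_mul]
        congr 1; push_cast; ring
      rw [this, he, one_pow]
    rw [sum_congr rfl h3] at h2
    simp at h2
    omega
  have h4 : (e ((1:ℝ) * k / N) - 1) * ∫ α in (0:ℝ)..1, F α = 0 := by
    rw [sub_mul, h1, one_mul, sub_self]
  exact (mul_eq_zero.mp h4).resolve_left (sub_ne_zero.mpr hne)

lemma avg_normSq_trig_mul {ι : Type*} (s : Finset ι) (φ : ι → ℤ) {K : ℝ → ℝ} (hK : Continuous K) :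
    ((avg fun α => ‖trig s φ α‖ ^ 2 * K α : ℝ) : ℂ) =
      ∑ p ∈ s ×ˢ s, ∫ α in (0:ℝ)..1, e (α * ((φ p.1 - φ p.2 : ℤ) : ℝ)) * (K α : ℂ) := by
  rw [avg, ← intervalIntegral.integral_ofReal, ← intervalIntegral.integral_finsetSum]
  · refine intervalIntegral.integral_congr fun α _ => ?_
    rw [Complex.ofReal_mul, normSq_trig, sum_mul]
  · intro p _
    apply Continuous.intervalIntegrable
    fun_prop

lemma avg_normSq_trig_mul_comp {ι : Type*} (s : Finset ι) (φ : ι → ℤ) {N : ℕ} (hN : 0 < N)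
    {G : ℝ → ℝ} (hGc : Continuous G) (hG : Function.Periodic G 1) :
    avg (fun α => ‖trig s φ α‖ ^ 2 * G (N * α)) = ∑ r ∈ range N,
        avg (fun α => ‖trig (s.filter fun i => φ i % N = r) φ α‖ ^ 2 * G (N * α)) := by
  classical
  have hK : Continuous fun α : ℝ => G (N * α) := by fun_prop
  apply Complex.ofReal_injective
  rw [ofReal_sum, avg_normSq_trig_mul s φ hK]
  simp_rw [avg_normSq_trig_mul _ φ hK]
  have hN' : (0 : ℤ) < N := mod_cast hN
  rw [← Finset.sum_filter_of_ne (p := fun p : ι × ι => φ p.1 % N = φ p.2 % N)]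
  · rw [← sum_fiberwise_of_maps_to (t := range N)
      (g := fun p : ι × ι => (φ p.1 % N).toNat)]
    · refine sum_congr rfl fun r _ => sum_congr ?_ fun _ _ => rfl
      ext ⟨i, j⟩
      simp only [mem_filter, mem_product]
      have h1 := emod_nonneg (φ i) hN'.ne'
      constructor
      · rintro ⟨⟨⟨hi, hj⟩, hij⟩, hr⟩
        exact ⟨⟨hi, by omega⟩, ⟨hj, by omega⟩⟩
      · rintro ⟨⟨hi, hir⟩, ⟨hj, hjr⟩⟩
        exact ⟨⟨⟨hi, hj⟩, by omega⟩, by omega⟩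
    · rintro ⟨i, j⟩ _
      have h1 := emod_nonneg (φ i) hN'.ne'
      have h2 := emod_lt_of_pos (φ i) hN'
      simp only [mem_range]
      omega
  · rintro p - hne
    by_contra hcon
    refine hne (integral_e_mul_comp_eq_zero hN (fun hd => hcon ?_) hG)
    exact Int.emod_eq_emod_iff_emod_sub_eq_zero.mpr (Int.emod_eq_zero_of_dvd hd)

lemma avg_normSq_trig_pow_four_le (s : Finset ℕ) {n : ℕ} (hn : 0 < n)
    (hs : ∀ x ∈ s, x.Coprime n) {G : ℝ → ℝ} (hGc : Continuous G) (hG : Function.Periodic G 1)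
    (hG0 : ∀ α, 0 ≤ G α) :
    avg (fun α => ‖trig s (fun x => (x : ℤ) ^ 4) α‖ ^ 2 * G (n * α)) ≤
      4 * (n.divisors.card : ℝ) ^ 4 * ∑ c ∈ range n,
        avg (fun α => ‖trig (s.filter fun x => x % n = c) (fun x => (x : ℤ) ^ 4) α‖ ^ 2 *
          G (n * α)) := by
  classical
  have hK : Continuous fun α : ℝ => G (n * α) := by fun_prop
  rw [avg_normSq_trig_mul_comp s _ hn hGc hG]
  set C : ℕ → Finset ℕ := fun r => (range n).filter fun c => c.Coprime n ∧ c ^ 4 % n = r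
    with hC
  have hcard : ∀ r, ((C r).card : ℝ) ≤ 4 * (n.divisors.card : ℝ) ^ 4 := by
    intro r
    have := card_pow_four_congr_le hn (C r)
      (fun x hx => mem_range.mp (mem_filter.mp hx).1)
      (fun x hx => (mem_filter.mp hx).2.1) (fun x hx y hy => by
        have ex := (mem_filter.mp hx).2.2
        have ey := (mem_filter.mp hy).2.2
        have : (y ^ 4) ≡ (x ^ 4) [MOD n] := by rw [Nat.ModEq, ex, ey]
        exact_mod_cast (Nat.modEq_iff_dvd.mp this))
    exact_mod_cast this
  have hsplit : ∀ (r : ℕ) (α : ℝ), trig (s.filter fun x : ℕ => ((x : ℤ) ^ 4) % n = r) (fun x => (x : ℤ) ^ 4) α =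
      ∑ c ∈ C r, trig (s.filter fun x => x % n = c) (fun x => (x : ℤ) ^ 4) α := by
    intro r α
    unfold trig
    rw [← sum_fiberwise_of_maps_to (t := C r) (g := fun x => x % n)]
    · refine sum_congr rfl fun c hc => sum_congr ?_ fun _ _ => rfl
      rw [filter_filter]
      refine filter_congr fun x _ => ?_
      constructor
      · exact fun hx => hx.2
      · intro hx
        refine ⟨?_, hx⟩
        have h1 := (mem_filter.mp hc).2.2
        have h2 : x ^ 4 % n = r := by rw [Nat.pow_mod, hx, h1]
        exact_mod_cast h2
    · intro x hx
      rw [mem_filter] at hx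
      rw [hC, mem_filter, mem_range]
      refine ⟨mod_lt _ hn, ?_, ?_⟩
      · rw [Nat.coprime_iff_gcd_eq_one, ← gcd_rec, Nat.gcd_comm]
        exact hs x hx.1
      · rw [← Nat.pow_mod]
        exact_mod_cast hx.2
  have hcont : ∀ t : Finset ℕ, Continuous fun α : ℝ =>
      ‖trig t (fun x => (x : ℤ) ^ 4) α‖ ^ 2 * G (n * α) := fun t => by fun_prop
  calc _ ≤ ∑ r ∈ range n, avg (fun α => (4 * (n.divisors.card : ℝ) ^ 4) *
        ∑ c ∈ C r, ‖trig (s.filter fun x => x % n = c) (fun x => (x : ℤ) ^ 4) α‖ ^ 2 *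
          G (n * α)) := by
        refine sum_le_sum fun r _ => avg_mono (hcont _) ?_ fun α => ?_
        · exact continuous_const.mul (continuous_finsetSum _ fun c _ => hcont _)
        · rw [← sum_mul, ← mul_assoc]
          refine mul_le_mul_of_nonneg_right ?_ (hG0 _)
          rw [hsplit]
          have h1 := norm_sum_le (C r)
            (fun c => trig (s.filter fun x => x % n = c) (fun x => (x : ℤ) ^ 4) α)
          calc _ ≤ (∑ c ∈ C r,
                ‖trig (s.filter fun x => x % n = c) (fun x => (x : ℤ) ^ 4) α‖) ^ 2 := by gcongr
            _ ≤ (C r).card * ∑ c ∈ C r,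
                ‖trig (s.filter fun x => x % n = c) (fun x => (x : ℤ) ^ 4) α‖ ^ 2 :=
              sq_sum_le_card_mul_sum_sq
            _ ≤ _ := by gcongr; exact hcard r
    _ = 4 * (n.divisors.card : ℝ) ^ 4 * ∑ r ∈ range n, ∑ c ∈ C r,
          avg (fun α => ‖trig (s.filter fun x => x % n = c) (fun x => (x : ℤ) ^ 4) α‖ ^ 2 *
          G (n * α)) := by
        rw [mul_sum]
        refine sum_congr rfl fun r _ => ?_
        rw [avg_const_mul, avg_sum _ _ fun c _ => hcont _]
    _ ≤ _ := by
        refine mul_le_mul_of_nonneg_left ?_ (by positivity)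
        have hsub : ∀ r, C r = ((range n).filter fun c => c.Coprime n).filter
            (fun c => c ^ 4 % n = r) := fun r => by rw [hC, filter_filter]
        simp_rw [hsub]
        rw [sum_fiberwise_of_maps_to (g := fun c => c ^ 4 % n)
          (fun c _ => mem_range.mpr (mod_lt _ hn))]
        refine sum_le_sum_of_subset_of_nonneg (filter_subset _ _) fun c _ _ => ?_
        exact avg_nonneg fun α => mul_nonneg (by positivity) (hG0 _)

/-! ### The differenced sum -/

/-- Pairs `(x, y)` of members of `s` with `y < x` and `x ≡ y` modulo `n`. -/
def congrPairs (s : Finset ℕ) (n : ℕ) : Finset (ℕ × ℕ) :=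
  (s ×ˢ s).filter fun p => p.2 < p.1 ∧ p.1 % n = p.2 % n

lemma sum_normSq_trig_residue (s : Finset ℕ) {n : ℕ} (hn : 0 < n) (φ : ℕ → ℤ) (α : ℝ) :
    ∑ c ∈ range n, ‖trig (s.filter fun x => x % n = c) φ α‖ ^ 2 =
      s.card + 2 * (trig (congrPairs s n) (fun p => φ p.1 - φ p.2) α).re := by
  classical
  set f : ℕ × ℕ → ℂ := fun p => e (α * ((φ p.1 - φ p.2 : ℤ) : ℝ)) with hf
  set B := (s ×ˢ s).filter fun p : ℕ × ℕ => p.1 % n = p.2 % n with hB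
  have h1 : ((∑ c ∈ range n, ‖trig (s.filter fun x => x % n = c) φ α‖ ^ 2 : ℝ) : ℂ) =
      ∑ p ∈ B, f p := by
    rw [ofReal_sum, ← sum_fiberwise_of_maps_to (t := range n)
      (g := fun p : ℕ × ℕ => p.1 % n) (fun p _ => mem_range.mpr (mod_lt _ hn))]
    refine sum_congr rfl fun c _ => ?_
    rw [normSq_trig]
    refine sum_congr ?_ fun _ _ => rfl
    ext ⟨i, j⟩
    simp only [hB, mem_filter, mem_product]
    constructor
    · rintro ⟨⟨hi, hir⟩, ⟨hj, hjr⟩⟩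
      exact ⟨⟨⟨hi, hj⟩, by omega⟩, hir⟩
    · rintro ⟨⟨⟨hi, hj⟩, hij⟩, hr⟩
      exact ⟨⟨hi, hr⟩, ⟨hj, by omega⟩⟩
  have hlow : B.filter (fun p => p.2 < p.1) = congrPairs s n := by
    rw [hB, congrPairs, filter_filter]
    exact filter_congr fun p _ => and_comm
  have hdiag : ∑ p ∈ (B.filter fun p => ¬ p.2 < p.1).filter (fun p => p.1 = p.2), f p = s.card := by
    have : (B.filter fun p => ¬ p.2 < p.1).filter (fun p => p.1 = p.2) =
        s.image fun x => (x, x) := by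
      ext ⟨i, j⟩
      simp only [hB, mem_filter, mem_product, mem_image, Prod.mk.injEq]
      constructor
      · rintro ⟨⟨⟨⟨hi, hj⟩, hij⟩, hr⟩, rfl⟩
        exact ⟨i, hi, rfl, rfl⟩
      · rintro ⟨x, hx, rfl, rfl⟩
        exact ⟨⟨⟨⟨hx, hx⟩, rfl⟩, lt_irrefl _⟩, rfl⟩
    rw [this, sum_image (fun x _ y _ hxy => (Prod.mk.inj hxy).1)]
    simp [hf, e_zero]
  have hup : ∑ p ∈ (B.filter fun p => ¬ p.2 < p.1).filter (fun p => ¬ p.1 = p.2), f p =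
      (starRingEnd ℂ) (∑ p ∈ congrPairs s n, f p) := by
    rw [map_sum]
    refine sum_nbij' Prod.swap Prod.swap ?_ ?_ ?_ ?_ ?_
    · rintro ⟨i, j⟩ hp
      simp only [hB, congrPairs, mem_filter, mem_product, Prod.swap] at hp ⊢
      exact ⟨⟨hp.1.1.1.2, hp.1.1.1.1⟩, by omega, by omega⟩
    · rintro ⟨i, j⟩ hp
      simp only [hB, congrPairs, mem_filter, mem_product, Prod.swap] at hp ⊢
      exact ⟨⟨⟨⟨hp.1.2, hp.1.1⟩, by omega⟩, by omega⟩, by omega⟩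
    · intro p _; simp
    · intro p _; simp
    · rintro ⟨i, j⟩ _
      simp only [hf, Prod.swap, conj_e]
      congr 1; push_cast; ring
  have h2 : ∑ p ∈ B, f p = (∑ p ∈ congrPairs s n, f p) +
      (s.card + (starRingEnd ℂ) (∑ p ∈ congrPairs s n, f p)) := by
    rw [← Finset.sum_filter_add_sum_filter_not B (fun p => p.2 < p.1), hlow,
      ← Finset.sum_filter_add_sum_filter_not (B.filter fun p => ¬ p.2 < p.1) (fun p => p.1 = p.2),
      hdiag, hup]
  have h3 := congrArg re (h1.trans h2)
  rw [ofReal_re] at h3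
  rw [h3]
  simp only [add_re, Complex.conj_re, Complex.natCast_re]
  change _ = _ + 2 * (∑ p ∈ congrPairs s n, f p).re
  ring

/-- Index set of the differenced sum. -/
def diffSet (M : ℕ) (Y R : ℝ) : Finset (Σ _ : ℕ, ℕ × ℕ) :=
  (moduli M R).sigma fun m => congrPairs ((smoothA Y R).filter fun x => x.Coprime m) (m ^ 4)

/-- Frequencies of the differenced sum. -/
def diffFreq (q : Σ _ : ℕ, ℕ × ℕ) : ℤ := ((q.2.1 : ℤ) ^ 4 - (q.2.2 : ℤ) ^ 4) / (q.1 : ℤ) ^ 4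

lemma congrPairs_dvd {s : Finset ℕ} {n : ℕ} {p : ℕ × ℕ} (hp : p ∈ congrPairs s n) :
    (n : ℤ) ∣ (p.1 : ℤ) - p.2 := by
  have h1 := (mem_filter.mp hp).2.2
  exact (Nat.modEq_iff_dvd.mp (show p.2 ≡ p.1 [MOD n] from h1.symm))

set_option maxHeartbeats 1000000 in
lemma sum_avg_normSq_hCop_mul_le {Y R D : ℝ} (hY : 0 ≤ Y) {M : ℕ}
    (hD : ∀ m ∈ moduli M R, 4 * ((m ^ 4).divisors.card : ℝ) ^ 4 ≤ D) {G : ℝ → ℝ}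
    (hGc : Continuous G) (hGp : Function.Periodic G 1) (hG0 : ∀ α, 0 ≤ G α) :
    ∑ m ∈ moduli M R, avg (fun α => ‖hCop m Y R α‖ ^ 2 * G ((m ^ 4 : ℕ) * α)) ≤
    D * ((moduli M R).card * Y * avg G +
      2 * avg (fun α => (trig (diffSet M Y R) diffFreq α).re * G α)) := by
  classical
  set A : ℕ → Finset ℕ := fun m => (smoothA Y R).filter fun x => x.Coprime m with hA
  have hAY : ∀ m, ((A m).card : ℝ) ≤ Y := fun m =>
    (cast_le.mpr (card_filter_le _ _)).trans (card_smoothA_le Y R hY)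
  clear_value A
  set Ψ : ℕ → ℝ → ℂ := fun m => trig (congrPairs (A m) (m ^ 4))
    (fun p => ((p.1 : ℤ) ^ 4 - (p.2 : ℤ) ^ 4) / (m : ℤ) ^ 4) with hΨ
  have hΨc : ∀ m, Continuous (Ψ m) := fun m => continuous_trig _ _
  have hcomp : ∀ m : ℕ, Continuous fun α : ℝ => G ((m ^ 4 : ℕ) * α) := fun m => by fun_prop
  have hsum : ∀ α, ∑ m ∈ moduli M R, Ψ m α = trig (diffSet M Y R) diffFreq α := by
    intro α
    simp only [hΨ, trig, diffSet]
    rw [sum_sigma, hA]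
    rfl
  have hone : ∀ m ∈ moduli M R, avg (fun α => ‖hCop m Y R α‖ ^ 2 * G ((m ^ 4 : ℕ) * α)) ≤
      D * avg (fun α => (Y + 2 * (Ψ m α).re) * G α) := by
    intro m hm
    have hmem := hm
    rw [moduli, mem_filter, mem_Icc] at hm
    obtain ⟨⟨hm1, -⟩, hMm, hmR⟩ := hm
    have hm4 : 0 < m ^ 4 := by positivity
    have hsplit := avg_normSq_trig_pow_four_le (A m) hm4 (fun x hx => by
      rw [hA] at hx
      exact Coprime.pow_right 4 (mem_filter.mp hx).2) hGc hGp hG0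
    have hn : 0 ≤ avg (fun α => (Y + 2 * (Ψ m α).re) * G α) ∧ ∑ c ∈ range (m ^ 4), avg (fun α =>
        ‖trig ((A m).filter fun x => x % (m ^ 4) = c) (fun x => (x : ℤ) ^ 4) α‖ ^ 2 *
          G ((m ^ 4 : ℕ) * α)) ≤ avg (fun α => (Y + 2 * (Ψ m α).re) * G α) := by
      have e1 : avg (fun α => (Y + 2 * (Ψ m α).re) * G α) =
          avg (fun α => (Y + 2 * (Ψ m ((m ^ 4 : ℕ) * α)).re) * G ((m ^ 4 : ℕ) * α)) := by
        refine (avg_comp_mul (f := fun α => (Y + 2 * (Ψ m α).re) * G α) ?_ ?_ hm4.ne').symm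
        · have := hΨc m
          exact (continuous_const.add (continuous_const.mul
            (continuous_re.comp this))).mul hGc
        · intro α
          simp only [hΨ, periodic_trig _ _ α, hGp α]
      have hcont : ∀ c, Continuous fun α : ℝ =>
        ‖trig ((A m).filter fun x => x % (m ^ 4) = c) (fun x => (x : ℤ) ^ 4) α‖ ^ 2 *
          G ((m ^ 4 : ℕ) * α) := fun c => ((continuous_trig _ _).norm.pow 2).mul (hcomp m)
      have hpt : ∀ α : ℝ, ∑ c ∈ range (m ^ 4),
        ‖trig ((A m).filter fun x => x % (m ^ 4) = c) (fun x => (x : ℤ) ^ 4) α‖ ^ 2 *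
          G ((m ^ 4 : ℕ) * α) ≤ (Y + 2 * (Ψ m ((m ^ 4 : ℕ) * α)).re) * G ((m ^ 4 : ℕ) * α) := by
        intro α
        rw [← sum_mul, sum_normSq_trig_residue _ hm4]
        refine mul_le_mul_of_nonneg_right ?_ (hG0 ((m ^ 4 : ℕ) * α))
        have h1 : ((A m).card : ℝ) ≤ Y := hAY m
        have h2 : trig (congrPairs (A m) (m ^ 4)) (fun p => (p.1 : ℤ) ^ 4 - (p.2 : ℤ) ^ 4) α =
            Ψ m ((m ^ 4 : ℕ) * α) := by
          simp only [hΨ, trig]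
          refine sum_congr rfl fun p hp => ?_
          have hd : (m : ℤ) ^ 4 ∣ (p.1 : ℤ) ^ 4 - (p.2 : ℤ) ^ 4 := by
            have := congrPairs_dvd hp
            push_cast at this
            exact this.trans (sub_dvd_pow_sub_pow _ _ 4)
          obtain ⟨k, hk⟩ := hd
          rw [hk, Int.mul_ediv_cancel_left _ (by positivity)]
          congr 1; push_cast; ring
        rw [h2]; linarith
      have hc1 : Continuous fun α : ℝ =>
          (Y + 2 * (Ψ m ((m ^ 4 : ℕ) * α)).re) * G ((m ^ 4 : ℕ) * α) := by
        have := hΨc m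
        exact (continuous_const.add (continuous_const.mul
          (continuous_re.comp (this.comp (by fun_prop))))).mul (hcomp m)
      have e2 : ∑ c ∈ range (m ^ 4), avg (fun α =>
        ‖trig ((A m).filter fun x => x % (m ^ 4) = c) (fun x => (x : ℤ) ^ 4) α‖ ^ 2 *
          G ((m ^ 4 : ℕ) * α)) ≤ avg (fun α => (Y + 2 * (Ψ m α).re) * G α) := by
        rw [← avg_sum _ _ fun c _ => hcont c, e1]
        exact avg_mono (continuous_finsetSum _ fun c _ => hcont c) hc1 hpt
      refine ⟨le_trans ?_ e2, e2⟩
      exact sum_nonneg fun c _ => avg_nonneg fun α => mul_nonneg (by positivity) (hG0 _)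
    calc _ ≤ avg (fun α => ‖trig (A m) (fun x => (x : ℤ) ^ 4) α‖ ^ 2 * G ((m ^ 4 : ℕ) * α)) := le_of_eq (by rw [hA]; rfl)
      _ ≤ _ := hsplit
      _ ≤ D * avg (fun α => (Y + 2 * (Ψ m α).re) * G α) :=
          mul_le_mul (hD m hmem) hn.2 (sum_nonneg fun c _ => avg_nonneg fun α =>
            mul_nonneg (by positivity) (hG0 _)) (le_trans (by positivity) (hD m hmem))
  refine (sum_le_sum hone).trans ?_
  rcases (moduli M R).eq_empty_or_nonempty with hemp | ⟨m0, hm0⟩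
  · have hds : diffSet M Y R = ∅ := by rw [diffSet, hemp]; rfl
    have h0 : avg (fun _ : ℝ => (0:ℝ)) = 0 := avg_const 0
    simp [hemp, hds, trig, h0]
  have hD0 : 0 ≤ D := le_trans (by positivity) (hD m0 hm0)
  rw [← mul_sum]
  refine mul_le_mul_of_nonneg_left ?_ hD0
  have hc2 : ∀ m, Continuous fun α => (Y + 2 * (Ψ m α).re) * G α := fun m =>
    (continuous_const.add (continuous_const.mul (continuous_re.comp (hΨc m)))).mul hGc
  rw [← avg_sum _ _ fun m _ => hc2 m, ← avg_const_mul, ← avg_const_mul, ← avg_add]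
  · refine avg_mono (continuous_finsetSum _ fun m _ => hc2 m) ?_ fun α => ?_
    · exact (continuous_const.mul hGc).add
        (continuous_const.mul ((continuous_re.comp (continuous_trig _ _)).mul hGc))
    · have : ∑ m ∈ moduli M R, (Y + 2 * (Ψ m α).re) * G α =
          ((moduli M R).card * Y + 2 * (trig (diffSet M Y R) diffFreq α).re) * G α := by
        rw [← sum_mul, sum_add_distrib, sum_const, nsmul_eq_mul, ← mul_sum, ← re_sum, hsum]
      rw [this, add_mul, mul_assoc 2]
  · exact continuous_const.mul hGc
  · exact continuous_const.mul ((continuous_re.comp (continuous_trig _ _)).mul hGc)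

lemma sum_avg_main_le {u Y R D : ℝ} (hu : 1 ≤ u) (hY : 0 ≤ Y) {M : ℕ} (hM : 1 ≤ M)
    (hD0 : 0 ≤ D) (hD : ∀ m ∈ moduli M R, 4 * ((m ^ 4).divisors.card : ℝ) ^ 4 ≤ D) :
    ∑ m ∈ moduli M R, avg (fun α => ‖hCop m Y R α‖ ^ 2 *
      ‖h (Y / m) m.minFac ((m ^ 4 : ℕ) * α)‖ ^ u) ≤
    D * ((moduli M R).card * Y * avg (shiftSum u (Y / M) R) +
      2 * avg (fun α => ‖trig (diffSet M Y R) diffFreq α‖ * shiftSum u (Y / M) R α)) := by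
  set G := shiftSum u (Y / M) R with hG
  have hGc : Continuous G := continuous_shiftSum (by linarith) _ _
  have hG0 : ∀ α, 0 ≤ G α := shiftSum_nonneg _ _ _
  refine (sum_le_sum fun m hm => ?_).trans
    ((sum_avg_normSq_hCop_mul_le hY hD hGc (periodic_shiftSum _ _ _) hG0).trans ?_)
  · rw [moduli, mem_filter, mem_Icc] at hm
    obtain ⟨⟨hm1, -⟩, hMm, hmR⟩ := hm
    have hmM : (M : ℝ) ≤ m := mod_cast hMm.le
    have hM0 : (0:ℝ) < M := mod_cast hM
    have hp2 : 2 ≤ m.minFac := (minFac_prime (by omega)).two_le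
    have hle : Y / m ≤ Y / M := by gcongr
    have hc : Continuous (hCop m Y R) := continuous_trig _ _
    refine avg_mono ((hc.norm.pow 2).mul
      ((continuous_norm_h_rpow _ _ (by linarith)).comp (by fun_prop)))
      ((hc.norm.pow 2).mul (hGc.comp (by fun_prop))) fun α => ?_
    refine mul_le_mul_of_nonneg_left ?_ (sq_nonneg _)
    exact norm_h_rpow_le_shiftSum hu (by positivity) hle hp2 hmR _
  · refine mul_le_mul_of_nonneg_left (add_le_add le_rfl
      (mul_le_mul_of_nonneg_left (avg_mono ?_ ?_ fun α => ?_) (by norm_num))) hD0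
    · exact (continuous_re.comp (continuous_trig _ _)).mul hGc
    · exact (continuous_trig _ _).norm.mul hGc
    · exact mul_le_mul_of_nonneg_right (re_le_norm _) (hG0 α)

/-! ### Passing to a full box -/

/-- The box of triples `(h, m, z)`. -/
def box (H N Z : ℕ) : Finset (ℕ × ℕ × ℕ) :=
  Icc 1 H ×ˢ (Icc 1 N ×ˢ Icc 1 Z)

/-- The frequencies `h z (z² + h² m⁸)`. -/
def boxFreq (q : ℕ × ℕ × ℕ) : ℤ :=
  (q.1 : ℤ) * q.2.2 * ((q.2.2 : ℤ) ^ 2 + (q.1 : ℤ) ^ 2 * (q.2.1 : ℤ) ^ 8)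

lemma exists_subset_box {M : ℕ} (hM : 1 ≤ M) {Y R : ℝ} (hY : 0 ≤ Y) :
    ∃ t ⊆ box ⌊Y / M ^ 4⌋₊ ⌊M * R⌋₊ ⌊2 * Y⌋₊, ∀ α,
      trig (diffSet M Y R) diffFreq ((2 : ℕ) * α) = trig t boxFreq α := by
  classical
  set ι : (Σ _ : ℕ, ℕ × ℕ) → ℕ × ℕ × ℕ :=
    fun q => ((q.2.1 - q.2.2) / q.1 ^ 4, q.1, q.2.1 + q.2.2) with hι
  have hmem : ∀ q ∈ diffSet M Y R, ∃ j : ℕ, 0 < q.1 ∧ q.2.1 = q.2.2 + j * q.1 ^ 4 ∧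
      ι q = (j, q.1, q.2.1 + q.2.2) ∧ 0 < j ∧ 0 < q.2.2 ∧ (q.2.1 : ℝ) ≤ Y ∧ M < q.1 ∧
      q.1 ≤ ⌊M * R⌋₊ := by
    rintro ⟨m, x, y⟩ hq
    rw [diffSet, mem_sigma] at hq
    obtain ⟨hm, hxy⟩ := hq
    simp only [moduli, mem_filter, mem_Icc] at hm
    have hdvd := congrPairs_dvd hxy
    simp only [congrPairs, mem_filter, mem_product, mem_smoothA hY] at hxy
    have hlt : y < x := hxy.2.1
    have hdvd' : m ^ 4 ∣ x - y := by
      rw [← natCast_dvd_natCast, cast_sub hlt.le]; exact hdvd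
    obtain ⟨j, hj⟩ := hdvd'
    have hm4 : 0 < m ^ 4 := by have := hm.1.1; positivity
    refine ⟨j, hm.1.1, by simp only; rw [mul_comm]; omega, ?_, ?_, hxy.1.2.1.1, hxy.1.1.1.2.1,
      hm.2.1, hm.1.2⟩
    · simp only [hι, hj, Nat.mul_div_cancel_left _ hm4]
    · rcases Nat.eq_zero_or_pos j with rfl | hj0
      · omega
      · exact hj0
  have hfreq : ∀ q ∈ diffSet M Y R, 2 * diffFreq q = boxFreq (ι q) := by
    intro q hq
    obtain ⟨j, hm, hx, hj, -⟩ := hmem q hq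
    rw [hj, boxFreq, diffFreq]
    have h1 : ((q.2.1 : ℤ) ^ 4 - (q.2.2 : ℤ) ^ 4) = (q.1 : ℤ) ^ 4 *
        (j * ((q.2.1 : ℤ) + q.2.2) * ((q.2.1 : ℤ) ^ 2 + (q.2.2 : ℤ) ^ 2)) := by
      rw [hx]; push_cast; ring
    rw [h1, Int.mul_ediv_cancel_left _ (by positivity), hx]
    push_cast; ring
  have hinj : Set.InjOn ι (diffSet M Y R) := by
    intro q hq q' hq' heq
    obtain ⟨j, hm, hx, hj, -⟩ := hmem q hq
    obtain ⟨j', hm', hx', hj', -⟩ := hmem q' hq'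
    rw [hj, hj', Prod.mk.injEq, Prod.mk.injEq] at heq
    obtain ⟨m, x, y⟩ := q
    obtain ⟨m', x', y'⟩ := q'
    simp only at heq hx hx'
    obtain ⟨rfl, rfl, h3⟩ := heq
    have hy : y = y' := by omega
    subst hy
    rw [hx, hx']
  have hsub : (diffSet M Y R).image ι ⊆ box ⌊Y / M ^ 4⌋₊ ⌊M * R⌋₊ ⌊2 * Y⌋₊ := by
    intro p hp
    obtain ⟨q, hq, rfl⟩ := mem_image.mp hp
    obtain ⟨j, hm, hx, hj, hj0, hy0, hxY, hMm, hmR⟩ := hmem q hq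
    rw [hj]
    have hM0 : (0:ℝ) < M := mod_cast hM
    have hyx : (q.2.2 : ℝ) ≤ q.2.1 := by
      have : q.2.2 ≤ q.2.1 := by omega
      exact_mod_cast this
    simp only [box, mem_product, mem_Icc]
    refine ⟨⟨hj0, le_floor ?_⟩, ⟨hm, hmR⟩, by omega, le_floor ?_⟩
    · rw [le_div_iff₀ (by positivity)]
      have h1 : (q.2.1 : ℝ) = q.2.2 + j * (q.1 : ℝ) ^ 4 := mod_cast hx
      have h2 : (M : ℝ) ^ 4 ≤ (q.1 : ℝ) ^ 4 := by
        have : (M : ℝ) ≤ q.1 := mod_cast hMm.le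
        gcongr
      have h3 : (0:ℝ) ≤ q.2.2 := by positivity
      calc (j : ℝ) * M ^ 4 ≤ j * (q.1 : ℝ) ^ 4 := by gcongr
        _ ≤ Y := by linarith
    · push_cast; linarith
  have heq : ∀ α, trig (diffSet M Y R) diffFreq ((2 : ℕ) * α) =
      trig ((diffSet M Y R).image ι) boxFreq α := by
    intro α
    have h1 := trig_mul_left (diffSet M Y R) diffFreq 2 α
    push_cast at h1 ⊢
    rw [← h1]
    unfold trig
    rw [sum_image hinj]
    exact sum_congr rfl fun q hq => by
      dsimp only
      rw [hfreq q hq]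
  exact ⟨_, hsub, heq⟩

lemma avg_norm_diff_pow_le {M : ℕ} (hM : 1 ≤ M) {Y R : ℝ} (hY : 0 ≤ Y) (k : ℕ) :
    avg (fun α => ‖trig (diffSet M Y R) diffFreq α‖ ^ (2 * k)) ≤
      avg (fun α => ‖trig (box ⌊Y / M ^ 4⌋₊ ⌊M * R⌋₊ ⌊2 * Y⌋₊) boxFreq α‖ ^ (2 * k)) := by
  obtain ⟨t, hsub, heq⟩ := exists_subset_box hM (R := R) hY
  rw [← avg_comp_mul (n := 2) (f := fun α => ‖trig (diffSet M Y R) diffFreq α‖ ^ (2 * k))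
    (by fun_prop) (fun α => by simp only [periodic_trig _ _ α]) (by norm_num)]
  simp_rw [heq]
  exact PosDefTrig.avg_norm_pow_mono (PosDefTrig.trig _ _) (PosDefTrig.trig _ _)
    (PosDefTrig.trig_subset hsub _) k

/-! ### Representations by the form `x² + 3 y²` -/

lemma card_primitive_sq_add_three_sq_le {n : ℕ} (hn : 0 < n) (S : Finset (ℕ × ℕ))
    (hS : ∀ p ∈ S, p.1 ^ 2 + 3 * p.2 ^ 2 = n ∧ p.1.Coprime p.2) :
    S.card ≤ 6 * n.divisors.card ^ 2 := by
  classical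
  have hcop : ∀ p ∈ S, IsCoprime (p.2 : ℤ) n := by
    intro p hp
    obtain ⟨h1, h2⟩ := hS p hp
    have h3 : IsCoprime (p.2 : ℤ) ((p.1 : ℤ) ^ 2) :=
      (Nat.isCoprime_iff_coprime.mpr h2.symm).pow_right
    have h4 : (n : ℤ) = (p.1 : ℤ) ^ 2 + p.2 * (3 * p.2) := by rw [← h1]; push_cast; ring
    rw [h4]
    exact h3.add_mul_left_right _
  have hex : ∀ p ∈ S, ∃ r : ℕ, r < n ∧ (n : ℤ) ∣ r * p.2 - p.1 := by
    intro p hp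
    obtain ⟨a, b, hab⟩ := hcop p hp
    have hn0 : (n : ℤ) ≠ 0 := by omega
    have h0 := emod_nonneg (a * p.1) hn0
    have h1 := emod_lt_of_pos (a * p.1) (by omega : (0:ℤ) < n)
    refine ⟨((a * p.1) % n).toNat, by omega, ?_⟩
    rw [Int.toNat_of_nonneg h0]
    have h2 := Int.emod_add_mul_ediv (a * p.1) n
    refine ⟨-(b * p.1) - (a * p.1 / n) * p.2, ?_⟩
    linear_combination (p.2 : ℤ) * h2 + (p.1 : ℤ) * hab
  choose! r hr using hex
  have hsq : ∀ p ∈ S, (n : ℤ) ∣ (r p : ℤ) ^ 2 + 3 := by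
    intro p hp
    have h1 := (hr p hp).2
    refine (hcop p hp).symm.dvd_of_dvd_mul_left (y := (p.2 : ℤ)) ?_ |> fun h =>
      (hcop p hp).symm.dvd_of_dvd_mul_left h
    have h2 : (n : ℤ) = (p.1 : ℤ) ^ 2 + 3 * (p.2 : ℤ) ^ 2 := mod_cast (hS p hp).1.symm
    have h3 : (p.2 : ℤ) * (p.2 * ((r p : ℤ) ^ 2 + 3)) =
        (r p * p.2 - p.1) * (r p * p.2 + p.1) + n := by rw [h2]; ring
    rw [h3]
    exact dvd_add (h1.mul_right _) dvd_rfl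
  have hinj : Set.InjOn r S := by
    intro p hp q hq hpq
    have hp' := (hr p hp).2
    have hq' := (hr q hq).2
    rw [← hpq] at hq'
    have h2 : (n : ℤ) = (p.1 : ℤ) ^ 2 + 3 * (p.2 : ℤ) ^ 2 := mod_cast (hS p hp).1.symm
    have h2' : (n : ℤ) = (q.1 : ℤ) ^ 2 + 3 * (q.2 : ℤ) ^ 2 := mod_cast (hS q hq).1.symm
    have hd : (n : ℤ) ∣ p.1 * q.2 - q.1 * p.2 := by
      have := dvd_sub (hq'.mul_right p.2) (hp'.mul_right q.2)
      rwa [show ((r p : ℤ) * q.2 - q.1) * p.2 - (r p * p.2 - p.1) * q.2 =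
        p.1 * q.2 - q.1 * p.2 by ring] at this
    have hz : (p.1 : ℤ) * q.2 - q.1 * p.2 = 0 := by
      by_contra hne
      obtain ⟨k, hk⟩ := hd
      have hk0 : k ≠ 0 := by rintro rfl; simp at hk; exact hne hk
      have hk1 : 1 ≤ k ^ 2 := by have := sq_pos_of_ne_zero hk0; omega
      have hid : ((p.1 : ℤ) * q.1 + 3 * (p.2 * q.2)) ^ 2 + 3 * ((p.1 : ℤ) * q.2 - q.1 * p.2) ^ 2 =
          n * n := by
        nth_rewrite 1 [h2]; rw [h2']; ring
      rw [hk] at hid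
      have hnn : (0 : ℤ) < n * n := by have : (0:ℤ) < n := by omega
                                       positivity
      nlinarith [sq_nonneg ((p.1 : ℤ) * q.1 + 3 * (p.2 * q.2))]
    have hz' : p.1 * q.2 = q.1 * p.2 := by
      have : (p.1 : ℤ) * q.2 = q.1 * p.2 := by linarith
      exact_mod_cast this
    have d1 : p.1 ∣ q.1 := (hS p hp).2.dvd_of_dvd_mul_right (hz' ▸ dvd_mul_right _ _)
    have d2 : q.1 ∣ p.1 := (hS q hq).2.dvd_of_dvd_mul_right (hz'.symm ▸ dvd_mul_right _ _)
    have e1 := Nat.dvd_antisymm d1 d2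
    have e2 : p.2 ^ 2 = q.2 ^ 2 := by
      have a1 := (hS p hp).1
      have a2 := (hS q hq).1
      rw [e1] at a1
      omega
    exact Prod.ext e1 (Nat.pow_left_injective two_ne_zero e2)
  rw [← card_image_of_injOn hinj]
  refine card_sq_congr_gcd_le (g := 3) hn (by norm_num) _ ?_ ?_ ?_
  · intro x hx
    obtain ⟨p, hp, rfl⟩ := mem_image.mp hx
    exact (hr p hp).1
  · intro x hx
    obtain ⟨p, hp, rfl⟩ := mem_image.mp hx
    have a1 : (((r p).gcd n : ℕ) : ℤ) ∣ r p := natCast_dvd_natCast.mpr (Nat.gcd_dvd_left _ _)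
    have a2 : (((r p).gcd n : ℕ) : ℤ) ∣ n := natCast_dvd_natCast.mpr (Nat.gcd_dvd_right _ _)
    have := dvd_sub (a2.trans (hsq p hp)) (a1.mul_right (r p))
    rw [show (r p : ℤ) ^ 2 + 3 - r p * r p = 3 by ring] at this
    exact_mod_cast this
  · intro x hx y hy
    obtain ⟨p, hp, rfl⟩ := mem_image.mp hx
    obtain ⟨q, hq, rfl⟩ := mem_image.mp hy
    have := dvd_sub (hsq p hp) (hsq q hq)
    rwa [add_sub_add_right_eq_sub] at this

lemma card_sq_add_three_sq_le {n : ℕ} (hn : 0 < n) (S : Finset (ℕ × ℕ))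
    (hS : ∀ p ∈ S, p.1 ^ 2 + 3 * p.2 ^ 2 = n) : S.card ≤ 6 * n.divisors.card ^ 3 := by
  classical
  have hdvd : ∀ p ∈ S, p.1.gcd p.2 ^ 2 ∣ n := by
    intro p hp
    rw [← hS p hp]
    exact dvd_add (pow_dvd_pow_of_dvd (Nat.gcd_dvd_left _ _) 2)
      ((pow_dvd_pow_of_dvd (Nat.gcd_dvd_right _ _) 2).mul_left 3)
  have h1 := Finset.card_le_mul_card_image_of_maps_to (s := S) (t := n.divisors)
    (f := fun p => p.1.gcd p.2) (n := 6 * n.divisors.card ^ 2)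
    (fun p hp => mem_divisors.mpr
      ⟨(dvd_pow_self _ two_ne_zero).trans (hdvd p hp), hn.ne'⟩) ?_
  · calc S.card ≤ _ := h1
      _ = _ := by ring
  intro g hg
  rcases (S.filter fun p => p.1.gcd p.2 = g).eq_empty_or_nonempty with h0 | ⟨p₀, hp₀⟩
  · simp [h0]
  obtain ⟨hp₀S, hp₀g⟩ := mem_filter.mp hp₀
  have hgn : g ^ 2 ∣ n := hp₀g ▸ hdvd p₀ hp₀S
  have hg0 : 0 < g := Nat.pos_of_mem_divisors hg
  have hdiv : n / g ^ 2 ∣ n := div_dvd_of_dvd hgn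
  have hpos : 0 < n / g ^ 2 := Nat.div_pos (le_of_dvd hn hgn) (by positivity)
  have hback : ∀ p ∈ S.filter fun p => p.1.gcd p.2 = g, p.1 = g * (p.1 / g) ∧ p.2 = g * (p.2 / g) := by
    intro p hp
    have := (mem_filter.mp hp).2
    exact ⟨(mul_div_cancel' (this ▸ Nat.gcd_dvd_left _ _)).symm,
      (mul_div_cancel' (this ▸ Nat.gcd_dvd_right _ _)).symm⟩
  have hinj : Set.InjOn (fun p : ℕ × ℕ => (p.1 / g, p.2 / g)) (S.filter fun p => p.1.gcd p.2 = g) := by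
    intro p hp q hq hpq
    simp only [Prod.mk.injEq] at hpq
    have a := hback p hp
    have b := hback q hq
    refine Prod.ext ?_ ?_
    · rw [a.1, b.1, hpq.1]
    · rw [a.2, b.2, hpq.2]
  rw [← card_image_of_injOn hinj]
  refine (card_primitive_sq_add_three_sq_le hpos _ ?_).trans ?_
  · intro q hq
    obtain ⟨p, hp, rfl⟩ := mem_image.mp hq
    obtain ⟨hpS, hpg⟩ := mem_filter.mp hp
    have a := hback p hp
    refine ⟨?_, ?_⟩
    · have h3 := hS p hpS
      rw [a.1, a.2] at h3
      symm
      apply Nat.div_eq_of_eq_mul_right (by positivity)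
      rw [← h3]; ring
    · have := Nat.coprime_div_gcd_div_gcd (m := p.1) (n := p.2) (by rw [hpg]; exact hg0)
      rwa [hpg] at this
  · gcongr

/-! ### Mean values over the full box -/

lemma Slow.comp_mul {f : ℝ → ℝ → ℝ} (hf : Slow f) : Slow fun X R => f (X * R) R := by
  refine ⟨fun X R hX hR => hf.1 _ _ (by nlinarith) hR, fun ε hε => ?_⟩
  obtain ⟨C, K, hC, hK, hb⟩ := hf.2 ε hε
  refine ⟨C, K + ε, hC, by linarith, fun X R hX hR => ?_⟩
  refine (hb _ _ (by nlinarith) hR).trans (le_of_eq ?_)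
  rw [mul_rpow (by linarith) (by linarith), rpow_add (by linarith)]
  ring

lemma boxFreq_eq (h m z : ℕ) :
    boxFreq (h, m, z) = ((h * z * (z ^ 2 + h ^ 2 * m ^ 8) : ℕ) : ℤ) := by
  simp [boxFreq]

lemma card_box (H N Z : ℕ) : (box H N Z).card = H * N * Z := by
  simp [box, mul_assoc]

lemma box_value_le {H N Z h m z : ℕ} (hh : h ≤ H) (hm : m ≤ N) (hz : z ≤ Z) :
    h * z * (z ^ 2 + h ^ 2 * m ^ 8) ≤ H * Z * (Z ^ 2 + H ^ 2 * N ^ 8) := by gcongr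

lemma avg_normSq_box_le (H N Z : ℕ) {D : ℝ}
    (hD : ∀ n : ℕ, n ≠ 0 → n ≤ H * Z * (Z ^ 2 + H ^ 2 * N ^ 8) → (n.divisors.card : ℝ) ≤ D) :
    avg (fun α => ‖trig (box H N Z) boxFreq α‖ ^ 2) ≤ D ^ 2 * (H * N * Z) := by
  classical
  have h := avg_normSq_trig_le (box H N Z) boxFreq (D ^ 2) 0 (by positivity) ?_ ?_
  · rw [card_box] at h
    push_cast at h
    simpa using h
  · rintro ⟨h, m, z⟩ hq _
    have hq' := hq
    simp only [box, mem_product, mem_Icc] at hq'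
    obtain ⟨⟨hh1, hh2⟩, ⟨hm1, hm2⟩, hz1, hz2⟩ := hq'
    rw [boxFreq_eq]
    set n := h * z * (z ^ 2 + h ^ 2 * m ^ 8) with hn
    have hn0 : n ≠ 0 := by positivity
    have hle : n ≤ H * Z * (Z ^ 2 + H ^ 2 * N ^ 8) := box_value_le hh2 hm2 hz2
    have hdD := hD n hn0 hle
    have hc : ((box H N Z).filter fun j => boxFreq j = (n : ℤ)).card ≤
        (n.divisors ×ˢ n.divisors).card := by
      refine card_le_card_of_injOn (fun q => (q.1, q.2.2)) ?_ ?_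
      · rintro ⟨h', m', z'⟩ hj
        have hj' := (mem_filter.mp hj).2
        rw [boxFreq_eq] at hj'
        have hj2 : h' * z' * (z' ^ 2 + h' ^ 2 * m' ^ 8) = n := mod_cast hj'
        simp only [coe_product, Set.mem_prod, mem_coe, mem_divisors]
        exact ⟨⟨hj2 ▸ Dvd.intro _ (mul_assoc _ _ _).symm, hn0⟩,
          ⟨hj2 ▸ ⟨h' * (z' ^ 2 + h' ^ 2 * m' ^ 8), by ring⟩, hn0⟩⟩
      · rintro ⟨h₁, m₁, z₁⟩ hj₁ ⟨h₂, m₂, z₂⟩ hj₂ heq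
        simp only [Prod.mk.injEq] at heq
        obtain ⟨rfl, rfl⟩ := heq
        obtain ⟨hb, e₁⟩ := mem_filter.mp hj₁
        obtain ⟨-, e₂⟩ := mem_filter.mp hj₂
        simp only [box, mem_product, mem_Icc] at hb
        have hh0 : 0 < h₁ := hb.1.1
        have hz0 : 0 < z₁ := hb.2.2.1
        rw [boxFreq_eq] at e₁ e₂
        have e : h₁ * z₁ * (z₁ ^ 2 + h₁ ^ 2 * m₁ ^ 8) = h₁ * z₁ * (z₁ ^ 2 + h₁ ^ 2 * m₂ ^ 8) := by
          exact_mod_cast e₁.trans e₂.symm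
        have e3 := eq_of_mul_eq_mul_left (by positivity) e
        have e4 := eq_of_mul_eq_mul_left (by positivity : 0 < h₁ ^ 2) (Nat.add_left_cancel e3)
        rw [Nat.pow_left_injective (by norm_num : 8 ≠ 0) e4]
    calc ((((box H N Z).filter fun j => boxFreq j = (n : ℤ)).card : ℕ) : ℝ)
        ≤ ((n.divisors ×ˢ n.divisors).card : ℕ) := cast_le.mpr hc
      _ = (n.divisors.card : ℝ) ^ 2 := by rw [card_product]; push_cast; ring
      _ ≤ D ^ 2 := by gcongr
  · refine le_of_eq ?_
    rw [Nat.cast_eq_zero, card_eq_zero, filter_eq_empty_iff]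
    rintro ⟨h, m, z⟩ hq
    simp only [box, mem_product, mem_Icc] at hq
    obtain ⟨⟨hh1, hh2⟩, ⟨hm1, hm2⟩, hz1, hz2⟩ := hq
    rw [boxFreq_eq]
    have : h * z * (z ^ 2 + h ^ 2 * m ^ 8) ≠ 0 := by positivity
    exact_mod_cast this

/-- Index set of the second difference of the box sum: `((h, m), (w, z))` with `z + w ≤ Z`. -/
def boxTwo (H N Z : ℕ) : Finset ((ℕ × ℕ) × ℕ × ℕ) :=
  ((Icc 1 H ×ˢ Icc 1 N) ×ˢ (Icc 1 Z ×ˢ Icc 1 Z)).filter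
    fun q => q.2.2 + q.2.1 ≤ Z

/-- The frequencies `h w (3z² + 3zw + w² + h² m⁸)`. -/
def boxTwoFreq (q : (ℕ × ℕ) × ℕ × ℕ) : ℕ :=
  q.1.1 * q.2.1 * (3 * q.2.2 ^ 2 + 3 * q.2.2 * q.2.1 + q.2.1 ^ 2 + q.1.1 ^ 2 * q.1.2 ^ 8)

lemma normSq_inner_box (h m Z : ℕ) (α : ℝ) :
    ‖trig (Icc 1 Z) (fun z => boxFreq (h, m, z)) α‖ ^ 2 = Z + 2 *
      (trig ((Icc 1 Z ×ˢ Icc 1 Z).filter fun p => p.2 + p.1 ≤ Z)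
        (fun p => (boxTwoFreq ((h, m), p) : ℤ)) α).re := by
  have h1 := sum_normSq_trig_residue (Icc 1 Z) one_pos (fun z => boxFreq (h, m, z)) α
  simp only [range_one, Finset.sum_singleton, mod_one, filter_true,
    card_Icc, Nat.add_sub_cancel] at h1
  rw [h1]
  congr 3
  unfold trig
  refine sum_nbij' (fun p => (p.1 - p.2, p.2)) (fun p => (p.2 + p.1, p.2)) ?_ ?_ ?_ ?_ ?_
  · rintro ⟨i, j⟩ hp
    simp only [congrPairs, mem_filter, mem_product, mem_Icc] at hp ⊢
    omega
  · rintro ⟨i, j⟩ hp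
    simp only [congrPairs, mem_filter, mem_product, mem_Icc, mod_one, and_true] at hp ⊢
    omega
  · rintro ⟨i, j⟩ hp
    simp only [congrPairs, mem_filter, mem_product, mem_Icc] at hp
    simp only [Prod.mk.injEq, and_true]
    omega
  · rintro ⟨i, j⟩ hp
    simp
  · rintro ⟨i, j⟩ hp
    simp only [congrPairs, mem_filter, mem_product, mem_Icc] at hp
    obtain ⟨w, rfl⟩ : ∃ w, i = j + w := ⟨i - j, by omega⟩
    simp only [Nat.add_sub_cancel_left, boxTwoFreq, boxFreq]
    congr 2
    push_cast
    ring


lemma avg_normSq_boxTwo_le (H N Z : ℕ) {D : ℝ} (hD0 : 0 ≤ D)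
    (hD : ∀ n : ℕ, n ≠ 0 → n ≤ 28 * (H * Z * (Z ^ 2 + H ^ 2 * N ^ 8)) → (n.divisors.card : ℝ) ≤ D) :
    avg (fun α => ‖trig (boxTwo H N Z) (fun q => (boxTwoFreq q : ℤ)) α‖ ^ 2) ≤
      6 * D ^ 5 * (H * N * Z ^ 2) := by
  classical
  have h := avg_normSq_trig_le (boxTwo H N Z) (fun q => (boxTwoFreq q : ℤ)) (6 * D ^ 5) 0
    (by positivity) ?_ ?_
  · refine h.trans ?_
    have h1 : ((boxTwo H N Z).card : ℝ) ≤ H * N * Z ^ 2 := by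
      have : (boxTwo H N Z).card ≤ H * N * Z ^ 2 := by
        refine (card_filter_le _ _).trans (le_of_eq ?_)
        simp only [card_product, card_Icc, Nat.add_sub_cancel]; ring
      exact_mod_cast this
    have h2 : 6 * D ^ 5 * ((boxTwo H N Z).card : ℝ) ≤ 6 * D ^ 5 * (H * N * Z ^ 2) := by gcongr
    linarith
  · rintro ⟨⟨h, m⟩, w, z⟩ hq _
    have hq' := hq
    simp only [boxTwo, mem_filter, mem_product, mem_Icc] at hq'
    obtain ⟨⟨⟨⟨hh1, hh2⟩, hm1, hm2⟩, ⟨hw1, hw2⟩, hz1, hz2⟩, hzw⟩ := hq'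
    set n := boxTwoFreq ((h, m), w, z) with hn
    have hn0 : n ≠ 0 := by rw [hn]; unfold boxTwoFreq; positivity
    have hle : n ≤ 7 * (H * Z * (Z ^ 2 + H ^ 2 * N ^ 8)) := by
      calc n ≤ H * Z * (3 * Z ^ 2 + 3 * Z * Z + Z ^ 2 + H ^ 2 * N ^ 8) := by
            rw [hn]; unfold boxTwoFreq; dsimp only; gcongr
        _ ≤ H * Z * (7 * Z ^ 2 + 7 * (H ^ 2 * N ^ 8)) := by
            apply Nat.mul_le_mul_left
            have : 0 ≤ H ^ 2 * N ^ 8 := Nat.zero_le _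
            rw [show 3 * Z * Z = 3 * Z ^ 2 by ring]
            omega
        _ = _ := by ring
    have hdD := hD n hn0 (hle.trans (by omega))
    have hmemdiv : ∀ q : (ℕ × ℕ) × ℕ × ℕ, boxTwoFreq q = n →
        (q.1.1, q.2.1) ∈ n.divisors ×ˢ n.divisors := by
      rintro ⟨⟨h', m'⟩, w', z'⟩ hj
      rw [← hj]
      rw [← hj] at hn0
      simp only [mem_product, mem_divisors]
      refine ⟨⟨Dvd.intro _ (mul_assoc _ _ _).symm, hn0⟩, ⟨?_, hn0⟩⟩
      unfold boxTwoFreq; dsimp only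
      rw [mul_comm h' w', mul_assoc]
      exact Dvd.intro _ rfl
    have hfib : ∀ b ∈ n.divisors ×ˢ n.divisors,
        ((((boxTwo H N Z).filter fun j => (boxTwoFreq j : ℤ) = (n : ℤ)).filter
          fun q => (q.1.1, q.2.1) = b).card : ℝ) ≤ 6 * D ^ 3 := by
      rintro ⟨h₀, w₀⟩ hb
      rcases Finset.eq_empty_or_nonempty (((boxTwo H N Z).filter
        fun j => (boxTwoFreq j : ℤ) = (n : ℤ)).filter fun q => (q.1.1, q.2.1) = (h₀, w₀)) with
        h0 | ⟨⟨⟨h₁, m₁⟩, w₁, z₁⟩, hne⟩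
      · rw [h0]; simp; positivity
      simp only [boxTwo, mem_filter, mem_product, mem_Icc, Prod.mk.injEq] at hne
      obtain ⟨⟨⟨⟨⟨⟨hh₁, -⟩, hm₁, -⟩, ⟨hw₁, -⟩, hz₁, -⟩, -⟩, hv⟩, rfl, rfl⟩ := hne
      have hv' : boxTwoFreq ((h₁, m₁), w₁, z₁) = n := mod_cast hv
      set k := 3 * z₁ ^ 2 + 3 * z₁ * w₁ + w₁ ^ 2 + h₁ ^ 2 * m₁ ^ 8 with hk
      have hkn : h₁ * w₁ * k = n := hv'
      set T := (2 * h₁ * m₁ ^ 4) ^ 2 + 3 * (2 * z₁ + w₁) ^ 2 with hT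
      have hT4 : T + w₁ ^ 2 = 4 * k := by rw [hT, hk]; ring
      have hT0 : 0 < T := by positivity
      have hkle : k ≤ n := by
        rw [← hkn]; exact Nat.le_mul_of_pos_left _ (by positivity)
      have hTD := hD T hT0.ne' (by omega)
      have hval : ∀ q ∈ (((boxTwo H N Z).filter fun j => (boxTwoFreq j : ℤ) = (n : ℤ)).filter
          fun q => (q.1.1, q.2.1) = (h₁, w₁)), q.1.1 = h₁ ∧ q.2.1 = w₁ ∧
          (2 * h₁ * q.1.2 ^ 4) ^ 2 + 3 * (2 * q.2.2 + w₁) ^ 2 = T := by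
        rintro ⟨⟨h', m'⟩, w', z'⟩ hj
        simp only [mem_filter, Prod.mk.injEq] at hj
        obtain ⟨⟨-, hj⟩, rfl, rfl⟩ := hj
        have hj' : boxTwoFreq ((h', m'), w', z') = n := mod_cast hj
        have e : h' * w' * (3 * z' ^ 2 + 3 * z' * w' + w' ^ 2 + h' ^ 2 * m' ^ 8) =
          h' * w' * k := by rw [hkn]; exact hj'
        have e' := eq_of_mul_eq_mul_left (by positivity) e
        refine ⟨rfl, rfl, ?_⟩
        have : (2 * h' * m' ^ 4) ^ 2 + 3 * (2 * z' + w') ^ 2 + w' ^ 2 = 4 * k := by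
          rw [← e']; ring
        dsimp only
        omega
      have hinj : Set.InjOn (fun q : (ℕ × ℕ) × ℕ × ℕ => (2 * h₁ * q.1.2 ^ 4, 2 * q.2.2 + w₁))
          (((boxTwo H N Z).filter fun j => (boxTwoFreq j : ℤ) = (n : ℤ)).filter
          fun q => (q.1.1, q.2.1) = (h₁, w₁)) := by
        intro q hq q' hq' heq
        obtain ⟨a1, a2, -⟩ := hval q hq
        obtain ⟨b1, b2, -⟩ := hval q' hq'
        simp only [Prod.mk.injEq] at heq
        have e1 := eq_of_mul_eq_mul_left (by positivity : 0 < 2 * h₁) heq.1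
        have e2 := Nat.pow_left_injective (by norm_num : 4 ≠ 0) e1
        exact Prod.ext (Prod.ext (a1.trans b1.symm) e2) (Prod.ext (a2.trans b2.symm) (by omega))
      have hcard := card_sq_add_three_sq_le hT0 (image
        (fun q : (ℕ × ℕ) × ℕ × ℕ => (2 * h₁ * q.1.2 ^ 4, 2 * q.2.2 + w₁)) _) (by
        intro p hp
        obtain ⟨q, hq, rfl⟩ := mem_image.mp hp
        exact (hval q hq).2.2)
      rw [card_image_of_injOn hinj] at hcard
      refine (cast_le.mpr hcard).trans ?_
      push_cast
      gcongr
    have hc := Finset.card_eq_sum_card_fiberwise (s := (boxTwo H N Z).filter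
      fun j => (boxTwoFreq j : ℤ) = (n : ℤ)) (t := n.divisors ×ˢ n.divisors)
      (f := fun q => (q.1.1, q.2.1)) (fun q hq => hmemdiv q (by
        exact_mod_cast (mem_filter.mp hq).2))
    rw [hc]
    push_cast
    refine (sum_le_sum hfib).trans ?_
    rw [sum_const, card_product, nsmul_eq_mul]
    push_cast
    calc (n.divisors.card : ℝ) * n.divisors.card * (6 * D ^ 3) ≤ D * D * (6 * D ^ 3) := by gcongr
      _ = _ := by ring
  · refine le_of_eq ?_
    rw [Nat.cast_eq_zero, card_eq_zero, filter_eq_empty_iff]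
    rintro ⟨⟨h, m⟩, w, z⟩ hq
    simp only [boxTwo, mem_filter, mem_product, mem_Icc] at hq
    obtain ⟨⟨⟨⟨hh1, hh2⟩, hm1, hm2⟩, ⟨hw1, hw2⟩, hz1, hz2⟩, hzw⟩ := hq
    have : boxTwoFreq ((h, m), w, z) ≠ 0 := by unfold boxTwoFreq; positivity
    exact_mod_cast this

lemma normSq_box_le (H N Z : ℕ) (α : ℝ) : ‖trig (box H N Z) boxFreq α‖ ^ 2 ≤ (H * N) * (H * N * Z +
      2 * ‖trig (boxTwo H N Z) (fun q => (boxTwoFreq q : ℤ)) α‖) := by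
  classical
  have h1 : trig (box H N Z) boxFreq α = ∑ p ∈ Icc 1 H ×ˢ Icc 1 N,
      trig (Icc 1 Z) (fun z => boxFreq (p.1, p.2, z)) α := by
    unfold trig box
    rw [sum_product, sum_product]
    refine sum_congr rfl fun h _ => ?_
    rw [sum_product]
  have h2 : ‖trig (box H N Z) boxFreq α‖ ^ 2 ≤ (H * N) * ∑ p ∈ Icc 1 H ×ˢ Icc 1 N,
      ‖trig (Icc 1 Z) (fun z => boxFreq (p.1, p.2, z)) α‖ ^ 2 := by
    rw [h1]
    have := sq_sum_le_card_mul_sum_sq (s := Icc 1 H ×ˢ Icc 1 N)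
      (f := fun p => ‖trig (Icc 1 Z) (fun z => boxFreq (p.1, p.2, z)) α‖)
    simp only [card_product, card_Icc, Nat.add_sub_cancel, cast_mul] at this
    refine le_trans ?_ this
    gcongr
    exact norm_sum_le _ _
  refine h2.trans ?_
  gcongr
  simp_rw [normSq_inner_box]
  rw [sum_add_distrib, ← mul_sum, sum_const, nsmul_eq_mul, ← re_sum]
  simp only [card_product, card_Icc, Nat.add_sub_cancel, cast_mul]
  have h3 : ∑ p ∈ Icc 1 H ×ˢ Icc 1 N, trig ((Icc 1 Z ×ˢ Icc 1 Z).filter fun p => p.2 + p.1 ≤ Z)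
        (fun q => (boxTwoFreq ((p.1, p.2), q) : ℤ)) α =
      trig (boxTwo H N Z) (fun q => (boxTwoFreq q : ℤ)) α := by
    simp only [trig, boxTwo, sum_filter]
    rw [sum_product (Icc 1 H ×ˢ Icc 1 N) (Icc 1 Z ×ˢ Icc 1 Z)]
  rw [h3]
  gcongr
  exact re_le_norm _

lemma avg_norm_pow_four_box_le (H N Z : ℕ) {D : ℝ} (hD0 : 1 ≤ D)
    (hD : ∀ n : ℕ, n ≠ 0 → n ≤ 28 * (H * Z * (Z ^ 2 + H ^ 2 * N ^ 8)) → (n.divisors.card : ℝ) ≤ D) :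
    avg (fun α => ‖trig (box H N Z) boxFreq α‖ ^ 4) ≤ 26 * D ^ 5 * ((H * N) ^ 3 * Z ^ 2) := by
  set F := trig (box H N Z) boxFreq
  set G := trig (boxTwo H N Z) (fun q => (boxTwoFreq q : ℤ))
  have hF : Continuous F := continuous_trig _ _
  have hG : Continuous G := continuous_trig _ _
  have hpt : ∀ α, ‖F α‖ ^ 4 ≤ 2 * (H * N) ^ 2 * Z * ‖F α‖ ^ 2 + 4 * (H * N) ^ 2 * ‖G α‖ ^ 2 := by
    intro α
    have h1 : ‖F α‖ ^ 2 ≤ _ := normSq_box_le H N Z α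
    have h2 : ‖F α‖ ^ 4 ≤ (H * N) * (H * N * Z + 2 * ‖G α‖) * ‖F α‖ ^ 2 := by
      calc ‖F α‖ ^ 4 = ‖F α‖ ^ 2 * ‖F α‖ ^ 2 := by ring
        _ ≤ _ := by gcongr
    nlinarith [sq_nonneg (‖F α‖ ^ 2 - 2 * (H * N) * ‖G α‖)]
  have h1 := avg_mono (by fun_prop) (by fun_prop) hpt
  rw [avg_add (by fun_prop) (by fun_prop), avg_const_mul, avg_const_mul] at h1
  have h2 := avg_normSq_box_le H N Z (D := D) fun n h0 hn => hD n h0 (by omega)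
  have h3 := avg_normSq_boxTwo_le H N Z (by linarith) hD
  have hDD : D ^ 2 ≤ D ^ 5 := pow_le_pow_right₀ hD0 (by norm_num)
  calc _ ≤ _ := h1
    _ ≤ 2 * (H * N) ^ 2 * Z * (D ^ 5 * (H * N * Z)) +
      4 * (H * N) ^ 2 * (6 * D ^ 5 * (H * N * Z ^ 2)) := by
        gcongr
        exact h2.trans (by gcongr)
    _ = _ := by ring

/-! ### The coprimality condition -/

lemma h_eq_zero {Y R : ℝ} (hY0 : 0 ≤ Y) (hY : Y < 1) (α : ℝ) : h Y R α = 0 := by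
  rw [h_eq_trig]
  have : smoothA Y R = ∅ := by
    refine Finset.eq_empty_of_forall_notMem fun n hn => ?_
    obtain ⟨h1, h2, -⟩ := (mem_smoothA hY0).mp hn
    have : (1:ℝ) ≤ n := mod_cast h1
    linarith
  simp [this, trig]

lemma norm_trig_smooth_dvd_le {Y R : ℝ} (hY : 0 ≤ Y) {d : ℕ} (hd : 0 < d) (α : ℝ) :
    ‖trig ((smoothA Y R).filter fun x => d ∣ x) (fun x => (x : ℤ) ^ 4) α‖ ≤
      ‖h (Y / d) R ((d ^ 4 : ℕ) * α)‖ := by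
  have hd' : (0:ℝ) < d := mod_cast hd
  by_cases hs : ∀ p ∈ d.primeFactors, (p : ℝ) ≤ R
  · refine le_of_eq (congrArg _ ?_)
    rw [h_eq_trig]
    unfold trig
    symm
    refine Finset.sum_bij (fun x _ => d * x) ?_ ?_ ?_ ?_
    · intro x hx
      obtain ⟨h1, h2, h3⟩ := (mem_smoothA (by positivity)).mp hx
      rw [mem_filter, mem_smoothA hY]
      refine ⟨⟨by positivity, ?_, smooth_mul hd.ne' h1.ne' hs h3⟩, dvd_mul_right _ _⟩
      rw [le_div_iff₀ hd'] at h2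
      push_cast; linarith
    · intro x _ y _ hxy
      exact eq_of_mul_eq_mul_left hd hxy
    · intro x hx
      rw [mem_filter, mem_smoothA hY] at hx
      obtain ⟨⟨h1, h2, h3⟩, y, rfl⟩ := hx
      refine ⟨y, ?_, rfl⟩
      rw [mem_smoothA (by positivity)]
      refine ⟨Nat.pos_of_mul_pos_left h1, ?_, smooth_of_dvd h1.ne' (dvd_mul_left _ _) h3⟩
      rw [le_div_iff₀ hd']
      push_cast at h2; linarith
    · intro x _
      congr 1
      push_cast; ring
  · have : (smoothA Y R).filter (fun x => d ∣ x) = ∅ := by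
      refine filter_eq_empty_iff.mpr fun x hx hdx => hs ?_
      obtain ⟨h1, h2, h3⟩ := (mem_smoothA hY).mp hx
      exact smooth_of_dvd h1.ne' hdx h3
    rw [this]
    simp [trig]

lemma norm_hCop_le {m : ℕ} (hm : 0 < m) {Y R : ℝ} (hY : 0 ≤ Y) (α : ℝ) :
    ‖hCop m Y R α‖ ≤ ∑ d ∈ m.divisors, ‖h (Y / d) R ((d ^ 4 : ℕ) * α)‖ := by
  have h1 : hCop m Y R α = ∑ d ∈ m.divisors, (ArithmeticFunction.moebius d : ℂ) *
      trig ((smoothA Y R).filter fun x => d ∣ x) (fun x => (x : ℤ) ^ 4) α := by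
    unfold hCop trig
    simp only [sum_filter, mul_sum]
    rw [sum_comm]
    refine sum_congr rfl fun x hx => ?_
    have hx0 : x ≠ 0 := ((mem_smoothA hY).mp hx).1.ne'
    have h2 : ∑ d ∈ (x.gcd m).divisors, ArithmeticFunction.moebius d =
        if x.gcd m = 1 then 1 else 0 := by
      rw [← ArithmeticFunction.coe_mul_zeta_apply, ArithmeticFunction.moebius_mul_coe_zeta,
        ArithmeticFunction.one_apply]
    have h3 : (x.gcd m).divisors = m.divisors.filter fun d => d ∣ x := by
      ext d
      simp only [mem_divisors, mem_filter, Nat.dvd_gcd_iff]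
      constructor
      · rintro ⟨⟨a, b⟩, -⟩; exact ⟨⟨b, hm.ne'⟩, a⟩
      · rintro ⟨⟨a, -⟩, b⟩; exact ⟨⟨b, a⟩, Nat.gcd_ne_zero_right hm.ne'⟩
    rw [h3, sum_filter] at h2
    have h4 := congrArg (fun z : ℤ => (z : ℂ) * e (α * ((x : ℤ) ^ 4 : ℤ))) h2
    simp only [Int.cast_sum, sum_mul] at h4
    rw [show (if x.Coprime m then e (α * ((x : ℤ) ^ 4 : ℤ)) else 0) =
      ((if x.gcd m = 1 then 1 else 0 : ℤ) : ℂ) * e (α * ((x : ℤ) ^ 4 : ℤ)) by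
        unfold Coprime; split_ifs <;> simp, ← h4]
    refine sum_congr rfl fun d _ => ?_
    split_ifs <;> simp
  rw [h1]
  refine (norm_sum_le _ _).trans (sum_le_sum fun d hd => ?_)
  rw [norm_mul]
  have h5 : ‖(ArithmeticFunction.moebius d : ℂ)‖ ≤ 1 := by
    rw [Complex.norm_intCast]
    exact_mod_cast ArithmeticFunction.abs_moebius_le_one
  have h6 := norm_trig_smooth_dvd_le (R := R) hY (Nat.pos_of_mem_divisors hd) α
  exact (mul_le_mul_of_nonneg_right h5 (norm_nonneg _)).trans (by rw [one_mul]; exact h6)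

lemma continuous_h_dilate (t : ℝ) (ht : 0 ≤ t) (Y R : ℝ) (n : ℕ) :
    Continuous fun α => ‖h Y R ((n : ℕ) * α)‖ ^ t :=
  (continuous_norm_h_rpow Y R ht).comp (continuous_const.mul continuous_id)

lemma periodic_norm_h_rpow (Y R t : ℝ) : Function.Periodic (fun α => ‖h Y R α‖ ^ t) 1 := by
  intro α; dsimp only; rw [periodic_h Y R α]

lemma continuous_hCop (m : ℕ) (Y R : ℝ) : Continuous (hCop m Y R) := continuous_trig _ _

lemma exists_slow_hCop {t l : ℝ} (ht : 1 ≤ t) (hl : 0 ≤ l) (H : Adm t l) :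
    ∃ f : ℝ → ℝ → ℝ, Slow f ∧ ∀ (X R Y R' : ℝ) (m : ℕ), 1 ≤ X → 2 ≤ R → 1 ≤ Y → Y ≤ X → 2 ≤ R' →
      R' ≤ R → 0 < m → (m : ℝ) ≤ X * R → avg (fun α => ‖hCop m Y R' α‖ ^ t) ≤ f X R * Y ^ l := by
  obtain ⟨g, hg, H⟩ := H
  obtain ⟨D, hD, hDb⟩ := exists_slow_card_divisors 1
  refine ⟨_, (hD.comp_mul.rpow (show 0 ≤ t by linarith)).mul hg,
    fun X R Y R' m hX hR hY hYX hR' hRR hm hmX => ?_⟩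
  have hg0 := hg.nonneg hX hR
  have hcard : (m.divisors.card : ℝ) ≤ D (X * R) R :=
    hDb _ _ (by nlinarith) hR m hm.ne' (by simpa using hmX)
  have hpt : ∀ α, ‖hCop m Y R' α‖ ^ t ≤ ∑ d ∈ m.divisors, (m.divisors.card : ℝ) ^ (t - 1) *
      ‖h (Y / d) R' ((d ^ 4 : ℕ) * α)‖ ^ t := by
    intro α
    have h1 := weighted_rpow_sum_le m.divisors ht (fun _ => 1)
      (fun d : ℕ => ‖h (Y / d) R' ((d ^ 4 : ℕ) * α)‖) (fun _ => zero_le_one)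
      (fun _ => norm_nonneg _)
    simp only [one_mul, sum_const, nsmul_eq_mul, mul_one] at h1
    rw [← mul_sum]
    exact (rpow_le_rpow (norm_nonneg _) (norm_hCop_le hm (by linarith) α)
      (by linarith)).trans h1
  refine (avg_mono ((continuous_hCop _ _ _).norm.rpow_const fun _ => Or.inr (by linarith))
    (continuous_finsetSum _ fun d _ => continuous_const.mul
      (continuous_h_dilate t (by linarith) _ _ _)) hpt).trans ?_
  rw [avg_sum _ _ fun d _ => continuous_const.mul (continuous_h_dilate t (by linarith) _ _ _)]
  have hterm : ∀ d ∈ m.divisors, avg (fun α => (m.divisors.card : ℝ) ^ (t - 1) *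
      ‖h (Y / d) R' ((d ^ 4 : ℕ) * α)‖ ^ t) ≤ (m.divisors.card : ℝ) ^ (t - 1) * (g X R * Y ^ l) := by
    intro d hd
    have hd0 := Nat.pos_of_mem_divisors hd
    have hd1 : (1:ℝ) ≤ d := mod_cast hd0
    rw [avg_const_mul]
    gcongr
    rw [avg_comp_mul (continuous_norm_h_rpow (Y / d) R' (by linarith : 0 ≤ t))
      (periodic_norm_h_rpow _ _ _) (by positivity)]
    rcases lt_or_ge (Y / d) 1 with h1 | h1
    · have : (fun α => ‖h (Y / d) R' α‖ ^ t) = fun _ => 0 := by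
        funext α
        rw [h_eq_zero (by positivity) h1, norm_zero, zero_rpow (by linarith)]
      rw [this, avg_const]; positivity
    · have h2 : Y / d ≤ Y := div_le_self (by linarith) hd1
      refine (H X R (Y / d) R' hX hR h1 (h2.trans hYX) hR' hRR).trans ?_
      gcongr
  refine (sum_le_sum hterm).trans ?_
  have hc1 : (0:ℝ) < m.divisors.card := by
    exact_mod_cast card_pos.mpr ⟨1, by simp [hm.ne']⟩
  rw [sum_const, nsmul_eq_mul, ← mul_assoc, ← mul_assoc]
  have : (m.divisors.card : ℝ) * (m.divisors.card : ℝ) ^ (t - 1) = (m.divisors.card : ℝ) ^ t := by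
    rw [← rpow_one_add' hc1.le (by linarith)]; congr 1; ring
  rw [this]
  gcongr

/-! ### Mean values of the pieces -/

lemma continuous_pairMain (M : ℕ) (Y R : ℝ) : Continuous (pairMain M Y R) :=
  continuous_finsetSum _ fun _ _ => (continuous_hCop _ _ _).norm.mul
    ((continuous_h _ _).comp (continuous_const.mul continuous_id)).norm

lemma continuous_pairSmall (M : ℕ) (Y R : ℝ) : Continuous (pairSmall M Y R) :=
  continuous_finsetSum _ fun _ _ => (continuous_hCop _ _ _).norm

lemma periodic_hCop (m : ℕ) (Y R : ℝ) : Function.Periodic (hCop m Y R) 1 := periodic_trig _ _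

lemma periodic_pairMain (M : ℕ) (Y R : ℝ) : Function.Periodic (pairMain M Y R) 1 := by
  intro α
  unfold pairMain
  refine sum_congr rfl fun m _ => ?_
  rw [periodic_hCop, mul_add, (periodic_h (Y / m) m.minFac).nat_mul (m ^ 4)]

lemma periodic_pairSmall (M : ℕ) (Y R : ℝ) : Function.Periodic (pairSmall M Y R) 1 := by
  intro α
  unfold pairSmall
  exact sum_congr rfl fun m _ => by rw [periodic_hCop]

lemma pairMain_nonneg (M : ℕ) (Y R α : ℝ) : 0 ≤ pairMain M Y R α :=
  sum_nonneg fun _ _ => by positivity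

lemma pairSmall_nonneg (M : ℕ) (Y R α : ℝ) : 0 ≤ pairSmall M Y R α :=
  sum_nonneg fun _ _ => by positivity

lemma add_rpow_le {a b s : ℝ} (ha : 0 ≤ a) (hb : 0 ≤ b) (hs : 1 ≤ s) :
    (a + b) ^ s ≤ 2 ^ (s - 1) * (a ^ s + b ^ s) := by
  have := weighted_rpow_sum_le (univ : Finset (Fin 2)) hs (fun _ => 1) ![a, b]
    (fun _ => zero_le_one) (fun i => by fin_cases i <;> simpa)
  simpa [Fin.sum_univ_two, one_add_one_eq_two] using this

lemma avg_norm_h_rpow_le_of_pieces {s Y R E : ℝ} (hs : 1 ≤ s) (hY : 1 ≤ Y) {M : ℕ} (hM : 1 ≤ M)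
    (hE : 0 ≤ E)
    (h1 : ∀ d : ℕ, 1 ≤ Y / d → d ≠ 0 → avg (fun α => pairMain M (Y / d) R α ^ s) ≤ E * (Y / d) ^ s)
    (h2 : ∀ d : ℕ, 1 ≤ Y / d → d ≠ 0 → avg (fun α => pairSmall M (Y / d) R α ^ s) ≤
      E * (Y / d) ^ s) :
    avg (fun α => ‖h Y R α‖ ^ (2 * s)) ≤ (2 * (1 + Real.log Y)) ^ s * E * Y ^ s := by
  set I := Icc 1 ⌊Y⌋₊ with hI
  have hlog : 0 ≤ Real.log Y := log_nonneg hY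
  have hs0 : 0 ≤ s := by linarith
  set T : ℕ → ℝ → ℝ := fun d α => pairMain M (Y / d) R α ^ s + pairSmall M (Y / d) R α ^ s with hT
  have hTc : ∀ d, Continuous (T d) := fun d =>
    ((continuous_pairMain _ _ _).rpow_const fun _ => Or.inr hs0).add
      ((continuous_pairSmall _ _ _).rpow_const fun _ => Or.inr hs0)
  have hTp : ∀ d, Function.Periodic (T d) 1 := by
    intro d α; simp only [hT]; rw [periodic_pairMain, periodic_pairSmall]
  have hTa : ∀ d ∈ I, avg (T d) ≤ 2 * (E * (Y / d) ^ s) := by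
    intro d hd
    rw [hI, mem_Icc, le_floor_iff (by linarith)] at hd
    have hd0 : (0:ℝ) < d := mod_cast hd.1
    have hYd : 1 ≤ Y / d := by rw [le_div_iff₀ hd0]; linarith [hd.2]
    simp only [hT]
    rw [avg_add ((continuous_pairMain _ _ _).rpow_const fun _ => Or.inr hs0)
      ((continuous_pairSmall _ _ _).rpow_const fun _ => Or.inr hs0)]
    linarith [h1 d hYd (by omega), h2 d hYd (by omega)]
  have hw : ∑ d ∈ I, 1 / (d : ℝ) ≤ 1 + Real.log Y := by
    refine (sum_Icc_one_div_le _).trans ?_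
    have : Real.log (⌊Y⌋₊ : ℝ) ≤ Real.log Y :=
      log_le_log (mod_cast Nat.floor_pos.mpr hY) (floor_le (by linarith))
    linarith
  set L := 1 + Real.log Y with hL
  have hpt : ∀ α, ‖h Y R α‖ ^ (2 * s) ≤ ∑ d ∈ I, L ^ (s - 1) *
      (1 / (d : ℝ) * ((d : ℝ) ^ s * 2 ^ (s - 1))) * T d ((d ^ 4 : ℕ) * α) := by
    intro α
    rw [rpow_mul (norm_nonneg _), rpow_two]
    set A : ℕ → ℝ := fun d =>
      pairMain M (Y / d) R ((d ^ 4 : ℕ) * α) + pairSmall M (Y / d) R ((d ^ 4 : ℕ) * α) with hA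
    have hA0 : ∀ d, 0 ≤ A d := fun d => add_nonneg (pairMain_nonneg _ _ _ _) (pairSmall_nonneg _ _ _ _)
    have e1 : ‖h Y R α‖ ^ 2 ≤ ∑ d ∈ I, 1 / (d : ℝ) * (d * A d) := by
      refine (normSq_h_le hY hM α).trans (le_of_eq (sum_congr rfl fun d hd => ?_))
      have : (d : ℝ) ≠ 0 := by
        rw [hI, mem_Icc] at hd; exact_mod_cast (by omega : d ≠ 0)
      field_simp
      simp [hA]
    refine (rpow_le_rpow (by positivity) e1 hs0).trans ?_
    refine (weighted_rpow_sum_le I hs (fun d : ℕ => 1 / (d : ℝ)) (fun d : ℕ => (d : ℝ) * A d)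
      (fun d => by positivity) (fun d => mul_nonneg (by positivity) (hA0 d))).trans ?_
    have hS0 : 0 ≤ ∑ d ∈ I, 1 / (d : ℝ) * ((d : ℝ) * A d) ^ s :=
      sum_nonneg fun d _ => by have := hA0 d; positivity
    calc _ ≤ L ^ (s - 1) * ∑ d ∈ I, 1 / (d : ℝ) * ((d : ℝ) * A d) ^ s := by
          have : 0 ≤ ∑ d ∈ I, 1 / (d : ℝ) := sum_nonneg fun d _ => by positivity
          gcongr
      _ ≤ _ := by
          rw [mul_sum]
          refine sum_le_sum fun d _ => ?_
          rw [mul_rpow (by positivity) (hA0 d)]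
          have := add_rpow_le (pairMain_nonneg M (Y / d) R ((d ^ 4 : ℕ) * α))
            (pairSmall_nonneg M (Y / d) R ((d ^ 4 : ℕ) * α)) hs
          have hc : 0 ≤ L ^ (s - 1) * (1 / (d : ℝ) * (d : ℝ) ^ s) := by positivity
          calc _ = L ^ (s - 1) * (1 / (d : ℝ) * (d : ℝ) ^ s) * A d ^ s := by ring
            _ ≤ L ^ (s - 1) * (1 / (d : ℝ) * (d : ℝ) ^ s) * (2 ^ (s - 1) * T d ((d ^ 4 : ℕ) * α)) :=
                mul_le_mul_of_nonneg_left this hc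
            _ = _ := by ring
  have hcomp : ∀ d : ℕ, Continuous fun α : ℝ => T d ((d ^ 4 : ℕ) * α) := fun d =>
    (hTc d).comp (continuous_const.mul continuous_id)
  refine (avg_mono (continuous_norm_h_rpow Y R (by linarith)) (continuous_finsetSum _ fun d _ =>
    continuous_const.mul (hcomp d)) hpt).trans ?_
  rw [avg_sum _ _ fun d _ => continuous_const.mul (hcomp d)]
  calc _ ≤ ∑ d ∈ I, L ^ (s - 1) * (2 ^ s * E * Y ^ s) * (1 / (d : ℝ)) := by
        refine sum_le_sum fun d hd => ?_
        have hd0 : (0:ℝ) < d := by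
          rw [hI, mem_Icc] at hd; exact_mod_cast hd.1
        refine (le_of_eq (avg_const_mul (L ^ (s - 1) * (1 / (d : ℝ) * ((d : ℝ) ^ s * 2 ^ (s - 1))))
          (fun α : ℝ => T d ((d ^ 4 : ℕ) * α)))).trans ?_
        rw [avg_comp_mul (hTc d) (hTp d) (by
          have : d ≠ 0 := mod_cast hd0.ne'
          positivity)]
        calc _ ≤ L ^ (s - 1) * (1 / (d : ℝ) * ((d : ℝ) ^ s * 2 ^ (s - 1))) *
              (2 * (E * (Y / d) ^ s)) := by
              have := hTa d hd
              gcongr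
          _ = _ := by
              rw [div_rpow (by linarith) hd0.le, rpow_sub_one two_ne_zero]
              have : (d:ℝ) ^ s ≠ 0 := (Real.rpow_pos_of_pos hd0 _).ne'
              field_simp
    _ = L ^ (s - 1) * (2 ^ s * E * Y ^ s) * ∑ d ∈ I, 1 / (d : ℝ) := by rw [mul_sum]
    _ ≤ L ^ (s - 1) * (2 ^ s * E * Y ^ s) * L := by gcongr
    _ = _ := by
        rw [mul_rpow (by norm_num) (by linarith), rpow_sub_one (by linarith)]
        have : L ≠ 0 := by linarith
        field_simp

lemma avg_rpow_half_le {f : ℝ → ℝ} (hf : Continuous f) (h0 : ∀ α, 0 ≤ f α) {s : ℝ} (hs : 0 ≤ s) :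
    avg (fun α => f α ^ s) ≤ avg (fun α => f α ^ (2 * s)) ^ (1 / 2 : ℝ) := by
  have := holder_two (f := fun α => f α ^ (2 * s)) (g := fun _ => 1)
    (hf.rpow_const fun _ => Or.inr (by linarith)) continuous_const
    (fun α => by have := h0 α; positivity) (fun _ => zero_le_one)
    (by norm_num : (0:ℝ) ≤ 1 / 2) (by norm_num : (0:ℝ) ≤ 1 / 2) (by norm_num)
  simp only [Real.one_rpow, mul_one, avg_const] at this
  refine le_trans (le_of_eq ?_) this
  congr 1
  funext α
  rw [← rpow_mul (h0 α)]
  congr 1; ring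

lemma avg_rpow_sum_le {ι : Type*} (I : Finset ι) (a : ι → ℝ → ℝ) (ha : ∀ i, Continuous (a i))
    (h0 : ∀ i α, 0 ≤ a i α) {s : ℝ} (hs : 1 ≤ s) :
    avg (fun α => (∑ i ∈ I, a i α) ^ s) ≤ (I.card : ℝ) ^ (s - 1) *
      ∑ i ∈ I, avg (fun α => a i α ^ s) := by
  have hc : ∀ i, Continuous fun α => a i α ^ s := fun i =>
    (ha i).rpow_const fun _ => Or.inr (by linarith)
  rw [← avg_sum _ _ fun i _ => hc i, ← avg_const_mul]
  refine avg_mono ((continuous_finsetSum _ fun i _ => ha i).rpow_const fun _ =>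
    Or.inr (by linarith)) (continuous_const.mul (continuous_finsetSum _ fun i _ => hc i))
    fun α => ?_
  have := weighted_rpow_sum_le I hs (fun _ => 1) (fun i => a i α) (fun _ => zero_le_one)
    (fun i => h0 i α)
  simpa using this

lemma card_mul_rpow_sub_one {n : ℕ} {s : ℝ} (hs : 1 ≤ s) :
    (n : ℝ) ^ (s - 1) * n = (n : ℝ) ^ s := by
  rw [mul_comm, ← rpow_one_add' (by positivity) (by linarith)]
  congr 1; ring

lemma avg_pairSmall_le {s Y R B : ℝ} (hs : 1 ≤ s) {M : ℕ}
    (hB : ∀ m ∈ Icc 1 (min M ⌊Y⌋₊), avg (fun α => ‖hCop m Y R α‖ ^ (2 * s)) ≤ B) :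
    avg (fun α => pairSmall M Y R α ^ s) ≤ ((min M ⌊Y⌋₊ : ℕ) : ℝ) ^ s * B ^ (1 / 2 : ℝ) := by
  unfold pairSmall
  refine (avg_rpow_sum_le _ _ (fun m => (continuous_hCop m Y R).norm)
    (fun _ _ => norm_nonneg _) hs).trans ?_
  calc _ ≤ ((Icc 1 (min M ⌊Y⌋₊)).card : ℝ) ^ (s - 1) *
        ∑ m ∈ Icc 1 (min M ⌊Y⌋₊), B ^ (1 / 2 : ℝ) := by
        gcongr with m hm
        refine (avg_rpow_half_le (continuous_hCop m Y R).norm (fun _ => norm_nonneg _)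
          (by linarith)).trans ?_
        have : 0 ≤ avg (fun α => ‖hCop m Y R α‖ ^ (2 * s)) := avg_nonneg fun _ => by positivity
        have := hB m hm
        gcongr
    _ = _ := by
        rw [sum_const, nsmul_eq_mul, ← mul_assoc, card_mul_rpow_sub_one hs, card_Icc]
        simp

lemma avg_pairMain_le {s Y R U : ℝ} (hs : 2 ≤ s) {M : ℕ}
    (hU : ∀ m ∈ moduli M R, avg (fun α => ‖hCop m Y R α‖ ^ (2 * s)) ≤ U) :
    avg (fun α => pairMain M Y R α ^ s) ≤ (((moduli M R).card : ℝ) ^ (2 * s - 3) * ∑ m ∈ moduli M R,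
        avg (fun α => ‖hCop m Y R α‖ ^ 2 * ‖h (Y / m) m.minFac ((m ^ 4 : ℕ) * α)‖ ^ (2 * s - 2)))
        ^ (s / (2 * s - 2)) * U ^ (1 - s / (2 * s - 2)) := by
  set ω := s / (2 * s - 2) with hω
  have hd : 0 < 2 * s - 2 := by linarith
  have hω0 : 0 < ω := div_pos (by linarith) hd
  have hω1 : ω ≤ 1 := by rw [hω, div_le_one hd]; linarith
  have hωu : ω * (2 * s - 2) = s := by rw [hω]; exact div_mul_cancel₀ _ hd.ne'
  rcases (moduli M R).eq_empty_or_nonempty with hem | ⟨m0, hm0⟩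
  · unfold pairMain
    rw [hem]
    simp only [Finset.sum_empty, Finset.card_empty, cast_zero, mul_zero]
    rw [zero_rpow hω0.ne', zero_rpow (by linarith), avg_const, zero_mul]
  have hU0 : 0 ≤ U := (avg_nonneg fun _ => by positivity).trans (hU m0 hm0)
  set F : ℕ → ℝ → ℝ := fun m α => ‖hCop m Y R α‖ with hF
  set G : ℕ → ℝ → ℝ := fun m α => ‖h (Y / m) m.minFac ((m ^ 4 : ℕ) * α)‖ with hG
  have hFc : ∀ m, Continuous (F m) := fun m => (continuous_hCop _ _ _).norm
  have hGc : ∀ m, Continuous (G m) := fun m =>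
    ((continuous_h _ _).comp (continuous_const.mul continuous_id)).norm
  have hF0 : ∀ m α, 0 ≤ F m α := fun _ _ => norm_nonneg _
  have hG0 : ∀ m α, 0 ≤ G m α := fun _ _ => norm_nonneg _
  have hVc : ∀ m, Continuous fun α => F m α ^ 2 * G m α ^ (2 * s - 2) := fun m =>
    ((hFc m).pow 2).mul ((hGc m).rpow_const fun _ => Or.inr hd.le)
  set V : ℕ → ℝ := fun m => avg fun α => F m α ^ 2 * G m α ^ (2 * s - 2) with hV
  have hV0 : ∀ m, 0 ≤ V m := fun m => avg_nonneg fun α => by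
    have := hF0 m α; have := hG0 m α; positivity
  have hterm : ∀ m ∈ moduli M R, avg (fun α => (F m α * G m α) ^ s) ≤ V m ^ ω * U ^ (1 - ω) := by
    intro m hm
    have h1 := holder_two (hVc m) ((hFc m).rpow_const fun _ => Or.inr (by linarith : 0 ≤ 2 * s))
      (fun α => by have := hF0 m α; have := hG0 m α; positivity)
      (fun α => by have := hF0 m α; positivity) hω0.le (by linarith : 0 ≤ 1 - ω) (by ring)
    have h2 : (fun α => (F m α ^ 2 * G m α ^ (2 * s - 2)) ^ ω * (F m α ^ (2 * s)) ^ (1 - ω)) =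
        fun α => (F m α * G m α) ^ s := by
      funext α
      have := hF0 m α
      have := hG0 m α
      rw [mul_rpow (by positivity) (by positivity), ← rpow_mul (hG0 m α),
        mul_comm (2 * s - 2), hωu, ← rpow_mul (hF0 m α), ← rpow_two,
        ← rpow_mul (hF0 m α), mul_rpow (hF0 m α) (hG0 m α), mul_right_comm,
        ← rpow_add_of_nonneg (hF0 m α) (by positivity)
          (mul_nonneg (by linarith) (by linarith))]
      congr 2
      linarith [hωu, show ω * (2 * s - 2) = 2 * ω * s - 2 * ω by ring]
    rw [h2] at h1
    have h3 := hU m hm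
    have h4 : 0 ≤ avg fun α => F m α ^ (2 * s) := avg_nonneg fun α => by
      have := hF0 m α; positivity
    have h5 : 0 ≤ 1 - ω := by linarith
    refine h1.trans ?_
    have := hV0 m
    gcongr
  have hsum : ∑ m ∈ moduli M R, V m ^ ω ≤
      ((moduli M R).card : ℝ) ^ (1 - ω) * (∑ m ∈ moduli M R, V m) ^ ω := by
    have h1 := weighted_rpow_sum_le (moduli M R) (one_le_one_div hω0 hω1) (fun _ => 1)
      (fun m => V m ^ ω) (fun _ => zero_le_one) (fun m => by have := hV0 m; positivity)
    simp only [one_mul, sum_const, nsmul_eq_mul, mul_one, ← rpow_mul (hV0 _),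
      mul_one_div_cancel hω0.ne', rpow_one] at h1
    have h0 : 0 ≤ ∑ m ∈ moduli M R, V m ^ ω :=
      sum_nonneg fun m _ => by have := hV0 m; positivity
    have h2 := rpow_le_rpow (by positivity) h1 hω0.le
    rw [← rpow_mul h0, one_div_mul_cancel hω0.ne', rpow_one,
      mul_rpow (by positivity) (sum_nonneg fun m _ => hV0 m),
      ← rpow_mul (by positivity)] at h2
    rwa [show (1 / ω - 1) * ω = 1 - ω by field_simp] at h2
  unfold pairMain
  refine (avg_rpow_sum_le (moduli M R) (fun m α => F m α * G m α)
    (fun m => (hFc m).mul (hGc m)) (fun m α => mul_nonneg (hF0 m α) (hG0 m α))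
    (by linarith)).trans ?_
  set n : ℝ := ((moduli M R).card : ℝ) with hn
  have hn0 : 0 < n := by
    rw [hn]; exact_mod_cast card_pos.mpr ⟨m0, hm0⟩
  have hVs : 0 ≤ ∑ m ∈ moduli M R, V m := sum_nonneg fun m _ => hV0 m
  calc _ ≤ n ^ (s - 1) * ∑ m ∈ moduli M R, V m ^ ω * U ^ (1 - ω) := by
        gcongr with m hm
        exact hterm m hm
    _ = n ^ (s - 1) * (∑ m ∈ moduli M R, V m ^ ω) * U ^ (1 - ω) := by
        rw [← sum_mul]; ring
    _ ≤ n ^ (s - 1) * (n ^ (1 - ω) * (∑ m ∈ moduli M R, V m) ^ ω) * U ^ (1 - ω) := by gcongr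
    _ = _ := by
        rw [mul_rpow (by positivity) hVs, ← rpow_mul hn0.le, ← mul_assoc, ← rpow_add hn0]
        congr 3
        linarith [hωu, show ω * (2 * s - 2) = (2 * s - 3) * ω + ω by ring]

/-! ### The efficient differencing bound -/

lemma card_moduli_le {M : ℕ} {R : ℝ} (hR : 0 ≤ R) : ((moduli M R).card : ℝ) ≤ M * R := by
  have h1 : (moduli M R).card ≤ ⌊M * R⌋₊ := by
    refine (card_filter_le _ _).trans ?_
    simp
  exact (cast_le.mpr h1).trans (floor_le (by positivity))

lemma le_of_mem_moduli {M : ℕ} {R : ℝ} (hR : 0 ≤ R) {m : ℕ} (hm : m ∈ moduli M R) :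
    0 < m ∧ (m : ℝ) ≤ M * R ∧ M < m := by
  unfold moduli at hm
  rw [mem_filter, mem_Icc, le_floor_iff (by positivity)] at hm
  exact ⟨hm.1.1, hm.1.2, hm.2.1⟩

lemma box_argument_le {X R y R' : ℝ} {M : ℕ} (hX : 1 ≤ X) (hR : 2 ≤ R) (hR' : 0 ≤ R') (hRR : R' ≤ R)
    (hM : 1 ≤ M) (hy0 : 0 ≤ y) (hy : y ≤ X) {n : ℕ}
    (hn : n ≤ 28 * (⌊y / M ^ 4⌋₊ * ⌊2 * y⌋₊ * (⌊2 * y⌋₊ ^ 2 + ⌊y / M ^ 4⌋₊ ^ 2 * ⌊M * R'⌋₊ ^ 8))) :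
    (n : ℝ) ≤ (300 : ℕ) * (X * R) ^ 300 := by
  have hM1 : (1:ℝ) ≤ M := mod_cast hM
  have hM0 : (0:ℝ) < M := by linarith
  set W := X * R with hW
  have hW2 : 2 ≤ W := by rw [hW]; nlinarith
  have hyW : y ≤ W := by rw [hW]; nlinarith
  have h1 : (⌊y / M ^ 4⌋₊ : ℝ) ≤ y / M ^ 4 := floor_le (by positivity)
  have h1' : y / M ^ 4 ≤ y := div_le_self hy0 (one_le_pow₀ hM1)
  have h2 : (⌊2 * y⌋₊ : ℝ) ≤ 2 * y := floor_le (by positivity)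
  have h3 : (⌊M * R'⌋₊ : ℝ) ≤ M * R := (floor_le (by positivity)).trans (by gcongr)
  have h4 : (⌊y / M ^ 4⌋₊ : ℝ) * (⌊M * R'⌋₊ : ℝ) ^ 4 ≤ W ^ 4 := by
    calc _ ≤ y / M ^ 4 * (M * R) ^ 4 := by gcongr
      _ = y * R ^ 4 := by field_simp
      _ ≤ X ^ 4 * R ^ 4 := by
          gcongr
          exact hy.trans (le_self_pow₀ hX (by norm_num))
      _ = W ^ 4 := by rw [hW]; ring
  have hn' : (n : ℝ) ≤ 28 * ((⌊y / M ^ 4⌋₊ : ℝ) * (⌊2 * y⌋₊ : ℝ) *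
      ((⌊2 * y⌋₊ : ℝ) ^ 2 + ((⌊y / M ^ 4⌋₊ : ℝ) * (⌊M * R'⌋₊ : ℝ) ^ 4) ^ 2)) := by
    refine (cast_le.mpr hn).trans (le_of_eq ?_)
    push_cast; ring
  calc (n : ℝ) ≤ 28 * (W * (2 * W) * ((2 * W) ^ 2 + (W ^ 4) ^ 2)) := by
        refine hn'.trans ?_
        gcongr <;> linarith
    _ ≤ 28 * (W * (2 * W) * (4 * W ^ 8 + W ^ 8)) := by
        have : W ^ 2 ≤ W ^ 8 := pow_le_pow_right₀ (by linarith) (by norm_num)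
        gcongr <;> nlinarith
    _ = 280 * W ^ 10 := by ring
    _ ≤ (300 : ℕ) * W ^ 300 := by
        have : W ^ 10 ≤ W ^ 300 := pow_le_pow_right₀ (by linarith) (by norm_num)
        push_cast
        have h0 : 0 ≤ W ^ 300 := by positivity
        linarith

lemma exists_slow_sum_avg_main {u c₁ c₂ l₁ l₂ : ℝ} (hu : 1 ≤ u) (hc₁ : 0 ≤ c₁) (hc₂ : 0 ≤ c₂)
    (hc : 2 * c₁ + 4 * c₂ = 1) (H₁ : Adm u l₁) (H₂ : Adm (u / (1 - c₁ - c₂)) l₂) :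
    ∃ f : ℝ → ℝ → ℝ, Slow f ∧ ∀ (X R y R' : ℝ) (M : ℕ), 1 ≤ X → 2 ≤ R → 2 ≤ R' → R' ≤ R →
      1 ≤ M → (M : ℝ) ≤ y → y ≤ X →
      ∑ m ∈ moduli M R', avg (fun α => ‖hCop m y R' α‖ ^ 2 *
        ‖h (y / m) m.minFac ((m ^ 4 : ℕ) * α)‖ ^ u) ≤
      f X R * (y ^ (1 + l₁) * (M : ℝ) ^ (1 - l₁) + y ^ (2 * c₁ + 5 * c₂ + (1 - c₁ - c₂) * l₂) *
        (M : ℝ) ^ (-(3 * c₁ + 9 * c₂ + (1 - c₁ - c₂) * l₂))) := by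
  set ct := 1 - c₁ - c₂ with hct
  have hct0 : 0 < ct := by rw [hct]; linarith
  have hct1 : ct ≤ 1 := by rw [hct]; linarith
  obtain ⟨g₁, hg₁, G₁⟩ := exists_slow_shiftSum hu le_rfl (by rwa [mul_one] : Adm (u * 1) l₁)
  obtain ⟨g₂, hg₂, G₂⟩ := exists_slow_shiftSum hu (one_le_one_div hct0 hct1)
    (by rwa [mul_one_div] : Adm (u * (1 / ct)) l₂)
  obtain ⟨D, hD, hDb⟩ := exists_slow_card_divisors 300
  have hE := hD.comp_mul
  set E : ℝ → ℝ → ℝ := fun X R => D (X * R) R with hEdef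
  have hK₁ : Slow fun X R => 2 * E X R ^ 2 * R :=
    ((Slow.const one_le_two).mul (hE.pow 2)).mul Slow.snd
  have hK₂ : Slow fun X R => 104 * E X R ^ 5 * R ^ 3 :=
    ((Slow.const (by norm_num : (1:ℝ) ≤ 104)).mul (hE.pow 5)).mul (Slow.snd.pow 3)
  refine ⟨_, ((Slow.const (by norm_num : (1:ℝ) ≤ 4)).mul (hE.pow 4)).mul
    ((Slow.snd.mul hg₁).add ((Slow.const one_le_two).mul
      (((hK₁.rpow hc₁).mul (hK₂.rpow hc₂)).mul (hg₂.rpow hct0.le)))),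
    fun X R y R' M hX hR hR' hRR hM hMy hyX => ?_⟩
  have hM1 : (1:ℝ) ≤ M := mod_cast hM
  have hM0 : (0:ℝ) < M := by linarith
  have hy0 : 0 < y := by linarith
  have hE1 := hE.1 X R hX hR
  have hg₁0 := hg₁.nonneg hX hR
  have hg₂0 := hg₂.nonneg hX hR
  have hyM : 1 ≤ y / M := by rwa [le_div_iff₀ hM0, one_mul]
  have hyMX : y / M ≤ X := (div_le_self hy0.le hM1).trans hyX
  have hXR : 1 ≤ X * R := by nlinarith
  have hdiv : ∀ n : ℕ, n ≠ 0 → (n : ℝ) ≤ (300 : ℕ) * (X * R) ^ 300 → (n.divisors.card : ℝ) ≤ E X R :=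
    fun n hn hn' => hDb _ _ hXR hR n hn hn'
  have hmod : ∀ m ∈ moduli M R', 4 * ((m ^ 4).divisors.card : ℝ) ^ 4 ≤ 4 * E X R ^ 4 := by
    intro m hm
    obtain ⟨h1, h2, -⟩ := le_of_mem_moduli (by linarith) hm
    have h3 : (m : ℝ) ≤ X * R := h2.trans (by gcongr; linarith)
    have := hdiv (m ^ 4) (by positivity) (by
      push_cast
      calc (m : ℝ) ^ 4 ≤ (X * R) ^ 4 := by gcongr
        _ ≤ (X * R) ^ 300 := pow_le_pow_right₀ hXR (by norm_num)
        _ ≤ _ := by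
          have : 0 ≤ (X * R) ^ 300 := by positivity
          linarith)
    gcongr
  refine (sum_avg_main_le hu hy0.le hM (by positivity) hmod).trans ?_
  rw [mul_assoc (4 * E X R ^ 4)]
  refine mul_le_mul_of_nonneg_left ?_ (by positivity)
  set G := shiftSum u (y / M) R' with hG
  have hGc : Continuous G := continuous_shiftSum (by linarith) _ _
  have hG0 : ∀ α, 0 ≤ G α := shiftSum_nonneg _ _ _
  have hA₁ : avg G ≤ g₁ X R * (y / M) ^ l₁ := by
    have := G₁ X R (y / M) R' hX hR hyM hyMX hR' hRR
    simpa only [rpow_one] using this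
  have hA₂ : avg (fun α => G α ^ (1 / ct)) ≤ g₂ X R * (y / M) ^ l₂ :=
    G₂ X R (y / M) R' hX hR hyM hyMX hR' hRR
  clear_value G
  set F := trig (diffSet M y R') diffFreq with hF
  have hFc : Continuous F := continuous_trig _ _
  have hH : (⌊y / M ^ 4⌋₊ : ℝ) ≤ y / M ^ 4 := floor_le (by positivity)
  have hZ : (⌊2 * y⌋₊ : ℝ) ≤ 2 * y := floor_le (by positivity)
  have hN : (⌊M * R'⌋₊ : ℝ) ≤ M * R := (floor_le (by positivity)).trans (by gcongr)
  have hS₂ : avg (fun α => ‖F α‖ ^ 2) ≤ (2 * E X R ^ 2 * R) * (y ^ (2:ℝ) * (M : ℝ) ^ (-3 : ℝ)) := by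
    refine (avg_norm_diff_pow_le hM hy0.le 1).trans ?_
    refine (avg_normSq_box_le _ _ _ (D := E X R) fun n hn hn' => hdiv n hn
      (box_argument_le hX hR (by linarith) hRR hM hy0.le hyX (hn'.trans (by omega)))).trans ?_
    calc _ ≤ E X R ^ 2 * (y / M ^ 4 * (M * R) * (2 * y)) := by gcongr
      _ = _ := by
        rw [rpow_neg hM0.le, show (3:ℝ) = (3:ℕ) by norm_num, rpow_natCast, rpow_two]
        field_simp
  have hS₄ : avg (fun α => ‖F α‖ ^ 4) ≤
      (104 * E X R ^ 5 * R ^ 3) * (y ^ (5:ℝ) * (M : ℝ) ^ (-9 : ℝ)) := by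
    refine (avg_norm_diff_pow_le hM hy0.le 2).trans ?_
    refine (avg_norm_pow_four_box_le _ _ _ (D := E X R) hE1 fun n hn hn' => hdiv n hn
      (box_argument_le hX hR (by linarith) hRR hM hy0.le hyX hn')).trans ?_
    calc _ ≤ 26 * E X R ^ 5 * ((y / M ^ 4 * (M * R)) ^ 3 * (2 * y) ^ 2) := by gcongr
      _ = _ := by
        rw [rpow_neg hM0.le, show (9:ℝ) = (9:ℕ) by norm_num, rpow_natCast,
          show (5:ℝ) = (5:ℕ) by norm_num, rpow_natCast]
        field_simp
        ring
  have hprod : avg (fun α => ‖F α‖ * G α) ≤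
      ((2 * E X R ^ 2 * R) ^ c₁ * (104 * E X R ^ 5 * R ^ 3) ^ c₂ * g₂ X R ^ ct) *
        (y ^ (2 * c₁ + 5 * c₂ + ct * l₂) * (M : ℝ) ^ (-(3 * c₁ + 9 * c₂ + ct * l₂))) := by
    have h1 := holder_three (f := fun α => ‖F α‖ ^ 2) (g := fun α => ‖F α‖ ^ 4)
      (k := fun α => G α ^ (1 / ct)) (hFc.norm.pow 2) (hFc.norm.pow 4)
      (hGc.rpow_const (p := 1 / ct) fun _ => Or.inr (by positivity))
      (fun α => by positivity) (fun α => by positivity) (fun α => by have := hG0 α; positivity)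
      hc₁ hc₂ hct0.le (by rw [hct]; ring)
    have h2 : (fun α => ((‖F α‖ ^ 2) ^ c₁ * (‖F α‖ ^ 4) ^ c₂ * (G α ^ (1 / ct)) ^ ct)) =
        fun α => ‖F α‖ * G α := by
      funext α
      rw [← rpow_mul (hG0 α), one_div_mul_cancel hct0.ne', rpow_one,
        ← rpow_natCast, ← rpow_natCast, ← rpow_mul (norm_nonneg _),
        ← rpow_mul (norm_nonneg _), ← rpow_add_of_nonneg (norm_nonneg _) (by positivity)
        (by positivity)]
      push_cast
      rw [hc, rpow_one]
    rw [h2] at h1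
    refine h1.trans ?_
    have n1 : 0 ≤ avg (fun α => ‖F α‖ ^ 2) := avg_nonneg fun _ => by positivity
    have n2 : 0 ≤ avg (fun α => ‖F α‖ ^ 4) := avg_nonneg fun _ => by positivity
    have n3 : 0 ≤ avg (fun α => G α ^ (1 / ct)) := avg_nonneg fun α => by
      have := hG0 α; positivity
    calc _ ≤ ((2 * E X R ^ 2 * R) * (y ^ (2:ℝ) * (M : ℝ) ^ (-3 : ℝ))) ^ c₁ *
          ((104 * E X R ^ 5 * R ^ 3) * (y ^ (5:ℝ) * (M : ℝ) ^ (-9 : ℝ))) ^ c₂ *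
          (g₂ X R * (y / M) ^ l₂) ^ ct := by gcongr
      _ = _ := by
        have k₁ : 0 ≤ 2 * E X R ^ 2 * R := by positivity
        have k₂ : 0 ≤ 104 * E X R ^ 5 * R ^ 3 := by positivity
        generalize 2 * E X R ^ 2 * R = K₁ at k₁ ⊢
        generalize 104 * E X R ^ 5 * R ^ 3 = K₂ at k₂ ⊢
        rw [div_eq_mul_inv, ← rpow_neg_one, mul_rpow k₁ (by positivity),
          mul_rpow k₂ (by positivity), mul_rpow hg₂0 (by positivity),
          mul_rpow hy0.le (by positivity)]
        rw [mul_rpow (x := y ^ (2:ℝ)) (by positivity) (by positivity),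
          mul_rpow (x := y ^ (5:ℝ)) (by positivity) (by positivity),
          mul_rpow (x := y ^ l₂) (by positivity) (by positivity)]
        simp only [← rpow_mul hy0.le, ← rpow_mul hM0.le]
        rw [show 2 * c₁ + 5 * c₂ + ct * l₂ = 2 * c₁ + 5 * c₂ + l₂ * ct by ring,
          show -(3 * c₁ + 9 * c₂ + ct * l₂) = -3 * c₁ + -9 * c₂ + -1 * l₂ * ct by ring,
          rpow_add hy0, rpow_add hy0, rpow_add hM0, rpow_add hM0]
        ring
  have hcard := card_moduli_le (M := M) (R := R') (by linarith)
  have hGn : 0 ≤ avg G := avg_nonneg hG0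
  have hdiag : ((moduli M R').card : ℝ) * y * avg G ≤
      R * g₁ X R * (y ^ (1 + l₁) * (M : ℝ) ^ (1 - l₁)) := by
    calc _ ≤ (M * R) * y * (g₁ X R * (y / M) ^ l₁) := by
          gcongr
          exact hcard.trans (by gcongr)
      _ = _ := by
          rw [rpow_add hy0, rpow_sub hM0, rpow_one, rpow_one, div_rpow hy0.le hM0.le]
          ring
  set A := y ^ (1 + l₁) * (M : ℝ) ^ (1 - l₁) with hA
  set B := y ^ (2 * c₁ + 5 * c₂ + ct * l₂) * (M : ℝ) ^ (-(3 * c₁ + 9 * c₂ + ct * l₂)) with hB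
  set Q := (2 * E X R ^ 2 * R) ^ c₁ * (104 * E X R ^ 5 * R ^ 3) ^ c₂ * g₂ X R ^ ct with hQ
  have hA0 : 0 ≤ A := by positivity
  have hB0 : 0 ≤ B := by positivity
  have hQ0 : 0 ≤ Q := by positivity
  have : 0 ≤ R * g₁ X R := by positivity
  nlinarith [mul_nonneg this hB0, mul_nonneg hQ0 hA0]

lemma rpow_le_two_rpow_abs_mul {M Z : ℝ} (hM : 0 < M) (h1 : M ≤ Z) (h2 : Z ≤ 2 * M) (a : ℝ) :
    M ^ a ≤ 2 ^ |a| * Z ^ a := by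
  have hZ : 0 < Z := by linarith
  rcases le_or_gt 0 a with ha | ha
  · have : (1:ℝ) ≤ 2 ^ |a| := one_le_rpow one_le_two (abs_nonneg a)
    have h3 : M ^ a ≤ Z ^ a := by gcongr
    have : 0 ≤ Z ^ a := by positivity
    nlinarith
  · rw [abs_of_neg ha]
    have h3 : M ^ a ≤ (Z / 2) ^ a := rpow_le_rpow_of_nonpos (by positivity) (by linarith) ha.le
    refine h3.trans (le_of_eq ?_)
    rw [div_rpow hZ.le (by norm_num), rpow_neg (by norm_num)]
    field_simp

lemma rpow_le_rpow_mul_rpow_sub {y Y a s : ℝ} (hy : 0 < y) (hyY : y ≤ Y) (h : s ≤ a) :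
    y ^ a ≤ y ^ s * Y ^ (a - s) := by
  calc y ^ a = y ^ s * y ^ (a - s) := by rw [← rpow_add hy]; congr 1; ring
    _ ≤ _ := by
      have : 0 ≤ a - s := by linarith
      gcongr

lemma pairMain_eq_zero {M : ℕ} {y R : ℝ} (hR : 0 ≤ R) (hy : 0 ≤ y) (hyM : y < M) (α : ℝ) :
    pairMain M y R α = 0 := by
  refine Finset.sum_eq_zero fun m hm => ?_
  obtain ⟨h1, -, h2⟩ := le_of_mem_moduli hR hm
  have h3 : (0:ℝ) < m := mod_cast h1
  have h4 : (M:ℝ) < m := mod_cast h2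
  rw [h_eq_zero (by positivity) (by rw [div_lt_one h3]; linarith), norm_zero, mul_zero]

lemma main_term_le {M : ℕ} {y Y θ a b s μ : ℝ} (hM : 1 ≤ M) (h1 : (M : ℝ) ≤ Y ^ θ)
    (h2 : Y ^ θ ≤ 2 * M) (hy : 0 < y) (hyY : y ≤ Y) (hY : 1 ≤ Y) (hs : s ≤ b)
    (hμ : b + θ * a ≤ μ) :
    y ^ b * (M : ℝ) ^ a ≤ 2 ^ |a| * (y ^ s * Y ^ (μ - s)) := by
  have hM0 : (0:ℝ) < M := mod_cast hM
  have hY0 : 0 < Y := by linarith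
  calc y ^ b * (M : ℝ) ^ a ≤ (y ^ s * Y ^ (b - s)) * (2 ^ |a| * (Y ^ θ) ^ a) := by
        gcongr
        · exact rpow_le_rpow_mul_rpow_sub hy hyY hs
        · exact rpow_le_two_rpow_abs_mul hM0 h1 h2 a
    _ = 2 ^ |a| * (y ^ s * Y ^ (b - s + θ * a)) := by
        rw [← rpow_mul hY0.le, rpow_add hY0]; ring
    _ ≤ _ := by
        gcongr
        linarith

lemma interp_rpow_eq {K f y Y : ℝ} (hK : 0 ≤ K) (hf : 0 ≤ f) (hy : 0 < y) (hY : 0 < Y)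
    (s a b ω : ℝ) :
    (K * (y ^ s * Y ^ a)) ^ ω * (f * (y ^ s * Y ^ b)) ^ (1 - ω) =
      K ^ ω * f ^ (1 - ω) * (y ^ s * Y ^ (a * ω + b * (1 - ω))) := by
  have h1 : y ^ s = y ^ (s * ω) * y ^ (s * (1 - ω)) := by
    rw [← rpow_add hy]; congr 1; ring
  rw [mul_rpow hK (by positivity), mul_rpow hf (by positivity),
    mul_rpow (by positivity) (by positivity), mul_rpow (by positivity) (by positivity),
    ← rpow_mul hy.le, ← rpow_mul hy.le, ← rpow_mul hY.le, ← rpow_mul hY.le,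
    h1, rpow_add hY]
  ring

/-- One step of efficient differencing, given a bound for the mean values of the differenced
sums. -/
lemma Adm.step_of {ι : Type*} [Fintype ι] {a b : ι → ℝ} {s l₀ θ μ l : ℝ} (hs2 : 2 ≤ s)
    (hθ0 : 0 ≤ θ) (hθ1 : θ ≤ 1) (H₀ : Adm (2 * s) l₀) (hl₀ : s ≤ l₀) (hl₀' : l₀ ≤ 2 * s)
    (HV : ∃ v : ℝ → ℝ → ℝ, Slow v ∧ ∀ (X R y R' : ℝ) (M : ℕ), 1 ≤ X → 2 ≤ R → 2 ≤ R' → R' ≤ R →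
      1 ≤ M → (M : ℝ) ≤ y → y ≤ X →
      ∑ m ∈ moduli M R', avg (fun α => ‖hCop m y R' α‖ ^ 2 *
        ‖h (y / m) m.minFac ((m ^ 4 : ℕ) * α)‖ ^ (2 * s - 2)) ≤
      v X R * ∑ i, y ^ b i * (M : ℝ) ^ a i)
    (hb : ∀ i, s ≤ b i) (hμ : ∀ i, b i + θ * (2 * s - 3 + a i) ≤ μ)
    (hl : s / (2 * s - 2) * μ + (1 - s / (2 * s - 2)) * l₀ ≤ l)
    (hl' : s + θ * l₀ / 2 ≤ l) : Adm (2 * s) l := by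
  obtain ⟨f, hf, Hf⟩ := exists_slow_hCop (by linarith) (by linarith) H₀
  obtain ⟨v, hv, Hv⟩ := HV
  set ω := s / (2 * s - 2) with hω
  have hd : 0 < 2 * s - 2 := by linarith
  have hω0 : 0 ≤ ω := div_nonneg (by linarith) hd.le
  have hω1 : 0 ≤ 1 - ω := by
    have : ω ≤ 1 := by rw [hω, div_le_one hd]; linarith
    linarith
  set κ : ℝ := 1 + ∑ i, 2 ^ |2 * s - 3 + a i| with hκ
  have hκ1 : 1 ≤ κ := le_add_of_nonneg_right (sum_nonneg fun _ _ => by positivity)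
  have hK : Slow fun X R => R ^ (2 * s - 3) * v X R * κ :=
    ((Slow.snd.rpow (by linarith)).mul hv).mul (Slow.const hκ1)
  have hF : Slow fun X R => (R ^ (2 * s - 3) * v X R * κ) ^ ω * f X R ^ (1 - ω) +
      f X R ^ (1 / 2 : ℝ) :=
    ((hK.rpow hω0).mul (hf.rpow hω1)).add (hf.rpow (by norm_num))
  refine ⟨_, (((Slow.const one_le_two).mul Slow.one_add_log).rpow
    (show 0 ≤ s by linarith)).mul hF, fun X R Y R' hX hR hY hYX hR' hRR => ?_⟩
  have hY0 : 0 < Y := by linarith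
  have hR0 : 0 < R := by linarith
  have hf0 := hf.nonneg hX hR
  have hv0 := hv.nonneg hX hR
  have hF0 := hF.nonneg hX hR
  have hXR : X ≤ X * R := le_mul_of_one_le_right (by linarith) (by linarith)
  set M := ⌊Y ^ θ⌋₊ with hM
  have hYθ : 1 ≤ Y ^ θ := one_le_rpow hY hθ0
  have hM1 : 1 ≤ M := le_floor (by simpa using hYθ)
  have hM1' : (1:ℝ) ≤ M := mod_cast hM1
  have hMY : (M : ℝ) ≤ Y ^ θ := floor_le (by linarith)
  have hMY' : Y ^ θ ≤ 2 * M := by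
    have := (Nat.lt_floor_add_one (Y ^ θ)).le
    rw [← hM] at this
    linarith
  have hMX : (M : ℝ) ≤ X := hMY.trans
    (((rpow_le_rpow_of_exponent_le hY hθ1).trans (le_of_eq (rpow_one _))).trans hYX)
  clear_value M
  set K := R ^ (2 * s - 3) * v X R * κ with hKdef
  have hK0 : 0 ≤ K := by positivity
  set F := K ^ ω * f X R ^ (1 - ω) + f X R ^ (1 / 2 : ℝ) with hFdef
  have hF1 : K ^ ω * f X R ^ (1 - ω) ≤ F := by
    have : 0 ≤ f X R ^ (1 / 2 : ℝ) := by positivity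
    linarith
  have hF2 : f X R ^ (1 / 2 : ℝ) ≤ F := by
    have : 0 ≤ K ^ ω * f X R ^ (1 - ω) := by positivity
    linarith
  have hmain : avg (fun α => ‖h Y R' α‖ ^ (2 * s)) ≤
      (2 * (1 + Real.log Y)) ^ s * (F * Y ^ (l - s)) * Y ^ s := by
    refine avg_norm_h_rpow_le_of_pieces (by linarith) hY hM1 (by positivity) ?_ ?_
    · intro d hd1 hd0
      have hdr : (1:ℝ) ≤ d := mod_cast one_le_iff_ne_zero.mpr hd0
      have hyY : Y / d ≤ Y := div_le_self hY0.le hdr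
      set y := Y / d with hy
      clear_value y
      have hy0 : 0 < y := by linarith
      rcases lt_or_ge y (M : ℝ) with hyM | hyM
      · have : (fun α => pairMain M y R' α ^ s) = fun _ => 0 := by
          funext α
          rw [pairMain_eq_zero (by linarith) hy0.le hyM, zero_rpow (by linarith)]
        rw [this, avg_const]
        positivity
      · refine (avg_pairMain_le hs2 (U := f X R * y ^ l₀) fun m hm => ?_).trans ?_
        · obtain ⟨h1, h2, -⟩ := le_of_mem_moduli (by linarith) hm
          exact Hf X R y R' m hX hR hd1 (hyY.trans hYX) hR' hRR h1 (h2.trans (by gcongr))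
        · have hV := Hv X R y R' M hX hR hR' hRR hM1 hyM (hyY.trans hYX)
          set V := ∑ m ∈ moduli M R', avg (fun α => ‖hCop m y R' α‖ ^ 2 *
            ‖h (y / m) m.minFac ((m ^ 4 : ℕ) * α)‖ ^ (2 * s - 2)) with hVdef
          have hV0 : 0 ≤ V := sum_nonneg fun m _ => avg_nonneg fun α => by positivity
          clear_value V
          have hcard : ((moduli M R').card : ℝ) ≤ M * R :=
            (card_moduli_le (by linarith)).trans (by gcongr)
          have hnV : ((moduli M R').card : ℝ) ^ (2 * s - 3) * V ≤ K * (y ^ s * Y ^ (μ - s)) := by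
            have h23 : 0 ≤ 2 * s - 3 := by linarith
            have hM0 : (0:ℝ) < M := by linarith
            calc _ ≤ (M * R) ^ (2 * s - 3) * (v X R * ∑ i, y ^ b i * (M : ℝ) ^ a i) :=
                  mul_le_mul (rpow_le_rpow (cast_nonneg _) hcard h23) hV hV0
                    (rpow_nonneg (mul_nonneg hM0.le hR0.le) _)
              _ = R ^ (2 * s - 3) * v X R * ∑ i, y ^ b i * (M : ℝ) ^ (2 * s - 3 + a i) := by
                  have e1 : ∀ i, y ^ b i * (M : ℝ) ^ (2 * s - 3 + a i) =
                      (M : ℝ) ^ (2 * s - 3) * (y ^ b i * (M : ℝ) ^ a i) := fun i => by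
                    rw [rpow_add hM0]; ring
                  simp_rw [e1]
                  rw [mul_rpow hM0.le hR0.le, ← mul_sum]
                  ring
              _ ≤ R ^ (2 * s - 3) * v X R * (κ * (y ^ s * Y ^ (μ - s))) := by
                  refine mul_le_mul_of_nonneg_left ?_ (by positivity)
                  rw [hκ, add_mul, one_mul, sum_mul]
                  exact (sum_le_sum fun i _ =>
                    main_term_le hM1 hMY hMY' hy0 hyY hY (hb i) (hμ i)).trans
                      (le_add_of_nonneg_left (by positivity))
              _ = _ := by rw [hKdef]; ring
          have hU : f X R * y ^ l₀ ≤ f X R * (y ^ s * Y ^ (l₀ - s)) := by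
            gcongr
            exact rpow_le_rpow_mul_rpow_sub hy0 hyY hl₀
          calc _ ≤ (K * (y ^ s * Y ^ (μ - s))) ^ ω * (f X R * (y ^ s * Y ^ (l₀ - s))) ^ (1 - ω) :=
                mul_le_mul (rpow_le_rpow (mul_nonneg (rpow_nonneg (cast_nonneg _) _) hV0) hnV hω0)
                  (rpow_le_rpow (by positivity) hU hω1) (by positivity) (by positivity)
            _ = K ^ ω * f X R ^ (1 - ω) * (y ^ s *
                Y ^ ((μ - s) * ω + (l₀ - s) * (1 - ω))) := interp_rpow_eq hK0 hf0 hy0 hY0 _ _ _ _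
            _ ≤ F * (y ^ s * Y ^ (l - s)) := by
                gcongr
                linarith
            _ = _ := by ring
    · intro d hd1 hd0
      have hdr : (1:ℝ) ≤ d := mod_cast one_le_iff_ne_zero.mpr hd0
      have hyY : Y / d ≤ Y := div_le_self hY0.le hdr
      set y := Y / d with hy
      clear_value y
      have hy0 : 0 < y := by linarith
      refine (avg_pairSmall_le (by linarith) (B := f X R * y ^ l₀) fun m hm => ?_).trans ?_
      · rw [mem_Icc, le_min_iff] at hm
        refine Hf X R y R' m hX hR hd1 (hyY.trans hYX) hR' hRR hm.1 ?_
        exact ((cast_le.mpr hm.2.1).trans hMX).trans hXR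
      · have hq1 : ((min M ⌊y⌋₊ : ℕ) : ℝ) ≤ M := cast_le.mpr (min_le_left _ _)
        have hq2 : ((min M ⌊y⌋₊ : ℕ) : ℝ) ≤ y :=
          (cast_le.mpr (min_le_right _ _)).trans (floor_le hy0.le)
        set q : ℝ := ((min M ⌊y⌋₊ : ℕ) : ℝ) with hq
        have hq0 : 0 ≤ q := cast_nonneg _
        clear_value q
        have hsl : 0 ≤ s - l₀ / 2 := by linarith
        have hl02 : 0 ≤ l₀ / 2 := by linarith
        calc q ^ s * (f X R * y ^ l₀) ^ (1 / 2 : ℝ)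
            = q ^ (l₀ / 2) * q ^ (s - l₀ / 2) * (f X R ^ (1 / 2 : ℝ) * y ^ (l₀ / 2)) := by
              rw [← rpow_add_of_nonneg hq0 hl02 hsl, mul_rpow hf0 (by positivity),
                ← rpow_mul hy0.le]
              congr 2
              · ring
              · rw [mul_one_div]
          _ ≤ (Y ^ θ) ^ (l₀ / 2) * y ^ (s - l₀ / 2) * (F * y ^ (l₀ / 2)) := by
              gcongr
              exact hq1.trans hMY
          _ = F * Y ^ (θ * (l₀ / 2)) * y ^ s := by
              rw [← rpow_mul hY0.le,
                show y ^ s = y ^ (s - l₀ / 2) * y ^ (l₀ / 2) by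
                  rw [← rpow_add hy0]; congr 1; ring]
              ring
          _ ≤ F * Y ^ (l - s) * y ^ s := by
              gcongr
              linarith
  refine hmain.trans ?_
  have hlog := log_nonneg hY
  calc _ = (2 * (1 + Real.log Y)) ^ s * F * (Y ^ (l - s) * Y ^ s) := by ring
    _ = (2 * (1 + Real.log Y)) ^ s * F * Y ^ l := by
        rw [← rpow_add hY0]; congr 2; ring
    _ ≤ _ := by
        gcongr

/-- One step of efficient differencing. -/
lemma Adm.step {t l₀ l₁ l₂ c₁ c₂ θ μ l : ℝ} (ht : 4 ≤ t) (hθ0 : 0 ≤ θ) (hθ1 : θ ≤ 1)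
    (hc₁ : 0 ≤ c₁) (hc₂ : 0 ≤ c₂) (hc : 2 * c₁ + 4 * c₂ = 1)
    (H₀ : Adm t l₀) (H₁ : Adm (t - 2) l₁) (H₂ : Adm ((t - 2) / (1 - c₁ - c₂)) l₂)
    (hl₀ : t / 2 ≤ l₀) (hl₀' : l₀ ≤ t) (hl₁ : t / 2 ≤ 1 + l₁)
    (hl₂ : t / 2 ≤ 2 * c₁ + 5 * c₂ + (1 - c₁ - c₂) * l₂)
    (hμ₁ : 1 + l₁ + θ * (t - 2 - l₁) ≤ μ)
    (hμ₂ : 2 * c₁ + 5 * c₂ + (1 - c₁ - c₂) * l₂ +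
      θ * (t - 3 - (3 * c₁ + 9 * c₂ + (1 - c₁ - c₂) * l₂)) ≤ μ)
    (hl : t / (2 * (t - 2)) * μ + (1 - t / (2 * (t - 2))) * l₀ ≤ l)
    (hl' : t / 2 + θ * l₀ / 2 ≤ l) : Adm t l := by
  obtain ⟨s, rfl⟩ : ∃ s, t = 2 * s := ⟨t / 2, by ring⟩
  rw [mul_div_cancel_left₀ s two_ne_zero] at *
  rw [mul_div_mul_left _ _ two_ne_zero] at hl
  obtain ⟨v, hv, Hv⟩ := exists_slow_sum_avg_main (by linarith) hc₁ hc₂ hc H₁ H₂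
  refine H₀.step_of (ι := Bool) (μ := μ)
    (a := fun i => bif i then 1 - l₁ else -(3 * c₁ + 9 * c₂ + (1 - c₁ - c₂) * l₂))
    (b := fun i => bif i then 1 + l₁ else 2 * c₁ + 5 * c₂ + (1 - c₁ - c₂) * l₂)
    (by linarith) hθ0 hθ1 hl₀ hl₀' ⟨v, hv, fun X R y R' M hX hR hR' hRR hM hMy hyX => ?_⟩
    ?_ ?_ hl hl'
  · rw [Fintype.sum_bool]
    exact Hv X R y R' M hX hR hR' hRR hM hMy hyX
  · rintro (_ | _) <;> assumption
  · rintro (_ | _)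
    · refine le_trans (le_of_eq ?_) hμ₂
      simp only [cond_false]; ring
    · refine le_trans (le_of_eq ?_) hμ₁
      simp only [cond_true]; ring

lemma Adm.lerp {a b x y ρ σ : ℝ} (hρ : 0 ≤ ρ) (hρ' : ρ ≤ 1) (ha : 0 ≤ a) (hb : 0 ≤ b)
    (Ha : Adm a (x + σ)) (Hb : Adm b (y + σ)) :
    Adm (ρ * a + (1 - ρ) * b) (ρ * x + (1 - ρ) * y + σ) := by
  have := Adm.interp ha hb hρ (sub_nonneg.mpr hρ') (by ring) Ha Hb
  exact this.mono (by linarith)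

lemma adm_half {t : ℝ} (h2 : 2 ≤ t) (h4 : t ≤ 4) : Adm t (t / 2) := by
  have := Adm.interp (ρ := (4 - t) / 2) (σ := (t - 2) / 2) (by norm_num) (by norm_num)
    (by linarith) (by linarith) (by ring) adm_two adm_four
  convert this using 1 <;> ring

lemma adm_sub_two {t : ℝ} (ht : 4 ≤ t) : Adm t (t - 2) := by
  obtain ⟨f, hf, H⟩ := adm_four
  refine ⟨f, hf, fun X R Y R' hX hR hY hYX hR' hRR => ?_⟩
  have hY0 : 0 < Y := by linarith
  calc avg (fun α => ‖h Y R' α‖ ^ t) ≤ avg (fun α => Y ^ (t - 4) * ‖h Y R' α‖ ^ (4 : ℝ)) := by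
        refine avg_mono (continuous_norm_h_rpow _ _ (by linarith))
          (continuous_const.mul (continuous_norm_h_rpow _ _ (by norm_num))) fun α => ?_
        have h1 : ‖h Y R' α‖ ^ t = ‖h Y R' α‖ ^ (t - 4) * ‖h Y R' α‖ ^ (4 : ℝ) := by
          rw [← rpow_add_of_nonneg (norm_nonneg _) (by linarith) (by norm_num)]
          congr 1; ring
        rw [h1]
        exact mul_le_mul_of_nonneg_right (rpow_le_rpow (norm_nonneg _)
          (norm_h_le _ _ _ hY0.le) (by linarith)) (by positivity)
    _ = Y ^ (t - 4) * avg (fun α => ‖h Y R' α‖ ^ (4 : ℝ)) := avg_const_mul _ _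
    _ ≤ Y ^ (t - 4) * (f X R * Y ^ (2 : ℝ)) :=
        mul_le_mul_of_nonneg_left (H X R Y R' hX hR hY hYX hR' hRR) (by positivity)
    _ = f X R * Y ^ (t - 2) := by
        rw [mul_left_comm, ← rpow_add hY0]; congr 2; ring

/-- `Adm.step` as a contraction of the distance `σ` to a fixed system of exponents. -/
lemma Adm.contract {t φ l₁ l₂ c₁ c₂ θ v σ : ℝ} (hσ : 0 ≤ σ) (hσt : φ + σ ≤ t) (ht : 4 ≤ t)
    (hθ0 : 0 ≤ θ) (hθ1 : θ ≤ 1) (hc₁ : 0 ≤ c₁) (hc₂ : 0 ≤ c₂) (hc : 2 * c₁ + 4 * c₂ = 1)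
    (hv : v * (1 - c₁ - c₂) = t - 2)
    (hφ : t / 2 ≤ φ) (hl₁ : t / 2 ≤ 1 + l₁)
    (hl₂ : t / 2 ≤ 2 * c₁ + 5 * c₂ + (1 - c₁ - c₂) * l₂)
    (hμ₁ : 1 + l₁ + θ * (t - 2 - l₁) ≤ φ)
    (hμ₂ : 2 * c₁ + 5 * c₂ + (1 - c₁ - c₂) * l₂ +
      θ * (t - 3 - (3 * c₁ + 9 * c₂ + (1 - c₁ - c₂) * l₂)) ≤ φ)
    (hρ : 1 / 1000 * (2 * (t - 2)) ≤ t * θ) (hl' : t / 2 + θ * φ / 2 ≤ φ)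
    (H₀ : Adm t (φ + σ)) (H₁ : Adm (t - 2) (l₁ + σ)) (H₂ : Adm v (l₂ + σ)) :
    Adm t (φ + 999 / 1000 * σ) := by
  have hct : 0 < 1 - c₁ - c₂ := by linarith
  have hct1 : 1 - c₁ - c₂ ≤ 1 := by linarith
  have hv' : v = (t - 2) / (1 - c₁ - c₂) := by rw [eq_div_iff hct.ne', hv]
  rw [hv'] at H₂
  have hθ' : 0 ≤ 1 - θ := by linarith
  have h1 : 0 ≤ (1 - θ) * σ := mul_nonneg hθ' hσ
  refine H₀.step (μ := φ + (1 - θ) * σ) ht hθ0 hθ1 hc₁ hc₂ hc H₁ H₂ (by linarith) hσt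
    (by linarith) ?_ ?_ ?_ ?_ ?_
  · nlinarith [mul_nonneg hct.le hσ]
  · nlinarith
  · nlinarith [mul_nonneg (sub_nonneg.mpr hct1) h1]
  · have h2 : 1 / 1000 ≤ t / (2 * (t - 2)) * θ := by
      rw [div_mul_eq_mul_div, le_div_iff₀ (by linarith)]
      exact hρ
    have h3 := mul_le_mul_of_nonneg_right h2 hσ
    linarith
  · nlinarith

/-- `Adm.contract` with the numerical conditions collected. -/
lemma Adm.contract_of_nums {t φ u l₁ l₂ v σ : ℝ} (hσ : 0 ≤ σ) (hσ' : σ ≤ 3 / 2) (c₁ c₂ θ : ℝ)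
    (hn : φ + 3 / 2 ≤ t ∧ 4 ≤ t ∧ u = t - 2 ∧ 0 ≤ θ ∧ θ ≤ 1 ∧ 0 ≤ c₁ ∧ 0 ≤ c₂ ∧
      2 * c₁ + 4 * c₂ = 1 ∧ v * (1 - c₁ - c₂) = t - 2 ∧ t / 2 ≤ φ ∧ t / 2 ≤ 1 + l₁ ∧
      t / 2 ≤ 2 * c₁ + 5 * c₂ + (1 - c₁ - c₂) * l₂ ∧ 1 + l₁ + θ * (t - 2 - l₁) ≤ φ ∧
      2 * c₁ + 5 * c₂ + (1 - c₁ - c₂) * l₂ +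
        θ * (t - 3 - (3 * c₁ + 9 * c₂ + (1 - c₁ - c₂) * l₂)) ≤ φ ∧
      1 / 1000 * (2 * (t - 2)) ≤ t * θ ∧ t / 2 + θ * φ / 2 ≤ φ)
    (H₀ : Adm t (φ + σ)) (H₁ : Adm u (l₁ + σ)) (H₂ : Adm v (l₂ + σ)) :
    Adm t (φ + 999 / 1000 * σ) := by
  obtain ⟨hφt, ht, rfl, hθ0, hθ1, hc₁, hc₂, hc, hv, hφ, hl₁, hl₂, hμ₁, hμ₂, hρ, hl'⟩ := hn
  exact H₀.contract hσ (by linarith) ht hθ0 hθ1 hc₁ hc₂ hc hv hφ hl₁ hl₂ hμ₁ hμ₂ hρ hl' H₁ H₂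

/-- Exponents for moments of order below eight, up to a common loss of `σ`. -/
structure AdmTable (σ : ℝ) : Prop where
  t17_4 : Adm (17/4) (42558939/20000000 + σ)
  t69_16 : Adm (69/16) (216104167/100000000 + σ)
  t139_32 : Adm (139/32) (54445141/25000000 + σ)
  t285_64 : Adm (285/64) (223730113/100000000 + σ)
  t9_2 : Adm (9/2) (226313127/100000000 + σ)
  t37_8 : Adm (37/8) (233330631/100000000 + σ)
  t149_32 : Adm (149/32) (29389573/12500000 + σ)
  t299_64 : Adm (299/64) (118007649/50000000 + σ)
  t75_16 : Adm (75/16) (47383643/20000000 + σ)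
  t157_32 : Adm (157/32) (249728633/100000000 + σ)
  t5 : Adm (5) (255308211/100000000 + σ)
  t21_4 : Adm (21/4) (27055383/10000000 + σ)
  t85_16 : Adm (85/16) (137226141/50000000 + σ)
  t171_32 : Adm (171/32) (138208931/50000000 + σ)
  t43_8 : Adm (43/8) (139197813/50000000 + σ)
  t93_16 : Adm (93/16) (306296511/100000000 + σ)
  t6 : Adm (6) (63668623/20000000 + σ)
  t25_4 : Adm (25/4) (167282943/50000000 + σ)
  t101_16 : Adm (101/16) (42333059/12500000 + σ)
  t203_32 : Adm (203/32) (85180331/25000000 + σ)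
  t413_64 : Adm (413/64) (347951199/100000000 + σ)
  t53_8 : Adm (53/8) (44924823/12500000 + σ)
  t213_32 : Adm (213/32) (361493277/100000000 + σ)
  t427_64 : Adm (427/64) (362542431/100000000 + σ)
  t107_16 : Adm (107/16) (72718577/20000000 + σ)
  t7 : Adm (7) (384940747/100000000 + σ)
  t8 : Adm (8) (229709701/50000000 + σ)

lemma AdmTable.contract {σ : ℝ} (hσ : 0 ≤ σ) (hσ' : σ ≤ 3 / 2) (H : AdmTable σ) :
    AdmTable (999 / 1000 * σ) := by
  have h2 (u : ℝ) (hu : 2 ≤ u ∧ u ≤ 4) : Adm u (u / 2 + σ) :=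
    (adm_half hu.1 hu.2).mono (le_add_of_nonneg_right hσ)
  constructor
  · exact .contract_of_nums hσ hσ' (1/2) 0 (4191/1600000) (by norm_num) H.t17_4
      (h2 (9/4) (by norm_num)) H.t9_2
  · exact .contract_of_nums hσ hσ' (1/2) 0 (2072009/500000000) (by norm_num) H.t69_16
      (h2 (37/16) (by norm_num)) H.t37_8
  · exact .contract_of_nums hσ hσ' (1/2) 0 (5060689/1000000000) (by norm_num) H.t139_32
      (h2 (75/32) (by norm_num)) H.t75_16
  · exact .contract_of_nums hσ hσ' (1/2) 0 (437747/50000000) (by norm_num) H.t285_64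
      (h2 (157/64) (by norm_num)) H.t157_32
  · exact .contract_of_nums hσ hσ' (1/2) 0 (5252449/500000000) (by norm_num) H.t9_2
      (h2 (5/2) (by norm_num)) H.t5
  · exact .contract_of_nums hσ hσ' (1/2) 0 (3963079/250000000) (by norm_num) H.t37_8
      (h2 (21/8) (by norm_num)) H.t21_4
  · exact .contract_of_nums hσ hσ' (1/2) 0 (271067/15625000) (by norm_num) H.t149_32
      (h2 (85/32) (by norm_num)) H.t85_16
  · exact .contract_of_nums hσ hσ' (1/2) 0 (18126103/1000000000) (by norm_num) H.t299_64
      (h2 (171/64) (by norm_num)) H.t171_32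
  · exact .contract_of_nums hσ hσ' (1/2) 0 (18926143/1000000000) (by norm_num) H.t75_16
      (h2 (43/16) (by norm_num)) H.t43_8
  · exact .contract_of_nums hσ hσ' (1/2) 0 (7597623/250000000) (by norm_num) H.t157_32
      (h2 (93/32) (by norm_num)) H.t93_16
  · exact .contract_of_nums hσ hσ' (1/2) 0 (17693989/500000000) (by norm_num) H.t5
      (h2 (3) (by norm_num)) H.t6
  · exact .contract_of_nums hσ hσ' (1/2) 0 (12390487/250000000) (by norm_num) H.t21_4
      (h2 (13/4) (by norm_num))
      (.lerp (ρ := 8/11) (by norm_num) (by norm_num) (by norm_num) (by norm_num) H.t413_64 H.t53_8)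
  · exact .contract_of_nums hσ hσ' (1/2) 0 (26648357/500000000) (by norm_num) H.t85_16
      (h2 (53/16) (by norm_num)) H.t53_8
  · exact .contract_of_nums hσ hσ' (1/2) 0 (55209557/1000000000) (by norm_num) H.t171_32
      (h2 (107/32) (by norm_num)) H.t107_16
  · exact .contract_of_nums hσ hσ' (105/214) (1/214) (28579591/500000000) (by norm_num) H.t43_8
      (h2 (27/8) (by norm_num)) H.t107_16
  · exact .contract_of_nums hσ hσ' (37/106) (4/53) (82211137/1000000000) (by norm_num) H.t93_16
      (h2 (61/16) (by norm_num)) H.t53_8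
  · exact .contract_of_nums hσ hσ' (215/826) (99/826) (22928879/250000000) (by norm_num) H.t6
      (h2 (4) (by norm_num)) H.t413_64
  · exact .contract_of_nums hσ hσ' (65/406) (69/406) (51297457/500000000) (by norm_num) H.t25_4
      H.t17_4 H.t203_32
  · exact .contract_of_nums hσ hσ' (27/202) (37/202) (104860497/1000000000) (by norm_num) H.t101_16
      H.t69_16 H.t101_16
  · exact .contract_of_nums hσ hσ' (25/202) (19/101) (105915713/1000000000) (by norm_num) H.t203_32
      H.t139_32 H.t101_16
  · exact .contract_of_nums hσ hσ' (9/101) (83/404) (109309593/1000000000) (by norm_num) H.t413_64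
      H.t285_64 H.t101_16
  · exact .contract_of_nums hσ hσ' (1/50) (6/25) (14218713/125000000) (by norm_num) H.t53_8 H.t37_8
      H.t25_4
  · exact .contract_of_nums hσ hσ' (1/100) (49/200) (57214153/500000000) (by norm_num) H.t213_32
      H.t149_32 H.t25_4
  · exact .contract_of_nums hσ hσ' (1/200) (99/400) (28687627/250000000) (by norm_num) H.t427_64
      H.t299_64 H.t25_4
  · exact .contract_of_nums hσ hσ' 0 (1/4) (115060431/1000000000) (by norm_num) H.t107_16 H.t75_16
      H.t25_4
  · exact .contract_of_nums hσ hσ' 0 (1/4) (2422029/20000000) (by norm_num) H.t7 H.t5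
      (.lerp (ρ := 1/3) (by norm_num) (by norm_num) (by norm_num) (by norm_num) H.t213_32 H.t427_64)
  · exact .contract_of_nums hσ hσ' 0 (1/4) (145838013/1000000000) (by norm_num) H.t8 H.t6 H.t8

lemma AdmTable.mono {σ σ' : ℝ} (h : σ ≤ σ') (H : AdmTable σ) : AdmTable σ' := by
  have m {t l : ℝ} (H : Adm t (l + σ)) : Adm t (l + σ') := H.mono (by linarith)
  exact ⟨m H.t17_4, m H.t69_16, m H.t139_32, m H.t285_64, m H.t9_2, m H.t37_8, m H.t149_32,
    m H.t299_64, m H.t75_16, m H.t157_32, m H.t5, m H.t21_4, m H.t85_16, m H.t171_32, m H.t43_8,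
    m H.t93_16, m H.t6, m H.t25_4, m H.t101_16, m H.t203_32, m H.t413_64, m H.t53_8, m H.t213_32,
    m H.t427_64, m H.t107_16, m H.t7, m H.t8⟩

lemma admTable_start : AdmTable (3 / 2) := by
  constructor <;> exact (adm_sub_two (by norm_num)).mono (by norm_num)

lemma admTable_pow (n : ℕ) : AdmTable ((999 / 1000) ^ n * (3 / 2)) := by
  induction n with
  | zero => simpa using admTable_start
  | succ n ih =>
    have h1 : ((999 / 1000 : ℝ)) ^ n ≤ 1 := pow_le_one₀ (by norm_num) (by norm_num)
    have h2 := ih.contract (by positivity) (by linarith)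
    rwa [← mul_assoc, ← pow_succ'] at h2

lemma admTable_of_pos {σ : ℝ} (hσ : 0 < σ) : AdmTable σ := by
  obtain ⟨n, hn⟩ := exists_pow_lt_of_lt_one (show 0 < σ * (2 / 3) by positivity)
    (show (999 / 1000 : ℝ) < 1 by norm_num)
  exact (admTable_pow n).mono (by linarith)

lemma adm_seven : Adm 7 (384940747/100000000) :=
  Adm.of_forall_add fun n => (admTable_of_pos (Nat.one_div_pos_of_nat (n := n))).t7

lemma adm_eight : Adm 8 (229709701/50000000) :=
  Adm.of_forall_add fun n => (admTable_of_pos (Nat.one_div_pos_of_nat (n := n))).t8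

/-- The distance to the nearest integer. -/
def distInt (x : ℝ) : ℝ := |x - round x|

lemma distInt_nonneg (x : ℝ) : 0 ≤ distInt x := abs_nonneg _

lemma distInt_le (x : ℝ) (z : ℤ) : distInt x ≤ |x - z| := round_le x z

lemma distInt_le_half (x : ℝ) : distInt x ≤ 1 / 2 := abs_sub_round x

lemma distInt_eq_of_abs_sub_le {x : ℝ} {z : ℤ} (h : |x - z| ≤ 1 / 2) : distInt x = |x - z| := by
  refine le_antisymm (distInt_le x z) ?_
  rcases eq_or_ne (round x) z with h1 | h1
  · rw [distInt, h1]
  · have h2 : (1:ℝ) ≤ |((round x : ℤ) : ℝ) - z| := by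
      have : (1:ℤ) ≤ |round x - z| := Int.one_le_abs (sub_ne_zero.mpr h1)
      exact_mod_cast this
    have h3 : |((round x : ℤ) : ℝ) - z| ≤ |x - z| + distInt x := by
      rw [distInt, show ((round x : ℤ) : ℝ) - z = (x - z) - (x - round x) by ring]
      exact abs_sub _ _
    linarith

/-- A version of `min Z (1 / u)` without singularity. -/
def minKer (Z u : ℝ) : ℝ := 2 * Z / (1 + Z * u)

lemma minKer_nonneg {Z u : ℝ} (hZ : 0 ≤ Z) (hu : 0 ≤ u) : 0 ≤ minKer Z u := by
  unfold minKer; positivity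

lemma minKer_le_two_mul {Z u : ℝ} (hZ : 0 ≤ Z) (hu : 0 ≤ u) : minKer Z u ≤ 2 * Z := by
  unfold minKer
  exact div_le_self (by positivity) (by nlinarith)

lemma minKer_le_two_div {Z u : ℝ} (hZ : 0 ≤ Z) (hu : 0 < u) : minKer Z u ≤ 2 / u := by
  unfold minKer
  rw [div_le_div_iff₀ (by positivity) hu]
  nlinarith

lemma minKer_anti {Z u v : ℝ} (hZ : 0 ≤ Z) (hu : 0 ≤ u) (h : u ≤ v) : minKer Z v ≤ minKer Z u := by
  unfold minKer
  gcongr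

lemma le_minKer {Z u x : ℝ} (hZ : 0 ≤ Z) (hu : 0 ≤ u) (h1 : x ≤ Z) (h2 : x * u ≤ 1) :
    x ≤ minKer Z u := by
  unfold minKer
  rw [le_div_iff₀ (by positivity)]
  nlinarith

lemma four_mul_distInt_le (α : ℝ) : 4 * distInt α ≤ ‖e α - 1‖ := by
  have h1 : e α = exp (I * ((2 * π * (α - round α) : ℝ) : ℂ)) := by
    have : e α = e (α - round α) := by
      conv_lhs => rw [show α = (α - round α) + ((round α : ℤ) : ℝ) by ring]
      rw [e_add_int]
    rw [this, e]
    congr 1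
    push_cast
    ring
  rw [h1, Complex.norm_exp_I_mul_ofReal_sub_one, norm_eq_abs, abs_mul, abs_two]
  have h2 : |2 * π * (α - round α) / 2| = π * distInt α := by
    rw [distInt, show 2 * π * (α - round α) / 2 = π * (α - round α) by ring, abs_mul,
      abs_of_pos pi_pos]
  have h3 := Real.mul_abs_le_abs_sin (x := 2 * π * (α - round α) / 2) (by
    rw [h2]; nlinarith [distInt_le_half α, pi_pos])
  rw [h2] at h3
  have h4 : 2 / π * (π * distInt α) = 2 * distInt α := by field_simp
  linarith

lemma norm_geom_sum_le_minKer (α : ℝ) (n : ℕ) {Z : ℝ} (hn : (n : ℝ) ≤ Z) :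
    ‖∑ z ∈ range n, e (α * z)‖ ≤ minKer Z (distInt α) := by
  have h0 : ∀ z : ℕ, e (α * z) = e α ^ z := by
    intro z
    induction z with
    | zero => simp [e_zero]
    | succ z ih => rw [pow_succ, ← ih, ← e_add]; congr 1; push_cast; ring
  refine le_minKer ((cast_nonneg n).trans hn) (distInt_nonneg _) ?_ ?_
  · refine (norm_sum_le _ _).trans ?_
    simpa [norm_e] using hn
  · have h1 := geom_sum_mul (e α) n
    simp only [h0]
    have h2 : ‖∑ z ∈ range n, e α ^ z‖ * ‖e α - 1‖ ≤ 2 := by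
      rw [← norm_mul, h1]
      refine (norm_sub_le _ _).trans ?_
      rw [norm_pow, norm_e, norm_one]; norm_num
    have h3 := mul_le_mul_of_nonneg_left (four_mul_distInt_le α)
      (norm_nonneg (∑ z ∈ range n, e α ^ z))
    linarith

/-- A rational approximation to `α` for which the multiples `kα` with `k ≤ K` behave like the
multiples of a fraction. -/
structure Approx (K : ℕ) (α : ℝ) (q : ℕ) (a : ℤ) : Prop where
  pos : 0 < q
  le : q ≤ 2 * K
  coprime : IsCoprime a q
  abs_le : |q * α - a| * (2 * K + 1) ≤ 1

lemma exists_approx {K : ℕ} (hK : 0 < K) (α : ℝ) : ∃ q a, Approx K α q a := by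
  obtain ⟨r, h1, h2⟩ := Real.exists_rat_abs_sub_le_and_den_le α (n := 2 * K) (by omega)
  have hd : (0:ℝ) < r.den := mod_cast r.den_pos
  refine ⟨r.den, r.num, r.den_pos, h2, ?_, ?_⟩
  · rw [Int.isCoprime_iff_gcd_eq_one]; exact r.reduced
  · have h3 : (r.den : ℝ) * α - r.num = r.den * (α - r) := by
      rw [mul_sub]; congr 1
      exact_mod_cast (Rat.den_mul_eq_num r).symm
    rw [h3, abs_mul, abs_of_pos hd]
    rw [le_div_iff₀ (by positivity)] at h1
    push_cast at h1
    linarith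

namespace Approx

variable {K : ℕ} {α : ℝ} {q : ℕ} {a : ℤ}

lemma distInt_mul (H : Approx K α q a) {j : ℕ} (hj : q * j ≤ K) :
    distInt ((q * j : ℕ) * α) = j * |q * α - a| := by
  have h0 : |((q * j : ℕ) : ℝ) * α - ((j * a : ℤ) : ℝ)| = j * |q * α - a| := by
    push_cast
    rw [show (q:ℝ) * j * α - j * a = j * (q * α - a) by ring, abs_mul, abs_cast]
  rw [distInt_eq_of_abs_sub_le (z := j * a), h0]
  rw [h0]
  have h1 := H.abs_le
  have h2 : (j:ℝ) ≤ K := by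
    have := H.pos
    exact_mod_cast le_trans (by nlinarith) hj
  have h3 := abs_nonneg ((q:ℝ) * α - a)
  nlinarith

lemma inv_distInt_le (H : Approx K α q a) {k : ℕ} (hk : k ≤ K) (hqk : ¬ q ∣ k) :
    0 < distInt (k * α) ∧
    1 / distInt (k * α) ≤ 2 * q * (1 / (((k : ℤ) * a % q : ℤ) : ℝ) +
      1 / ((q : ℝ) - ((k : ℤ) * a % q : ℤ))) := by
  have hq : (0:ℝ) < q := mod_cast H.pos
  have hqz : (0:ℤ) < q := mod_cast H.pos
  set r : ℤ := (k : ℤ) * a % q with hr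
  have hr0 : 0 ≤ r := emod_nonneg _ hqz.ne'
  have hrq : r < q := emod_lt_of_pos _ hqz
  have hr1 : 1 ≤ r := by
    rcases hr0.eq_or_lt with h | h
    · exfalso
      have h1 : (q : ℤ) ∣ k * a := Int.dvd_of_emod_eq_zero h.symm
      have h2 : (q : ℤ) ∣ k := H.coprime.symm.dvd_of_dvd_mul_right h1
      exact hqk (mod_cast h2)
    · exact h
  have hr1' : (1:ℝ) ≤ r := mod_cast hr1
  have hrq' : (r:ℝ) + 1 ≤ q := mod_cast hrq
  set z := round ((k:ℝ) * α) with hz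
  have hkey : distInt (k * α) * (2 * q) ≥ min (r:ℝ) (q - r) := by
    have h1 : (k:ℝ) * (q * α - a) = q * (k * α - z) - ((k * a - q * z : ℤ) : ℝ) := by
      push_cast; ring
    have h2 : |((k * a - q * z : ℤ) : ℝ)| ≤ q * distInt (k * α) + 1 / 2 := by
      have h3 : ((k * a - q * z : ℤ) : ℝ) = q * (k * α - z) - k * (q * α - a) := by
        rw [h1]; ring
      rw [h3]
      refine (abs_sub _ _).trans (add_le_add ?_ ?_)
      · rw [abs_mul, abs_of_pos hq]; rfl
      · rw [abs_mul, abs_cast]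
        have h4 := H.abs_le
        have h5 : (k:ℝ) ≤ K := mod_cast hk
        have h6 := abs_nonneg ((q:ℝ) * α - a)
        nlinarith
    have h3 : min (r:ℝ) (q - r) ≤ |((k * a - q * z : ℤ) : ℝ)| := by
      have h4 : (k:ℤ) * a - q * z = r + q * ((k * a) / q - z) := by
        have := Int.emod_add_mul_ediv ((k:ℤ) * a) q
        rw [← hr] at this
        linarith
      rw [h4]
      set w := (k:ℤ) * a / q - z
      rcases le_or_gt 0 w with hw | hw
      · refine (min_le_left _ _).trans (le_trans ?_ (le_abs_self _))
        push_cast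
        have : (0:ℝ) ≤ w := mod_cast hw
        nlinarith
      · refine (min_le_right _ _).trans (le_trans ?_ (neg_le_abs _))
        push_cast
        have : (w:ℝ) + 1 ≤ 0 := mod_cast hw
        nlinarith
    have h5 : 1 ≤ min (r:ℝ) (q - r) := le_min hr1' (by linarith)
    linarith
  have h5 : 1 ≤ min (r:ℝ) (q - r) := le_min hr1' (by linarith)
  have hpos : 0 < distInt (k * α) := by
    by_contra hcon
    nlinarith
  refine ⟨hpos, ?_⟩
  have h6 : 1 / min (r:ℝ) (q - r) ≤ 1 / (r:ℝ) + 1 / ((q:ℝ) - r) := by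
    have h7 : (0:ℝ) < r := by linarith
    have h8 : (0:ℝ) < q - r := by linarith
    rcases min_cases (r:ℝ) (q - r) with h | h
    · rw [h.1]; linarith [one_div_pos.mpr h8]
    · rw [h.1]; linarith [one_div_pos.mpr h7]
  calc 1 / distInt (k * α) ≤ 2 * q * (1 / min (r:ℝ) (q - r)) := by
        rw [mul_one_div, div_le_div_iff₀ hpos (by linarith)]
        linarith
    _ ≤ _ := by gcongr

lemma sum_inv_le (H : Approx K α q a) :
    ∑ k ∈ (Icc 1 K).filter (fun k => ¬ q ∣ k), 1 / distInt (k * α) ≤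
      12 * K * (1 + Real.log (2 * K)) := by
  classical
  have hq := H.pos
  have hqz : (0:ℤ) < q := mod_cast H.pos
  set g : ℕ → ℝ := fun r => 2 * q * (1 / (r : ℝ) + 1 / ((q : ℝ) - r)) with hg
  set ι : ℕ → ℕ × ℕ := fun k => (((k : ℤ) * a % q).toNat, k / q) with hι
  have hcast : ∀ k : ℕ, ((((k : ℤ) * a % q).toNat : ℕ) : ℤ) = (k : ℤ) * a % q :=
    fun k => Int.toNat_of_nonneg (emod_nonneg _ hqz.ne')
  have hmem : ∀ k ∈ (Icc 1 K).filter (fun k => ¬ q ∣ k),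
      ι k ∈ Icc 1 (q - 1) ×ˢ range (K / q + 1) := by
    intro k hk
    rw [mem_filter, mem_Icc] at hk
    have h1 := emod_nonneg ((k:ℤ) * a) hqz.ne'
    have h2 := emod_lt_of_pos ((k:ℤ) * a) hqz
    have h3 : (k:ℤ) * a % q ≠ 0 := by
      intro h
      have h2 : (q : ℤ) ∣ k := H.coprime.symm.dvd_of_dvd_mul_right (Int.dvd_of_emod_eq_zero h)
      exact hk.2 (mod_cast h2)
    rw [mem_product, mem_Icc, mem_range]
    have h4 := hcast k
    refine ⟨⟨?_, ?_⟩, ?_⟩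
    · simp only [hι]; omega
    · simp only [hι]; omega
    · exact Nat.lt_succ_of_le (Nat.div_le_div_right hk.1.2)
  have hinj : Set.InjOn ι ((Icc 1 K).filter (fun k => ¬ q ∣ k) : Finset ℕ) := by
    intro k _ l _ hkl
    simp only [hι, Prod.mk.injEq] at hkl
    have h1 : (k:ℤ) * a % q = (l:ℤ) * a % q := by rw [← hcast k, ← hcast l, hkl.1]
    have h2 : (q:ℤ) ∣ ((l:ℤ) - k) * a := by
      rw [sub_mul]; exact Int.ModEq.dvd h1
    have h3 : (q:ℤ) ∣ (l:ℤ) - k := H.coprime.symm.dvd_of_dvd_mul_right h2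
    have h4 : k % q = l % q := (Nat.modEq_iff_dvd (n := q)).mpr h3
    rw [← div_add_mod k q, ← div_add_mod l q, hkl.2, h4]
  have hg0 : ∀ p ∈ Icc 1 (q - 1) ×ˢ range (K / q + 1), 0 ≤ g p.1 := by
    intro p hp
    rw [mem_product, mem_Icc] at hp
    have : ((p.1 + 1 : ℕ) : ℝ) ≤ q := cast_le.mpr (by omega)
    push_cast at this
    have : 0 ≤ 1 / ((q:ℝ) - p.1) := by apply one_div_nonneg.mpr; linarith
    simp only [hg]; positivity
  have hlog : ∑ r ∈ Icc 1 (q - 1), 1 / (r : ℝ) ≤ 1 + Real.log (2 * K) := by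
    have h1 := sum_Icc_one_div_le (2 * K)
    push_cast at h1
    refine le_trans (sum_le_sum_of_subset_of_nonneg ?_ fun i _ _ => by positivity) h1
    refine Finset.Icc_subset_Icc_right ?_
    have := H.le
    omega
  have hrefl : ∑ r ∈ Icc 1 (q - 1), 1 / ((q : ℝ) - r) =
      ∑ r ∈ Icc 1 (q - 1), 1 / (r : ℝ) := by
    refine sum_nbij' (fun r => q - r) (fun r => q - r) ?_ ?_ ?_ ?_ ?_
    · intro r hr; rw [mem_Icc] at hr ⊢; omega
    · intro r hr; rw [mem_Icc] at hr ⊢; omega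
    · intro r hr; rw [mem_Icc] at hr; omega
    · intro r hr; rw [mem_Icc] at hr; omega
    · intro r hr
      rw [mem_Icc] at hr
      rw [cast_sub (by omega)]
  calc _ ≤ ∑ k ∈ (Icc 1 K).filter (fun k => ¬ q ∣ k), g (ι k).1 := by
        refine sum_le_sum fun k hk => ?_
        rw [mem_filter, mem_Icc] at hk
        have h1 := (H.inv_distInt_le hk.1.2 hk.2).2
        have h2 : (((ι k).1 : ℕ) : ℝ) = (((k : ℤ) * a % q : ℤ) : ℝ) := by
          rw [← hcast k]; rfl
        simp only [hg]
        rw [h2]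
        exact h1
    _ = ∑ p ∈ ((Icc 1 K).filter (fun k => ¬ q ∣ k)).image ι, g p.1 :=
        (sum_image (f := fun p : ℕ × ℕ => g p.1) hinj).symm
    _ ≤ ∑ p ∈ Icc 1 (q - 1) ×ˢ range (K / q + 1), g p.1 := by
        refine sum_le_sum_of_subset_of_nonneg (Finset.image_subset_iff.mpr hmem)
          fun p hp _ => hg0 p hp
    _ = ((K / q : ℕ) + 1) * (4 * q * ∑ r ∈ Icc 1 (q - 1), 1 / (r : ℝ)) := by
        rw [Finset.sum_product_right]
        dsimp only
        rw [sum_const, card_range, nsmul_eq_mul]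
        simp only [hg]
        rw [← mul_sum, sum_add_distrib, hrefl]
        push_cast; ring
    _ ≤ ((K / q : ℕ) + 1) * (4 * q * (1 + Real.log (2 * K))) := by gcongr
    _ = 4 * ((((K / q * q : ℕ)) : ℝ) + q) * (1 + Real.log (2 * K)) := by push_cast; ring
    _ ≤ 4 * (K + 2 * K) * (1 + Real.log (2 * K)) := by
        have h1 : ((K / q * q : ℕ) : ℝ) ≤ K := mod_cast Nat.div_mul_le_self K q
        have h2 : (q:ℝ) ≤ 2 * K := mod_cast H.le
        have h3 : 0 ≤ Real.log (2 * K) := by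
          refine log_nonneg ?_
          exact_mod_cast hq.trans_le H.le
        have h4 : (0:ℝ) ≤ K := by positivity
        nlinarith
    _ = _ := by ring

end Approx

/-! ### A majorant for the major arcs -/

/-- A nonnegative trigonometric polynomial that is at least `1` near fractions with denominator
at most `X`. -/
def arcKer (X L : ℕ) (α : ℝ) : ℝ :=
  4 / L ^ 2 * ∑ q ∈ Icc 1 X, ‖trig (range L) (fun n => (n : ℤ) * q) α‖ ^ 2

@[fun_prop]
lemma continuous_arcKer (X L : ℕ) : Continuous (arcKer X L) := by
  unfold arcKer; fun_prop

lemma arcKer_nonneg (X L : ℕ) (α : ℝ) : 0 ≤ arcKer X L α := by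
  unfold arcKer; positivity

lemma norm_e_sub_one_le (x : ℝ) : ‖e x - 1‖ ≤ 7 * |x| := by
  have h1 : e x = exp (I * ((2 * π * x : ℝ) : ℂ)) := by
    rw [e]; congr 1; push_cast; ring
  rw [h1]
  refine (Real.norm_exp_I_mul_ofReal_sub_one_le (x := 2 * π * x)).trans ?_
  rw [norm_eq_abs, abs_mul, abs_of_pos (by positivity : 0 < 2 * π)]
  have := Real.pi_lt_d2
  gcongr
  linarith

lemma half_le_norm_geom_sum {L : ℕ} {x : ℝ} (hx : L * distInt x ≤ 1 / 14) :
    (L : ℝ) / 2 ≤ ‖∑ n ∈ range L, e (x * n)‖ := by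
  have h1 : ∀ n ∈ range L, ‖e (x * n) - 1‖ ≤ 1 / 2 := by
    intro n hn
    have hnL : (n : ℝ) ≤ L := mod_cast (mem_range.mp hn).le
    have h2 : e (x * n) = e ((x - round x) * n) := by
      have : x * n = (x - round x) * n + ((round x * n : ℤ) : ℝ) := by push_cast; ring
      rw [this, e_add_int]
    rw [h2]
    refine (norm_e_sub_one_le _).trans ?_
    rw [abs_mul, abs_cast]
    have h3 : distInt x * n ≤ L * distInt x := by
      rw [mul_comm]; exact mul_le_mul_of_nonneg_right hnL (distInt_nonneg x)
    unfold distInt at h3 hx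
    linarith
  have h2 : ‖∑ n ∈ range L, (e (x * n) - 1)‖ ≤ L * (1 / 2) := by
    refine (norm_sum_le_of_le _ h1).trans ?_
    simp
  rw [Finset.sum_sub_distrib] at h2
  simp only [sum_const, card_range, nsmul_eq_mul, mul_one] at h2
  have h3 := norm_sub_norm_le (L : ℂ) (∑ n ∈ range L, e (x * n))
  rw [norm_sub_rev, Complex.norm_natCast] at h3
  linarith

lemma one_le_arcKer {X L q : ℕ} {α : ℝ} (hL : 0 < L) (hq : 0 < q) (hqX : q ≤ X)
    (h : L * distInt (q * α) ≤ 1 / 14) : 1 ≤ arcKer X L α := by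
  have hL' : (0:ℝ) < L := mod_cast hL
  have h1 := half_le_norm_geom_sum h
  have h2 : ∑ n ∈ range L, e (q * α * n) =
      trig (range L) (fun n => (n : ℤ) * q) α := by
    unfold trig
    refine sum_congr rfl fun n _ => ?_
    congr 1; push_cast; ring
  rw [h2] at h1
  have h3 : ((L : ℝ) / 2) ^ 2 ≤ ∑ q ∈ Icc 1 X, ‖trig (range L) (fun n => (n : ℤ) * q) α‖ ^ 2 :=
    (pow_le_pow_left₀ (by positivity) h1 2).trans
      (single_le_sum (f := fun q : ℕ => ‖trig (range L) (fun n => (n : ℤ) * q) α‖ ^ 2)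
        (fun _ _ => by positivity) (mem_Icc.mpr ⟨hq, hqX⟩))
  unfold arcKer
  calc (1:ℝ) = 4 / L ^ 2 * (L / 2) ^ 2 := by field_simp; norm_num
    _ ≤ _ := by gcongr

lemma avg_arcKer_mul_le {ι : Type*} (s : Finset ι) (ψ : ι → ℤ) (X L : ℕ) :
    avg (fun α => arcKer X L α * ‖trig s ψ α‖ ^ 2) ≤ 4 / L * ∑ q ∈ Icc 1 X,
      (((s ×ˢ s).filter fun p => (q : ℤ) ∣ ψ p.1 - ψ p.2).card : ℝ) := by
  classical
  rcases Nat.eq_zero_or_pos L with rfl | hL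
  · simp [arcKer, avg]
  have hL' : (0:ℝ) < L := mod_cast hL
  have h1 : ∀ q ∈ Icc 1 X, avg (fun α =>
      ‖trig (range L) (fun n => (n : ℤ) * q) α‖ ^ 2 * ‖trig s ψ α‖ ^ 2) ≤
      L * (((s ×ˢ s).filter fun p => (q : ℤ) ∣ ψ p.1 - ψ p.2).card : ℝ) := by
    intro q hq
    have hq0 : (0:ℤ) < q := mod_cast (mem_Icc.mp hq).1
    have h2 : ∀ α, ‖trig (range L) (fun n => (n : ℤ) * q) α‖ ^ 2 * ‖trig s ψ α‖ ^ 2 =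
        ‖trig (range L ×ˢ s) (fun p => (p.1 : ℤ) * q + ψ p.2) α‖ ^ 2 := by
      intro α
      rw [← mul_pow, ← norm_mul]
      congr 2
      unfold trig
      rw [sum_mul_sum, sum_product]
      refine sum_congr rfl fun n _ => sum_congr rfl fun i _ => ?_
      rw [← e_add]; congr 1; push_cast; ring
    simp only [h2]
    rw [avg_normSq_trig]
    have h3 : ((((range L ×ˢ s) ×ˢ (range L ×ˢ s)).filter fun p =>
        (p.1.1 : ℤ) * q + ψ p.1.2 = (p.2.1 : ℤ) * q + ψ p.2.2).card) ≤
        (range L ×ˢ ((s ×ˢ s).filter fun p => (q : ℤ) ∣ ψ p.1 - ψ p.2)).card := by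
      refine card_le_card_of_injOn (fun p => (p.1.1, (p.1.2, p.2.2))) ?_ ?_
      · rintro ⟨⟨n, i⟩, m, j⟩ hp
        simp only [coe_filter, mem_product, mem_range, Set.mem_setOf_eq] at hp
        simp only [coe_product, coe_filter, Set.mem_prod, Finset.coe_range,
          Set.mem_Iio, mem_product, Set.mem_setOf_eq]
        exact ⟨hp.1.1.1, ⟨hp.1.1.2, hp.1.2.2⟩, (m : ℤ) - n, by linarith [hp.2]⟩
      · rintro ⟨⟨n, i⟩, m, j⟩ hp ⟨⟨n', i'⟩, m', j'⟩ hp' heq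
        simp only [coe_filter, Set.mem_setOf_eq] at hp hp'
        simp only [Prod.mk.injEq] at heq
        obtain ⟨rfl, rfl, rfl⟩ := heq
        have : (m : ℤ) * q = m' * q := by linarith [hp.2, hp'.2]
        have := Int.eq_of_mul_eq_mul_right hq0.ne' this
        simpa using this
    refine (cast_le.mpr h3).trans (le_of_eq ?_)
    rw [card_product, card_range]
    push_cast; rfl
  have h2 : (fun α => arcKer X L α * ‖trig s ψ α‖ ^ 2) = fun α => 4 / (L : ℝ) ^ 2 * ∑ q ∈ Icc 1 X,
        ‖trig (range L) (fun n => (n : ℤ) * q) α‖ ^ 2 * ‖trig s ψ α‖ ^ 2 := by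
    funext α
    rw [arcKer, mul_assoc, sum_mul]
  rw [h2, avg_const_mul, avg_sum _ _ fun q _ => by fun_prop]
  calc _ ≤ 4 / (L : ℝ) ^ 2 * ∑ q ∈ Icc 1 X,
        L * (((s ×ˢ s).filter fun p => (q : ℤ) ∣ ψ p.1 - ψ p.2).card : ℝ) := by
        refine mul_le_mul_of_nonneg_left (sum_le_sum h1) (by positivity)
    _ = _ := by
        rw [← mul_sum, ← mul_assoc]
        congr 1
        field_simp

lemma sum_card_dvd_sub_le (s : Finset ℕ) (X : ℕ) {D : ℝ}
    (hD : ∀ x ∈ s, ∀ y ∈ s, x < y → (((y ^ 4 - x ^ 4).divisors.card : ℕ) : ℝ) ≤ D) (hD0 : 0 ≤ D) :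
    ∑ q ∈ Icc 1 X, (((s ×ˢ s).filter fun p => (q : ℤ) ∣ (p.1 : ℤ) ^ 4 - (p.2 : ℤ) ^ 4).card : ℝ) ≤
      X * s.card + D * s.card ^ 2 := by
  classical
  have h1 : ∀ q : ℕ, (((s ×ˢ s).filter fun p => (q : ℤ) ∣ (p.1 : ℤ) ^ 4 - (p.2 : ℤ) ^ 4).card : ℝ) =
      ∑ p ∈ s ×ˢ s, if (q : ℤ) ∣ (p.1 : ℤ) ^ 4 - (p.2 : ℤ) ^ 4 then (1:ℝ) else 0 := by
    intro q; rw [card_filter]; push_cast; rfl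
  simp only [h1]
  rw [sum_comm]
  have h2 : ∀ p ∈ s ×ˢ s, (∑ q ∈ Icc 1 X,
      if (q : ℤ) ∣ (p.1 : ℤ) ^ 4 - (p.2 : ℤ) ^ 4 then (1:ℝ) else 0) ≤
      (if p.1 = p.2 then (X : ℝ) else 0) + D := by
    rintro ⟨x, y⟩ hp
    rw [mem_product] at hp
    rw [← sum_filter, sum_const, nsmul_eq_mul, mul_one]
    have key : ∀ a ∈ s, ∀ b ∈ s, a < b → (((Icc 1 X).filter fun q : ℕ =>
        (q : ℤ) ∣ (b : ℤ) ^ 4 - (a : ℤ) ^ 4).card : ℝ) ≤ D := by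
      intro a ha b hb hab
      have hlt : a ^ 4 < b ^ 4 := pow_lt_pow_left hab (by norm_num)
      refine le_trans (cast_le.mpr (card_le_card ?_)) (hD a ha b hb hab)
      intro q hq
      have hq' := (mem_filter.mp hq).2
      rw [mem_divisors]
      refine ⟨?_, by omega⟩
      have : ((b ^ 4 - a ^ 4 : ℕ) : ℤ) = (b : ℤ) ^ 4 - (a : ℤ) ^ 4 := by
        rw [cast_sub hlt.le]; push_cast; rfl
      rw [← this] at hq'
      exact_mod_cast hq'
    rcases lt_trichotomy x y with hxy | rfl | hxy
    · rw [if_neg hxy.ne, zero_add]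
      refine le_trans (le_of_eq ?_) (key x hp.1 y hp.2 hxy)
      congr 2
      ext q
      rw [mem_filter, mem_filter, ← dvd_neg, neg_sub]
    · simp [hD0]
    · rw [if_neg hxy.ne', zero_add]
      exact key y hp.2 x hp.1 hxy
  refine (sum_le_sum h2).trans (le_of_eq ?_)
  rw [sum_add_distrib, sum_product]
  simp [card_product]
  ring

/-! ### Weyl sums and major arcs -/

lemma Approx.sum_minKer_not_dvd_le {K : ℕ} {α : ℝ} {q : ℕ} {a : ℤ} (H : Approx K α q a) {Z : ℝ}
    (hZ : 0 ≤ Z) :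
    ∑ k ∈ (Icc 1 K).filter (fun k => ¬ q ∣ k), minKer Z (distInt (k * α)) ≤
      24 * K * (1 + Real.log (2 * K)) := by
  calc _ ≤ ∑ k ∈ (Icc 1 K).filter (fun k => ¬ q ∣ k), 2 * (1 / distInt (k * α)) := by
        refine sum_le_sum fun k hk => ?_
        rw [mem_filter, mem_Icc] at hk
        rw [mul_one_div]
        exact minKer_le_two_div hZ (H.inv_distInt_le hk.1.2 hk.2).1
    _ ≤ _ := by
        rw [← mul_sum]
        have := H.sum_inv_le
        linarith

lemma Approx.sum_minKer_dvd_le {K : ℕ} {α : ℝ} {q : ℕ} {a : ℤ} (H : Approx K α q a) {Z : ℝ}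
    (hZ : 0 < Z) (hK : 0 < K) :
    ∑ k ∈ (Icc 1 K).filter (fun k => q ∣ k), minKer Z (distInt (k * α)) ≤
      4 * (K * Z / (q + K * Z * |q * α - a|)) * (1 + Real.log (2 * K)) := by
  have hq := H.pos
  have hq' : (0:ℝ) < q := mod_cast hq
  have hK' : (1:ℝ) ≤ K := mod_cast hK
  have hlog : 0 ≤ Real.log (2 * K) := log_nonneg (by linarith)
  set δ := |q * α - a| with hδ
  have hδ0 : 0 ≤ δ := abs_nonneg _
  have h1 : ∑ k ∈ (Icc 1 K).filter (fun k => q ∣ k), minKer Z (distInt (k * α)) =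
      ∑ j ∈ Icc 1 (K / q), minKer Z (j * δ) := by
    symm
    refine sum_nbij' (fun j => q * j) (fun k => k / q) ?_ ?_ ?_ ?_ ?_
    · intro j hj
      rw [mem_Icc, Nat.le_div_iff_mul_le hq] at hj
      rw [mem_filter, mem_Icc]
      exact ⟨⟨Nat.mul_pos hq hj.1, by linarith⟩, dvd_mul_right _ _⟩
    · intro k hk
      rw [mem_filter, mem_Icc] at hk
      rw [mem_Icc]
      exact ⟨Nat.div_pos (le_of_dvd hk.1.1 hk.2) hq, Nat.div_le_div_right hk.1.2⟩
    · intro j _; exact Nat.mul_div_cancel_left j hq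
    · intro k hk
      rw [mem_filter] at hk
      exact mul_div_cancel' hk.2
    · intro j hj
      rw [mem_Icc, Nat.le_div_iff_mul_le hq] at hj
      rw [H.distInt_mul (by linarith)]
  rw [h1]
  have hN : 0 < K * Z := by positivity
  rcases le_or_gt (K * Z * δ) q with hc | hc
  · have h2 : ∑ j ∈ Icc 1 (K / q), minKer Z (j * δ) ≤ (K / q : ℕ) * (2 * Z) := by
      refine (sum_le_card_nsmul _ _ (2 * Z) fun j _ => minKer_le_two_mul hZ.le
        (by positivity)).trans ?_
      simp
    have h3 : ((K / q : ℕ) : ℝ) ≤ K / q := cast_div_le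
    calc _ ≤ (K / q : ℝ) * (2 * Z) := h2.trans (by gcongr)
      _ = 4 * (K * Z / (q + q)) * 1 := by field_simp; norm_num
      _ ≤ _ := by gcongr; linarith
  · have hδ1 : 0 < δ := by
      by_contra hcon
      have : δ = 0 := le_antisymm (not_lt.mp hcon) hδ0
      rw [this, mul_zero] at hc; linarith
    have h2 : ∑ j ∈ Icc 1 (K / q), minKer Z (j * δ) ≤
        ∑ j ∈ Icc 1 (2 * K), (2 / δ) * (1 / (j : ℝ)) := by
      refine (sum_le_sum fun j hj => ?_).trans
        (sum_le_sum_of_subset_of_nonneg (Finset.Icc_subset_Icc_right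
          ((Nat.div_le_self _ _).trans (by omega))) fun _ _ _ => by positivity)
      have hj0 : (0:ℝ) < j := mod_cast (mem_Icc.mp hj).1
      refine (minKer_le_two_div hZ.le (by positivity)).trans (le_of_eq ?_)
      field_simp
    rw [← mul_sum] at h2
    have h3 := sum_Icc_one_div_le (2 * K)
    push_cast at h3
    calc _ ≤ 2 / δ * (1 + Real.log (2 * K)) := h2.trans (by gcongr)
      _ = 4 * (K * Z / (K * Z * δ + K * Z * δ)) * (1 + Real.log (2 * K)) := by
          field_simp; norm_num
      _ ≤ _ := by gcongr

/-- The dyadic majorant of `K Z / (q + K Z |q α - a|)` on the major arcs. -/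
def arcMaj (K Z : ℕ) (α : ℝ) : ℝ :=
  ∑ i ∈ range (Nat.log 2 (2 * Z) + 1), K * Z / 2 ^ i * arcKer (2 ^ i) (K * Z / (14 * 2 ^ i)) α

@[fun_prop]
lemma continuous_arcMaj (K Z : ℕ) : Continuous (arcMaj K Z) := by
  unfold arcMaj; fun_prop

lemma arcMaj_nonneg (K Z : ℕ) (α : ℝ) : 0 ≤ arcMaj K Z α :=
  sum_nonneg fun _ _ => mul_nonneg (by positivity) (arcKer_nonneg _ _ _)

lemma one_le_arcKer_div {N X q : ℕ} {α : ℝ} {a : ℤ} (hq : 0 < q) (hN : 14 * X ≤ N)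
    (h : q + N * |q * α - a| ≤ X) : 1 ≤ arcKer X (N / (14 * X)) α := by
  have hδ := abs_nonneg ((q:ℝ) * α - a)
  have hNp : (0:ℝ) ≤ N := cast_nonneg N
  have hqX : (q:ℝ) ≤ X := by nlinarith
  have hq' : (0:ℝ) < q := mod_cast hq
  have hX : 0 < X := mod_cast hq'.trans_le hqX
  have hX' : (0:ℝ) < X := mod_cast hX
  refine one_le_arcKer (Nat.div_pos hN (by omega)) hq (mod_cast hqX) ?_
  calc _ ≤ (N / (14 * X) : ℝ) * |q * α - a| := by
        have h1 := distInt_le (q * α) a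
        have h2 : ((N / (14 * X) : ℕ) : ℝ) ≤ N / (14 * X) := by
          refine cast_div_le.trans (le_of_eq ?_); push_cast; rfl
        exact mul_le_mul h2 h1 (distInt_nonneg _) (by positivity)
    _ = N * |q * α - a| / (14 * X) := by ring
    _ ≤ X / (14 * X) := by gcongr; linarith
    _ = 1 / 14 := by field_simp

lemma exists_two_pow_near {x : ℝ} (hx : 1 ≤ x) : ∃ i : ℕ, x ≤ 2 ^ i ∧ (2:ℝ) ^ i ≤ 2 * x := by
  obtain ⟨n, h1, h2⟩ := exists_nat_pow_near hx one_lt_two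
  exact ⟨n + 1, h2.le, by rw [pow_succ]; linarith⟩

lemma sum_minKer_le {K Z : ℕ} (hK : 28 ≤ K) (hZ : 0 < Z) (α : ℝ) :
    ∑ k ∈ Icc 1 K, minKer Z (distInt (k * α)) ≤
      (1 + Real.log (2 * K)) * (28 * K + 8 * arcMaj K Z α) := by
  obtain ⟨q, a, H⟩ := exists_approx (by omega : 0 < K) α
  have hZ' : (1:ℝ) ≤ Z := mod_cast hZ
  have hK' : (28:ℝ) ≤ K := mod_cast hK
  have hlog : 0 ≤ Real.log (2 * K) := log_nonneg (by linarith)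
  have hq1 : (1:ℝ) ≤ q := mod_cast H.pos
  rw [← Finset.sum_filter_not_add_sum_filter _ (fun k => q ∣ k)]
  have h1 := H.sum_minKer_not_dvd_le (Z := Z) (by linarith)
  have h2 := H.sum_minKer_dvd_le (Z := Z) (by linarith) (by omega)
  set x := (q:ℝ) + K * Z * |q * α - a| with hx
  have hδ : 0 ≤ K * Z * |q * α - a| := by positivity
  have hx1 : 1 ≤ x := by linarith
  have h3 : 4 * (K * Z / x) ≤ 4 * K + 8 * arcMaj K Z α := by
    rcases le_or_gt (Z : ℝ) x with hc | hc
    · have h4 : K * Z / x ≤ (K : ℝ) := by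
        rw [div_le_iff₀ (by linarith)]; gcongr
      have := arcMaj_nonneg K Z α
      linarith
    · obtain ⟨i, hi1, hi2⟩ := exists_two_pow_near hx1
      have hi3 : 2 ^ i ≤ 2 * Z := by
        have : (2:ℝ) ^ i ≤ 2 * Z := by linarith
        exact_mod_cast this
      have hi4 : i ∈ range (Nat.log 2 (2 * Z) + 1) := by
        rw [mem_range, lt_succ_iff]
        exact Nat.le_log_of_pow_le (by norm_num) hi3
      have h5 : 1 ≤ arcKer (2 ^ i) (K * Z / (14 * 2 ^ i)) α :=
        one_le_arcKer_div (a := a) H.pos (by nlinarith) (by push_cast; linarith)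
      have h6 : K * Z / 2 ^ i * arcKer (2 ^ i) (K * Z / (14 * 2 ^ i)) α ≤ arcMaj K Z α :=
        single_le_sum (f := fun i => (K * Z / 2 ^ i : ℝ) * arcKer (2 ^ i) (K * Z / (14 * 2 ^ i)) α)
          (fun i _ => mul_nonneg (by positivity) (arcKer_nonneg _ _ _)) hi4
      have h7 : K * Z / x ≤ 2 * (K * Z / 2 ^ i : ℝ) := by
        rw [← mul_div_assoc, div_le_div_iff₀ (by linarith) (by positivity)]
        have : (0:ℝ) ≤ K * Z := by positivity
        nlinarith
      have h8 : (K * Z / 2 ^ i : ℝ) ≤ arcMaj K Z α :=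
        (le_mul_of_one_le_right (by positivity) h5).trans h6
      have : (0:ℝ) ≤ K := by linarith
      linarith
  have h4 : 4 * (K * Z / x) * (1 + Real.log (2 * K)) ≤
      (4 * K + 8 * arcMaj K Z α) * (1 + Real.log (2 * K)) := by gcongr
  linarith

lemma log_two_add_one_le {Z : ℕ} (hZ : 0 < Z) :
    ((Nat.log 2 (2 * Z) + 1 : ℕ) : ℝ) ≤ 4 * (1 + Real.log Z) := by
  have hZ' : (0:ℝ) < Z := mod_cast hZ
  have h1 : ((2 ^ Nat.log 2 (2 * Z) : ℕ) : ℝ) ≤ (2 * Z : ℕ) :=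
    cast_le.mpr (Nat.pow_log_le_self 2 (by omega))
  push_cast at h1
  have h2 := log_le_log (by positivity) h1
  rw [log_pow, log_mul (by norm_num) hZ'.ne'] at h2
  have h3 := Real.log_two_gt_d9
  have h4 := log_two_lt_d9
  have h5 : 0 ≤ Real.log Z := log_nonneg (mod_cast hZ)
  set n : ℝ := ((Nat.log 2 (2 * Z) : ℕ) : ℝ) with hn
  have hn0 : 0 ≤ n := cast_nonneg _
  push_cast
  nlinarith

lemma avg_arcMaj_mul_normSq_h_le {K Z : ℕ} (hK : 28 ≤ K) (hZ : 0 < Z) {Q R D : ℝ} (hQ : 1 ≤ Q)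
    (hD0 : 0 ≤ D) (hD : ∀ n : ℕ, n ≠ 0 → (n : ℝ) ≤ Q ^ 4 → (n.divisors.card : ℝ) ≤ D) :
    avg (fun α => arcMaj K Z α * ‖h Q R α‖ ^ 2) ≤
      448 * (1 + Real.log Z) * (2 * Z * Q + D * Q ^ 2) := by
  have hZ' : (1:ℝ) ≤ Z := mod_cast hZ
  have hs : ((smoothA Q R).card : ℝ) ≤ Q := card_smoothA_le Q R (by linarith)
  have h0 : (fun α => arcMaj K Z α * ‖h Q R α‖ ^ 2) = fun α =>
      ∑ i ∈ range (Nat.log 2 (2 * Z) + 1), K * Z / 2 ^ i *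
        (arcKer (2 ^ i) (K * Z / (14 * 2 ^ i)) α *
          ‖trig (smoothA Q R) (fun x => (x : ℤ) ^ 4) α‖ ^ 2) := by
    funext α
    rw [arcMaj, sum_mul, h_eq_trig]
    simp only [mul_assoc]
  rw [h0, avg_sum _ _ fun i _ => by fun_prop]
  have h1 : ∀ i ∈ range (Nat.log 2 (2 * Z) + 1), avg (fun α => K * Z / 2 ^ i *
        (arcKer (2 ^ i) (K * Z / (14 * 2 ^ i)) α *
          ‖trig (smoothA Q R) (fun x => (x : ℤ) ^ 4) α‖ ^ 2)) ≤
        112 * (2 * Z * Q + D * Q ^ 2) := by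
    intro i hi
    rw [mem_range, lt_succ_iff] at hi
    have hi2 : 2 ^ i ≤ 2 * Z :=
      (Nat.pow_le_pow_right (by norm_num) hi).trans (Nat.pow_log_le_self 2 (by omega))
    have hi2' : (2:ℝ) ^ i ≤ 2 * Z := mod_cast hi2
    set L := K * Z / (14 * 2 ^ i) with hL
    have hL0 : 0 < L := Nat.div_pos (by nlinarith) (by positivity)
    have hL0' : (1:ℝ) ≤ L := mod_cast hL0
    have hL1 : (K * Z : ℝ) ≤ 28 * 2 ^ i * L := by
      have h2 : K * Z < 14 * 2 ^ i * (L + 1) := Nat.lt_mul_div_succ _ (by positivity)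
      have h3 : (K * Z : ℝ) < 14 * 2 ^ i * (L + 1) := mod_cast h2
      have h4 : (0:ℝ) < 2 ^ i := by positivity
      nlinarith
    rw [avg_const_mul]
    have h2 := avg_arcKer_mul_le (smoothA Q R) (fun x => (x : ℤ) ^ 4) (2 ^ i) L
    have h3 := sum_card_dvd_sub_le (smoothA Q R) (2 ^ i) (D := D) (fun x hx y hy hxy => by
      have hlt : x ^ 4 < y ^ 4 := pow_lt_pow_left hxy (by norm_num)
      refine hD _ (by omega) ?_
      have hyQ : (y:ℝ) ≤ Q := by
        exact ((mem_smoothA (by linarith)).mp hy).2.1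
      calc ((y ^ 4 - x ^ 4 : ℕ) : ℝ) ≤ ((y ^ 4 : ℕ) : ℝ) := cast_le.mpr (sub_le _ _)
        _ ≤ Q ^ 4 := by push_cast; gcongr) hD0
    have h4 : ((2 ^ i : ℕ) : ℝ) * (smoothA Q R).card + D * ((smoothA Q R).card : ℝ) ^ 2 ≤
        2 * Z * Q + D * Q ^ 2 := by
      push_cast
      gcongr
    calc _ ≤ K * Z / 2 ^ i * (4 / L * (2 * Z * Q + D * Q ^ 2)) := by
          refine mul_le_mul_of_nonneg_left (h2.trans ?_) (by positivity)
          exact mul_le_mul_of_nonneg_left (h3.trans h4) (by positivity)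
      _ ≤ 28 * 2 ^ i * L / 2 ^ i * (4 / L * (2 * Z * Q + D * Q ^ 2)) := by gcongr
      _ = _ := by field_simp; ring
  refine (sum_le_card_nsmul _ _ _ h1).trans ?_
  rw [card_range, nsmul_eq_mul]
  have h2 := log_two_add_one_le hZ
  have h3 : 0 ≤ 112 * (2 * Z * Q + D * Q ^ 2) := by positivity
  calc _ ≤ 4 * (1 + Real.log Z) * (112 * (2 * Z * Q + D * Q ^ 2)) := by gcongr
    _ = _ := by ring

/-! ### Splitting the second difference -/

lemma sum_comp_le_mul_sum {ι : Type*} (s : Finset ι) (κ : ι → ℕ) {K : ℕ} {B : ℝ}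
    (hκ : ∀ i ∈ s, κ i ∈ Icc 1 K)
    (hB : ∀ i ∈ s, ((s.filter fun j => κ j = κ i).card : ℝ) ≤ B) (hB0 : 0 ≤ B)
    {g : ℕ → ℝ} (hg : ∀ k, 0 ≤ g k) :
    ∑ i ∈ s, g (κ i) ≤ B * ∑ k ∈ Icc 1 K, g k := by
  classical
  rw [← sum_fiberwise_of_maps_to hκ, mul_sum]
  refine sum_le_sum fun k _ => ?_
  rw [sum_congr rfl (g := fun _ => g k) fun i hi => by rw [(mem_filter.mp hi).2],
    sum_const, nsmul_eq_mul]
  refine mul_le_mul_of_nonneg_right ?_ (hg k)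
  rcases Finset.eq_empty_or_nonempty (s.filter fun j => κ j = k) with h0 | ⟨i, hi⟩
  · rw [h0]; simpa using hB0
  · rw [mem_filter] at hi
    rw [← hi.2]
    exact hB i hi.1

lemma normSq_trig_eq_card_add (s : Finset ℕ) (φ : ℕ → ℤ) (α : ℝ) :
    ‖trig s φ α‖ ^ 2 = s.card + 2 * (trig (congrPairs s 1) (fun p => φ p.1 - φ p.2) α).re := by
  have h1 := sum_normSq_trig_residue s one_pos φ α
  simpa only [range_one, Finset.sum_singleton, mod_one, filter_true] using h1

lemma card_congrPairs_le (s : Finset ℕ) (n : ℕ) : (congrPairs s n).card ≤ s.card ^ 2 := by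
  refine (card_filter_le _ _).trans (le_of_eq ?_)
  rw [card_product, sq]

lemma normSq_quad_le (h w Z : ℕ) (α : ℝ) : ‖trig ((Icc 1 Z).filter fun z => z + w ≤ Z)
      (fun z => (h : ℤ) * w * (3 * (z : ℤ) ^ 2 + 3 * z * w + (w : ℤ) ^ 2)) α‖ ^ 2 ≤
    Z + 2 * ∑ j ∈ Icc 1 Z, minKer Z (distInt ((6 * h * w * j : ℕ) * α)) := by
  rw [normSq_trig_eq_card_add]
  set s := (Icc 1 Z).filter fun z => z + w ≤ Z with hs
  set φ : ℕ → ℤ := fun z => (h : ℤ) * w * (3 * (z : ℤ) ^ 2 + 3 * z * w + (w : ℤ) ^ 2) with hφ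
  have hc : (s.card : ℝ) ≤ Z := by
    have : s.card ≤ Z := (card_filter_le _ _).trans (by simp)
    exact_mod_cast this
  have h1 : trig (congrPairs s 1) (fun p => φ p.1 - φ p.2) α =
      ∑ j ∈ Icc 1 Z, ∑ n ∈ range (Z - w - j),
        e (α * ((φ (n + 1 + j) - φ (n + 1) : ℤ) : ℝ)) := by
    rw [Finset.sum_sigma']
    unfold trig
    refine sum_nbij' (fun p => ⟨p.1 - p.2, p.2 - 1⟩) (fun q => (q.2 + 1 + q.1, q.2 + 1))
      ?_ ?_ ?_ ?_ ?_
    · rintro ⟨a, b⟩ hp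
      simp only [hs, congrPairs, mem_filter, mem_product, mem_Icc, mem_sigma, mem_range] at hp ⊢
      omega
    · rintro ⟨j, n⟩ hp
      simp only [hs, congrPairs, mem_filter, mem_product, mem_Icc,
        mem_sigma, mem_range, mod_one, and_true] at hp ⊢
      omega
    · rintro ⟨a, b⟩ hp
      simp only [hs, congrPairs, mem_filter, mem_product, mem_Icc] at hp
      simp only [Prod.mk.injEq]
      omega
    · rintro ⟨j, n⟩ hp
      simp
    · rintro ⟨a, b⟩ hp
      simp only [hs, congrPairs, mem_filter, mem_product, mem_Icc] at hp
      dsimp only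
      rw [show b - 1 + 1 = b by omega, show b + (a - b) = a by omega]
  have h2 : ‖trig (congrPairs s 1) (fun p => φ p.1 - φ p.2) α‖ ≤
      ∑ j ∈ Icc 1 Z, minKer Z (distInt ((6 * h * w * j : ℕ) * α)) := by
    rw [h1]
    refine norm_sum_le_of_le _ fun j _ => ?_
    have h3 : ∀ n ∈ range (Z - w - j), e (α * ((φ (n + 1 + j) - φ (n + 1) : ℤ) : ℝ)) =
        e (α * (h * w * (3 * j ^ 2 + 3 * j * w + 6 * j))) *
          e (((6 * h * w * j : ℕ) * α) * n) := by
      intro n _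
      rw [← e_add]
      congr 1
      simp only [hφ]
      push_cast
      ring
    rw [sum_congr rfl h3, ← mul_sum, norm_mul, norm_e, one_mul]
    exact norm_geom_sum_le_minKer _ _ (cast_le.mpr ((sub_le _ _).trans (sub_le _ _)))
  have h3 := (re_le_norm (trig (congrPairs s 1) (fun p => φ p.1 - φ p.2) α)).trans h2
  linarith

/-- The quadratic factor of the second difference. -/
def quadSum (H Z : ℕ) (α : ℝ) : ℝ :=
  ∑ p ∈ Icc 1 H ×ˢ Icc 1 Z, ‖trig ((Icc 1 Z).filter fun z => z + p.2 ≤ Z)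
    (fun z => (p.1 : ℤ) * p.2 * (3 * (z : ℤ) ^ 2 + 3 * z * p.2 + (p.2 : ℤ) ^ 2)) α‖ ^ 2

/-- The monomial factor of the second difference. -/
def monoSum (H N Z : ℕ) (α : ℝ) : ℝ :=
  ∑ p ∈ Icc 1 H ×ˢ Icc 1 Z, ‖trig (Icc 1 N) (fun m => (p.1 : ℤ) ^ 3 * p.2 * (m : ℤ) ^ 8) α‖ ^ 2

lemma monoSum_nonneg (H N Z : ℕ) (α : ℝ) : 0 ≤ monoSum H N Z α :=
  sum_nonneg fun _ _ => by positivity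

lemma normSq_boxTwo_le (H N Z : ℕ) (α : ℝ) :
    ‖trig (boxTwo H N Z) (fun q => (boxTwoFreq q : ℤ)) α‖ ^ 2 ≤
      quadSum H Z α * monoSum H N Z α := by
  set A : ℕ × ℕ → ℂ := fun p => trig ((Icc 1 Z).filter fun z => z + p.2 ≤ Z)
    (fun z => (p.1 : ℤ) * p.2 * (3 * (z : ℤ) ^ 2 + 3 * z * p.2 + (p.2 : ℤ) ^ 2)) α with hA
  set B : ℕ × ℕ → ℂ := fun p =>
    trig (Icc 1 N) (fun m => (p.1 : ℤ) ^ 3 * p.2 * (m : ℤ) ^ 8) α with hB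
  have h1 : trig (boxTwo H N Z) (fun q => (boxTwoFreq q : ℤ)) α =
      ∑ p ∈ Icc 1 H ×ˢ Icc 1 Z, A p * B p := by
    simp only [hA, hB]
    unfold trig boxTwo
    simp only [sum_mul_sum]
    rw [sum_filter, sum_product, sum_product]
    simp only [sum_product, sum_filter]
    refine sum_congr rfl fun h _ => ?_
    rw [sum_comm]
    refine sum_congr rfl fun w _ => ?_
    rw [sum_comm]
    refine sum_congr rfl fun z _ => ?_
    split_ifs with hz
    · refine sum_congr rfl fun m _ => ?_
      rw [← e_add]
      congr 1
      simp only [boxTwoFreq]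
      push_cast
      ring
    · simp
  rw [h1]
  have h2 : ‖∑ p ∈ Icc 1 H ×ˢ Icc 1 Z, A p * B p‖ ≤ ∑ p ∈ Icc 1 H ×ˢ Icc 1 Z, ‖A p‖ * ‖B p‖ :=
    norm_sum_le_of_le _ fun p _ => (norm_mul _ _).le
  exact (pow_le_pow_left₀ (norm_nonneg _) h2 2).trans
    (Finset.sum_mul_sq_le_sq_mul_sq _ (fun p => ‖A p‖) (fun p => ‖B p‖))

lemma quadSum_le (H Z : ℕ) {D : ℝ} (hD0 : 0 ≤ D) (α : ℝ)
    (hD : ∀ n : ℕ, n ≠ 0 → n ≤ 28 * H * Z ^ 2 → (n.divisors.card : ℝ) ≤ D) :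
    quadSum H Z α ≤ H * Z ^ 2 + 2 * (D ^ 3 *
      ∑ k ∈ Icc (1:ℕ) (28 * H * Z ^ 2), minKer Z (distInt ((k : ℕ) * α))) := by
  have h1 : quadSum H Z α ≤ ∑ p ∈ Icc 1 H ×ˢ Icc 1 Z, ((Z : ℝ) + 2 *
      ∑ j ∈ Icc 1 Z, minKer Z (distInt ((6 * p.1 * p.2 * j : ℕ) * α))) :=
    sum_le_sum fun p _ => normSq_quad_le _ _ _ _
  refine h1.trans ?_
  rw [sum_add_distrib, ← mul_sum, ← Finset.sum_product']
  refine add_le_add (le_of_eq ?_) (mul_le_mul_of_nonneg_left ?_ (by norm_num))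
  · simp [card_product]; ring
  · refine sum_comp_le_mul_sum (K := 28 * H * Z ^ 2) (B := D ^ 3)
      (g := fun k => minKer Z (distInt (k * α))) _
      (fun x : (ℕ × ℕ) × ℕ => 6 * x.1.1 * x.1.2 * x.2) ?_ ?_ (by positivity) fun k =>
        minKer_nonneg (cast_nonneg _) (distInt_nonneg _)
    · rintro ⟨⟨h, w⟩, j⟩ hx
      simp only [mem_product, mem_Icc] at hx ⊢
      obtain ⟨⟨⟨h1, h2⟩, h3, h4⟩, h5, h6⟩ := hx
      refine ⟨one_le_iff_ne_zero.mpr (by positivity), ?_⟩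
      calc 6 * h * w * j ≤ 28 * H * Z * Z := by gcongr; norm_num
        _ = _ := by ring
    · rintro ⟨⟨h, w⟩, j⟩ hx
      simp only [mem_product, mem_Icc] at hx
      obtain ⟨⟨⟨h1, h2⟩, h3, h4⟩, h5, h6⟩ := hx
      set n := 6 * h * w * j with hn
      have hn0 : n ≠ 0 := by positivity
      have hle : n ≤ 28 * H * Z ^ 2 := by
        calc 6 * h * w * j ≤ 28 * H * Z * Z := by gcongr; norm_num
          _ = _ := by ring
      have hdD := hD n hn0 hle
      have hc : ((((Icc 1 H ×ˢ Icc 1 Z) ×ˢ Icc 1 Z).filter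
          fun x : (ℕ × ℕ) × ℕ => 6 * x.1.1 * x.1.2 * x.2 = n).card) ≤
          ((n.divisors ×ˢ n.divisors) ×ˢ n.divisors).card := by
        refine card_le_card fun x hx => ?_
        have hx' := (mem_filter.mp hx).2
        simp only [mem_product, mem_divisors]
        refine ⟨⟨⟨?_, hn0⟩, ?_, hn0⟩, ?_, hn0⟩ <;> rw [← hx']
        · exact ⟨6 * x.1.2 * x.2, by ring⟩
        · exact ⟨6 * x.1.1 * x.2, by ring⟩
        · exact ⟨6 * x.1.1 * x.1.2, by ring⟩
      refine (cast_le.mpr hc).trans ?_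
      rw [card_product, card_product]
      push_cast
      calc _ = (n.divisors.card : ℝ) ^ 3 := by ring
        _ ≤ D ^ 3 := by gcongr

/-- Parameters `(w, m₁, m₂)` of the differenced monomial sum. -/
def monoIdx (N Z : ℕ) : Finset (ℕ × ℕ × ℕ) := Icc 1 Z ×ˢ congrPairs (Icc 1 N) 1

def monoCoeff (u : ℕ × ℕ × ℕ) : ℤ := (u.1 : ℤ) * ((u.2.1 : ℤ) ^ 8 - (u.2.2 : ℤ) ^ 8)

/-- The twice differenced monomial sum. -/
def monoDiff (H N Z : ℕ) (α : ℝ) : ℂ :=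
  trig (monoIdx N Z ×ˢ congrPairs (Icc 1 H) 1)
    (fun x => monoCoeff x.1 * ((x.2.1 : ℤ) ^ 3 - (x.2.2 : ℤ) ^ 3)) α

lemma card_monoIdx_le (N Z : ℕ) : ((monoIdx N Z).card : ℝ) ≤ Z * N ^ 2 := by
  have h : (monoIdx N Z).card ≤ Z * N ^ 2 := by
    rw [monoIdx, card_product]
    have := card_congrPairs_le (Icc 1 N) 1
    simp only [card_Icc, Nat.add_sub_cancel] at this ⊢
    exact Nat.mul_le_mul_left _ this
  exact_mod_cast h

lemma monoSum_le (H N Z : ℕ) (α : ℝ) : monoSum H N Z α ≤ H * Z * N +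
      2 * √(Z * N ^ 2 * (Z * N ^ 2 * H + 2 * ‖monoDiff H N Z α‖)) := by
  set U := monoIdx N Z with hU
  set E := ∑ u ∈ U, trig (Icc 1 H) (fun x => monoCoeff u * (x : ℤ) ^ 3) α with hE
  have h1 : monoSum H N Z α ≤ H * Z * N + 2 * ‖E‖ := by
    have h2 : monoSum H N Z α = H * Z * N + 2 * E.re := by
      unfold monoSum
      simp only [normSq_trig_eq_card_add]
      rw [sum_add_distrib, ← mul_sum, ← re_sum]
      congr 2
      · simp [card_product]
      · congr 1
        rw [hE, hU, monoIdx]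
        unfold trig
        rw [sum_product, sum_product]
        rw [sum_comm]
        refine sum_congr rfl fun w _ => ?_
        rw [sum_comm]
        refine sum_congr rfl fun p _ => sum_congr rfl fun x _ => ?_
        congr 1
        simp only [monoCoeff]
        push_cast
        ring
    have := re_le_norm E
    linarith
  have h2 : ‖E‖ ^ 2 ≤ Z * N ^ 2 * (Z * N ^ 2 * H + 2 * ‖monoDiff H N Z α‖) := by
    have h3 : ‖E‖ ^ 2 ≤ U.card * ∑ u ∈ U,
        ‖trig (Icc 1 H) (fun x => monoCoeff u * (x : ℤ) ^ 3) α‖ ^ 2 :=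
      (pow_le_pow_left₀ (norm_nonneg _) (norm_sum_le _ _) 2).trans sq_sum_le_card_mul_sum_sq
    have h4 : ∑ u ∈ U, ‖trig (Icc 1 H) (fun x => monoCoeff u * (x : ℤ) ^ 3) α‖ ^ 2 =
        U.card * H + 2 * (monoDiff H N Z α).re := by
      simp only [normSq_trig_eq_card_add]
      rw [sum_add_distrib, ← mul_sum, ← re_sum]
      congr 2
      · simp
      · congr 1
        unfold monoDiff trig
        rw [sum_product]
        refine sum_congr rfl fun u _ => sum_congr rfl fun x _ => ?_
        congr 2
        push_cast
        ring
    have h5 := re_le_norm (monoDiff H N Z α)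
    have h6 := card_monoIdx_le N Z
    have h7 : ∑ u ∈ U, ‖trig (Icc 1 H) (fun x => monoCoeff u * (x : ℤ) ^ 3) α‖ ^ 2 ≤
        Z * N ^ 2 * H + 2 * ‖monoDiff H N Z α‖ := by
      rw [h4]
      exact add_le_add (mul_le_mul_of_nonneg_right h6 (cast_nonneg _)) (by linarith)
    exact h3.trans (mul_le_mul h6 h7 (sum_nonneg fun _ _ => by positivity) (by positivity))
  have h3 : ‖E‖ ≤ √(Z * N ^ 2 * (Z * N ^ 2 * H + 2 * ‖monoDiff H N Z α‖)) :=
    Real.le_sqrt_of_sq_le h2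
  linarith

lemma monoSum_le_trivial (H N Z : ℕ) (α : ℝ) : monoSum H N Z α ≤ H * Z * N ^ 2 := by
  refine (sum_le_card_nsmul _ _ ((N:ℝ) ^ 2) fun p _ => ?_).trans (le_of_eq ?_)
  · have := norm_trig_le (Icc 1 N) (fun m => (p.1 : ℤ) ^ 3 * p.2 * (m : ℤ) ^ 8) α
    rw [card_Icc, Nat.add_sub_cancel] at this
    gcongr
  · simp [card_product]

lemma mono_sub_pow_inj {k : ℕ} (hk : 2 ≤ k) {a b a' b' : ℕ} (hab : b < a) (hab' : b' < a')
    (h1 : a - b = a' - b') (h2 : a ^ k - b ^ k = a' ^ k - b' ^ k) : a = a' ∧ b = b' := by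
  obtain ⟨d, rfl⟩ : ∃ d, a = b + d := ⟨a - b, by omega⟩
  obtain ⟨d', rfl⟩ : ∃ d', a' = b' + d' := ⟨a' - b', by omega⟩
  obtain rfl : d = d' := by omega
  have hd : 0 < d := by omega
  have key : ∀ x y : ℕ, x < y → (x + d) ^ k - x ^ k < (y + d) ^ k - y ^ k := by
    intro x y hxy
    have h3 : (x + d) ^ k + y ^ k < (y + d) ^ k + x ^ k := by
      obtain ⟨t, rfl⟩ : ∃ t, y = x + t := ⟨y - x, by omega⟩
      have ht : 0 < t := by omega
      have hconv : ∀ n : ℕ, (x + d) ^ (n + 2) + (x + t) ^ (n + 2) <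
          (x + t + d) ^ (n + 2) + x ^ (n + 2) := by
        intro n
        induction n with
        | zero =>
          simp only [Nat.zero_add]
          nlinarith [Nat.mul_pos ht hd]
        | succ n ih =>
          have e1 : (x + d) ^ (n + 2) < (x + t + d) ^ (n + 2) :=
            pow_lt_pow_left (by omega) (by omega)
          have e2 : (x + t) ^ (n + 2) < (x + t + d) ^ (n + 2) :=
            pow_lt_pow_left (by omega) (by omega)
          rw [show n + 1 + 2 = (n + 2) + 1 by ring, pow_succ, pow_succ (x + t),
            pow_succ (x + t + d), pow_succ x]
          generalize (x + d) ^ (n + 2) = A at *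
          generalize (x + t) ^ (n + 2) = B at *
          generalize (x + t + d) ^ (n + 2) = C at *
          generalize x ^ (n + 2) = E at *
          nlinarith [Nat.mul_lt_mul_of_pos_left e1 hd, Nat.mul_lt_mul_of_pos_left e2 ht,
            Nat.mul_le_mul_left x ih.le]
      obtain ⟨n, rfl⟩ : ∃ n, k = n + 2 := ⟨k - 2, by omega⟩
      exact hconv n
    have h4 : x ^ k ≤ (x + d) ^ k := pow_le_pow_left (by omega) _
    have h5 : y ^ k ≤ (y + d) ^ k := pow_le_pow_left (by omega) _
    omega
  rcases lt_trichotomy b b' with h | h | h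
  · have := key _ _ h; omega
  · exact ⟨by omega, h⟩
  · have := key _ _ h; omega

lemma avg_normSq_monoDiff_le (H N Z : ℕ) {D : ℝ} (hD0 : 0 ≤ D)
    (hD : ∀ n : ℕ, n ≠ 0 → n ≤ Z * N ^ 8 * H ^ 3 → (n.divisors.card : ℝ) ≤ D) :
    avg (fun α => ‖monoDiff H N Z α‖ ^ 2) ≤ D ^ 5 * (Z * N ^ 2 * H ^ 2) := by
  classical
  set s := monoIdx N Z ×ˢ congrPairs (Icc 1 H) 1 with hs
  set φ : (ℕ × ℕ × ℕ) × ℕ × ℕ → ℤ :=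
    fun x => monoCoeff x.1 * ((x.2.1 : ℤ) ^ 3 - (x.2.2 : ℤ) ^ 3) with hφ
  set ν : (ℕ × ℕ × ℕ) × ℕ × ℕ → ℕ :=
    fun x => x.1.1 * (x.1.2.1 ^ 8 - x.1.2.2 ^ 8) * (x.2.1 ^ 3 - x.2.2 ^ 3) with hν
  have hmem : ∀ x ∈ s, (1 ≤ x.1.1 ∧ x.1.1 ≤ Z) ∧ (x.1.2.2 < x.1.2.1 ∧ x.1.2.1 ≤ N) ∧
      (x.2.2 < x.2.1 ∧ x.2.1 ≤ H) := by
    intro x hx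
    simp only [hs, monoIdx, congrPairs, mem_filter, mem_product, mem_Icc] at hx
    omega
  have hνφ : ∀ x ∈ s, φ x = (ν x : ℤ) := by
    intro x hx
    obtain ⟨-, ⟨h1, -⟩, h2, -⟩ := hmem x hx
    have h3 : x.1.2.2 ^ 8 ≤ x.1.2.1 ^ 8 := by gcongr
    have h4 : x.2.2 ^ 3 ≤ x.2.1 ^ 3 := by gcongr
    simp only [hφ, hν, monoCoeff]
    rw [cast_mul, cast_mul, cast_sub h3, cast_sub h4]
    push_cast
    ring
  have hν0 : ∀ x ∈ s, ν x ≠ 0 := by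
    intro x hx
    obtain ⟨⟨h0, -⟩, ⟨h1, -⟩, h2, -⟩ := hmem x hx
    have h3 : x.1.2.2 ^ 8 < x.1.2.1 ^ 8 := pow_lt_pow_left h1 (by norm_num)
    have h4 : x.2.2 ^ 3 < x.2.1 ^ 3 := pow_lt_pow_left h2 (by norm_num)
    simp only [hν]
    have h5 := Nat.sub_pos_of_lt h3
    have h6 := Nat.sub_pos_of_lt h4
    positivity
  have hνle : ∀ x ∈ s, ν x ≤ Z * N ^ 8 * H ^ 3 := by
    intro x hx
    obtain ⟨⟨-, h0⟩, ⟨-, h1⟩, -, h2⟩ := hmem x hx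
    simp only [hν]
    gcongr
    · exact (sub_le _ _).trans (by gcongr)
    · exact (sub_le _ _).trans (by gcongr)
  have h := avg_normSq_trig_le s φ (D ^ 5) 0 (by positivity) ?_ ?_
  · have hc : (s.card : ℝ) ≤ Z * N ^ 2 * H ^ 2 := by
      rw [hs, card_product]
      push_cast
      have h1 := card_monoIdx_le N Z
      have h2 : ((congrPairs (Icc 1 H) 1).card : ℝ) ≤ H ^ 2 := by
        have := card_congrPairs_le (Icc 1 H) 1
        simp only [card_Icc, Nat.add_sub_cancel] at this
        exact_mod_cast this
      exact mul_le_mul h1 h2 (cast_nonneg _) (by positivity)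
    have h1 : D ^ 5 * (s.card : ℝ) ≤ D ^ 5 * (Z * N ^ 2 * H ^ 2) := by gcongr
    have h2 : avg (fun α => ‖monoDiff H N Z α‖ ^ 2) = avg (fun α => ‖trig s φ α‖ ^ 2) := rfl
    rw [h2]
    linarith
  · intro x hx _
    set n := ν x with hn
    have hn0 : n ≠ 0 := hν0 x hx
    have hdD := hD n hn0 (hνle x hx)
    set T := n.divisors with hT
    have hc : (s.filter fun y => φ y = φ x).card ≤ (((T ×ˢ T) ×ˢ T) ×ˢ (T ×ˢ T)).card := by
      refine card_le_card_of_injOn (fun y => (((y.1.1, y.1.2.1 - y.1.2.2),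
        y.1.2.1 ^ 8 - y.1.2.2 ^ 8), (y.2.1 - y.2.2, y.2.1 ^ 3 - y.2.2 ^ 3))) ?_ ?_
      · intro y hy
        obtain ⟨hys, hy2⟩ := mem_filter.mp hy
        have hyn : ν y = n := by
          rw [hνφ y hys, hνφ x hx] at hy2
          exact_mod_cast hy2
        have d1 : y.1.2.1 - y.1.2.2 ∣ y.1.2.1 ^ 8 - y.1.2.2 ^ 8 := Nat.sub_dvd_pow_sub_pow _ _ 8
        have d2 : y.2.1 - y.2.2 ∣ y.2.1 ^ 3 - y.2.2 ^ 3 := Nat.sub_dvd_pow_sub_pow _ _ 3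
        have d3 : y.1.2.1 ^ 8 - y.1.2.2 ^ 8 ∣ n := by
          rw [← hyn]; exact Dvd.dvd.mul_right (dvd_mul_left _ _) _
        have d4 : y.2.1 ^ 3 - y.2.2 ^ 3 ∣ n := by
          rw [← hyn]; exact dvd_mul_left _ _
        have d5 : y.1.1 ∣ n := by
          rw [← hyn]; exact Dvd.dvd.mul_right (dvd_mul_right _ _) _
        simp only [coe_product, Set.mem_prod, mem_coe, hT, mem_divisors]
        exact ⟨⟨⟨⟨d5, hn0⟩, d1.trans d3, hn0⟩, d3, hn0⟩, ⟨d2.trans d4, hn0⟩, d4, hn0⟩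
      · rintro ⟨⟨w, a, b⟩, c, d⟩ hy ⟨⟨w', a', b'⟩, c', d'⟩ hy' heq
        have m1 := hmem _ (mem_filter.mp hy).1
        have m2 := hmem _ (mem_filter.mp hy').1
        simp only [Prod.mk.injEq] at heq m1 m2 ⊢
        obtain ⟨⟨⟨e1, e2⟩, e3⟩, e4, e5⟩ := heq
        have i1 := mono_sub_pow_inj (by norm_num) m1.2.1.1 m2.2.1.1 e2 e3
        have i2 := mono_sub_pow_inj (by norm_num) m1.2.2.1 m2.2.2.1 e4 e5
        exact ⟨⟨e1, i1.1, i1.2⟩, i2.1, i2.2⟩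
    refine (cast_le.mpr hc).trans ?_
    simp only [card_product]
    push_cast
    calc _ = (T.card : ℝ) ^ 5 := by ring
      _ ≤ D ^ 5 := by gcongr
  · refine le_of_eq ?_
    rw [Nat.cast_eq_zero, card_eq_zero, filter_eq_empty_iff]
    intro x hx h0
    rw [hνφ x hx] at h0
    exact hν0 x hx (mod_cast h0)

/-! ### Mean values for an even exponent -/

lemma PosDefTrig.avg_normSq_mul_mono {F : ℝ → ℂ} (hF : PosDefTrig F) {A B : ℝ → ℝ}
    (hA : Continuous A) (hB : Continuous B)
    (h : PosDefTrig fun α => (B α : ℂ) - (A α : ℂ)) :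
    avg (fun α => ‖F α‖ ^ 2 * A α) ≤ avg (fun α => ‖F α‖ ^ 2 * B α) := by
  have h1 := integral_re_mono (F := fun α => (A α : ℂ)) (G := fun α => (B α : ℂ))
    (by fun_prop) (by fun_prop) h hF.normSq
  have e1 : ∀ K : ℝ → ℝ, (∫ α in (0:ℝ)..1, (K α : ℂ) * ((‖F α‖ ^ 2 : ℝ) : ℂ)).re =
      avg (fun α => ‖F α‖ ^ 2 * K α) := by
    intro K
    rw [avg, ← ofReal_re (∫ α in (0:ℝ)..1, ‖F α‖ ^ 2 * K α), ← intervalIntegral.integral_ofReal]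
    congr 2
    funext α
    push_cast
    ring
  rwa [e1, e1] at h1

lemma avg_re_mul_eq {F : ℝ → ℂ} (hF : Continuous F) {G : ℝ → ℝ} (hG : Continuous G) :
    avg (fun α => (F α).re * G α) = (∫ α in (0:ℝ)..1, F α * (G α : ℂ)).re := by
  have h1 := reCLM.intervalIntegral_comp_comm (μ := volume) (a := (0:ℝ)) (b := 1)
    (f := fun α => F α * (G α : ℂ)) (Continuous.intervalIntegrable (by fun_prop) _ _)
  rw [avg]
  simpa [mul_re] using h1

lemma sum_avg_even_le {Y R D : ℝ} (hY : 0 ≤ Y) {M : ℕ} (hM : 1 ≤ M) (hD0 : 0 ≤ D)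
    (hD : ∀ m ∈ moduli M R, 4 * ((m ^ 4).divisors.card : ℝ) ^ 4 ≤ D) (k : ℕ) :
    ∑ m ∈ moduli M R, avg (fun α => ‖hCop m Y R α‖ ^ 2 *
      ‖h (Y / m) m.minFac ((m ^ 4 : ℕ) * α)‖ ^ (2 * k)) ≤
    D * ((moduli M R).card * Y * avg (fun α => ‖h (Y / M) R α‖ ^ (2 * k)) +
      2 * avg (fun α => ‖trig (box ⌊Y / M ^ 4⌋₊ ⌊M * R⌋₊ ⌊2 * Y⌋₊) boxFreq α‖ *
        ‖h (Y / M) R ((2 : ℕ) * α)‖ ^ (2 * k))) := by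
  set G : ℝ → ℝ := fun α => ‖h (Y / M) R α‖ ^ (2 * k) with hG
  have hhc := continuous_h (Y / M) R
  have hGc : Continuous G := by fun_prop
  have hGp : Function.Periodic G 1 := fun α => by simp only [hG, periodic_h (Y / M) R α]
  have hG0 : ∀ α, 0 ≤ G α := fun α => by positivity
  have hpd : ∀ Q R, PosDefTrig (h Q R) := fun Q R => by
    rw [show h Q R = trig (smoothA Q R) (fun x => (x : ℤ) ^ 4) from funext (h_eq_trig Q R)]
    exact PosDefTrig.trig _ _
  have hsub : ∀ {Q Q' R R' : ℝ}, Q ≤ Q' → R ≤ R' → PosDefTrig fun α => h Q' R' α - h Q R α := by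
    intro Q Q' R R' h1 h2
    simp only [h_eq_trig]
    exact PosDefTrig.trig_subset (smoothA_mono h1 h2) _
  refine (sum_le_sum fun m hm => ?_).trans ((sum_avg_normSq_hCop_mul_le hY hD hGc hGp hG0).trans ?_)
  · rw [moduli, mem_filter, mem_Icc] at hm
    obtain ⟨⟨hm1, -⟩, hMm, hmR⟩ := hm
    have hmM : (M : ℝ) ≤ m := mod_cast hMm.le
    have hM0 : (0:ℝ) < M := mod_cast hM
    have hle : Y / m ≤ Y / M := by gcongr
    have hc := continuous_h (Y / m) m.minFac
    exact PosDefTrig.avg_normSq_mul_mono (PosDefTrig.trig _ _)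
      (A := fun α => ‖h (Y / m) m.minFac ((m ^ 4 : ℕ) * α)‖ ^ (2 * k))
      (B := fun α => G ((m ^ 4 : ℕ) * α)) (by fun_prop) (by fun_prop)
      ((PosDefTrig.norm_pow_sub (hpd _ _) (hpd _ _) (hsub hle hmR) k).comp_mul (m ^ 4))
  · refine mul_le_mul_of_nonneg_left (add_le_add le_rfl
      (mul_le_mul_of_nonneg_left ?_ (by norm_num))) hD0
    obtain ⟨t, ht, heq⟩ := exists_subset_box hM (R := R) hY
    have hc : Continuous fun α => (trig (diffSet M Y R) diffFreq α).re * G α :=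
      (continuous_re.comp (continuous_trig _ _)).mul hGc
    have hp : Function.Periodic (fun α => (trig (diffSet M Y R) diffFreq α).re * G α) 1 :=
      fun α => by simp only [hGp α, periodic_trig _ _ α]
    have hG2 : Continuous fun α : ℝ => G ((2 : ℕ) * α) := by fun_prop
    rw [← avg_comp_mul (n := 2) hc hp (by norm_num)]
    simp_rw [heq]
    rw [avg_re_mul_eq (continuous_trig _ _) hG2]
    have h1 := PosDefTrig.integral_re_mono (continuous_trig t boxFreq)
      (continuous_trig _ boxFreq) (PosDefTrig.trig_subset ht boxFreq)
      (((hpd (Y / M) R).norm_pow k).comp_mul 2)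
    refine h1.trans ?_
    have h2 := avg_re_mul_eq (continuous_trig
      (box ⌊Y / M ^ 4⌋₊ ⌊M * R⌋₊ ⌊2 * Y⌋₊) boxFreq) hG2
    refine (le_of_eq h2.symm).trans (avg_mono ?_ ?_ fun α => ?_)
    · exact (continuous_re.comp (continuous_trig _ _)).mul hG2
    · exact (continuous_trig _ _).norm.mul hG2
    · exact mul_le_mul_of_nonneg_right (re_le_norm _) (hG0 _)

/-! ### A pointwise bound for the box sum -/

lemma root_combine {x n Z T q μ L a b g H W E : ℝ} (hx : 0 ≤ x) (hn : 0 ≤ n) (hZ : 0 ≤ Z)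
    (hT : 0 ≤ T) (hμ0 : 0 ≤ μ) (hL : 0 ≤ L) (ha : 0 ≤ a) (hb : 0 ≤ b) (hg : 0 ≤ g) (hH : 0 ≤ H)
    (hW : 0 ≤ W) (hE : 0 ≤ E) (h1 : x ^ 2 ≤ n * (n * Z + 2 * T)) (h2 : T ^ 2 ≤ q * μ)
    (h3 : q ≤ L * (a + W)) (h4 : μ ≤ b + 2 * √(g * (g * H + 2 * E))) (h5 : μ ≤ H * g) :
    x ≤ n * Z ^ (1 / 2 : ℝ) + 8 * (n ^ (1 / 2 : ℝ) * L ^ (1 / 4 : ℝ)) *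
      ((a * b) ^ (1 / 4 : ℝ) + a ^ (1 / 4 : ℝ) * (g ^ 2 * H) ^ (1 / 8 : ℝ) +
        a ^ (1 / 4 : ℝ) * g ^ (1 / 8 : ℝ) * E ^ (1 / 8 : ℝ) + (H * g * W) ^ (1 / 4 : ℝ)) := by
  have two_rpow : ∀ p : ℝ, p ≤ 1 → (2:ℝ) ^ p ≤ 2 := fun p hp =>
    (rpow_le_rpow_of_exponent_le one_le_two hp).trans (le_of_eq (rpow_one 2))
  set S := g ^ 2 * H + 2 * (g * E) with hS
  have hS0 : 0 ≤ S := by positivity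
  have hSr : √(g * (g * H + 2 * E)) = S ^ (1 / 2 : ℝ) := by
    rw [Real.sqrt_eq_rpow]; congr 1; rw [hS]; ring
  rw [hSr] at h4
  have hS8 : S ^ (1 / 8 : ℝ) ≤ (g ^ 2 * H) ^ (1 / 8 : ℝ) +
      2 * (g ^ (1 / 8 : ℝ) * E ^ (1 / 8 : ℝ)) := by
    refine (Real.rpow_add_le_add_rpow (by positivity) (by positivity) (by norm_num)
      (by norm_num)).trans ?_
    rw [mul_rpow (x := 2) (y := g * E) (by norm_num) (by positivity),
      mul_rpow (x := g) (y := E) hg hE]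
    gcongr
    exact two_rpow (1 / 8) (by norm_num)
  have hT2 : T ^ 2 ≤ L * (a * b + 2 * (a * S ^ (1 / 2 : ℝ)) + H * g * W) := by
    calc T ^ 2 ≤ L * (a + W) * μ := h2.trans (mul_le_mul_of_nonneg_right h3 hμ0)
      _ = L * (a * μ + W * μ) := by ring
      _ ≤ L * (a * (b + 2 * S ^ (1 / 2 : ℝ)) + W * (H * g)) := by gcongr
      _ = _ := by ring
  have hT4 : T ^ (1 / 2 : ℝ) ≤ L ^ (1 / 4 : ℝ) * ((a * b) ^ (1 / 4 : ℝ) +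
      2 * (a ^ (1 / 4 : ℝ) * S ^ (1 / 8 : ℝ)) + (H * g * W) ^ (1 / 4 : ℝ)) := by
    calc T ^ (1 / 2 : ℝ) = (T ^ 2) ^ (1 / 4 : ℝ) := by
          rw [← rpow_natCast, ← rpow_mul hT]; norm_num
      _ ≤ (L * (a * b + 2 * (a * S ^ (1 / 2 : ℝ)) + H * g * W)) ^ (1 / 4 : ℝ) := by gcongr
      _ ≤ L ^ (1 / 4 : ℝ) * ((a * b) ^ (1 / 4 : ℝ) + (2 * (a * S ^ (1 / 2 : ℝ))) ^ (1 / 4 : ℝ) +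
          (H * g * W) ^ (1 / 4 : ℝ)) := by
        rw [mul_rpow hL (by positivity)]
        gcongr
        refine (Real.rpow_add_le_add_rpow (by positivity) (by positivity) (by norm_num)
          (by norm_num)).trans ?_
        gcongr
        exact Real.rpow_add_le_add_rpow (by positivity) (by positivity) (by norm_num)
          (by norm_num)
      _ ≤ _ := by
        rw [mul_rpow (x := 2) (y := a * S ^ (1 / 2 : ℝ)) (by norm_num) (by positivity),
          mul_rpow (x := a) (y := S ^ (1 / 2 : ℝ)) ha (by positivity),
          ← rpow_mul hS0, show (1 / 2 : ℝ) * (1 / 4) = 1 / 8 by norm_num]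
        gcongr
        exact two_rpow (1 / 4) (by norm_num)
  have hx1 : x ≤ n * Z ^ (1 / 2 : ℝ) + 2 * (n ^ (1 / 2 : ℝ) * T ^ (1 / 2 : ℝ)) := by
    calc x = (x ^ 2) ^ (1 / 2 : ℝ) := by
          rw [← rpow_natCast, ← rpow_mul hx]; norm_num
      _ ≤ (n ^ 2 * Z + 2 * (n * T)) ^ (1 / 2 : ℝ) := by
          gcongr
          exact h1.trans (le_of_eq (by ring))
      _ ≤ (n ^ 2 * Z) ^ (1 / 2 : ℝ) + (2 * (n * T)) ^ (1 / 2 : ℝ) :=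
          Real.rpow_add_le_add_rpow (by positivity) (by positivity) (by norm_num) (by norm_num)
      _ ≤ _ := by
          rw [mul_rpow (x := n ^ 2) (y := Z) (by positivity) hZ,
            mul_rpow (x := 2) (y := n * T) (by norm_num) (by positivity),
            mul_rpow (x := n) (y := T) hn hT, ← Real.sqrt_eq_rpow (n ^ 2), Real.sqrt_sq hn]
          gcongr
          exact two_rpow (1 / 2) (by norm_num)
  refine hx1.trans ?_
  have h6 : 0 ≤ (a * b) ^ (1 / 4 : ℝ) := by positivity
  have h7 : 0 ≤ (H * g * W) ^ (1 / 4 : ℝ) := by positivity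
  have h8 : T ^ (1 / 2 : ℝ) ≤ L ^ (1 / 4 : ℝ) * (2 * ((a * b) ^ (1 / 4 : ℝ) +
      a ^ (1 / 4 : ℝ) * (g ^ 2 * H) ^ (1 / 8 : ℝ) +
        2 * (a ^ (1 / 4 : ℝ) * g ^ (1 / 8 : ℝ) * E ^ (1 / 8 : ℝ)) +
          (H * g * W) ^ (1 / 4 : ℝ))) := by
    refine hT4.trans (mul_le_mul_of_nonneg_left ?_ (by positivity))
    have h9 := mul_le_mul_of_nonneg_left hS8 (show 0 ≤ a ^ (1 / 4 : ℝ) by positivity)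
    linarith
  have h10 := mul_le_mul_of_nonneg_left h8 (show 0 ≤ n ^ (1 / 2 : ℝ) by positivity)
  have h11 : 0 ≤ a ^ (1 / 4 : ℝ) * (g ^ 2 * H) ^ (1 / 8 : ℝ) := by positivity
  have h12 : 0 ≤ n ^ (1 / 2 : ℝ) * L ^ (1 / 4 : ℝ) := by positivity
  nlinarith [mul_nonneg h12 h6, mul_nonneg h12 h7, mul_nonneg h12 h11]

lemma distInt_two_mul_le (x : ℝ) : distInt (2 * x) ≤ 2 * distInt x := by
  refine (distInt_le (2 * x) (2 * round x)).trans (le_of_eq ?_)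
  rw [distInt]
  push_cast
  rw [← mul_sub, abs_mul, abs_of_pos (by norm_num : (0:ℝ) < 2)]

lemma minKer_distInt_le_two_mul {Z : ℝ} (hZ : 0 ≤ Z) (x : ℝ) :
    minKer Z (distInt x) ≤ 2 * minKer Z (distInt (2 * x)) := by
  have h0 := distInt_nonneg x
  have h1 := distInt_two_mul_le x
  have h2 := minKer_anti hZ (distInt_nonneg _) h1
  have h3 : minKer Z (distInt x) ≤ 2 * minKer Z (2 * distInt x) := by
    unfold minKer
    rw [mul_div_assoc', div_le_div_iff₀ (by positivity) (by positivity)]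
    nlinarith [mul_nonneg hZ h0]
  linarith

lemma norm_box_le (H N Z : ℕ) {D : ℝ} (hD1 : 1 ≤ D) (α : ℝ)
    (hD : ∀ n : ℕ, n ≠ 0 → n ≤ 28 * H * Z ^ 2 → (n.divisors.card : ℝ) ≤ D) :
    ‖trig (box H N Z) boxFreq α‖ ≤ H * N * (Z : ℝ) ^ (1 / 2 : ℝ) +
      8 * (3137 * D ^ 3 * (1 + Real.log (2 * (28 * H * Z ^ 2 : ℕ)))) ^ (1 / 4 : ℝ) *
      (H * (N : ℝ) ^ (3 / 4 : ℝ) * (Z : ℝ) ^ (3 / 4 : ℝ) +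
        (H : ℝ) ^ (7 / 8 : ℝ) * N * (Z : ℝ) ^ (3 / 4 : ℝ) +
        (H : ℝ) ^ (3 / 4 : ℝ) * (N : ℝ) ^ (3 / 4 : ℝ) * (Z : ℝ) ^ (5 / 8 : ℝ) *
          ‖monoDiff H N Z α‖ ^ (1 / 8 : ℝ) +
        (H : ℝ) ^ (3 / 4 : ℝ) * N * (Z : ℝ) ^ (1 / 4 : ℝ) *
          arcMaj (28 * H * Z ^ 2) Z (2 * α) ^ (1 / 4 : ℝ)) := by
  set Λ := 1 + Real.log (2 * (28 * H * Z ^ 2 : ℕ)) with hΛ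
  have hΛ1 : 1 ≤ Λ := by
    rcases Nat.eq_zero_or_pos (28 * H * Z ^ 2) with h0 | h0
    · rw [hΛ, h0]; simp
    · have : (1:ℝ) ≤ (28 * H * Z ^ 2 : ℕ) := mod_cast h0
      have := log_nonneg (show (1:ℝ) ≤ 2 * (28 * H * Z ^ 2 : ℕ) by linarith)
      linarith
  have hW0 := arcMaj_nonneg (28 * H * Z ^ 2) Z (2 * α)
  rcases Nat.eq_zero_or_pos (H * N * Z) with h0 | h0
  · have h1 := norm_trig_le (box H N Z) boxFreq α
    rw [card_box, h0, cast_zero] at h1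
    exact h1.trans (by positivity)
  have hH : 0 < H := Nat.pos_of_ne_zero fun h => by simp [h] at h0
  have hN : 0 < N := Nat.pos_of_ne_zero fun h => by simp [h] at h0
  have hZ : 0 < Z := Nat.pos_of_ne_zero fun h => by simp [h] at h0
  have hK : 28 ≤ 28 * H * Z ^ 2 := by
    have : 0 < H * Z ^ 2 := by positivity
    rw [mul_assoc]; omega
  have hq : quadSum H Z α ≤ 3137 * D ^ 3 * Λ * (H * Z ^ 2 + arcMaj (28 * H * Z ^ 2) Z (2 * α)) := by
    have h1 : ∑ k ∈ Icc (1:ℕ) (28 * H * Z ^ 2), minKer Z (distInt ((k : ℕ) * α)) ≤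
        2 * (Λ * (28 * (28 * H * Z ^ 2 : ℕ) + 8 * arcMaj (28 * H * Z ^ 2) Z (2 * α))) := by
      refine le_trans ?_ (mul_le_mul_of_nonneg_left (sum_minKer_le hK hZ (2 * α)) zero_le_two)
      rw [mul_sum]
      refine sum_le_sum fun k _ => ?_
      rw [show ((k : ℕ) : ℝ) * (2 * α) = 2 * (k * α) by ring]
      exact minKer_distInt_le_two_mul (cast_nonneg _) _
    refine (quadSum_le H Z (by linarith) α hD).trans ?_
    push_cast at h1
    have hD3 : 1 ≤ D ^ 3 := one_le_pow₀ hD1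
    have h2 := mul_le_mul_of_nonneg_left h1 (show 0 ≤ 2 * D ^ 3 by positivity)
    have h3 : 1 ≤ D ^ 3 * Λ := one_le_mul_of_one_le_of_one_le hD3 hΛ1
    have h4 : (0:ℝ) ≤ H * Z ^ 2 := by positivity
    have h5 := mul_nonneg (show 0 ≤ D ^ 3 * Λ by positivity) hW0
    nlinarith [mul_le_mul_of_nonneg_right h3 h4]
  have hmain := root_combine (norm_nonneg _) (by positivity) (by positivity) (norm_nonneg _)
    (monoSum_nonneg H N Z α) (by positivity) (by positivity) (by positivity) (by positivity)
    (by positivity) hW0 (norm_nonneg (monoDiff H N Z α)) (normSq_box_le H N Z α)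
    (normSq_boxTwo_le H N Z α) hq (monoSum_le H N Z α)
    ((monoSum_le_trivial H N Z α).trans (le_of_eq (by ring)))
  refine hmain.trans (le_of_eq ?_)
  generalize 3137 * D ^ 3 * Λ = L
  generalize arcMaj (28 * H * Z ^ 2) Z (2 * α) = W at hW0 ⊢
  have hH' : (0:ℝ) < H := mod_cast hH
  have hN' : (0:ℝ) < N := mod_cast hN
  have hZ' : (0:ℝ) < Z := mod_cast hZ
  generalize (H : ℝ) = H at hH' ⊢
  generalize (N : ℝ) = N at hN' ⊢
  generalize (Z : ℝ) = Z at hZ' ⊢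
  have e1 : (H * N) ^ (1 / 2 : ℝ) * (H * Z ^ 2 * (H * Z * N)) ^ (1 / 4 : ℝ) =
      H * N ^ (3 / 4 : ℝ) * Z ^ (3 / 4 : ℝ) := by
    rw [show H * Z ^ 2 * (H * Z * N) = H ^ (2:ℝ) * Z ^ (3:ℝ) * N by
      rw [rpow_two, show (3:ℝ) = (3:ℕ) by norm_num, rpow_natCast]; ring,
      mul_rpow (by positivity) (by positivity),
      mul_rpow (x := H ^ (2:ℝ) * Z ^ (3:ℝ)) (by positivity) (by positivity),
      mul_rpow (x := H ^ (2:ℝ)) (by positivity) (by positivity),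
      ← rpow_mul hH'.le, ← rpow_mul hZ'.le]
    calc _ = (H ^ (1 / 2 : ℝ) * H ^ (2 * (1 / 4) : ℝ)) * (N ^ (1 / 2 : ℝ) * N ^ (1 / 4 : ℝ)) *
          Z ^ (3 * (1 / 4) : ℝ) := by ring
      _ = _ := by
        rw [← rpow_add hH', ← rpow_add hN']
        norm_num
  have e2 : (H * N) ^ (1 / 2 : ℝ) * ((H * Z ^ 2) ^ (1 / 4 : ℝ) * ((Z * N ^ 2) ^ 2 * H) ^ (1 / 8 : ℝ)) =
      H ^ (7 / 8 : ℝ) * N * Z ^ (3 / 4 : ℝ) := by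
    rw [show (Z * N ^ 2) ^ 2 * H = Z ^ (2:ℝ) * N ^ (4:ℝ) * H by
      rw [rpow_two, show (4:ℝ) = (4:ℕ) by norm_num, rpow_natCast]; ring, ← rpow_two Z,
      mul_rpow (by positivity) (by positivity),
      mul_rpow (x := H) (y := Z ^ (2:ℝ)) (by positivity) (by positivity),
      mul_rpow (x := Z ^ (2:ℝ) * N ^ (4:ℝ)) (by positivity) (by positivity),
      mul_rpow (x := Z ^ (2:ℝ)) (by positivity) (by positivity),
      ← rpow_mul hN'.le, ← rpow_mul hZ'.le, ← rpow_mul hZ'.le]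
    calc _ = (H ^ (1 / 2 : ℝ) * H ^ (1 / 4 : ℝ) * H ^ (1 / 8 : ℝ)) *
          (N ^ (1 / 2 : ℝ) * N ^ (4 * (1 / 8) : ℝ)) *
          (Z ^ (2 * (1 / 4) : ℝ) * Z ^ (2 * (1 / 8) : ℝ)) := by ring
      _ = _ := by
        rw [← rpow_add hH', ← rpow_add hH', ← rpow_add hN', ← rpow_add hZ']
        norm_num
  have e3 : (H * N) ^ (1 / 2 : ℝ) * ((H * Z ^ 2) ^ (1 / 4 : ℝ) * (Z * N ^ 2) ^ (1 / 8 : ℝ)) =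
      H ^ (3 / 4 : ℝ) * N ^ (3 / 4 : ℝ) * Z ^ (5 / 8 : ℝ) := by
    rw [← rpow_two Z, ← rpow_two N,
      mul_rpow (by positivity) (by positivity),
      mul_rpow (x := H) (y := Z ^ (2:ℝ)) (by positivity) (by positivity),
      mul_rpow (x := Z) (y := N ^ (2:ℝ)) (by positivity) (by positivity),
      ← rpow_mul hN'.le, ← rpow_mul hZ'.le]
    calc _ = (H ^ (1 / 2 : ℝ) * H ^ (1 / 4 : ℝ)) * (N ^ (1 / 2 : ℝ) * N ^ (2 * (1 / 8) : ℝ)) *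
          (Z ^ (2 * (1 / 4) : ℝ) * Z ^ (1 / 8 : ℝ)) := by ring
      _ = _ := by
        rw [← rpow_add hH', ← rpow_add hN', ← rpow_add hZ']
        norm_num
  have e4 : (H * N) ^ (1 / 2 : ℝ) * (H * (Z * N ^ 2) * W) ^ (1 / 4 : ℝ) =
      H ^ (3 / 4 : ℝ) * N * Z ^ (1 / 4 : ℝ) * W ^ (1 / 4 : ℝ) := by
    rw [← rpow_two N,
      mul_rpow (by positivity) (by positivity),
      mul_rpow (x := H * (Z * N ^ (2:ℝ))) (by positivity) hW0,
      mul_rpow (x := H) (y := Z * N ^ (2:ℝ)) (by positivity) (by positivity),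
      mul_rpow (x := Z) (y := N ^ (2:ℝ)) (by positivity) (by positivity),
      ← rpow_mul hN'.le]
    calc _ = (H ^ (1 / 2 : ℝ) * H ^ (1 / 4 : ℝ)) *
          (N ^ (1 / 2 : ℝ) * N ^ (2 * (1 / 4) : ℝ)) * Z ^ (1 / 4 : ℝ) * W ^ (1 / 4 : ℝ) := by ring
      _ = _ := by
        rw [← rpow_add hH', ← rpow_add hN']
        norm_num
  rw [← e1, ← e2, ← e3, ← e4]
  ring

/-- Monomials in the sides of a box. -/
lemma floor_monomial_le {H N Z y M R a b c : ℝ} (hH : 0 ≤ H) (hN : 0 ≤ N) (hZ : 0 ≤ Z)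
    (hy : 0 < y) (hM : 0 < M) (hR : 1 ≤ R) (hHy : H ≤ y / M ^ 4) (hNM : N ≤ M * R)
    (hZy : Z ≤ 2 * y) (ha : 0 ≤ a) (hb : 0 ≤ b) (hb1 : b ≤ 1) (hc : 0 ≤ c) (hc1 : c ≤ 1) :
    H ^ a * N ^ b * Z ^ c ≤ 2 * R * (y ^ (a + c) * M ^ (b - 4 * a)) := by
  calc H ^ a * N ^ b * Z ^ c ≤ (y / M ^ 4) ^ a * (M * R) ^ b * (2 * y) ^ c := by gcongr
    _ = (2:ℝ) ^ c * R ^ b * (y ^ (a + c) * M ^ (b - 4 * a)) := by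
      rw [div_rpow hy.le (by positivity), mul_rpow (x := M) hM.le (by linarith),
        mul_rpow (x := 2) (by norm_num) hy.le, rpow_add hy, rpow_sub hM,
        rpow_mul hM.le, show (4:ℝ) = (4:ℕ) by norm_num, rpow_natCast]
      ring
    _ ≤ _ := by
      have h1 : (2:ℝ) ^ c ≤ 2 := by
        simpa using rpow_le_rpow_of_exponent_le one_le_two hc1
      have h2 : R ^ b ≤ R := by simpa using rpow_le_rpow_of_exponent_le hR hb1
      gcongr

/-! ### Mean values of the box sum against eighth powers -/

lemma periodic_arcMaj (K Z : ℕ) : Function.Periodic (arcMaj K Z) 1 := by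
  intro α
  simp only [arcMaj, arcKer, periodic_trig _ _ α]

lemma avg_mul_pow_eight_le {F U W g : ℝ → ℝ} (hF : Continuous F) (hU : Continuous U)
    (hW : Continuous W) (hg : Continuous g) (hU0 : ∀ α, 0 ≤ U α) (hW0 : ∀ α, 0 ≤ W α)
    (hg0 : ∀ α, 0 ≤ g α) (hWp : Function.Periodic W 1) (hgp : Function.Periodic g 1)
    {c₀ c₁ c₂ : ℝ} (hc₁ : 0 ≤ c₁) (hc₂ : 0 ≤ c₂)
    (h : ∀ α, F α ≤ c₀ + c₁ * U α ^ (1 / 8 : ℝ) + c₂ * W ((2 : ℕ) * α) ^ (1 / 4 : ℝ)) :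
    avg (fun α => F α * g ((2 : ℕ) * α) ^ 8) ≤ c₀ * avg (fun α => g α ^ (8 : ℝ)) +
      c₁ * (avg (fun α => U α ^ 2) ^ (1 / 16 : ℝ) *
        avg (fun α => g α ^ (128 / 15 : ℝ)) ^ (15 / 16 : ℝ)) +
      c₂ * (avg (fun α => W α * g α ^ 2) ^ (1 / 4 : ℝ) *
        avg (fun α => g α ^ (10 : ℝ)) ^ (3 / 4 : ℝ)) := by
  have dil : ∀ {f : ℝ → ℝ}, Continuous f → Function.Periodic f 1 →
      avg (fun α => f ((2 : ℕ) * α)) = avg f := fun hc hp => avg_comp_mul (n := 2) hc hp (by norm_num)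
  have hcg : ∀ t : ℝ, 0 ≤ t → Continuous fun α => g α ^ t := fun t ht =>
    hg.rpow_const fun _ => Or.inr ht
  have hpg : ∀ t : ℝ, Function.Periodic (fun α => g α ^ t) 1 := fun t α => by simp only [hgp α]
  have h2c : Continuous fun α : ℝ => ((2 : ℕ) : ℝ) * α := by fun_prop
  have hUc : Continuous fun α => U α ^ (1 / 8 : ℝ) := hU.rpow_const fun _ => Or.inr (by norm_num)
  have hWc : Continuous fun α => W ((2 : ℕ) * α) ^ (1 / 4 : ℝ) :=
    (hW.comp h2c).rpow_const fun _ => Or.inr (by norm_num)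
  have hg2 : Continuous fun α => g ((2 : ℕ) * α) ^ 8 := (hg.comp h2c).pow 8
  have hA := dil (hcg 8 (by norm_num)) (hpg 8)
  have hB := dil (hcg (128 / 15) (by norm_num)) (hpg (128 / 15))
  have hC := dil (hcg 10 (by norm_num)) (hpg 10)
  have hD := dil (hW.mul (hg.pow 2)) (fun α => by simp only [Pi.mul_apply, Pi.pow_apply, hWp α, hgp α])
  have k1 := holder_two (f := fun α => U α ^ 2) (g := fun α => g ((2 : ℕ) * α) ^ (128 / 15 : ℝ))
    (a := 1 / 16) (b := 15 / 16) (hU.pow 2) ((hcg _ (by norm_num)).comp h2c) (fun α => by positivity)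
    (fun α => by have := hg0 ((2 : ℕ) * α); positivity) (by norm_num) (by norm_num) (by norm_num)
  have k2 := holder_two (f := fun α => W ((2 : ℕ) * α) * g ((2 : ℕ) * α) ^ 2)
    (g := fun α => g ((2 : ℕ) * α) ^ (10 : ℝ)) (a := 1 / 4) (b := 3 / 4)
    ((hW.comp h2c).mul ((hg.comp h2c).pow 2)) ((hcg 10 (by norm_num)).comp h2c)
    (fun α => mul_nonneg (hW0 _) (by positivity))
    (fun α => by have := hg0 ((2 : ℕ) * α); positivity) (by norm_num) (by norm_num) (by norm_num)
  have e1 : ∀ α, (U α ^ 2) ^ (1 / 16 : ℝ) * (g ((2 : ℕ) * α) ^ (128 / 15 : ℝ)) ^ (15 / 16 : ℝ) =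
      U α ^ (1 / 8 : ℝ) * g ((2 : ℕ) * α) ^ 8 := fun α => by
    rw [← rpow_mul (hg0 _), ← rpow_natCast, ← rpow_mul (hU0 α), ← rpow_natCast (g _)]
    norm_num
  have e2 : ∀ α, (W ((2 : ℕ) * α) * g ((2 : ℕ) * α) ^ 2) ^ (1 / 4 : ℝ) *
      (g ((2 : ℕ) * α) ^ (10 : ℝ)) ^ (3 / 4 : ℝ) =
      W ((2 : ℕ) * α) ^ (1 / 4 : ℝ) * g ((2 : ℕ) * α) ^ 8 := fun α => by
    have h0 := hg0 ((2 : ℕ) * α)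
    rw [mul_rpow (hW0 _) (by positivity), ← rpow_mul h0, ← rpow_natCast,
      ← rpow_mul h0, ← rpow_natCast, mul_assoc, ← rpow_add_of_nonneg h0
      (by norm_num) (by norm_num)]
    norm_num
  simp only [Pi.mul_apply, Pi.pow_apply] at hD
  simp only [e1, hB] at k1
  simp only [e2, hC, hD] at k2
  have hg8 : ∀ α, g α ^ (8:ℝ) = g α ^ 8 := fun α => by
    rw [← rpow_natCast]; norm_num
  simp only [hg8] at hA ⊢
  have c1 : Continuous fun α => U α ^ (1 / 8 : ℝ) * g ((2 : ℕ) * α) ^ 8 := hUc.mul hg2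
  have c2 : Continuous fun α => W ((2 : ℕ) * α) ^ (1 / 4 : ℝ) * g ((2 : ℕ) * α) ^ 8 := hWc.mul hg2
  calc avg (fun α => F α * g ((2 : ℕ) * α) ^ 8) ≤
      avg (fun α => c₀ * g ((2 : ℕ) * α) ^ 8 + c₁ * (U α ^ (1 / 8 : ℝ) * g ((2 : ℕ) * α) ^ 8) +
        c₂ * (W ((2 : ℕ) * α) ^ (1 / 4 : ℝ) * g ((2 : ℕ) * α) ^ 8)) := by
        refine avg_mono (hF.mul hg2) (((hg2.const_mul c₀).add (c1.const_mul c₁)).add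
          (c2.const_mul c₂)) fun α => ?_
        refine (mul_le_mul_of_nonneg_right (h α)
          (pow_nonneg (hg0 ((2 : ℕ) * α)) 8)).trans (le_of_eq (by ring))
    _ = c₀ * avg (fun α => g ((2 : ℕ) * α) ^ 8) +
        c₁ * avg (fun α => U α ^ (1 / 8 : ℝ) * g ((2 : ℕ) * α) ^ 8) +
        c₂ * avg (fun α => W ((2 : ℕ) * α) ^ (1 / 4 : ℝ) * g ((2 : ℕ) * α) ^ 8) := by
        have d : Continuous fun α => c₀ * g ((2 : ℕ) * α) ^ 8 +
            c₁ * (U α ^ (1 / 8 : ℝ) * g ((2 : ℕ) * α) ^ 8) :=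
          (hg2.const_mul c₀).add (c1.const_mul c₁)
        rw [avg_add d (c2.const_mul c₂), avg_add (hg2.const_mul c₀) (c1.const_mul c₁), avg_const_mul, avg_const_mul,
          avg_const_mul]
    _ ≤ _ := by
        rw [hA]
        exact add_le_add (add_le_add le_rfl (mul_le_mul_of_nonneg_left k1 hc₁))
          (mul_le_mul_of_nonneg_left k2 hc₂)

lemma rpow_mul_div_rpow {y M : ℝ} (hy : 0 < y) (hM : 0 < M) (p q r : ℝ) :
    y ^ p * M ^ q * (y / M) ^ r = y ^ (p + r) * M ^ (q - r) := by
  rw [div_rpow hy.le hM.le, rpow_add hy, rpow_sub hM]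
  ring

lemma rpow_le_self_of_one_le {x p : ℝ} (hx : 1 ≤ x) (hp : p ≤ 1) : x ^ p ≤ x := by
  simpa using rpow_le_rpow_of_exponent_le hx hp

lemma avg_box_mul_pow_eight_le {H N Z : ℕ} {y M R R' L D a₁ a₂ a₃ l₁ l₂ l₃ : ℝ}
    (hM : 1 ≤ M) (hMy : M ≤ y) (hR : 1 ≤ R) (hHy : H ≤ y / M ^ 4) (hNM : N ≤ M * R)
    (hZy : Z ≤ 2 * y) (hD1 : 1 ≤ D) (hL1 : 1 ≤ L)
    (hL : 3137 * D ^ 3 * (1 + Real.log (2 * (28 * H * Z ^ 2 : ℕ))) ≤ L) (hLZ : 1 + Real.log Z ≤ L)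
    (hDK : ∀ n : ℕ, n ≠ 0 → n ≤ 28 * H * Z ^ 2 → (n.divisors.card : ℝ) ≤ D)
    (hDm : ∀ n : ℕ, n ≠ 0 → n ≤ Z * N ^ 8 * H ^ 3 → (n.divisors.card : ℝ) ≤ D)
    (hDQ : ∀ n : ℕ, n ≠ 0 → (n : ℝ) ≤ (y / M) ^ 4 → (n.divisors.card : ℝ) ≤ D)
    (ha₁ : 1 ≤ a₁) (ha₂ : 1 ≤ a₂) (ha₃ : 1 ≤ a₃)
    (H₁ : avg (fun α => ‖h (y / M) R' α‖ ^ (8:ℝ)) ≤ a₁ * (y / M) ^ l₁)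
    (H₂ : avg (fun α => ‖h (y / M) R' α‖ ^ (128 / 15 : ℝ)) ≤ a₂ * (y / M) ^ l₂)
    (H₃ : avg (fun α => ‖h (y / M) R' α‖ ^ (10:ℝ)) ≤ a₃ * (y / M) ^ l₃) :
    avg (fun α => ‖trig (box H N Z) boxFreq α‖ * ‖h (y / M) R' ((2 : ℕ) * α)‖ ^ 8) ≤
      40000 * L ^ 2 * D ^ 5 * R * (a₁ * a₂ * a₃) *
      (y ^ (3 / 2 + l₁) * M ^ (-3 - l₁) + y ^ (7 / 4 + l₁) * M ^ (-13 / 4 - l₁) +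
        y ^ (13 / 8 + l₁) * M ^ (-5 / 2 - l₁) +
        y ^ (25 / 16 + l₂ * (15 / 16)) * M ^ (-21 / 8 - l₂ * (15 / 16)) +
        y ^ (3 / 2 + l₃ * (3 / 4)) * M ^ (-9 / 4 - l₃ * (3 / 4))) := by
  have hM0 : 0 < M := by linarith
  have hy : 0 < y := by linarith
  have hQ1 : 1 ≤ y / M := by rwa [le_div_iff₀ hM0, one_mul]
  rcases Nat.eq_zero_or_pos (H * N * Z) with h0 | h0
  · have h1 : ∀ α, ‖trig (box H N Z) boxFreq α‖ = 0 := fun α => by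
      have h1 := norm_trig_le (box H N Z) boxFreq α
      rw [card_box, h0, cast_zero] at h1
      exact le_antisymm h1 (norm_nonneg _)
    simp only [h1, zero_mul, avg_const]
    positivity
  have hH : 0 < H := Nat.pos_of_ne_zero fun h => by simp [h] at h0
  have hZ : 0 < Z := Nat.pos_of_ne_zero fun h => by simp [h] at h0
  have hK : 28 ≤ 28 * H * Z ^ 2 := by
    have : 0 < H * Z ^ 2 := by positivity
    rw [mul_assoc]; omega
  have hmono (a b c : ℝ) (hn : 0 ≤ a ∧ 0 ≤ b ∧ b ≤ 1 ∧ 0 ≤ c ∧ c ≤ 1) :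
      (H : ℝ) ^ a * (N : ℝ) ^ b * (Z : ℝ) ^ c ≤ 2 * R * (y ^ (a + c) * M ^ (b - 4 * a)) :=
    floor_monomial_le (cast_nonneg _) (cast_nonneg _)
      (cast_nonneg _) hy hM0 hR hHy hNM hZy hn.1 hn.2.1 hn.2.2.1 hn.2.2.2.1 hn.2.2.2.2
  have hpt : ∀ α, ‖trig (box H N Z) boxFreq α‖ ≤ (H * N * (Z : ℝ) ^ (1 / 2 : ℝ) +
      8 * L * (H * (N : ℝ) ^ (3 / 4 : ℝ) * (Z : ℝ) ^ (3 / 4 : ℝ) +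
        (H : ℝ) ^ (7 / 8 : ℝ) * N * (Z : ℝ) ^ (3 / 4 : ℝ))) +
      8 * L * ((H : ℝ) ^ (3 / 4 : ℝ) * (N : ℝ) ^ (3 / 4 : ℝ) * (Z : ℝ) ^ (5 / 8 : ℝ)) *
        ‖monoDiff H N Z α‖ ^ (1 / 8 : ℝ) +
      8 * L * ((H : ℝ) ^ (3 / 4 : ℝ) * N * (Z : ℝ) ^ (1 / 4 : ℝ)) *
        arcMaj (28 * H * Z ^ 2) Z ((2 : ℕ) * α) ^ (1 / 4 : ℝ) := fun α => by
    have hW0 := arcMaj_nonneg (28 * H * Z ^ 2) Z (2 * α)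
    refine (norm_box_le H N Z hD1 α hDK).trans ?_
    have h1 : (3137 * D ^ 3 * (1 + Real.log (2 * (28 * H * Z ^ 2 : ℕ)))) ^ (1 / 4 : ℝ) ≤ L := by
      refine (rpow_le_rpow ?_ hL (by norm_num)).trans (rpow_le_self_of_one_le hL1 (by norm_num))
      have : (1:ℝ) ≤ (28 * H * Z ^ 2 : ℕ) := mod_cast (by omega : 1 ≤ 28 * H * Z ^ 2)
      have := log_nonneg (show (1:ℝ) ≤ 2 * (28 * H * Z ^ 2 : ℕ) by linarith)
      positivity
    refine (add_le_add le_rfl (mul_le_mul_of_nonneg_right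
      (mul_le_mul_of_nonneg_left h1 (by norm_num)) (by positivity))).trans (le_of_eq ?_)
    push_cast
    ring
  have hmain := avg_mul_pow_eight_le (F := fun α => ‖trig (box H N Z) boxFreq α‖)
    (U := fun α => ‖monoDiff H N Z α‖) (W := arcMaj (28 * H * Z ^ 2) Z)
    (g := fun α => ‖h (y / M) R' α‖) (continuous_trig _ _).norm (continuous_trig _ _).norm
    (continuous_arcMaj _ _) (continuous_h _ _).norm (fun _ => norm_nonneg _) (arcMaj_nonneg _ _)
    (fun _ => norm_nonneg _) (periodic_arcMaj _ _) (fun α => by simp only [periodic_h _ _ α])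
    (by positivity) (by positivity) hpt
  refine hmain.trans ?_
  have hA (s : ℝ) : 0 ≤ avg (fun α => ‖h (y / M) R' α‖ ^ s) := avg_nonneg fun _ => by positivity
  have hU : avg (fun α => ‖monoDiff H N Z α‖ ^ 2) ^ (1 / 16 : ℝ) ≤
      D ^ 5 * ((H : ℝ) ^ (1 / 8 : ℝ) * (N : ℝ) ^ (1 / 8 : ℝ) * (Z : ℝ) ^ (1 / 16 : ℝ)) := by
    have h1 := avg_normSq_monoDiff_le H N Z (by linarith) hDm
    refine (rpow_le_rpow (avg_nonneg fun _ => by positivity) h1 (by norm_num)).trans ?_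
    rw [mul_rpow (x := D ^ 5) (by positivity) (by positivity),
      mul_rpow (x := (Z:ℝ) * N ^ 2) (by positivity) (by positivity),
      mul_rpow (x := (Z:ℝ)) (by positivity) (by positivity), ← rpow_two (H:ℝ),
      ← rpow_two (N:ℝ), ← rpow_mul (cast_nonneg _), ← rpow_mul (cast_nonneg _),
      show (2:ℝ) * (1 / 16) = 1 / 8 by norm_num]
    have h2 : (D ^ 5) ^ (1 / 16 : ℝ) ≤ D ^ 5 :=
      rpow_le_self_of_one_le (one_le_pow₀ hD1) (by norm_num)
    refine (mul_le_mul_of_nonneg_right h2 (by positivity)).trans (le_of_eq (by ring))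
  have hW : avg (fun α => arcMaj (28 * H * Z ^ 2) Z α * ‖h (y / M) R' α‖ ^ 2) ^ (1 / 4 : ℝ) ≤
      2240 * L * D * (y ^ (1 / 2 : ℝ) * M ^ (-1 / 4 : ℝ)) := by
    have h1 := avg_arcMaj_mul_normSq_h_le hK hZ (R := R') hQ1 (by linarith) hDQ
    have h2 : 448 * (1 + Real.log Z) * (2 * Z * (y / M) + D * (y / M) ^ 2) ≤
        2240 * L * D * (y ^ (2:ℝ) * M ^ (-1:ℝ)) := by
      have h3 : y / M ≤ y := div_le_self hy.le hM
      calc _ ≤ 448 * L * (2 * (2 * y) * (y / M) + D * ((y / M) * y)) := by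
            rw [sq]; gcongr
        _ ≤ 448 * L * (D * (2 * (2 * y) * (y / M)) + D * ((y / M) * y)) := by
            refine mul_le_mul_of_nonneg_left (add_le_add ?_ le_rfl) (by positivity)
            exact le_mul_of_one_le_left (by positivity) hD1
        _ = _ := by
            rw [rpow_two, rpow_neg_one]
            ring
    have h4 : 0 ≤ avg (fun α => arcMaj (28 * H * Z ^ 2) Z α * ‖h (y / M) R' α‖ ^ 2) :=
      avg_nonneg fun α => mul_nonneg (arcMaj_nonneg _ _ _) (by positivity)
    refine (rpow_le_rpow h4 (h1.trans h2) (by norm_num)).trans ?_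
    have hLD : 1 ≤ 2240 * L * D := by nlinarith
    rw [mul_rpow (x := 2240 * L * D) (by positivity) (by positivity),
      mul_rpow (x := y ^ (2:ℝ)) (by positivity) (by positivity), ← rpow_mul hy.le,
      ← rpow_mul hM0.le]
    refine (mul_le_mul_of_nonneg_right (rpow_le_self_of_one_le hLD (by norm_num))
      (by positivity)).trans (le_of_eq ?_)
    norm_num
  have hB {s r a l : ℝ} (ha : 1 ≤ a) (hr : 0 ≤ r ∧ r ≤ 1)
      (hs : avg (fun α => ‖h (y / M) R' α‖ ^ s) ≤ a * (y / M) ^ l) :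
      avg (fun α => ‖h (y / M) R' α‖ ^ s) ^ r ≤ a * (y / M) ^ (l * r) := by
    refine (rpow_le_rpow (hA s) hs hr.1).trans ?_
    rw [mul_rpow (by linarith) (by positivity), rpow_mul (by positivity)]
    exact mul_le_mul_of_nonneg_right (rpow_le_self_of_one_le ha hr.2) (by positivity)
  have hB₂ := hB (r := 15 / 16) ha₂ (by norm_num) H₂
  have hB₃ := hB (r := 3 / 4) ha₃ (by norm_num) H₃
  have hA₂ := hA (128 / 15)
  have hA₃ := hA 10
  have m₁ := hmono 1 1 (1 / 2) (by norm_num)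
  have m₂ := hmono 1 (3 / 4) (3 / 4) (by norm_num)
  have m₃ := hmono (7 / 8) 1 (3 / 4) (by norm_num)
  have m₄ := hmono (7 / 8) (7 / 8) (11 / 16) (by norm_num)
  have m₅ := hmono (3 / 4) 1 (1 / 4) (by norm_num)
  simp only [rpow_one] at m₁ m₂ m₃ m₅
  have hH' : (0:ℝ) < H := mod_cast hH
  have hZ' : (0:ℝ) < Z := mod_cast hZ
  have hN' : (0:ℝ) < N := by
    exact_mod_cast Nat.pos_of_ne_zero fun h => by simp [h] at h0
  set W := L ^ 2 * D ^ 5 * R * (a₁ * a₂ * a₃) with hWdef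
  have hL2 : 1 ≤ L ^ 2 := one_le_pow₀ hL1
  have hD5 : 1 ≤ D ^ 5 := one_le_pow₀ hD1
  have ha12 : 1 ≤ a₁ * a₂ := one_le_mul_of_one_le_of_one_le ha₁ ha₂
  have ha13 : 1 ≤ a₁ * a₃ := one_le_mul_of_one_le_of_one_le ha₁ ha₃
  have ha23 : 1 ≤ a₂ * a₃ := one_le_mul_of_one_le_of_one_le ha₂ ha₃
  have one_mul_one : ∀ {u v : ℝ}, 1 ≤ u → 1 ≤ v → 1 ≤ u * v :=
    fun hu hv => one_le_mul_of_one_le_of_one_le hu hv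
  have w₂ : L * R * a₁ ≤ W := by
    rw [hWdef, show L ^ 2 * D ^ 5 * R * (a₁ * a₂ * a₃) = L * R * a₁ * (L * D ^ 5 * (a₂ * a₃)) by ring]
    exact le_mul_of_one_le_right (by positivity) (one_mul_one (one_mul_one hL1 hD5) ha23)
  have w₁ : R * a₁ ≤ W := by
    refine le_trans ?_ w₂
    rw [mul_assoc]
    exact le_mul_of_one_le_left (by positivity) hL1
  have w₄ : L * D ^ 5 * R * a₂ ≤ W := by
    rw [hWdef, show L ^ 2 * D ^ 5 * R * (a₁ * a₂ * a₃) = L * D ^ 5 * R * a₂ * (L * (a₁ * a₃)) by ring]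
    exact le_mul_of_one_le_right (by positivity) (one_mul_one hL1 ha13)
  have w₅ : L ^ 2 * D * R * a₃ ≤ W := by
    rw [hWdef, show L ^ 2 * D ^ 5 * R * (a₁ * a₂ * a₃) = L ^ 2 * D * R * a₃ * (D ^ 4 * (a₁ * a₂)) by ring]
    exact le_mul_of_one_le_right (by positivity) (one_mul_one (one_le_pow₀ hD1) ha12)
  have T := fun p q r => rpow_mul_div_rpow (y := y) (M := M) hy hM0 p q r
  have t₁ : H * N * (Z : ℝ) ^ (1 / 2 : ℝ) * avg (fun α => ‖h (y / M) R' α‖ ^ (8:ℝ)) ≤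
      2 * W * (y ^ (3 / 2 + l₁) * M ^ (-3 - l₁)) := by
    calc _ ≤ 2 * R * (y ^ (1 + 1 / 2 : ℝ) * M ^ (1 - 4 * 1 : ℝ)) * (a₁ * (y / M) ^ l₁) :=
          mul_le_mul m₁ H₁ (hA _) (by positivity)
      _ = 2 * (R * a₁) * (y ^ (1 + 1 / 2 : ℝ) * M ^ (1 - 4 * 1 : ℝ) * (y / M) ^ l₁) := by ring
      _ ≤ _ := by
        rw [T]; norm_num only
        exact mul_le_mul_of_nonneg_right (by linarith) (by positivity)
  have t₂ : 8 * L * (H * (N : ℝ) ^ (3 / 4 : ℝ) * (Z : ℝ) ^ (3 / 4 : ℝ)) *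
      avg (fun α => ‖h (y / M) R' α‖ ^ (8:ℝ)) ≤ 16 * W * (y ^ (7 / 4 + l₁) * M ^ (-13 / 4 - l₁)) := by
    calc _ ≤ 8 * L * (2 * R * (y ^ (1 + 3 / 4 : ℝ) * M ^ (3 / 4 - 4 * 1 : ℝ))) *
          (a₁ * (y / M) ^ l₁) :=
          mul_le_mul (mul_le_mul_of_nonneg_left m₂ (by positivity)) H₁ (hA _) (by positivity)
      _ = 16 * (L * R * a₁) * (y ^ (1 + 3 / 4 : ℝ) * M ^ (3 / 4 - 4 * 1 : ℝ) * (y / M) ^ l₁) := by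
          ring
      _ ≤ _ := by
        rw [T]; norm_num only
        exact mul_le_mul_of_nonneg_right (by linarith) (by positivity)
  have t₃ : 8 * L * ((H : ℝ) ^ (7 / 8 : ℝ) * N * (Z : ℝ) ^ (3 / 4 : ℝ)) *
      avg (fun α => ‖h (y / M) R' α‖ ^ (8:ℝ)) ≤ 16 * W * (y ^ (13 / 8 + l₁) * M ^ (-5 / 2 - l₁)) := by
    calc _ ≤ 8 * L * (2 * R * (y ^ (7 / 8 + 3 / 4 : ℝ) * M ^ (1 - 4 * (7 / 8) : ℝ))) *
          (a₁ * (y / M) ^ l₁) :=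
          mul_le_mul (mul_le_mul_of_nonneg_left m₃ (by positivity)) H₁ (hA _) (by positivity)
      _ = 16 * (L * R * a₁) * (y ^ (7 / 8 + 3 / 4 : ℝ) * M ^ (1 - 4 * (7 / 8) : ℝ) *
          (y / M) ^ l₁) := by ring
      _ ≤ _ := by
        rw [T]; norm_num only
        exact mul_le_mul_of_nonneg_right (by linarith) (by positivity)
  have t₄ : 8 * L * ((H : ℝ) ^ (3 / 4 : ℝ) * (N : ℝ) ^ (3 / 4 : ℝ) * (Z : ℝ) ^ (5 / 8 : ℝ)) *
      (avg (fun α => ‖monoDiff H N Z α‖ ^ 2) ^ (1 / 16 : ℝ) *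
        avg (fun α => ‖h (y / M) R' α‖ ^ (128 / 15 : ℝ)) ^ (15 / 16 : ℝ)) ≤
      16 * W * (y ^ (25 / 16 + l₂ * (15 / 16)) * M ^ (-21 / 8 - l₂ * (15 / 16))) := by
    calc _ ≤ 8 * L * ((H : ℝ) ^ (3 / 4 : ℝ) * (N : ℝ) ^ (3 / 4 : ℝ) * (Z : ℝ) ^ (5 / 8 : ℝ)) *
          (D ^ 5 * ((H : ℝ) ^ (1 / 8 : ℝ) * (N : ℝ) ^ (1 / 8 : ℝ) * (Z : ℝ) ^ (1 / 16 : ℝ)) *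
            (a₂ * (y / M) ^ (l₂ * (15 / 16)))) :=
          mul_le_mul_of_nonneg_left (mul_le_mul hU hB₂ (by positivity) (by positivity))
            (by positivity)
      _ = 8 * L * ((H : ℝ) ^ (7 / 8 : ℝ) * (N : ℝ) ^ (7 / 8 : ℝ) * (Z : ℝ) ^ (11 / 16 : ℝ)) *
          (D ^ 5 * (a₂ * (y / M) ^ (l₂ * (15 / 16)))) := by
        rw [show (7 / 8 : ℝ) = 3 / 4 + 1 / 8 by norm_num,
          show (11 / 16 : ℝ) = 5 / 8 + 1 / 16 by norm_num, rpow_add hH', rpow_add hN',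
          rpow_add hZ']
        ring
      _ ≤ 8 * L * (2 * R * (y ^ (7 / 8 + 11 / 16 : ℝ) * M ^ (7 / 8 - 4 * (7 / 8) : ℝ))) *
          (D ^ 5 * (a₂ * (y / M) ^ (l₂ * (15 / 16)))) :=
          mul_le_mul_of_nonneg_right (mul_le_mul_of_nonneg_left m₄ (by positivity)) (by positivity)
      _ = 16 * (L * D ^ 5 * R * a₂) * (y ^ (7 / 8 + 11 / 16 : ℝ) * M ^ (7 / 8 - 4 * (7 / 8) : ℝ) *
          (y / M) ^ (l₂ * (15 / 16))) := by ring
      _ ≤ _ := by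
        rw [T]; norm_num only
        exact mul_le_mul_of_nonneg_right (by linarith) (by positivity)
  have t₅ : 8 * L * ((H : ℝ) ^ (3 / 4 : ℝ) * N * (Z : ℝ) ^ (1 / 4 : ℝ)) *
      (avg (fun α => arcMaj (28 * H * Z ^ 2) Z α * ‖h (y / M) R' α‖ ^ 2) ^ (1 / 4 : ℝ) *
        avg (fun α => ‖h (y / M) R' α‖ ^ (10:ℝ)) ^ (3 / 4 : ℝ)) ≤
      35840 * W * (y ^ (3 / 2 + l₃ * (3 / 4)) * M ^ (-9 / 4 - l₃ * (3 / 4))) := by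
    calc _ ≤ 8 * L * (2 * R * (y ^ (3 / 4 + 1 / 4 : ℝ) * M ^ (1 - 4 * (3 / 4) : ℝ))) *
          (2240 * L * D * (y ^ (1 / 2 : ℝ) * M ^ (-1 / 4 : ℝ)) * (a₃ * (y / M) ^ (l₃ * (3 / 4)))) :=
          mul_le_mul (mul_le_mul_of_nonneg_left m₅ (by positivity))
            (mul_le_mul hW hB₃ (by positivity) (by positivity))
            (mul_nonneg (rpow_nonneg (avg_nonneg fun α =>
              mul_nonneg (arcMaj_nonneg _ _ _) (by positivity)) _) (by positivity)) (by positivity)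
      _ = 35840 * (L ^ 2 * D * R * a₃) * ((y ^ (3 / 4 + 1 / 4 : ℝ) * y ^ (1 / 2 : ℝ)) *
          (M ^ (1 - 4 * (3 / 4) : ℝ) * M ^ (-1 / 4 : ℝ)) * (y / M) ^ (l₃ * (3 / 4))) := by ring
      _ ≤ _ := by
        rw [← rpow_add hy, ← rpow_add hM0, T]; norm_num only
        exact mul_le_mul_of_nonneg_right (by linarith) (by positivity)
  clear hWdef
  have hW0 : 0 ≤ W := le_trans (by positivity) w₁
  have n₁ : 0 ≤ W * (y ^ (3 / 2 + l₁) * M ^ (-3 - l₁)) := by positivity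
  have n₂ : 0 ≤ W * (y ^ (7 / 4 + l₁) * M ^ (-13 / 4 - l₁)) := by positivity
  have n₃ : 0 ≤ W * (y ^ (13 / 8 + l₁) * M ^ (-5 / 2 - l₁)) := by positivity
  have n₄ : 0 ≤ W * (y ^ (25 / 16 + l₂ * (15 / 16)) * M ^ (-21 / 8 - l₂ * (15 / 16))) := by
    positivity
  have n₅ : 0 ≤ W * (y ^ (3 / 2 + l₃ * (3 / 4)) * M ^ (-9 / 4 - l₃ * (3 / 4))) := by positivity
  have e : 40000 * L ^ 2 * D ^ 5 * R * (a₁ * a₂ * a₃) = 40000 * W := by ring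
  rw [e]
  linarith

lemma log_le_of_le_mul_pow {X : ℝ} (hX : 1 ≤ X) {n : ℕ} {k : ℕ} (h : (n : ℝ) ≤ 224 * X ^ k) :
    Real.log n ≤ 8 + k * Real.log X := by
  have hX0 := log_nonneg hX
  rcases Nat.eq_zero_or_pos n with rfl | hn
  · simp only [cast_zero, Real.log_zero]; positivity
  have h1 := log_le_log (mod_cast hn) h
  rw [log_mul (by norm_num) (by positivity), log_pow] at h1
  have h2 : Real.log 224 ≤ 8 := by
    have h3 := log_le_log (by norm_num) (show (224:ℝ) ≤ 2 ^ 8 by norm_num)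
    rw [log_pow] at h3
    have := log_two_lt_d9
    push_cast at h3
    linarith
  linarith

lemma exists_slow_sum_avg_eight {l₁ l₂ l₃ : ℝ} (H₁ : Adm 8 l₁) (H₂ : Adm (128 / 15) l₂)
    (H₃ : Adm 10 l₃) :
    ∃ v : ℝ → ℝ → ℝ, Slow v ∧ ∀ (X R y R' : ℝ) (M : ℕ), 1 ≤ X → 2 ≤ R → 2 ≤ R' → R' ≤ R →
      1 ≤ M → (M : ℝ) ≤ y → y ≤ X →
      ∑ m ∈ moduli M R', avg (fun α => ‖hCop m y R' α‖ ^ 2 *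
        ‖h (y / m) m.minFac ((m ^ 4 : ℕ) * α)‖ ^ (8:ℝ)) ≤
      v X R * (y ^ (1 + l₁) * (M : ℝ) ^ (1 - l₁) +
        (y ^ (3 / 2 + l₁) * (M : ℝ) ^ (-3 - l₁) + y ^ (7 / 4 + l₁) * (M : ℝ) ^ (-13 / 4 - l₁) +
        y ^ (13 / 8 + l₁) * (M : ℝ) ^ (-5 / 2 - l₁) +
        y ^ (25 / 16 + l₂ * (15 / 16)) * (M : ℝ) ^ (-21 / 8 - l₂ * (15 / 16)) +
        y ^ (3 / 2 + l₃ * (3 / 4)) * (M : ℝ) ^ (-9 / 4 - l₃ * (3 / 4)))) := by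
  obtain ⟨g₁, hg₁, G₁⟩ := H₁
  obtain ⟨g₂, hg₂, G₂⟩ := H₂
  obtain ⟨g₃, hg₃, G₃⟩ := H₃
  obtain ⟨D, hD, hDb⟩ := exists_slow_card_divisors 300
  have hE := hD.comp_mul
  set E : ℝ → ℝ → ℝ := fun X R => D (X * R) R with hEdef
  have hL : Slow fun X R => 30000 * E X R ^ 3 * (1 + Real.log X) :=
    ((Slow.const (by norm_num : (1:ℝ) ≤ 30000)).mul (hE.pow 3)).mul Slow.one_add_log
  set L : ℝ → ℝ → ℝ := fun X R => 30000 * E X R ^ 3 * (1 + Real.log X) with hLdef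
  refine ⟨_, ((Slow.const (by norm_num : (1:ℝ) ≤ 4)).mul (hE.pow 4)).mul
    ((Slow.snd.mul hg₁).add ((Slow.const one_le_two).mul
      (((((Slow.const (by norm_num : (1:ℝ) ≤ 40000)).mul (hL.pow 2)).mul (hE.pow 5)).mul
        Slow.snd).mul ((hg₁.mul hg₂).mul hg₃)))),
    fun X R y R' M hX hR hR' hRR hM hMy hyX => ?_⟩
  have hM1 : (1:ℝ) ≤ M := mod_cast hM
  have hM0 : (0:ℝ) < M := by linarith
  have hy0 : 0 < y := by linarith
  have hE1 := hE.1 X R hX hR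
  have hL1 := hL.1 X R hX hR
  have hyM : 1 ≤ y / M := by rwa [le_div_iff₀ hM0, one_mul]
  have hyMX : y / M ≤ X := (div_le_self hy0.le hM1).trans hyX
  have hXR : 1 ≤ X * R := by nlinarith
  have hlog := log_nonneg hX
  have hdiv : ∀ n : ℕ, n ≠ 0 → (n : ℝ) ≤ (300 : ℕ) * (X * R) ^ 300 → (n.divisors.card : ℝ) ≤ E X R :=
    fun n hn hn' => hDb _ _ hXR hR n hn hn'
  have hpow4 : ∀ n : ℕ, n ≠ 0 → (n : ℝ) ≤ (X * R) ^ 4 → (n.divisors.card : ℝ) ≤ E X R :=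
    fun n hn hn' => hdiv n hn (by
      push_cast
      have h1 : (X * R) ^ 4 ≤ (X * R) ^ 300 := pow_le_pow_right₀ hXR (by norm_num)
      have : 0 ≤ (X * R) ^ 300 := by positivity
      linarith)
  have hmod : ∀ m ∈ moduli M R', 4 * ((m ^ 4).divisors.card : ℝ) ^ 4 ≤ 4 * E X R ^ 4 := by
    intro m hm
    obtain ⟨h1, h2, -⟩ := le_of_mem_moduli (by linarith) hm
    have h3 : (m : ℝ) ≤ X * R := h2.trans (by gcongr; linarith)
    have := hpow4 (m ^ 4) (by positivity) (by push_cast; gcongr)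
    gcongr
  have hev := sum_avg_even_le hy0.le hM (by positivity) hmod 4
  have e8 : ∀ x : ℝ, x ^ (8:ℝ) = x ^ (2 * 4) := fun x => by
    rw [← rpow_natCast]; norm_num
  have hA₁ := G₁ X R (y / M) R' hX hR hyM hyMX hR' hRR
  have hA₂ := G₂ X R (y / M) R' hX hR hyM hyMX hR' hRR
  have hA₃ := G₃ X R (y / M) R' hX hR hyM hyMX hR' hRR
  have hH : (⌊y / M ^ 4⌋₊ : ℝ) ≤ y / M ^ 4 := floor_le (by positivity)
  have hZ : (⌊2 * y⌋₊ : ℝ) ≤ 2 * y := floor_le (by positivity)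
  have hN : (⌊M * R'⌋₊ : ℝ) ≤ M * R := (floor_le (by positivity)).trans (by gcongr)
  have hHX : (⌊y / M ^ 4⌋₊ : ℝ) ≤ X :=
    hH.trans ((div_le_self hy0.le (one_le_pow₀ hM1)).trans hyX)
  have hZX : (⌊2 * y⌋₊ : ℝ) ≤ 2 * X := hZ.trans (by linarith)
  have hE3 : 1 ≤ E X R ^ 3 := one_le_pow₀ hE1
  have hb₁ : 3137 * E X R ^ 3 * (1 + Real.log (2 * (28 * ⌊y / M ^ 4⌋₊ * ⌊2 * y⌋₊ ^ 2 : ℕ))) ≤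
      L X R := by
    have h1 := log_le_of_le_mul_pow hX (n := 2 * (28 * ⌊y / M ^ 4⌋₊ * ⌊2 * y⌋₊ ^ 2)) (k := 3) (by
      push_cast
      calc (2:ℝ) * (28 * ⌊y / M ^ 4⌋₊ * ⌊2 * y⌋₊ ^ 2) ≤ 2 * (28 * X * (2 * X) ^ 2) := by gcongr
        _ = _ := by ring)
    rw [cast_mul, Nat.cast_ofNat] at h1
    calc _ ≤ 3137 * E X R ^ 3 * (9 * (1 + Real.log X)) := by
          refine mul_le_mul_of_nonneg_left ?_ (by positivity)
          push_cast at h1 ⊢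
          linarith
      _ ≤ _ := by
          rw [hLdef]
          have : 0 ≤ E X R ^ 3 * (1 + Real.log X) := by positivity
          dsimp only
          linarith
  have hb₂ : 1 + Real.log (⌊2 * y⌋₊ : ℕ) ≤ L X R := by
    have h1 := log_le_of_le_mul_pow hX (n := ⌊2 * y⌋₊) (k := 1) (by linarith)
    have : 1 * (1 + Real.log X) ≤ E X R ^ 3 * (1 + Real.log X) :=
      mul_le_mul_of_nonneg_right hE3 (by linarith)
    rw [hLdef]
    push_cast at h1
    dsimp only
    linarith
  have hbox : ∀ n : ℕ, n ≤ 28 * (⌊y / M ^ 4⌋₊ * ⌊2 * y⌋₊ *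
      (⌊2 * y⌋₊ ^ 2 + ⌊y / M ^ 4⌋₊ ^ 2 * ⌊M * R'⌋₊ ^ 8)) → n ≠ 0 →
      (n.divisors.card : ℝ) ≤ E X R := fun n hn' hn =>
    hdiv n hn (box_argument_le hX hR (by linarith) hRR hM hy0.le hyX hn')
  have hF := avg_box_mul_pow_eight_le (R' := R') (R := R) (D := E X R) (L := L X R) hM1 hMy
    (by linarith) hH hN hZ hE1 hL1 hb₁ hb₂
    (fun n hn hn' => hbox n (hn'.trans (by
      generalize ⌊y / (M:ℝ) ^ 4⌋₊ = H
      generalize ⌊2 * y⌋₊ = Z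
      generalize ⌊M * R'⌋₊ = N
      rw [mul_assoc, mul_assoc H Z]
      have h1 : Z ≤ Z ^ 2 + H ^ 2 * N ^ 8 := (Nat.le_self_pow two_ne_zero Z).trans (by omega)
      have h2 : Z ^ 2 ≤ Z * (Z ^ 2 + H ^ 2 * N ^ 8) := by
        rw [sq Z] at h1 ⊢
        exact Nat.mul_le_mul le_rfl h1
      exact Nat.mul_le_mul le_rfl (Nat.mul_le_mul le_rfl h2))) hn)
    (fun n hn hn' => hbox n (hn'.trans (by
      generalize ⌊y / (M:ℝ) ^ 4⌋₊ = H
      generalize ⌊2 * y⌋₊ = Z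
      generalize ⌊M * R'⌋₊ = N
      have : Z * N ^ 8 * H ^ 3 = H * Z * (H ^ 2 * N ^ 8) := by ring
      rw [this, mul_add]
      have := Nat.zero_le (H * Z * Z ^ 2)
      omega)) hn)
    (fun n hn hn' => hpow4 n hn (hn'.trans (by
      refine pow_le_pow_left₀ (by positivity) (hyMX.trans ?_) 4
      nlinarith)))
    (hg₁.1 X R hX hR) (hg₂.1 X R hX hR) (hg₃.1 X R hX hR) hA₁ hA₂ hA₃
  simp only [e8] at hA₁ ⊢
  refine hev.trans ?_
  rw [mul_assoc (4 * E X R ^ 4)]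
  refine mul_le_mul_of_nonneg_left ?_ (by positivity)
  have hcard := card_moduli_le (M := M) (R := R') (by linarith)
  have hg₁0 := hg₁.nonneg hX hR
  have hg₂0 := hg₂.nonneg hX hR
  have hg₃0 := hg₃.nonneg hX hR
  have hdiag : ((moduli M R').card : ℝ) * y * avg (fun α => ‖h (y / M) R' α‖ ^ (2 * 4)) ≤
      R * g₁ X R * (y ^ (1 + l₁) * (M : ℝ) ^ (1 - l₁)) := by
    calc _ ≤ (M * R) * y * (g₁ X R * (y / M) ^ l₁) := by
          refine mul_le_mul (mul_le_mul_of_nonneg_right (hcard.trans (by gcongr)) hy0.le) hA₁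
            (avg_nonneg fun _ => by positivity) (by positivity)
      _ = _ := by
          rw [rpow_add hy0, rpow_sub hM0, rpow_one, rpow_one, div_rpow hy0.le hM0.le]
          ring
  refine (add_le_add hdiag (mul_le_mul_of_nonneg_left hF zero_le_two)).trans ?_
  have k₁ : 0 ≤ R * g₁ X R := by positivity
  have k₂ : 0 ≤ 40000 * L X R ^ 2 * E X R ^ 5 * R * (g₁ X R * g₂ X R * g₃ X R) := by positivity
  rw [← mul_assoc 2]
  refine le_trans ?_ (le_of_eq (mul_add _ _ _).symm)
  refine add_le_add (mul_le_mul_of_nonneg_right ?_ (by positivity))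
    (mul_le_mul_of_nonneg_right ?_ (by positivity)) <;> linarith

lemma adm_ten_step {l : ℝ} (H : Adm 10 l) (hl : 62134 / 10000 ≤ l) (hl' : l ≤ 10) :
    Adm 10 (l - 1 / 100000) := by
  have H₂ : Adm (128 / 15) (11 / 15 * (229709701 / 50000000) + 4 / 15 * l) := by
    have h := Adm.interp (a := 8) (b := 10) (ρ := 11 / 15) (σ := 4 / 15) (by norm_num)
      (by norm_num) (by norm_num) (by norm_num) (by norm_num) adm_eight H
    convert h using 1
    norm_num
  have := Adm.step_of (s := 5) (l₀ := l) (θ := 909 / 5000) (μ := l - 3 / 100000)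
    (b := ![1 + 229709701 / 50000000, 3 / 2 + 229709701 / 50000000,
      7 / 4 + 229709701 / 50000000, 13 / 8 + 229709701 / 50000000,
      25 / 16 + (11 / 15 * (229709701 / 50000000) + 4 / 15 * l) * (15 / 16), 3 / 2 + l * (3 / 4)])
    (a := ![1 - 229709701 / 50000000, -3 - 229709701 / 50000000,
      -13 / 4 - 229709701 / 50000000, -5 / 2 - 229709701 / 50000000,
      -21 / 8 - (11 / 15 * (229709701 / 50000000) + 4 / 15 * l) * (15 / 16), -9 / 4 - l * (3 / 4)])
    (l := l - 1 / 100000) (by norm_num) (by norm_num) (by norm_num) (by norm_num; exact H)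
    (by linarith) (by linarith) ?_ ?_ ?_ (by linarith) (by linarith)
  · norm_num at this ⊢
    exact this
  · obtain ⟨v, hv, hb⟩ := exists_slow_sum_avg_eight adm_eight H₂ H
    refine ⟨v, hv, fun X R y R' M hX hR hR' hRR hM hMy hyX => ?_⟩
    rw [show (2:ℝ) * 5 - 2 = 8 by norm_num]
    refine (hb X R y R' M hX hR hR' hRR hM hMy hyX).trans (le_of_eq ?_)
    congr 1
    simp only [Fin.sum_univ_six]
    simp only [Matrix.cons_val]
    ring
  · intro i
    fin_cases i <;> simp <;> linarith
  · intro i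
    fin_cases i <;> simp <;> linarith

theorem adm_ten : Adm 10 (62134 / 10000) := by
  have H : ∀ n : ℕ, Adm 10 (max (62134 / 10000) (10 - n / 100000)) := by
    intro n
    induction n with
    | zero => exact Adm.mono (l := 10) (by simp) (adm_self (by norm_num))
    | succ n ih =>
      rcases le_total ((10:ℝ) - n / 100000) (62134 / 10000) with h | h
      · exact Adm.mono (max_le (le_max_left _ _) (h.trans (le_max_left _ _))) ih
      · rw [max_eq_right h] at ih
        have : (0:ℝ) ≤ n / 100000 := by positivity
        refine Adm.mono (le_trans (le_of_eq ?_) (le_max_right _ _))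
          (adm_ten_step ih h (by linarith))
        push_cast; ring
  have := H 400000
  rwa [max_eq_left (by norm_num)] at this

/-! ### A lossless Weyl inequality -/

lemma norm_sum_range_sq_le (φ : ℕ → ℝ) {N M : ℕ} (hM : M ≤ N) :
    ‖∑ n ∈ range M, e (φ n)‖ ^ 2 ≤ N + 2 * ∑ d ∈ Icc 1 N,
      ‖∑ n ∈ range (M - d), e (φ (n + d) - φ n)‖ := by
  have h1 : ∀ M ≤ N, ‖∑ n ∈ range M, e (φ n)‖ ^ 2 = M + 2 * (∑ d ∈ Icc 1 N,
      ∑ n ∈ range (M - d), e (φ (n + d) - φ n)).re := by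
    intro M
    induction M with
    | zero => simp
    | succ M ih =>
      intro hM
      have h2 : ∑ d ∈ Icc 1 N, ∑ n ∈ range (M + 1 - d), e (φ (n + d) - φ n) =
          ∑ d ∈ Icc 1 N, ∑ n ∈ range (M - d), e (φ (n + d) - φ n) +
          ∑ d ∈ Icc 1 M, e (φ M - φ (M - d)) := by
        have h3 : Icc 1 M = (Icc 1 N).filter (· ≤ M) := by ext; simp; omega
        rw [h3, sum_filter, ← sum_add_distrib]
        refine sum_congr rfl fun d hd => ?_
        rcases le_or_gt d M with h | h
        · rw [Nat.succ_sub h, sum_range_succ, Nat.sub_add_cancel h, if_pos h]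
        · rw [Nat.sub_eq_zero_of_le h, Nat.sub_eq_zero_of_le h.le, if_neg (by omega)]
          simp
      have h4 : ∑ d ∈ Icc 1 M, e (φ M - φ (M - d)) =
          e (φ M) * (starRingEnd ℂ) (∑ n ∈ range M, e (φ n)) := by
        rw [map_sum, mul_sum]
        refine sum_nbij' (fun d => M - d) (fun n => M - n) ?_ ?_ ?_ ?_ ?_ <;>
          simp only [mem_Icc, mem_range] <;> intro d hd
        iterate 4 omega
        rw [conj_e, ← e_add, sub_eq_add_neg]
      have h5 := ih (by omega)
      rw [h2, h4, sum_range_succ, add_re, mul_add, add_comm (Finset.sum _ _),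
        sq_norm, Complex.normSq_add, ← sq_norm, ← sq_norm, norm_e, h5]
      push_cast
      ring
  rw [h1 M hM]
  have h2 : ((M : ℕ) : ℝ) ≤ N := mod_cast hM
  have h3 := (re_le_norm (∑ d ∈ Icc 1 N,
      ∑ n ∈ range (M - d), e (φ (n + d) - φ n))).trans (norm_sum_le _ _)
  linarith

lemma norm_sum_pow_four_pow_eight_le {N : ℕ} (hN1 : (1:ℝ) ≤ N) (α : ℝ) :
    ‖∑ n ∈ range N, e (α * ((n : ℝ) + 1) ^ 4)‖ ^ 8 ≤ 712 * (N : ℝ) ^ 7 +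
      1024 * (N : ℝ) ^ 4 * ∑ a ∈ Icc 1 N, ∑ b ∈ Icc 1 N, ∑ c ∈ Icc 1 N,
        minKer N (distInt ((24 * (a * b * c) : ℕ) * α)) := by
  set φ : ℕ → ℝ := fun n => α * ((n : ℝ) + 1) ^ 4 with hφ
  set φ₁ : ℕ → ℕ → ℝ := fun a n => φ (n + a) - φ n with hφ₁
  set φ₂ : ℕ → ℕ → ℕ → ℝ := fun a b n => φ₁ a (n + b) - φ₁ a n with hφ₂
  set φ₃ : ℕ → ℕ → ℕ → ℕ → ℝ := fun a b c n => φ₂ a b (n + c) - φ₂ a b n with hφ₃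
  have hlin : ∀ a b c n, φ₃ a b c n = φ₃ a b c 0 + ((24 * (a * b * c) : ℕ) * α) * n := by
    intro a b c n
    simp only [hφ₃, hφ₂, hφ₁, hφ]
    push_cast
    ring
  have hker : ∀ a b c, ‖∑ n ∈ range (N - a - b - c), e (φ₃ a b c n)‖ ≤
      minKer N (distInt ((24 * (a * b * c) : ℕ) * α)) := by
    intro a b c
    rw [sum_congr rfl fun n _ => by rw [hlin, e_add], ← mul_sum, norm_mul, norm_e, one_mul]
    exact norm_geom_sum_le_minKer _ _ (cast_le.mpr (by omega))
  have hcs : ∀ F : ℕ → ℝ, (∑ a ∈ Icc 1 N, F a) ^ 2 ≤ N * ∑ a ∈ Icc 1 N, F a ^ 2 := by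
    intro F
    simpa using sq_sum_le_card_mul_sum_sq (s := Icc 1 N) (f := F)
  have hN : (0:ℝ) ≤ N := cast_nonneg _
  have step : ∀ x F : ℕ → ℝ, (∀ a ∈ Icc 1 N, x a ^ 2 ≤ N + 2 * F a) →
      (∑ a ∈ Icc 1 N, x a) ^ 2 ≤ N * N ^ 2 + 2 * N * ∑ a ∈ Icc 1 N, F a := by
    intro x F hx
    refine (hcs x).trans ?_
    have := sum_le_sum hx
    rw [sum_add_distrib, ← mul_sum] at this
    simp only [sum_const, card_Icc, add_tsub_cancel_right, nsmul_eq_mul] at this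
    nlinarith
  set T := ∑ a ∈ Icc 1 N, ∑ b ∈ Icc 1 N, ∑ c ∈ Icc 1 N,
    minKer N (distInt ((24 * (a * b * c) : ℕ) * α)) with hT
  set x₁ : ℕ → ℝ := fun a => ‖∑ n ∈ range (N - a), e (φ₁ a n)‖
  set x₂ : ℕ → ℕ → ℝ := fun a b => ‖∑ n ∈ range (N - a - b), e (φ₂ a b n)‖
  have s1 := norm_sum_range_sq_le φ (le_refl N)
  have s2 := step x₁ (fun a => ∑ b ∈ Icc 1 N, x₂ a b)
    fun a _ => norm_sum_range_sq_le (φ₁ a) (by omega)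
  have s3 : (∑ a ∈ Icc 1 N, ∑ b ∈ Icc 1 N, x₂ a b) ^ 2 ≤
      N * (N * (N * N ^ 2) + 2 * N * T) := by
    refine (hcs _).trans (mul_le_mul_of_nonneg_left ?_ hN)
    refine (sum_le_sum fun a _ => step (x₂ a)
      (fun b => ∑ c ∈ Icc 1 N, minKer N (distInt ((24 * (a * b * c) : ℕ) * α)))
      fun b _ => (norm_sum_range_sq_le (φ₂ a b) (N := N) (by omega)).trans ?_).trans
      (le_of_eq ?_)
    · exact add_le_add le_rfl (mul_le_mul_of_nonneg_left
        (sum_le_sum fun c _ => hker a b c) (by norm_num))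
    · rw [sum_add_distrib, sum_const, card_Icc, nsmul_eq_mul, add_tsub_cancel_right, ← mul_sum]
  have s1' : ‖∑ n ∈ range N, e (φ n)‖ ^ 2 ≤ N + 2 * ∑ a ∈ Icc 1 N, x₁ a := s1
  generalize ‖∑ n ∈ range N, e (φ n)‖ = F at s1'
  generalize ∑ a ∈ Icc 1 N, ∑ b ∈ Icc 1 N, x₂ a b = B at s2 s3
  generalize ∑ a ∈ Icc 1 N, x₁ a = A at s1' s2
  have hN2 : ((N : ℕ) : ℝ) ^ 2 ≤ N ^ 3 := pow_le_pow_right₀ hN1 (by norm_num)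
  have hN3 : ((N : ℕ) : ℝ) ^ 6 ≤ N ^ 7 := pow_le_pow_right₀ hN1 (by norm_num)
  have t1 : F ^ 4 ≤ 10 * N ^ 3 + 16 * N * B := by
    have : (F ^ 2) ^ 2 ≤ (N + 2 * A) ^ 2 := pow_le_pow_left₀ (by positivity) s1' 2
    nlinarith [sq_nonneg ((N:ℝ) - 2 * A)]
  have t2 : (F ^ 4) ^ 2 ≤ (10 * N ^ 3 + 16 * N * B) ^ 2 := pow_le_pow_left₀ (by positivity) t1 2
  have t3 : (256 * N ^ 2 : ℝ) * B ^ 2 ≤ 256 * N ^ 2 * (N * (N * (N * N ^ 2) + 2 * N * T)) :=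
    mul_le_mul_of_nonneg_left s3 (by positivity)
  nlinarith [sq_nonneg ((10:ℝ) * N ^ 3 - 16 * N * B)]

lemma sum_Icc_rpow_sub_one_le {κ : ℝ} (h0 : 0 < κ) (h1 : κ ≤ 1) (n : ℕ) :
    ∑ k ∈ Icc (1:ℕ) n, (k : ℝ) ^ (κ - 1) ≤ (n : ℝ) ^ κ / κ := by
  induction n with
  | zero => simp; positivity
  | succ n ih =>
    rw [Finset.sum_Icc_succ_top (by omega)]
    have hn : (0:ℝ) < (n + 1 : ℕ) := by positivity
    have h2 := rpow_one_add_le_one_add_mul_self (s := -1 / (n + 1 : ℕ))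
      ((le_div_iff₀ hn).mpr (by push_cast; linarith [(n.cast_nonneg : (0:ℝ) ≤ n)])) h0.le h1
    have h3 : (1:ℝ) + -1 / (n + 1 : ℕ) = n / (n + 1 : ℕ) := by field_simp; push_cast; ring
    rw [h3, div_rpow (cast_nonneg _) hn.le, div_le_iff₀ (by positivity)] at h2
    have h4 : (((n + 1 : ℕ) : ℝ)) ^ κ = ((n + 1 : ℕ) : ℝ) ^ (κ - 1) * (n + 1 : ℕ) := by
      rw [← rpow_add_one hn.ne']; ring_nf
    refine (add_le_add_left ih _).trans ?_
    rw [← sub_nonneg]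
    have h5 : ((n + 1 : ℕ) : ℝ) ^ κ / κ - ((n : ℝ) ^ κ / κ + ((n + 1 : ℕ) : ℝ) ^ (κ - 1)) =
      ((1 + κ * (-1 / (n + 1 : ℕ))) * ((n + 1 : ℕ) : ℝ) ^ κ - (n : ℝ) ^ κ) / κ := by
      rw [h4]; field_simp; ring
    rw [h5]
    exact div_nonneg (by linarith) h0.le

lemma sum_filter_dvd_rpow_sub_one_le {κ : ℝ} (h0 : 0 < κ) (h1 : κ ≤ 1) (N : ℕ) {q : ℕ}
    (hq : 0 < q) : ∑ k ∈ (Icc 1 N).filter (q ∣ ·), (k : ℝ) ^ (κ - 1) ≤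
      (N : ℝ) ^ κ / κ / q := by
  have hq' : (0:ℝ) < q := mod_cast hq
  have h2 : (Icc 1 N).filter (q ∣ ·) = (Icc 1 (N / q)).image (q * ·) := by
    ext k
    simp only [mem_filter, mem_Icc, mem_image, Nat.le_div_iff_mul_le hq]
    constructor
    · rintro ⟨⟨h, h'⟩, j, rfl⟩
      exact ⟨j, ⟨Nat.pos_of_mul_pos_left h, by linarith⟩, rfl⟩
    · rintro ⟨j, ⟨h, h'⟩, rfl⟩
      exact ⟨⟨Nat.mul_pos hq h, by linarith⟩, dvd_mul_right _ _⟩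
  rw [h2, sum_image fun a _ b _ h => eq_of_mul_eq_mul_left hq h]
  calc _ = (q : ℝ) ^ (κ - 1) * ∑ j ∈ Icc (1:ℕ) (N / q), (j : ℝ) ^ (κ - 1) := by
        rw [mul_sum]
        refine sum_congr rfl fun j _ => ?_
        rw [cast_mul, mul_rpow hq'.le (cast_nonneg _)]
    _ ≤ (q : ℝ) ^ (κ - 1) * ((N / q : ℝ) ^ κ / κ) := by
        refine mul_le_mul_of_nonneg_left ((sum_Icc_rpow_sub_one_le h0 h1 _).trans ?_)
          (by positivity)
        have : ((N / q : ℕ) : ℝ) ≤ N / q := cast_div_le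
        gcongr
    _ = _ := by
        rw [div_rpow (cast_nonneg _) hq'.le, rpow_sub_one hq'.ne']
        field_simp

lemma sum_filter_dvd_mul_le {ι : Type*} {S : Finset ℕ} {T : Finset ι} {t : ι → ℕ} {w : ℕ → ℝ}
    {v : ι → ℝ} {q : ℕ} {B G : ℝ} (hq : q ≠ 0) (hw : ∀ k, 0 ≤ w k) (hv : ∀ i, 0 ≤ v i)
    (hB0 : 0 ≤ B) (hB : ∀ d, d ∣ q → ∑ k ∈ S.filter (d ∣ ·), w k ≤ B / d)
    (hG : ∀ m, m ∣ q → ∑ i ∈ T.filter (m ∣ t ·), v i ≤ G / m) :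
    ∑ p ∈ (S ×ˢ T).filter (fun p => q ∣ p.1 * t p.2), w p.1 * v p.2 ≤
      q.divisors.card * (B * G) / q := by
  have h1 : ∑ p ∈ (S ×ˢ T).filter (fun p => q ∣ p.1 * t p.2), w p.1 * v p.2 ≤
      ∑ d ∈ q.divisors, ∑ p ∈ S.filter (d ∣ ·) ×ˢ T.filter (q / d ∣ t ·), w p.1 * v p.2 := by
    have h2 : ∀ d, S.filter (d ∣ ·) ×ˢ T.filter (q / d ∣ t ·) =
        (S ×ˢ T).filter fun p => d ∣ p.1 ∧ q / d ∣ t p.2 := fun d =>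
      (Finset.filter_product (d ∣ ·) (q / d ∣ t ·)).symm
    simp only [h2]
    simp only [sum_filter]
    rw [sum_comm]
    refine sum_le_sum fun p _ => ?_
    have h0 : ∀ d ∈ q.divisors, 0 ≤ if d ∣ p.1 ∧ q / d ∣ t p.2 then w p.1 * v p.2 else 0 :=
      fun d _ => by split_ifs <;> first | exact mul_nonneg (hw _) (hv _) | rfl
    split_ifs with h
    · obtain ⟨d, m, hd, hm, rfl⟩ := exists_dvd_and_dvd_of_dvd_mul h
      have hd0 : 0 < d := Nat.pos_of_ne_zero (left_ne_zero_of_mul hq)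
      refine le_trans (le_of_eq ?_) (single_le_sum h0
        (mem_divisors.mpr ⟨dvd_mul_right d m, hq⟩))
      rw [Nat.mul_div_cancel_left m hd0, if_pos ⟨hd, hm⟩]
    · exact sum_nonneg h0
  refine h1.trans ?_
  rw [mul_div_assoc, ← nsmul_eq_mul]
  refine sum_le_card_nsmul _ _ _ fun d hd => ?_
  have hdq := Nat.dvd_of_mem_divisors hd
  have hd0 : (d:ℝ) ≠ 0 := Nat.cast_ne_zero.mpr (Nat.pos_of_mem_divisors hd).ne'
  rw [sum_product, ← sum_mul_sum]
  calc _ ≤ B / d * (G / (q / d : ℕ)) := mul_le_mul (hB d hdq) (hG _ (div_dvd_of_dvd hdq))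
        (sum_nonneg fun i _ => hv i) (by positivity)
    _ = _ := by rw [cast_div hdq hd0]; field_simp

lemma sum_filter_dvd_mul_mul_le {κ : ℝ} (h0 : 0 < κ) (h1 : κ ≤ 1) (N : ℕ) {q : ℕ} (hq : q ≠ 0) :
    ∑ p ∈ (Icc 1 N ×ˢ Icc 1 N ×ˢ Icc 1 N).filter
      (fun p => q ∣ p.1 * (p.2.1 * p.2.2)), ((p.1 * (p.2.1 * p.2.2) : ℕ) : ℝ) ^ (κ - 1) ≤
      (q.divisors.card : ℝ) ^ 2 * ((N : ℝ) ^ κ / κ) ^ 3 / q := by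
  set w : ℕ → ℝ := fun k => (k : ℝ) ^ (κ - 1) with hw
  have hw0 : ∀ k, 0 ≤ w k := fun k => by positivity
  have hmul : ∀ a b, w (a * b) = w a * w b := fun a b => by
    simp only [hw, cast_mul]
    exact mul_rpow (cast_nonneg _) (cast_nonneg _)
  have hpos : ∀ {d}, d ∣ q → 0 < d := fun hd => Nat.pos_of_dvd_of_pos hd (Nat.pos_of_ne_zero hq)
  set B := (N : ℝ) ^ κ / κ with hB
  have hB0 : 0 ≤ B := by positivity
  have hone : ∀ d, d ∣ q → ∑ k ∈ (Icc 1 N).filter (d ∣ ·), w k ≤ B / d :=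
    fun d hd => sum_filter_dvd_rpow_sub_one_le h0 h1 N (hpos hd)
  have h2 := sum_filter_dvd_mul_le (T := Icc 1 N ×ˢ Icc 1 N)
    (t := fun i => i.1 * i.2) (v := fun i => w i.1 * w i.2) (G := q.divisors.card * (B * B)) hq
    hw0 (fun i => mul_nonneg (hw0 _) (hw0 _)) hB0 hone fun m hm => by
      refine (sum_filter_dvd_mul_le (t := fun k => k) (hpos hm).ne' hw0 hw0 hB0
        (fun d hd => hone d (hd.trans hm)) fun d hd => hone d (hd.trans hm)).trans ?_
      have : (m.divisors.card : ℝ) ≤ q.divisors.card :=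
        cast_le.mpr (card_le_card (Nat.divisors_subset_of_dvd hq hm))
      gcongr
  refine (le_of_eq ?_).trans (h2.trans (le_of_eq (by ring)))
  exact sum_congr rfl fun p _ => (hmul _ _).trans (by rw [hmul])

def cubeBox (N : ℕ) : Finset (ℕ × ℕ × ℕ) := Icc 1 N ×ˢ Icc 1 N ×ˢ Icc 1 N

lemma sum_cubeBox_not_dvd_le {N q : ℕ} {a : ℤ} {α D : ℝ} (H : Approx (24 * N ^ 3) α q a)
    (hD0 : 0 ≤ D) (hD : ∀ n : ℕ, n ≠ 0 → n ≤ 24 * N ^ 3 → (n.divisors.card : ℝ) ≤ D) :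
    ∑ p ∈ (cubeBox N).filter (fun p => ¬ q ∣ 24 * (p.1 * (p.2.1 * p.2.2))),
      minKer N (distInt ((24 * (p.1 * (p.2.1 * p.2.2)) : ℕ) * α)) ≤
      D ^ 3 * (24 * (24 * N ^ 3 : ℕ) * (1 + Real.log (2 * (24 * N ^ 3 : ℕ)))) := by
  set t : ℕ × ℕ × ℕ → ℕ := fun p => 24 * (p.1 * (p.2.1 * p.2.2)) with ht
  have hmem : ∀ p ∈ cubeBox N, t p ∈ Icc 1 (24 * N ^ 3) := by
    rintro ⟨a, b, c⟩ hp
    simp only [cubeBox, mem_product, mem_Icc, ht] at hp ⊢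
    obtain ⟨⟨h1, h2⟩, ⟨h3, h4⟩, h5, h6⟩ := hp
    refine ⟨one_le_iff_ne_zero.mpr (by positivity), ?_⟩
    calc 24 * (a * (b * c)) ≤ 24 * (N * (N * N)) := by gcongr
      _ = _ := by ring
  have h1 := sum_comp_le_mul_sum (cubeBox N) t (K := 24 * N ^ 3) (B := D ^ 3)
    (g := fun k => if ¬ q ∣ k then minKer N (distInt (k * α)) else 0) hmem ?_ (by positivity)
    fun k => by
      split_ifs
      exacts [le_rfl, minKer_nonneg (cast_nonneg _) (distInt_nonneg _)]
  · rw [← sum_filter, ← sum_filter] at h1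
    exact h1.trans (mul_le_mul_of_nonneg_left (H.sum_minKer_not_dvd_le (cast_nonneg N))
      (by positivity))
  · intro p hp
    have hn := mem_Icc.mp (hmem p hp)
    have hn0 : t p ≠ 0 := by omega
    have hc : ((cubeBox N).filter fun x => t x = t p).card ≤
        ((t p).divisors ×ˢ (t p).divisors ×ˢ (t p).divisors).card := by
      refine card_le_card fun x hx => ?_
      have hx' := (mem_filter.mp hx).2
      simp only [mem_product, mem_divisors]
      refine ⟨⟨?_, hn0⟩, ⟨?_, hn0⟩, ?_, hn0⟩ <;> rw [← hx']
      · exact ⟨24 * (x.2.1 * x.2.2), by ring⟩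
      · exact ⟨24 * (x.1 * x.2.2), by ring⟩
      · exact ⟨24 * (x.1 * x.2.1), by ring⟩
    refine (cast_le.mpr hc).trans ?_
    rw [card_product, card_product]
    push_cast
    have := hD _ hn0 hn.2
    calc _ = ((t p).divisors.card : ℝ) ^ 3 := by ring
      _ ≤ D ^ 3 := by gcongr

lemma minKer_le_rpow {Z u κ : ℝ} (hZ : 0 ≤ Z) (hu : 0 ≤ u) (hκ0 : 0 ≤ κ)
    (h : 0 < Z * u ∧ κ ≤ 1 ∨ κ = 1) : minKer Z u ≤ 2 * Z * (Z * u) ^ (κ - 1) := by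
  rcases h with ⟨h, h1⟩ | rfl
  · have h2 : (Z * u) ^ (1 - κ) ≤ 1 + Z * u := by
      have := (rpow_one_add_le_one_add_mul_self (s := Z * u - 1) (by linarith)
        (by linarith : (0:ℝ) ≤ 1 - κ) (by linarith))
      rw [add_sub_cancel] at this
      nlinarith
    rw [minKer, div_eq_mul_inv, ← neg_sub 1 κ, rpow_neg h.le]
    gcongr
  · simpa using minKer_le_two_mul hZ hu

lemma sum_cubeBox_dvd_le {N q : ℕ} {a : ℤ} {α κ : ℝ} (H : Approx (24 * N ^ 3) α q a) (hN : 0 < N)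
    (hκ0 : 0 < κ) (hκ1 : κ ≤ 1) (h : 0 < |q * α - a| ∨ κ = 1) :
    ∑ p ∈ (cubeBox N).filter (fun p => q ∣ 24 * (p.1 * (p.2.1 * p.2.2))),
      minKer N (distInt ((24 * (p.1 * (p.2.1 * p.2.2)) : ℕ) * α)) ≤
      48 / κ ^ 3 * N ^ 4 * (q.divisors.card ^ 2 / q) * (N ^ 4 * |q * α - a| / q) ^ (κ - 1) := by
  set δ := |q * α - a| with hδ
  have hδ0 : 0 ≤ δ := abs_nonneg _
  have hq : (0:ℝ) < q := mod_cast H.pos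
  have hN' : (0:ℝ) < N := mod_cast hN
  set r := q / q.gcd 24 with hr
  have hrq : r ∣ q := div_dvd_of_dvd (Nat.gcd_dvd_left _ _)
  have hr0 : 0 < r := Nat.pos_of_dvd_of_pos hrq H.pos
  have hr' : (0:ℝ) < r := mod_cast hr0
  have hqr : (q : ℝ) ≤ 24 * r := by
    have h1 : q.gcd 24 * r = q := mul_div_cancel' (Nat.gcd_dvd_left _ _)
    have h2 : q ≤ 24 * r := by
      conv_lhs => rw [← h1]
      exact Nat.mul_le_mul_right _ (Nat.gcd_le_right _ (by norm_num))
    exact_mod_cast h2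
  set m : ℕ × ℕ × ℕ → ℕ := fun p => p.1 * (p.2.1 * p.2.2) with hm
  have hm0 : ∀ p ∈ cubeBox N, 0 < m p ∧ 24 * m p ≤ 24 * N ^ 3 := by
    rintro ⟨a, b, c⟩ hp
    simp only [cubeBox, mem_product, mem_Icc, hm] at hp ⊢
    obtain ⟨⟨h1, h2⟩, ⟨h3, h4⟩, h5, h6⟩ := hp
    refine ⟨by positivity, ?_⟩
    calc 24 * (a * (b * c)) ≤ 24 * (N * (N * N)) := by gcongr
      _ = _ := by ring
  calc _ ≤ ∑ p ∈ (cubeBox N).filter (fun p => q ∣ 24 * m p),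
        2 * N * (N * δ / q) ^ (κ - 1) * ((m p : ℕ) : ℝ) ^ (κ - 1) := by
        refine sum_le_sum fun p hp => ?_
        obtain ⟨hp1, j, hj⟩ := mem_filter.mp hp
        obtain ⟨h1, h2⟩ := hm0 p hp1
        have hmp : (0:ℝ) < m p := mod_cast h1
        have hj' : (24:ℝ) * m p = q * j := mod_cast hj
        have h3 : m p * δ / q ≤ distInt ((24 * m p : ℕ) * α) := by
          rw [hj, H.distInt_mul (hj ▸ h2), ← hδ, div_le_iff₀ hq]
          nlinarith
        refine (minKer_anti hN'.le (by positivity) h3).trans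
          ((minKer_le_rpow hN'.le (by positivity) hκ0.le ?_).trans (le_of_eq ?_))
        · rcases h with h | h
          exacts [Or.inl ⟨by positivity, hκ1⟩, Or.inr h]
        · rw [mul_assoc (2 * (N:ℝ)), ← mul_rpow (by positivity) hmp.le]
          congr 2; ring
    _ ≤ ∑ p ∈ (cubeBox N).filter (fun p => r ∣ m p),
        2 * N * (N * δ / q) ^ (κ - 1) * ((m p : ℕ) : ℝ) ^ (κ - 1) := by
        refine sum_le_sum_of_subset_of_nonneg
          (Finset.monotone_filter_right _ fun p _ hp => ?_) fun p _ _ => by positivity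
        have h1 : r ∣ 24 / q.gcd 24 * m p := by
          rw [← Nat.mul_div_right_comm (Nat.gcd_dvd_right _ _)]
          exact Nat.div_dvd_div (Nat.gcd_dvd_left _ _) hp
        exact (Nat.coprime_div_gcd_div_gcd (gcd_pos_of_pos_left _ H.pos)).dvd_of_dvd_mul_left h1
    _ ≤ 2 * N * (N * δ / q) ^ (κ - 1) * (q.divisors.card ^ 2 * ((N : ℝ) ^ κ / κ) ^ 3 * (24 / q)) := by
        rw [← mul_sum]
        refine mul_le_mul_of_nonneg_left
          ((sum_filter_dvd_mul_mul_le hκ0 hκ1 N hr0.ne').trans ?_) (by positivity)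
        have h1 : (r.divisors.card : ℝ) ≤ q.divisors.card :=
          cast_le.mpr (card_le_card (Nat.divisors_subset_of_dvd H.pos.ne' hrq))
        have h2 : 1 / (r:ℝ) ≤ 24 / q := by rw [div_le_div_iff₀ hr' hq]; linarith
        rw [div_eq_mul_one_div]
        gcongr
    _ = _ := by
        have h1 : (N ^ 4 * δ / q : ℝ) ^ (κ - 1) =
            ((N:ℝ) ^ κ) ^ 3 / N ^ 3 * (N * δ / q) ^ (κ - 1) := by
          rw [← div_pow, ← rpow_sub_one hN'.ne', Real.rpow_pow_comm hN'.le,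
            ← mul_rpow (by positivity) (by positivity)]
          congr 1; ring
        rw [h1]
        field_simp
        ring

lemma Approx.exists_sum_cubeBox_dvd_le {κ : ℝ} (hκ0 : 0 < κ) (hκ1 : κ ≤ 1) : ∃ C : ℝ, 0 ≤ C ∧
    ∀ (N q : ℕ) (a : ℤ) (α : ℝ), 0 < N → Approx (24 * N ^ 3) α q a →
    ∑ p ∈ (cubeBox N).filter (fun p => q ∣ 24 * (p.1 * (p.2.1 * p.2.2))),
      minKer N (distInt ((24 * (p.1 * (p.2.1 * p.2.2)) : ℕ) * α)) ≤
      C * N ^ 4 * (q + N ^ 4 * |q * α - a|) ^ (κ - 1) := by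
  obtain ⟨D, hD0, hD⟩ := card_divisors_le_rpow (ε := κ / 2) (by positivity)
  refine ⟨48 / κ ^ 3 * D ^ 2 * 2, by positivity, fun N q a α hN H => ?_⟩
  have hq : (0:ℝ) < q := mod_cast H.pos
  have hN' : (0:ℝ) < N := mod_cast hN
  set y := (N:ℝ) ^ 4 * |q * α - a| with hy
  have hy0 : 0 ≤ y := by positivity
  have hd : (q.divisors.card : ℝ) ^ 2 / q ≤ D ^ 2 * (q:ℝ) ^ (κ - 1) := by
    rw [rpow_sub_one hq.ne', ← mul_div_assoc]
    gcongr
    calc (q.divisors.card : ℝ) ^ 2 ≤ (D * (q:ℝ) ^ (κ / 2)) ^ 2 := by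
          gcongr; exact hD q H.pos.ne'
      _ = _ := by
          rw [mul_pow, ← rpow_natCast ((q:ℝ) ^ (κ / 2)), ← rpow_mul hq.le]
          congr 2; push_cast; ring
  have hx : ∀ z : ℝ, 0 < z → q + y ≤ 2 * z → z ^ (κ - 1) ≤ 2 * (q + y) ^ (κ - 1) := by
    intro z hz hxz
    have h1 : (2 * z) ^ (κ - 1) ≤ (q + y) ^ (κ - 1) :=
      rpow_le_rpow_of_nonpos (by positivity) hxz (by linarith)
    have h2 : (2:ℝ)⁻¹ ≤ 2 ^ (κ - 1) := by
      rw [← rpow_neg_one]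
      exact rpow_le_rpow_of_exponent_le (by norm_num) (by linarith)
    rw [mul_rpow (by norm_num) hz.le] at h1
    have h3 : 0 ≤ z ^ (κ - 1) := by positivity
    nlinarith
  rcases le_or_gt y q with h | h
  · have h1 := sum_cubeBox_dvd_le H hN one_pos le_rfl (Or.inr rfl)
    rw [sub_self, rpow_zero] at h1
    have hκ3 : (48:ℝ) / 1 ^ 3 ≤ 48 / κ ^ 3 := by gcongr
    have h2 := hx q hq (by linarith)
    calc _ ≤ 48 / κ ^ 3 * N ^ 4 * (D ^ 2 * (2 * (q + y) ^ (κ - 1))) * 1 := by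
          refine h1.trans ?_
          gcongr
          exact hd.trans (by gcongr)
      _ = _ := by ring
  · have h1 := sum_cubeBox_dvd_le H hN hκ0 hκ1
      (Or.inl (pos_of_mul_pos_right (hq.trans h) (by positivity)))
    have hyp := hq.trans h
    have h2 := hx y hyp (by linarith)
    rw [← hy, div_rpow hy0 hq.le] at h1
    calc _ ≤ 48 / κ ^ 3 * N ^ 4 * (D ^ 2 * (q:ℝ) ^ (κ - 1)) *
          (2 * (q + y) ^ (κ - 1) / (q:ℝ) ^ (κ - 1)) := by
          refine h1.trans ?_
          gcongr
      _ = _ := by field_simp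

lemma exists_weyl : ∃ C : ℝ, 0 ≤ C ∧ ∀ (N : ℕ) (α : ℝ), 0 < N → ∃ (q : ℕ) (a : ℤ), 0 < q ∧
    ‖∑ n ∈ range N, e (α * ((n : ℝ) + 1) ^ 4)‖ ^ 8 ≤ C * ((N:ℝ) ^ (225 / 32 : ℝ) +
        N ^ 8 * (q + N ^ 4 * |q * α - a|) ^ (1 / 32 - 1 : ℝ)) := by
  obtain ⟨B, hB0, hB⟩ := Approx.exists_sum_cubeBox_dvd_le (κ := 1 / 32) (by norm_num) (by norm_num)
  obtain ⟨D, hD, hDb⟩ := exists_slow_card_divisors 24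
  obtain ⟨A, K, hA0, -, hA⟩ := ((hD.pow 3).mul Slow.one_add_log).2 (1 / 32) (by norm_num)
  refine ⟨712 + 1024 * (5184 * (A * 2 ^ K) + B), by positivity, fun N α hN => ?_⟩
  have hN1 : (1:ℝ) ≤ N := mod_cast hN
  obtain ⟨q, a, H⟩ := exists_approx (K := 24 * N ^ 3) (by positivity) α
  refine ⟨q, a, H.pos, (norm_sum_pow_four_pow_eight_le hN1 α).trans ?_⟩
  have h0 := hD.nonneg hN1 le_rfl
  have h1 := sum_cubeBox_not_dvd_le H h0 fun n hn hle => hDb N 2 hN1 le_rfl n hn (by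
    have : (n:ℝ) ≤ 24 * N ^ 3 := mod_cast hle
    refine this.trans ?_
    push_cast
    gcongr <;> norm_num)
  have h2 := hB N q a α hN H
  have h3 := hA N 2 hN1 le_rfl
  have h4 := log_le_of_le_mul_pow hN1 (n := 2 * (24 * N ^ 3)) (k := 3) (by
    push_cast
    nlinarith [pow_pos (zero_lt_one.trans_le hN1) 3])
  have h5 : D N 2 ^ 3 * (24 * (24 * N ^ 3 : ℕ) * (1 + Real.log (2 * (24 * N ^ 3 : ℕ)))) ≤
      5184 * (A * 2 ^ K) * (N:ℝ) ^ (97 / 32 : ℝ) := by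
    have h6 : (N:ℝ) ^ (97 / 32 : ℝ) = N ^ 3 * (N:ℝ) ^ (1 / 32 : ℝ) := by
      rw [← rpow_natCast, ← rpow_add (by positivity)]; norm_num
    have h7 := log_nonneg hN1
    push_cast at h4 ⊢
    calc _ ≤ D N 2 ^ 3 * (24 * (24 * N ^ 3) * (9 * (1 + Real.log N))) := by
          gcongr; linarith
      _ = 5184 * N ^ 3 * (D N 2 ^ 3 * (1 + Real.log N)) := by ring
      _ ≤ 5184 * N ^ 3 * (A * (N:ℝ) ^ (1 / 32 : ℝ) * 2 ^ K) := by gcongr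
      _ = _ := by rw [h6]; ring
  have h6 : ∑ a ∈ Icc 1 N, ∑ b ∈ Icc 1 N, ∑ c ∈ Icc 1 N,
      minKer N (distInt ((24 * (a * b * c) : ℕ) * α)) = ∑ p ∈ cubeBox N,
      minKer N (distInt ((24 * (p.1 * (p.2.1 * p.2.2)) : ℕ) * α)) := by
    simp only [cubeBox, sum_product, mul_assoc]
  rw [h6, ← Finset.sum_filter_add_sum_filter_not _ fun p => q ∣ 24 * (p.1 * (p.2.1 * p.2.2))]
  have h7 : (N:ℝ) ^ 7 ≤ (N:ℝ) ^ (225 / 32 : ℝ) := by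
    rw [← rpow_natCast]; exact rpow_le_rpow_of_exponent_le hN1 (by norm_num)
  have h8 : (N:ℝ) ^ (225 / 32 : ℝ) = N ^ 4 * (N:ℝ) ^ (97 / 32 : ℝ) := by
    rw [← rpow_natCast, ← rpow_add (by positivity)]; norm_num
  set x := ((q + N ^ 4 * |q * α - a|) ^ (1 / 32 - 1 : ℝ) : ℝ) with hx
  have hx0 : 0 ≤ x := by positivity
  calc _ ≤ 712 * (N:ℝ) ^ (225 / 32 : ℝ) + 1024 * N ^ 4 * (B * N ^ 4 * x +
        5184 * (A * 2 ^ K) * (N:ℝ) ^ (97 / 32 : ℝ)) := by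
        gcongr
        exact h1.trans h5
    _ = 712 * (N:ℝ) ^ (225 / 32 : ℝ) + 1024 * B * (N ^ 8 * x) +
        1024 * (5184 * (A * 2 ^ K)) * (N:ℝ) ^ (225 / 32 : ℝ) := by rw [h8]; ring
    _ ≤ _ := by
        have : 0 ≤ A * 2 ^ K := by positivity
        have h9 : 0 ≤ (N:ℝ) ^ (225 / 32 : ℝ) := by positivity
        have h10 : 0 ≤ (N:ℝ) ^ 8 * x := by positivity
        nlinarith [mul_nonneg this h10, mul_nonneg hB0 h9]

/-! ### Counting solutions of `x ^ 4 ≡ y ^ 4` on average over the modulus -/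

lemma card_filter_coprime_dvd_sub_le {n : ℕ} (hn : 0 < n) (Y : ℕ) (y : ℤ) :
    ((Icc 1 Y).filter fun x : ℕ => x.Coprime n ∧ (n:ℤ) ∣ (x:ℤ) ^ 4 - y ^ 4).card ≤
      (Y / n + 1) * (4 * n.divisors.card ^ 4) := by
  set S := (Icc 1 Y).filter fun x : ℕ => x.Coprime n ∧ (n:ℤ) ∣ (x:ℤ) ^ 4 - y ^ 4 with hS
  refine (Finset.card_le_mul_card_image (f := (· % n)) S (Y / n + 1) fun a _ => ?_).trans
    (Nat.mul_le_mul_left _ (card_pow_four_congr_le hn _ ?_ ?_ ?_))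
  · rw [← card_range (Y / n + 1)]
    refine card_le_card_of_injOn (· / n) (fun x hx => ?_) fun x hx x' hx' h => ?_
    · simp only [hS, coe_filter, mem_filter, mem_Icc, Set.mem_ofPred_eq] at hx
      simpa [lt_succ_iff] using Nat.div_le_div_right hx.1.1.2
    · simp only [coe_filter, Set.mem_ofPred_eq] at hx hx' h
      rw [← div_add_mod x n, ← div_add_mod x' n, hx.2, hx'.2, h]
  · intro x hx
    obtain ⟨z, -, rfl⟩ := mem_image.mp hx
    exact mod_lt _ hn
  · intro x hx
    obtain ⟨z, hz, rfl⟩ := mem_image.mp hx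
    have := (mem_filter.mp hz).2.1
    rw [Nat.coprime_iff_gcd_eq_one] at this ⊢
    rw [← this, ← gcd_rec, Nat.gcd_comm]
  · intro x hx x' hx'
    obtain ⟨z, hz, rfl⟩ := mem_image.mp hx
    obtain ⟨z', hz', rfl⟩ := mem_image.mp hx'
    have h1 := (mem_filter.mp hz).2.2
    have h2 := (mem_filter.mp hz').2.2
    have h3 : ∀ w : ℕ, ((w % n : ℕ) : ℤ) ^ 4 ≡ (w:ℤ) ^ 4 [ZMOD n] := fun w => by
      push_cast; exact (Int.mod_modEq _ _).pow 4
    refine ((h3 z').trans (Int.ModEq.trans ?_ (h3 z).symm)).dvd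
    exact (Int.modEq_iff_dvd.mpr (by simpa using dvd_sub h1 h2))

lemma sum_card_dvd_pow_four_sub_le (N X : ℕ) :
    ∑ q ∈ Icc 1 X, ((Icc 1 N ×ˢ Icc 1 N).filter fun p : ℕ × ℕ =>
      (q:ℤ) ∣ (p.1:ℤ) ^ 4 - (p.2:ℤ) ^ 4).card ≤
    ∑ g ∈ Icc 1 N, (g ^ 4).divisors.card * ∑ n ∈ Icc 1 X,
      N / g * ((N / g / n + 1) * (4 * n.divisors.card ^ 4)) := by
  classical
  let U := (Icc 1 N).sigma fun g => (g ^ 4).divisors ×ˢ ((Icc 1 X).sigma fun n =>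
    (Icc 1 (N / g)).sigma fun y => (Icc 1 (N / g)).filter
      fun x : ℕ => x.Coprime n ∧ (n:ℤ) ∣ (x:ℤ) ^ 4 - (y:ℤ) ^ 4)
  have hU : U.card ≤ ∑ g ∈ Icc 1 N, (g ^ 4).divisors.card * ∑ n ∈ Icc 1 X,
      N / g * ((N / g / n + 1) * (4 * n.divisors.card ^ 4)) := by
    simp only [U, card_sigma, card_product]
    refine sum_le_sum fun g _ => Nat.mul_le_mul_left _ (sum_le_sum fun n hn => ?_)
    refine (sum_le_card_nsmul _ _ _ fun y _ =>
      card_filter_coprime_dvd_sub_le (mem_Icc.mp hn).1 _ _).trans (le_of_eq (by simp))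
  refine le_trans ?_ hU
  rw [← card_sigma]
  refine Finset.card_le_card_of_surjOn
    (fun u => ⟨u.2.1 * u.2.2.1, (u.1 * u.2.2.2.2, u.1 * u.2.2.2.1)⟩) ?_
  rintro ⟨q, x, y⟩ h
  simp only [coe_sigma, coe_filter, Set.mem_sigma_iff, Finset.coe_Icc,
    mem_product, mem_Icc, Set.mem_Icc, Set.mem_ofPred_eq] at h
  obtain ⟨⟨hq1, hqX⟩, ⟨⟨hx1, hxN⟩, hy1, hyN⟩, hd⟩ := h
  obtain ⟨x', y', hco, hx, hy⟩ := Nat.exists_coprime x y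
  set g := x.gcd y with hg
  have hg0 : 0 < g := gcd_pos_of_pos_left _ hx1
  have hx0 : 0 < x' := Nat.pos_of_ne_zero (by rintro rfl; omega)
  have hy0 : 0 < y' := Nat.pos_of_ne_zero (by rintro rfl; omega)
  have hd2 : (q:ℤ) ∣ ((g:ℤ) ^ 4) * ((x':ℤ) ^ 4 - (y':ℤ) ^ 4) := by
    convert hd using 1
    nth_rw 1 [hx]
    rw [hy]
    push_cast; ring
  have hd3 : q ∣ g ^ 4 * ((x':ℤ) ^ 4 - (y':ℤ) ^ 4).natAbs := by
    have := Int.natAbs_dvd_natAbs.mpr hd2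
    simpa [Int.natAbs_mul, Int.natAbs_pow] using this
  obtain ⟨a, n, ha, hn, rfl⟩ := exists_dvd_and_dvd_of_dvd_mul hd3
  have hn' : (n:ℤ) ∣ (x':ℤ) ^ 4 - (y':ℤ) ^ 4 := natCast_dvd.mpr hn
  refine ⟨⟨g, a, n, y', x'⟩, ?_, ?_⟩
  · simp only [U, coe_sigma, Set.mem_sigma_iff, mem_coe, mem_product,
      mem_Icc, mem_divisors, mem_sigma, mem_filter,
      Nat.le_div_iff_mul_le hg0]
    refine ⟨⟨hg0, (Nat.gcd_le_left _ hx1).trans hxN⟩, ⟨ha, by positivity⟩,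
      ⟨Nat.pos_of_mul_pos_left hq1, ?_⟩, ⟨hy0, by rwa [← hy]⟩, ⟨hx0, by rwa [← hx]⟩, ?_, hn'⟩
    · exact (Nat.le_mul_of_pos_left n (Nat.pos_of_mul_pos_right hq1)).trans hqX
    · refine coprime_of_dvd fun p hp hpx hpn => ?_
      have h1 : (p:ℤ) ∣ (x':ℤ) ^ 4 := dvd_pow (natCast_dvd_natCast.mpr hpx) (by norm_num)
      have h2 := (dvd_sub_right h1).mp ((natCast_dvd_natCast.mpr hpn).trans hn')
      have h3 : p ∣ y' := hp.dvd_of_dvd_pow (mod_cast h2)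
      exact hp.one_lt.ne' (Nat.eq_one_of_dvd_coprimes hco hpx h3)
  · simp only [Sigma.mk.injEq, heq_eq_eq, Prod.mk.injEq, true_and]
    exact ⟨by rw [mul_comm, ← hx], by rw [mul_comm, ← hy]⟩

lemma exists_sum_card_dvd_pow_four_sub_le : ∃ C : ℝ, 0 ≤ C ∧ ∀ N X : ℕ,
    (X:ℝ) ≤ 2 * (N:ℝ) ^ (15 / 16 : ℝ) →
    ∑ q ∈ Icc 1 X, (((Icc 1 N ×ˢ Icc 1 N).filter fun p : ℕ × ℕ =>
      (q:ℤ) ∣ (p.1:ℤ) ^ 4 - (p.2:ℤ) ^ 4).card : ℝ) ≤ C * N ^ 2 * (X:ℝ) ^ (1 / 8 : ℝ) := by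
  obtain ⟨D, hD0, hD⟩ := card_divisors_le_rpow (ε := 1 / 32) (by norm_num)
  obtain ⟨E, hE0, hE⟩ := card_divisors_le_rpow (ε := 1 / 64) (by norm_num)
  have hsum : Summable fun g : ℕ => (g:ℝ) ^ (1 / 16 - 2 : ℝ) :=
    Real.summable_nat_rpow.mpr (by norm_num)
  set S := ∑' g : ℕ, (g:ℝ) ^ (1 / 16 - 2 : ℝ) with hS
  have hS0 : 0 ≤ S := tsum_nonneg fun g => by positivity
  refine ⟨4 * E * D ^ 4 * (8 * S + 32), by positivity, fun N X hX => ?_⟩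
  have hN0 : (0:ℝ) ≤ N := N.cast_nonneg
  have h1 : ∀ g ∈ Icc 1 N, ((g ^ 4).divisors.card : ℝ) ≤ E * (g:ℝ) ^ (1 / 16 : ℝ) := by
    intro g hg
    refine (hE _ (pow_pos (mem_Icc.mp hg).1 4).ne').trans (le_of_eq ?_)
    rw [Nat.cast_pow, ← rpow_natCast, ← rpow_mul g.cast_nonneg]
    norm_num
  have h2 : ∀ n ∈ Icc 1 X, (n.divisors.card : ℝ) ^ 4 ≤ D ^ 4 * (n:ℝ) ^ (1 / 8 : ℝ) := by
    intro n hn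
    calc _ ≤ (D * (n:ℝ) ^ (1 / 32 : ℝ)) ^ 4 :=
          pow_le_pow_left₀ (by positivity)
            (hD n (one_le_iff_ne_zero.mp (mem_Icc.mp hn).1)) 4
      _ = _ := by
          rw [mul_pow, ← rpow_natCast ((n:ℝ) ^ (1 / 32 : ℝ)), ← rpow_mul n.cast_nonneg]
          norm_num
  have h3 : ∀ g ∈ Icc 1 N, ∀ n ∈ Icc 1 X,
      ((N / g * ((N / g / n + 1) * (4 * n.divisors.card ^ 4)) : ℕ) : ℝ) ≤
      4 * D ^ 4 * (N ^ 2 * ((g:ℝ) ^ 2)⁻¹ * (n:ℝ) ^ (1 / 8 - 1 : ℝ) +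
        N * (g:ℝ)⁻¹ * (n:ℝ) ^ (1 / 8 : ℝ)) := by
    intro g hg n hn
    have hg0 : (0:ℝ) < g := mod_cast (mem_Icc.mp hg).1
    have hn0 : (0:ℝ) < n := mod_cast (mem_Icc.mp hn).1
    have h4 : ((N / g : ℕ) : ℝ) ≤ N / g := cast_div_le
    have h5 : ((N / g / n : ℕ) : ℝ) ≤ N / g / n := cast_div_le.trans (by gcongr)
    push_cast
    calc _ ≤ (N / g : ℝ) * ((N / g / n + 1) * (4 * (D ^ 4 * (n:ℝ) ^ (1 / 8 : ℝ)))) := by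
          gcongr; exact h2 n hn
      _ = _ := by rw [rpow_sub_one hn0.ne']; field_simp
  have h4 : ∑ n ∈ Icc 1 X, (n:ℝ) ^ (1 / 8 : ℝ) ≤ X * (X:ℝ) ^ (1 / 8 : ℝ) := by
    refine (sum_le_card_nsmul _ _ ((X:ℝ) ^ (1 / 8 : ℝ)) fun n hn => ?_).trans
      (le_of_eq (by simp))
    exact rpow_le_rpow n.cast_nonneg (cast_le.mpr (mem_Icc.mp hn).2) (by norm_num)
  have h5 := sum_Icc_rpow_sub_one_le (κ := 1 / 8) (by norm_num) (by norm_num) X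
  have h6 := sum_Icc_rpow_sub_one_le (κ := 1 / 16) (by norm_num) (by norm_num) N
  have h7 : ∑ g ∈ Icc 1 N, (g:ℝ) ^ (1 / 16 - 2 : ℝ) ≤ S :=
    hsum.sum_le_tsum _ fun g _ => by positivity
  have h8 : (N:ℝ) ^ (1 / 16 : ℝ) * X ≤ 2 * N := by
    rcases hN0.eq_or_lt with h | h
    · rw [← h, zero_rpow (by norm_num)]; simp
    · calc _ ≤ (N:ℝ) ^ (1 / 16 : ℝ) * (2 * (N:ℝ) ^ (15 / 16 : ℝ)) := by gcongr
        _ = 2 * ((N:ℝ) ^ (1 / 16 : ℝ) * (N:ℝ) ^ (15 / 16 : ℝ)) := by ring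
        _ = _ := by rw [← rpow_add h]; norm_num
  have h9 := sum_card_dvd_pow_four_sub_le N X
  rw [← cast_le (α := ℝ), Nat.cast_sum, Nat.cast_sum] at h9
  refine h9.trans ?_
  calc _ ≤ ∑ g ∈ Icc 1 N, E * (g:ℝ) ^ (1 / 16 : ℝ) * ∑ n ∈ Icc 1 X,
        4 * D ^ 4 * (N ^ 2 * ((g:ℝ) ^ 2)⁻¹ * (n:ℝ) ^ (1 / 8 - 1 : ℝ) +
          N * (g:ℝ)⁻¹ * (n:ℝ) ^ (1 / 8 : ℝ)) := by
        refine sum_le_sum fun g hg => ?_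
        rw [cast_mul, Nat.cast_sum]
        exact mul_le_mul (h1 g hg) (sum_le_sum fun n hn => h3 g hg n hn)
          (sum_nonneg fun _ _ => cast_nonneg _) (by positivity)
    _ = 4 * E * D ^ 4 * (N ^ 2 * (∑ g ∈ Icc 1 N, (g:ℝ) ^ (1 / 16 - 2 : ℝ)) *
          (∑ n ∈ Icc 1 X, (n:ℝ) ^ (1 / 8 - 1 : ℝ)) +
        N * (∑ g ∈ Icc 1 N, (g:ℝ) ^ (1 / 16 - 1 : ℝ)) *
          ∑ n ∈ Icc 1 X, (n:ℝ) ^ (1 / 8 : ℝ)) := by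
        rw [mul_sum (f := fun g : ℕ => (g:ℝ) ^ (1 / 16 - 2 : ℝ)),
          mul_sum (f := fun g : ℕ => (g:ℝ) ^ (1 / 16 - 1 : ℝ)), sum_mul,
          sum_mul, ← sum_add_distrib, mul_sum]
        refine sum_congr rfl fun g hg => ?_
        have hg0 : (0:ℝ) < g := mod_cast (mem_Icc.mp hg).1
        rw [← mul_sum, sum_add_distrib, ← mul_sum, ← mul_sum,
          rpow_sub_one hg0.ne', show (1 / 16 - 2 : ℝ) = 1 / 16 - (2 : ℕ) by norm_num,
          Real.rpow_sub_natCast hg0.ne']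
        ring
    _ ≤ 4 * E * D ^ 4 * (N ^ 2 * S * ((X:ℝ) ^ (1 / 8 : ℝ) / (1 / 8)) +
        N * ((N:ℝ) ^ (1 / 16 : ℝ) / (1 / 16)) * (X * (X:ℝ) ^ (1 / 8 : ℝ))) := by gcongr
    _ = 4 * E * D ^ 4 * (8 * S * N ^ 2 + 16 * N * ((N:ℝ) ^ (1 / 16 : ℝ) * X)) *
        (X:ℝ) ^ (1 / 8 : ℝ) := by ring
    _ ≤ 4 * E * D ^ 4 * (8 * S * N ^ 2 + 16 * N * (2 * N)) * (X:ℝ) ^ (1 / 8 : ℝ) := by gcongr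
    _ = _ := by ring

/-! ### The twelfth moment -/

lemma trig_Icc_pow_four (N : ℕ) (α : ℝ) : trig (Icc 1 N) (fun x => (x:ℤ) ^ 4) α =
    ∑ n ∈ range N, e (α * ((n : ℝ) + 1) ^ 4) := by
  induction N with
  | zero => simp [trig]
  | succ N ih => rw [sum_range_succ, ← ih]; simp [trig, Finset.sum_Icc_succ_top]

/-- A majorant for the twelfth power of a Weyl sum on the major arcs. -/
def majorTwelve (C : ℝ) (N : ℕ) (α : ℝ) : ℝ :=
  C * N ^ 10 * ∑ i ∈ (range (N + 1)).filter fun i => (2:ℝ) ^ i ≤ 2 * (N:ℝ) ^ (15 / 16 : ℝ),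
    ((2:ℝ) ^ i) ^ (-155 / 128 : ℝ) * (arcKer (2 ^ i) (N ^ 4 / (14 * 2 ^ i)) α *
      ‖trig (Icc 1 N) (fun x => (x:ℤ) ^ 4) α‖ ^ 2)

lemma continuous_majorTwelve (C : ℝ) (N : ℕ) : Continuous (majorTwelve C N) := by
  unfold majorTwelve; fun_prop

lemma majorTwelve_nonneg {C : ℝ} (hC : 0 ≤ C) (N : ℕ) (α : ℝ) : 0 ≤ majorTwelve C N α :=
  mul_nonneg (by positivity) (sum_nonneg fun _ _ =>
    mul_nonneg (by positivity) (mul_nonneg (arcKer_nonneg _ _ _) (by positivity)))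

lemma fourteen_mul_two_pow_le {N i : ℕ} (hN : 4 ≤ N) (hi : (2:ℝ) ^ i ≤ 2 * (N:ℝ) ^ (15 / 16 : ℝ)) :
    14 * 2 ^ i ≤ N ^ 4 := by
  have hN' : (4:ℝ) ≤ N := mod_cast hN
  have h1 : (N:ℝ) ^ (15 / 16 : ℝ) ≤ N := by
    conv_rhs => rw [← rpow_one (N:ℝ)]
    exact rpow_le_rpow_of_exponent_le (by linarith) (by norm_num)
  have h2 : (14:ℝ) * 2 ^ i ≤ N ^ 4 := by nlinarith [pow_le_pow_left₀ (by norm_num) hN' 3]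
  exact_mod_cast h2

lemma exists_avg_majorTwelve_le : ∃ D : ℝ, 0 ≤ D ∧ ∀ (C : ℝ) (N : ℕ), 0 ≤ C → 4 ≤ N →
    avg (majorTwelve C N) ≤ C * D * N ^ 8 := by
  obtain ⟨B, hB0, hB⟩ := exists_sum_card_dvd_pow_four_sub_le
  set ρ : ℝ := 2 ^ (-11 / 128 : ℝ) with hρ
  have hρ0 : 0 ≤ ρ := by positivity
  have hρ1 : ρ < 1 := Real.rpow_lt_one_of_one_lt_of_neg (by norm_num) (by norm_num)
  refine ⟨112 * B * (1 - ρ)⁻¹, by have := sub_pos.mpr hρ1; positivity, fun C N hC hN => ?_⟩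
  have hN' : (0:ℝ) < N := mod_cast (by omega : 0 < N)
  unfold majorTwelve
  rw [avg_const_mul, avg_sum _ _ fun i _ => by fun_prop]
  have h1 : ∀ i ∈ (range (N + 1)).filter fun i => (2:ℝ) ^ i ≤ 2 * (N:ℝ) ^ (15 / 16 : ℝ),
      avg (fun α => ((2:ℝ) ^ i) ^ (-155 / 128 : ℝ) * (arcKer (2 ^ i) (N ^ 4 / (14 * 2 ^ i)) α *
        ‖trig (Icc 1 N) (fun x => (x:ℤ) ^ 4) α‖ ^ 2)) ≤ 112 * B * ((N:ℝ) ^ 2)⁻¹ * ρ ^ i := by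
    intro i hi
    have hi2 := (mem_filter.mp hi).2
    have h2 := avg_arcKer_mul_le (Icc 1 N) (fun x => (x:ℤ) ^ 4) (2 ^ i)
      (N ^ 4 / (14 * 2 ^ i))
    have h3 := hB N (2 ^ i) (by push_cast; exact hi2)
    have h4 := fourteen_mul_two_pow_le hN hi2
    have h5 : 0 < N ^ 4 / (14 * 2 ^ i) := Nat.div_pos h4 (by positivity)
    set L := N ^ 4 / (14 * 2 ^ i) with hL
    have h6 : N ^ 4 < 14 * 2 ^ i * (L + 1) := Nat.lt_mul_div_succ _ (by positivity)
    have h7 : (N:ℝ) ^ 4 ≤ 28 * 2 ^ i * L := by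
      have : N ^ 4 ≤ 28 * 2 ^ i * L := by nlinarith [pow_pos (two_pos (α := ℕ)) i]
      exact_mod_cast this
    have hL0 : (0:ℝ) < L := mod_cast h5
    have h8 : (4:ℝ) / L ≤ 112 * 2 ^ i / N ^ 4 := by
      rw [div_le_div_iff₀ hL0 (by positivity)]; linarith
    have h9 : ((2:ℝ) ^ i) ^ (-155 / 128 : ℝ) * (2 ^ i * ((2:ℝ) ^ i) ^ (1 / 8 : ℝ)) = ρ ^ i := by
      rw [← rpow_one_add' (by positivity) (by norm_num), ← rpow_add (by positivity), hρ,
        Real.rpow_pow_comm (by norm_num)]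
      norm_num
    rw [avg_const_mul]
    push_cast at h3
    calc _ ≤ ((2:ℝ) ^ i) ^ (-155 / 128 : ℝ) *
          (112 * 2 ^ i / N ^ 4 * (B * N ^ 2 * ((2:ℝ) ^ i) ^ (1 / 8 : ℝ))) := by
          refine mul_le_mul_of_nonneg_left (h2.trans ?_) (by positivity)
          exact mul_le_mul h8 h3 (sum_nonneg fun _ _ => cast_nonneg _) (by positivity)
      _ = 112 * B * ((N:ℝ) ^ 2)⁻¹ * (((2:ℝ) ^ i) ^ (-155 / 128 : ℝ) *
          (2 ^ i * ((2:ℝ) ^ i) ^ (1 / 8 : ℝ))) := by field_simp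
      _ = _ := by rw [h9]
  have h2 : ∑ i ∈ (range (N + 1)).filter fun i => (2:ℝ) ^ i ≤ 2 * (N:ℝ) ^ (15 / 16 : ℝ),
      ρ ^ i ≤ (1 - ρ)⁻¹ := by
    rw [← tsum_geometric_of_lt_one hρ0 hρ1]
    exact (summable_geometric_of_lt_one hρ0 hρ1).sum_le_tsum _ fun _ _ => by positivity
  calc _ ≤ C * N ^ 10 * (112 * B * ((N:ℝ) ^ 2)⁻¹ * (1 - ρ)⁻¹) := by
        refine mul_le_mul_of_nonneg_left ((sum_le_sum h1).trans ?_) (by positivity)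
        rw [← mul_sum]
        gcongr
    _ = _ := by field_simp

lemma exists_normSq_weyl_le : ∃ A C : ℝ, 0 ≤ A ∧ 0 ≤ C ∧ ∀ (N : ℕ) (α : ℝ), 4 ≤ N →
    ‖trig (Icc 1 N) (fun x => (x:ℤ) ^ 4) α‖ ^ 2 ≤
      A * (N:ℝ) ^ (227 / 128 : ℝ) + (majorTwelve C N α) ^ (1 / 6 : ℝ) := by
  obtain ⟨C, hC0, hC⟩ := exists_weyl
  refine ⟨(2 * C) ^ (1 / 4 : ℝ), (4 * C) ^ (5 / 4 : ℝ), by positivity, by positivity,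
    fun N α hN => ?_⟩
  have hN1 : (1:ℝ) ≤ N := mod_cast (by omega : 1 ≤ N)
  have hN0 : (0:ℝ) < N := by linarith
  obtain ⟨q, a, hq, H⟩ := hC N α (by omega)
  rw [← trig_Icc_pow_four] at H
  have hM0 := majorTwelve_nonneg (C := (4 * C) ^ (5 / 4 : ℝ)) (by positivity) N α
  set F := ‖trig (Icc 1 N) (fun x => (x:ℤ) ^ 4) α‖ with hF
  have hF0 : 0 ≤ F := norm_nonneg _
  set x := (q:ℝ) + N ^ 4 * |q * α - a| with hx
  have hq1 : (1:ℝ) ≤ q := mod_cast hq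
  have hx1 : 1 ≤ x := by have : 0 ≤ N ^ 4 * |q * α - a| := by positivity
                         linarith
  have hpow : ∀ m n : ℕ, ∀ r : ℝ, m * r = n → (F ^ m) ^ r = F ^ n := fun m n r h => by
    rw [← rpow_natCast, ← rpow_mul hF0, h, rpow_natCast]
  have hNe : (N:ℝ) ^ 8 * ((N:ℝ) ^ (15 / 16 : ℝ)) ^ (1 / 32 - 1 : ℝ) =
      (N:ℝ) ^ (3631 / 512 : ℝ) := by
    rw [← rpow_natCast, ← rpow_mul hN0.le, ← rpow_add hN0]; norm_num
  have hmono : ∀ {r s : ℝ}, r ≤ s → (N:ℝ) ^ r ≤ (N:ℝ) ^ s := fun h =>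
    rpow_le_rpow_of_exponent_le hN1 h
  rcases le_or_gt ((N:ℝ) ^ (15 / 16 : ℝ)) x with hc | hc
  · have h1 := rpow_le_rpow_of_nonpos (z := (1 / 32 - 1 : ℝ)) (by positivity) hc (by norm_num)
    have h2 : F ^ 8 ≤ 2 * C * (N:ℝ) ^ (227 / 32 : ℝ) := by
      calc _ ≤ C * ((N:ℝ) ^ (227 / 32 : ℝ) + (N:ℝ) ^ (227 / 32 : ℝ)) := by
            refine H.trans (mul_le_mul_of_nonneg_left (add_le_add (hmono (by norm_num)) ?_) hC0)
            refine (mul_le_mul_of_nonneg_left h1 (by positivity)).trans ?_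
            rw [hNe]
            exact hmono (by norm_num)
        _ = _ := by ring
    have h3 := rpow_le_rpow (by positivity) h2 (by norm_num : (0:ℝ) ≤ 1 / 4)
    rw [hpow 8 2 _ (by norm_num), mul_rpow (by positivity) (by positivity), ← rpow_mul hN0.le] at h3
    norm_num at h3 ⊢
    have : 0 ≤ majorTwelve ((4 * C) ^ (5 / 4 : ℝ)) N α ^ (1 / 6 : ℝ) := by positivity
    linarith
  · obtain ⟨i, hi1, hi2⟩ := exists_two_pow_near hx1
    have hi3 : (2:ℝ) ^ i ≤ 2 * (N:ℝ) ^ (15 / 16 : ℝ) := by linarith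
    have h4 := fourteen_mul_two_pow_le hN hi3
    have h5 : 1 ≤ arcKer (2 ^ i) (N ^ 4 / (14 * 2 ^ i)) α :=
      one_le_arcKer_div (a := a) hq h4 (by push_cast; exact hi1)
    have hi4 : i ∈ (range (N + 1)).filter
        fun i => (2:ℝ) ^ i ≤ 2 * (N:ℝ) ^ (15 / 16 : ℝ) := by
      rw [mem_filter, mem_range]
      refine ⟨(Nat.pow_lt_pow_iff_right (a := 2) (by norm_num)).mp ?_, hi3⟩
      have h6 : (2:ℝ) ^ i ≤ 2 * N := by
        refine hi3.trans ?_
        have := hmono (r := 15 / 16) (s := 1) (by norm_num)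
        rw [rpow_one] at this
        linarith
      have h7 : 2 ^ i ≤ 2 * N := mod_cast h6
      have := Nat.lt_two_pow_self (n := N)
      rw [pow_succ]; omega
    have h6 : x ^ (1 / 32 - 1 : ℝ) ≤ 2 * ((2:ℝ) ^ i) ^ (1 / 32 - 1 : ℝ) := by
      have h1 := rpow_le_rpow_of_nonpos (z := (1 / 32 - 1 : ℝ)) (by positivity) hi2
        (by norm_num)
      have h2 : (2:ℝ)⁻¹ ≤ 2 ^ (1 / 32 - 1 : ℝ) := by
        rw [← rpow_neg_one]
        exact rpow_le_rpow_of_exponent_le (by norm_num) (by norm_num)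
      rw [mul_rpow (by norm_num) (by linarith)] at h1
      have h3 : 0 ≤ x ^ (1 / 32 - 1 : ℝ) := by positivity
      nlinarith
    have h7 : F ^ 8 ≤ 4 * C * (N ^ 8 * ((2:ℝ) ^ i) ^ (1 / 32 - 1 : ℝ)) := by
      have h8 := rpow_le_rpow_of_nonpos (z := (1 / 32 - 1 : ℝ)) (by positivity) hc.le
        (by norm_num)
      have h9 := mul_le_mul_of_nonneg_left h8 (by positivity : 0 ≤ (N:ℝ) ^ 8)
      rw [hNe] at h9
      calc _ ≤ C * (N ^ 8 * x ^ (1 / 32 - 1 : ℝ) + N ^ 8 * x ^ (1 / 32 - 1 : ℝ)) := by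
            refine H.trans (mul_le_mul_of_nonneg_left (add_le_add_left ?_ _) hC0)
            exact (hmono (by norm_num)).trans h9
        _ ≤ C * (N ^ 8 * (2 * ((2:ℝ) ^ i) ^ (1 / 32 - 1 : ℝ)) +
            N ^ 8 * (2 * ((2:ℝ) ^ i) ^ (1 / 32 - 1 : ℝ))) := by gcongr
        _ = _ := by ring
    have h8 := rpow_le_rpow (by positivity) h7 (by norm_num : (0:ℝ) ≤ 5 / 4)
    rw [hpow 8 10 _ (by norm_num), mul_rpow (x := 4 * C) (by positivity) (by positivity),
      mul_rpow (x := (N:ℝ) ^ 8) (by positivity) (by positivity),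
      ← rpow_mul (by positivity),
      ← rpow_natCast (N:ℝ), ← rpow_mul hN0.le,
      show (1 / 32 - 1) * (5 / 4) = (-155 / 128 : ℝ) by norm_num,
      show ((8 : ℕ) : ℝ) * (5 / 4) = (10 : ℕ) by norm_num, rpow_natCast] at h8
    have h9 : F ^ 12 ≤ majorTwelve ((4 * C) ^ (5 / 4 : ℝ)) N α := by
      calc F ^ 12 = F ^ 10 * F ^ 2 := by ring
        _ ≤ (4 * C) ^ (5 / 4 : ℝ) * (N ^ 10 * ((2:ℝ) ^ i) ^ (-155 / 128 : ℝ)) *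
            (arcKer (2 ^ i) (N ^ 4 / (14 * 2 ^ i)) α * F ^ 2) := by
            exact mul_le_mul h8 (le_mul_of_one_le_left (by positivity) h5) (by positivity)
              (by positivity)
        _ = (4 * C) ^ (5 / 4 : ℝ) * N ^ 10 * (((2:ℝ) ^ i) ^ (-155 / 128 : ℝ) *
            (arcKer (2 ^ i) (N ^ 4 / (14 * 2 ^ i)) α * F ^ 2)) := by ring
        _ ≤ _ := by
            refine mul_le_mul_of_nonneg_left ?_ (by positivity)
            exact single_le_sum (f := fun i => ((2:ℝ) ^ i) ^ (-155 / 128 : ℝ) *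
              (arcKer (2 ^ i) (N ^ 4 / (14 * 2 ^ i)) α * F ^ 2)) (fun _ _ => mul_nonneg
              (by positivity) (mul_nonneg (arcKer_nonneg _ _ _) (by positivity))) hi4
    have h10 := rpow_le_rpow (by positivity) h9 (by norm_num : (0:ℝ) ≤ 1 / 6)
    rw [hpow 12 2 _ (by norm_num)] at h10
    have : 0 ≤ (2 * C) ^ (1 / 4 : ℝ) * (N:ℝ) ^ (227 / 128 : ℝ) := by positivity
    linarith

lemma exists_avg_norm_h_pow_twelve_le : ∃ A B : ℝ, 0 ≤ A ∧ 0 ≤ B ∧ ∀ P R : ℝ, 4 ≤ P →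
    avg (fun α => ‖h P R α‖ ^ 12) ≤ A * P ^ (227 / 128 : ℝ) * avg (fun α => ‖h P R α‖ ^ 10) +
      B * P ^ (4 / 3 : ℝ) * avg (fun α => ‖h P R α‖ ^ 12) ^ (5 / 6 : ℝ) := by
  obtain ⟨A, C, hA, hC, H⟩ := exists_normSq_weyl_le
  obtain ⟨D, hD, HD⟩ := exists_avg_majorTwelve_le
  refine ⟨A, (C * D) ^ (1 / 6 : ℝ), hA, by positivity, fun P R hP => ?_⟩
  have hP0 : 0 ≤ P := by linarith
  set N := ⌊P⌋₊ with hN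
  have hN4 : 4 ≤ N := le_floor hP
  have hNP : (N:ℝ) ≤ P := floor_le hP0
  have hch := continuous_h P R
  have hcM := continuous_majorTwelve C N
  have hM0 := majorTwelve_nonneg hC N
  have hct := continuous_trig (Icc 1 N) (fun x => (x:ℤ) ^ 4)
  have hsub : smoothA P R ⊆ Icc 1 N := filter_subset _ _
  have hpd : PosDefTrig (h P R) := by
    rw [funext (h_eq_trig P R)]; exact PosDefTrig.trig _ _
  have h1 := PosDefTrig.norm_pow_sub hpd (PosDefTrig.trig (Icc 1 N) (fun x => (x:ℤ) ^ 4))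
    (by rw [funext (h_eq_trig P R)]; exact PosDefTrig.trig_subset hsub _) 1
  have h2 := (hpd.pow 5).avg_normSq_mul_mono (by fun_prop) (by fun_prop) h1
  simp only [norm_pow, ← pow_mul, ← pow_add, Nat.reduceMul, Nat.reduceAdd] at h2
  refine h2.trans ?_
  have h3 := holder_two (g := fun α => ‖h P R α‖ ^ 12) hcM (hch.norm.pow 12) hM0
    (fun α => by positivity) (by norm_num : (0:ℝ) ≤ 1 / 6) (by norm_num : (0:ℝ) ≤ 5 / 6) (by norm_num)
  have h4 : ∀ α, (‖h P R α‖ ^ 12) ^ (5 / 6 : ℝ) = ‖h P R α‖ ^ 10 := fun α => by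
    rw [← rpow_natCast, ← rpow_mul (norm_nonneg _), ← rpow_natCast]; norm_num
  simp only [h4] at h3
  have hcm : Continuous fun α => majorTwelve C N α ^ (1 / 6 : ℝ) * ‖h P R α‖ ^ 10 :=
    (hcM.rpow_const fun _ => Or.inr (by norm_num)).mul (hch.norm.pow 10)
  have h5 : avg (majorTwelve C N) ^ (1 / 6 : ℝ) ≤ (C * D) ^ (1 / 6 : ℝ) * P ^ (4 / 3 : ℝ) := by
    have h6 : avg (majorTwelve C N) ≤ C * D * P ^ 8 := (HD C N hC hN4).trans (by gcongr)
    refine (rpow_le_rpow (avg_nonneg hM0) h6 (by norm_num)).trans (le_of_eq ?_)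
    rw [mul_rpow (by positivity) (by positivity), ← rpow_natCast P, ← rpow_mul hP0]
    norm_num
  calc _ ≤ avg (fun α => A * P ^ (227 / 128 : ℝ) * ‖h P R α‖ ^ 10 +
        majorTwelve C N α ^ (1 / 6 : ℝ) * ‖h P R α‖ ^ 10) := by
        refine avg_mono (by fun_prop) (by fun_prop) fun α => ?_
        have h6 : (N:ℝ) ^ (227 / 128 : ℝ) ≤ P ^ (227 / 128 : ℝ) := by gcongr
        rw [mul_comm, ← add_mul]
        exact mul_le_mul_of_nonneg_right ((H N α hN4).trans
          (add_le_add_left (mul_le_mul_of_nonneg_left h6 hA) _)) (by positivity)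
    _ ≤ _ := by
        rw [avg_add (by fun_prop) hcm, avg_const_mul]
        exact add_le_add_right (h3.trans (mul_le_mul_of_nonneg_right h5
          (rpow_nonneg (avg_nonneg fun α => by positivity) _))) _

lemma Adm.exists_avg_le {t : ℕ} {l l' : ℝ} (H : Adm t l) (hl : l < l') :
    ∃ η : ℝ, 0 < η ∧ ∃ C : ℝ, 0 ≤ C ∧ ∀ P R : ℝ, 2 ≤ P → 2 ≤ R → R ≤ P ^ η →
      avg (fun α => ‖h P R α‖ ^ t) ≤ C * P ^ l' := by
  obtain ⟨f, hf, Hf⟩ := H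
  obtain ⟨C, K, hC, hK, HC⟩ := hf.2 ((l' - l) / 2) (by linarith)
  have hη : 0 < (l' - l) / 2 / (K + 1) := by
    have := sub_pos.mpr hl
    positivity
  refine ⟨_, hη, C, hC, fun P R hP hR hRP => ?_⟩
  have hP0 : 0 < P := by linarith
  have h1 := Hf P R P R (by linarith) hR (by linarith) le_rfl hR le_rfl
  simp only [rpow_natCast] at h1
  have h2 : R ^ K ≤ P ^ ((l' - l) / 2) := by
    refine (rpow_le_rpow (by linarith) hRP hK).trans ?_
    rw [← rpow_mul hP0.le]
    refine rpow_le_rpow_of_exponent_le (by linarith) ?_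
    rw [div_mul_eq_mul_div, div_le_iff₀ (by linarith)]
    exact mul_le_mul_of_nonneg_left (by linarith) (by linarith)
  calc _ ≤ C * P ^ ((l' - l) / 2) * P ^ ((l' - l) / 2) * P ^ l := by
        refine h1.trans (mul_le_mul_of_nonneg_right ((HC P R (by linarith) hR).trans ?_)
          (by positivity))
        exact mul_le_mul_of_nonneg_left h2 (by positivity)
    _ = C * P ^ l' := by
        rw [mul_assoc, mul_assoc, ← rpow_add hP0, ← rpow_add hP0]
        ring_nf

lemma le_max_of_le_add_mul_rpow {I U V : ℝ} (hI : 0 ≤ I) (h : I ≤ U + V * I ^ (5 / 6 : ℝ)) :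
    I ≤ max (2 * U) ((2 * V) ^ 6) := by
  have h1 : I ^ (1 / 6 : ℝ) * I ^ (5 / 6 : ℝ) = I := by
    rw [← rpow_add_of_nonneg hI (by norm_num) (by norm_num)]; norm_num
  have h5 : 0 ≤ I ^ (5 / 6 : ℝ) := by positivity
  rcases le_total (I ^ (1 / 6 : ℝ)) (2 * V) with h2 | h2
  · refine le_max_of_le_right ?_
    have h3 := pow_le_pow_left₀ (by positivity) h2 6
    rwa [← rpow_natCast (I ^ _), ← rpow_mul hI, Nat.cast_ofNat,
      show (1 / 6 : ℝ) * 6 = 1 by norm_num, rpow_one] at h3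
  · refine le_max_of_le_left ?_
    have := mul_le_mul_of_nonneg_right h2 h5
    linarith

/-- the exponents `Δ₇ = 0.849408`, `Δ₁₀ = 0.213431` and `Δ₁₂ = 0` are
admissible: for some `η > 0` and `C > 0`, whenever `P ≥ 2` and `2 ≤ R ≤ P^η` one has
`∫₀¹|h|⁷ ≤ C·P^{3+Δ₇}`, `∫₀¹|h|¹⁰ ≤ C·P^{6+Δ₁₀}` and `∫₀¹|h|¹² ≤ C·P⁸`. -/
theorem admissible_exponents :
    ∃ η : ℝ, 0 < η ∧ ∃ C : ℝ, 0 < C ∧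
      ∀ P R : ℝ, 2 ≤ P → 2 ≤ R → R ≤ P ^ η →
        (∫ α in (0:ℝ)..1, ‖h P R α‖ ^ 7) ≤ C * P ^ ((3:ℝ) + Δ₇) ∧
        (∫ α in (0:ℝ)..1, ‖h P R α‖ ^ 10) ≤ C * P ^ ((6:ℝ) + Δ₁₀) ∧
        (∫ α in (0:ℝ)..1, ‖h P R α‖ ^ 12) ≤ C * P ^ (8:ℝ) := by
  obtain ⟨η₇, h7, C₇, hC7, H7⟩ := Adm.exists_avg_le (t := 7) (l' := 3 + Δ₇)
    (by exact_mod_cast adm_seven) (by norm_num [Δ₇])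
  obtain ⟨η₁₀, h10, C₁₀, hC10, H10⟩ := Adm.exists_avg_le (t := 10) (l' := 6 + Δ₁₀)
    (by exact_mod_cast adm_ten) (by norm_num [Δ₁₀])
  obtain ⟨A, B, hA, hB, H12⟩ := exists_avg_norm_h_pow_twelve_le
  refine ⟨min (1 / 2) (min η₇ η₁₀), by positivity, 1 + C₇ + C₁₀ + 2 * A * C₁₀ + (2 * B) ^ 6,
    by positivity, fun P R hP hR hRP => ?_⟩
  have hP0 : 0 < P := by linarith
  have hη : ∀ {η : ℝ}, min (1 / 2) (min η₇ η₁₀) ≤ η → R ≤ P ^ η := fun hle =>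
    hRP.trans (Real.rpow_le_rpow_of_exponent_le (by linarith) hle)
  have hP4 : 4 ≤ P := by
    have h1 := hR.trans (hη (min_le_left _ _))
    rw [← Real.sqrt_eq_rpow] at h1
    nlinarith [Real.sq_sqrt hP0.le]
  have k7 := H7 P R hP hR (hη ((min_le_right _ _).trans (min_le_left _ _)))
  have k10 := H10 P R hP hR (hη ((min_le_right _ _).trans (min_le_right _ _)))
  have hAC : 0 ≤ 2 * A * C₁₀ := by positivity
  have hB6 : 0 ≤ (2 * B) ^ 6 := by positivity
  refine ⟨k7.trans ?_, k10.trans ?_, ?_⟩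
  · gcongr; linarith
  · gcongr; linarith
  set I := avg (fun α => ‖h P R α‖ ^ 12) with hI
  have h1 : A * P ^ (227 / 128 : ℝ) * avg (fun α => ‖h P R α‖ ^ 10) ≤ A * C₁₀ * P ^ (8:ℝ) := by
    calc _ ≤ A * P ^ (227 / 128 : ℝ) * (C₁₀ * P ^ (6 + Δ₁₀)) := by gcongr
      _ = A * C₁₀ * (P ^ (227 / 128 : ℝ) * P ^ (6 + Δ₁₀)) := by ring
      _ ≤ _ := by
          rw [← Real.rpow_add hP0]
          gcongr
          · linarith
          · norm_num [Δ₁₀]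
  have h2 := le_max_of_le_add_mul_rpow (avg_nonneg fun α => by positivity)
    ((H12 P R hP4).trans (add_le_add_left h1 _))
  have h3 : (2 * (B * P ^ (4 / 3 : ℝ))) ^ 6 = (2 * B) ^ 6 * P ^ (8:ℝ) := by
    rw [← mul_assoc, mul_pow, ← Real.rpow_natCast (P ^ _), ← Real.rpow_mul hP0.le]; norm_num
  rw [h3] at h2
  have hP8 : 0 ≤ P ^ (8:ℝ) := by positivity
  refine h2.trans (max_le ?_ ?_)
  · rw [← mul_assoc, ← mul_assoc]; gcongr; linarith
  · gcongr; linarith
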